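/- Let A(t), B(t) ∈ ℤ[t] be such that Δ(t) = −16(4A(t)³ + 27B(t)²) is not the zero polynomial and j(t) = −6912·A(t)³/(4A(t)³ + 27B(t)²) is non-constant, and let 𝕂 be an imaginary quadratic field. Fix ε > 0. Then there is a constant C > 0 (depending only on A, B, 𝕂, ε) such that for all real x ≥ 2 and all T ≥ x^{5/6+ε}, (1/#F(T))·Σ_{τ ∈ F(T), Δ(τ) ≠ 0} Π_{E(τ)}(𝕂, x) ≤ C·x^{2/3}. -/

import Mathlib

/-- The Farey pairs of order `T`: coprime pairs `(α, β)` of positive integers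
with `α, β ≤ T`; the pair `(α, β)` represents the Farey fraction `α/β ∈ F(T)`. -/
noncomputable def fareyPairs (T : ℝ) : Finset (ℕ × ℕ) :=
  (Finset.Icc 1 ⌊T⌋₊ ×ˢ Finset.Icc 1 ⌊T⌋₊).filter fun ab => Nat.Coprime ab.1 ab.2

/-- The Farey fraction `α/β ∈ ℚ` associated to a pair `(α, β)`. -/
def fareyFrac (ab : ℕ × ℕ) : ℚ := (ab.1 : ℚ) / (ab.2 : ℚ)

/-- Evaluation of an integer polynomial at a rational point. -/
def evalQ (A : Polynomial ℤ) (τ : ℚ) : ℚ := Polynomial.eval₂ (Int.castRingHom ℚ) τ A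

/-- The discriminant `Δ(τ) = −16(4A(τ)³ + 27B(τ)²)` of the specialized curve
`E(τ) : Y² = X³ + A(τ)X + B(τ)`. -/
def discQ (A B : Polynomial ℤ) (τ : ℚ) : ℚ :=
  -16 * (4 * evalQ A τ ^ 3 + 27 * evalQ B τ ^ 2)

/-- The reduction of a rational number modulo `p` (for `p` not dividing the
denominator this is the usual reduction). -/
def ratRed (p : ℕ) (q : ℚ) : ZMod p := (q.num : ZMod p) * ((q.den : ZMod p))⁻¹

/-- The curve `E(τ) : Y² = X³ + A(τ)X + B(τ)` has good reduction at `p` (for this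
model): `p` divides neither the denominators of `A(τ)`, `B(τ)` nor the
discriminant `Δ(τ)`, i.e. `p ∤ N(τ)`. -/
def goodRed (A B : Polynomial ℤ) (τ : ℚ) (p : ℕ) : Prop :=
  ¬ (p : ℤ) ∣ (evalQ A τ).den ∧ ¬ (p : ℤ) ∣ (evalQ B τ).den ∧
    ratRed p (discQ A B τ) ≠ 0

/-- The number of affine points `(x, y) ∈ 𝔽_p²` on `y² = x³ + a·x + b`. -/
def affinePoints (p : ℕ) (a b : ZMod p) : ℕ :=
  ((Finset.range p ×ˢ Finset.range p).filter fun xy =>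
    (xy.2 : ZMod p) ^ 2 = (xy.1 : ZMod p) ^ 3 + a * (xy.1 : ZMod p) + b).card

/-- The Frobenius trace `a_p(τ) = p + 1 − #E_p(τ)(𝔽_p)` of the reduction mod `p`
of the curve `E(τ) : Y² = X³ + A(τ)X + B(τ)` (the projective point count is the
affine count plus one, for the point at infinity). -/
def apFrob (A B : Polynomial ℤ) (τ : ℚ) (p : ℕ) : ℤ :=
  (p : ℤ) - affinePoints p (ratRed p (evalQ A τ)) (ratRed p (evalQ B τ))

open Classical in
/-- `Π_{E(τ)}(a, x)`: the number of primes `p ≤ x` of good reduction for `E(τ)`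
with `a_p(τ) = a`. -/
noncomputable def PiTrace (A B : Polynomial ℤ) (τ : ℚ) (a : ℤ) (x : ℝ) : ℕ :=
  ((Finset.range (⌊x⌋₊ + 1)).filter fun p =>
    p.Prime ∧ goodRed A B τ p ∧ apFrob A B τ p = a).card

/-- The `j`-invariant `j(t) = −6912·A(t)³/(4A(t)³ + 27B(t)²)` is a non-constant
rational function: for no constant `c ∈ ℚ` does `−6912·A(t)³ = c·(4A(t)³ + 27B(t)²)`
hold identically. -/
def jNonconstant (A B : Polynomial ℤ) : Prop :=
  ∀ c : ℚ, (-6912 : Polynomial ℚ) * (A.map (Int.castRingHom ℚ)) ^ 3 ≠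
    Polynomial.C c *
      (4 * (A.map (Int.castRingHom ℚ)) ^ 3 + 27 * (B.map (Int.castRingHom ℚ)) ^ 2)

open Classical in
/-- `Π_{E(τ)}(𝕂, x)` for the imaginary quadratic field `𝕂 = ℚ(√d)` (with `d` a
squarefree negative integer): the number of primes `p ≤ x` of good reduction for
`E(τ)` with `a_p(τ) ≠ 0` and `ℚ(√(a_p(τ)² − 4p)) = 𝕂`, the latter condition
being equivalent to `(a_p(τ)² − 4p)/d` being the square of a rational. -/
noncomputable def PiField (A B : Polynomial ℤ) (τ : ℚ) (d : ℤ) (x : ℝ) : ℕ :=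
  ((Finset.range (⌊x⌋₊ + 1)).filter fun p =>
    p.Prime ∧ goodRed A B τ p ∧ apFrob A B τ p ≠ 0 ∧
      ∃ r : ℚ, ((apFrob A B τ p : ℚ) ^ 2 - 4 * p) = d * r ^ 2).card

open Polynomial

/-- A short Weierstrass curve `y² = x³ + Ax + B` with nonzero discriminant, over a field in which
`2` is invertible. -/
@[ext] structure ShortCurve (F : Type) [Field F] where
  /-- the coefficient of `x` -/
  A : F
  /-- the constant coefficient -/
  B : F
  disc : 4 * A ^ 3 + 27 * B ^ 2 ≠ 0
  two : (2 : F) ≠ 0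

namespace ShortCurve

section Points

variable {F : Type} [Field F] (W : ShortCurve F)

/-- The Mathlib Weierstrass curve. -/
def toW : WeierstrassCurve.Affine F := ⟨0, 0, 0, W.A, W.B⟩

/-- The cubic `x³ + Ax + B`. -/
def f (x : F) : F := x ^ 3 + W.A * x + W.B

/-- Points of the curve, including the point at infinity. -/
def Pt : Type := W.toW.Point

open scoped Classical in
noncomputable instance : AddCommGroup W.Pt := inferInstanceAs (AddCommGroup W.toW.Point)

variable {W}

lemma equation_iff {x y : F} : W.toW.Equation x y ↔ y ^ 2 = W.f x := by
  rw [WeierstrassCurve.Affine.equation_iff]; simp [toW, f]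

lemma nonsingular_of {x y : F} (h : y ^ 2 = W.f x) : W.toW.Nonsingular x y := by
  rw [WeierstrassCurve.Affine.nonsingular_iff, equation_iff]
  refine ⟨h, ?_⟩
  by_contra! hc
  obtain ⟨h1, h2⟩ := hc
  simp only [toW] at h1 h2
  have h3 : y = 0 := by
    have : 2 * y = 0 := by linear_combination h2
    exact (mul_eq_zero.mp this).resolve_left W.two
  subst h3
  apply W.disc
  simp only [f] at h
  have hA : W.A = -3 * x ^ 2 := by linear_combination -h1
  have hB : W.B = 2 * x ^ 3 := by rw [hA] at h; linear_combination -h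
  rw [hA, hB]; ring

/-- The affine point with given coordinates. -/
def pt (x y : F) (h : y ^ 2 = W.f x) : W.Pt := .some x y (nonsingular_of h)

/-- The first coordinate, with junk value `0` at infinity. -/
def px : W.Pt → F
  | .zero => 0
  | .some x _ _ => x

/-- The second coordinate, with junk value `0` at infinity. -/
def py : W.Pt → F
  | .zero => 0
  | .some _ y _ => y

lemma zero_eq : (0 : W.Pt) = WeierstrassCurve.Affine.Point.zero := rfl

@[simp] lemma px_pt {x y : F} (h : y ^ 2 = W.f x) : px (pt x y h) = x := rfl
@[simp] lemma py_pt {x y : F} (h : y ^ 2 = W.f x) : py (pt x y h) = y := rfl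
@[simp] lemma px_zero : px (0 : W.Pt) = 0 := rfl
@[simp] lemma py_zero : py (0 : W.Pt) = 0 := rfl

lemma pt_ne_zero {x y : F} (h : y ^ 2 = W.f x) : pt x y h ≠ 0 := by
  rw [zero_eq]; exact fun h => by cases h

lemma exists_pt {P : W.Pt} (hP : P ≠ 0) : ∃ x y h, P = pt x y h := by
  cases P with
  | zero => exact absurd rfl hP
  | some x y h => exact ⟨x, y, equation_iff.mp h.1, rfl⟩

lemma py_sq {P : W.Pt} (hP : P ≠ 0) : py P ^ 2 = W.f (px P) := by
  obtain ⟨x, y, h, rfl⟩ := exists_pt hP; exact h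

lemma ext_pt {P Q : W.Pt} (hP : P ≠ 0) (hQ : Q ≠ 0) (hx : px P = px Q) (hy : py P = py Q) :
    P = Q := by
  obtain ⟨x, y, h, rfl⟩ := exists_pt hP
  obtain ⟨x', y', h', rfl⟩ := exists_pt hQ
  simp only [px_pt, py_pt] at hx hy; subst hx hy; rfl

lemma neg_pt {x y : F} (h : y ^ 2 = W.f x) : -pt x y h = pt x (-y) (by rw [neg_sq, h]) := by
  apply ext_pt (neg_ne_zero.mpr (pt_ne_zero h)) (pt_ne_zero _)
  · rfl
  · change W.toW.negY x y = -y
    simp [WeierstrassCurve.Affine.negY, toW]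

@[simp] lemma px_neg (P : W.Pt) : px (-P) = px P := by
  by_cases hP : P = 0
  · simp [hP]
  · obtain ⟨x, y, h, rfl⟩ := exists_pt hP; simp [neg_pt]

@[simp] lemma py_neg (P : W.Pt) : py (-P) = -py P := by
  by_cases hP : P = 0
  · simp [hP]
  · obtain ⟨x, y, h, rfl⟩ := exists_pt hP; simp [neg_pt]

lemma px_eq_iff {P Q : W.Pt} (hP : P ≠ 0) (hQ : Q ≠ 0) : px P = px Q ↔ P = Q ∨ P = -Q := by
  refine ⟨fun h => ?_, by rintro (rfl | rfl) <;> simp⟩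
  have h1 := py_sq hP
  rw [h, ← py_sq hQ, sq_eq_sq_iff_eq_or_eq_neg] at h1
  rcases h1 with h1 | h1
  · exact .inl (ext_pt hP hQ h h1)
  · exact .inr (ext_pt hP (neg_ne_zero.mpr hQ) (by simp [h]) (by simp [h1]))

lemma eq_neg_self_iff {P : W.Pt} (hP : P ≠ 0) : P = -P ↔ py P = 0 := by
  constructor
  · intro h
    have h1 : py P = - py P := by rw [← py_neg, ← h]
    have : 2 * py P = 0 := by linear_combination h1
    exact (mul_eq_zero.mp this).resolve_left W.two
  · intro h
    exact ext_pt hP (neg_ne_zero.mpr hP) (by simp) (by simp [h])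

lemma add_of_px_ne {P Q : W.Pt} (hP : P ≠ 0) (hQ : Q ≠ 0) (h : px P ≠ px Q) :
    P + Q ≠ 0 ∧
    px (P + Q) = ((py P - py Q) / (px P - px Q)) ^ 2 - px P - px Q ∧
    py (P + Q) = ((py P - py Q) / (px P - px Q)) * (px P - px (P + Q)) - py P := by
  classical
  obtain ⟨x, y, h1, rfl⟩ := exists_pt hP
  obtain ⟨x', y', h2, rfl⟩ := exists_pt hQ
  simp only [px_pt, py_pt] at h ⊢
  obtain ⟨_, key⟩ : ∃ hn, pt x y h1 + pt x' y' h2 = WeierstrassCurve.Affine.Point.some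
      (W.toW.addX x x' (W.toW.slope x x' y y')) (W.toW.addY x x' y (W.toW.slope x x' y y')) hn :=
    ⟨_, WeierstrassCurve.Affine.Point.add_of_X_ne (h₁ := nonsingular_of h1)
      (h₂ := nonsingular_of h2) h⟩
  have e1 : px (pt x y h1 + pt x' y' h2) = ((y - y') / (x - x')) ^ 2 - x - x' := by
    rw [key]
    change W.toW.addX _ _ _ = _
    rw [WeierstrassCurve.Affine.slope_of_X_ne h]
    simp [WeierstrassCurve.Affine.addX, toW]
  refine ⟨by rw [key, zero_eq]; exact (fun h => by cases h), e1, ?_⟩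
  rw [e1, key]
  change W.toW.addY _ _ _ _ = _
  rw [WeierstrassCurve.Affine.slope_of_X_ne h]
  simp [WeierstrassCurve.Affine.addX, WeierstrassCurve.Affine.addY, WeierstrassCurve.Affine.negAddY,
    WeierstrassCurve.Affine.negY, toW]
  ring

lemma add_self_of_py_ne {P : W.Pt} (h : py P ≠ 0) :
    P + P ≠ 0 ∧
    px (P + P) = ((3 * px P ^ 2 + W.A) / (2 * py P)) ^ 2 - 2 * px P ∧
    py (P + P) = ((3 * px P ^ 2 + W.A) / (2 * py P)) * (px P - px (P + P)) - py P := by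
  classical
  have hP : P ≠ 0 := by rintro rfl; simp at h
  obtain ⟨x, y, h1, rfl⟩ := exists_pt hP
  simp only [px_pt, py_pt] at h ⊢
  have hn : y ≠ W.toW.negY x y := by
    simp only [WeierstrassCurve.Affine.negY, toW]
    intro h'
    have : 2 * y = 0 := by linear_combination h'
    exact h ((mul_eq_zero.mp this).resolve_left W.two)
  obtain ⟨_, key⟩ : ∃ hn, pt x y h1 + pt x y h1 = WeierstrassCurve.Affine.Point.some
      (W.toW.addX x x (W.toW.slope x x y y)) (W.toW.addY x x y (W.toW.slope x x y y)) hn :=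
    ⟨_, WeierstrassCurve.Affine.Point.add_self_of_Y_ne (h₁ := nonsingular_of h1) hn⟩
  have hs : W.toW.slope x x y y = (3 * x ^ 2 + W.A) / (2 * y) := by
    rw [WeierstrassCurve.Affine.slope_of_Y_ne rfl hn]
    simp [WeierstrassCurve.Affine.negY, toW]
    ring
  have e1 : px (pt x y h1 + pt x y h1) = ((3 * x ^ 2 + W.A) / (2 * y)) ^ 2 - 2 * x := by
    rw [key]
    change W.toW.addX _ _ _ = _
    rw [hs]
    simp [WeierstrassCurve.Affine.addX, toW]
    ring
  refine ⟨by rw [key, zero_eq]; exact (fun h => by cases h), e1, ?_⟩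
  rw [e1, key]
  change W.toW.addY _ _ _ _ = _
  rw [hs]
  simp [WeierstrassCurve.Affine.addX, WeierstrassCurve.Affine.addY, WeierstrassCurve.Affine.negAddY,
    WeierstrassCurve.Affine.negY, toW]
  ring

section Map

variable {F' F'' : Type} [Field F'] [Field F''] {W' : ShortCurve F'} {W'' : ShortCurve F''}

/-- A ring homomorphism sends the coefficients of `W` to those of `W'`. -/
def Compat (σ : F →+* F') (W : ShortCurve F) (W' : ShortCurve F') : Prop :=
  σ W.A = W'.A ∧ σ W.B = W'.B

lemma Compat.f {σ : F →+* F'} (h : Compat σ W W') (x : F) : σ (W.f x) = W'.f (σ x) := by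
  simp [ShortCurve.f, h.1, h.2]

open scoped Classical in
/-- The map on points induced by a ring homomorphism, as a function. -/
noncomputable def pmapFun (σ : F →+* F') (h : Compat σ W W') (P : W.Pt) : W'.Pt :=
  if hP : P = 0 then 0 else pt (σ (px P)) (σ (py P)) (by rw [← map_pow, py_sq hP, h.f])

lemma pmapFun_ne {σ : F →+* F'} (h : Compat σ W W') {P : W.Pt} (hP : P ≠ 0) :
    pmapFun σ h P ≠ 0 := by rw [pmapFun, dif_neg hP]; exact pt_ne_zero _

lemma px_pmapFun (σ : F →+* F') (h : Compat σ W W') (P : W.Pt) :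
    px (pmapFun σ h P) = σ (px P) := by
  rw [pmapFun]; split_ifs with hP <;> simp [hP]

lemma py_pmapFun (σ : F →+* F') (h : Compat σ W W') (P : W.Pt) :
    py (pmapFun σ h P) = σ (py P) := by
  rw [pmapFun]; split_ifs with hP <;> simp [hP]

/-- The map on points induced by a ring homomorphism. -/
noncomputable def pmap (σ : F →+* F') (h : Compat σ W W') : W.Pt →+ W'.Pt where
  toFun := pmapFun σ h
  map_zero' := by simp [pmapFun]
  map_add' P Q := by
    by_cases hP : P = 0
    · subst hP; rw [zero_add]; simp [pmapFun]
    by_cases hQ : Q = 0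
    · subst hQ; rw [add_zero]; simp [pmapFun]
    have hP' := pmapFun_ne h hP
    have hQ' := pmapFun_ne h hQ
    by_cases hx : px P = px Q
    · by_cases hs : P + Q = 0
      · have : Q = -P := by rw [eq_neg_iff_add_eq_zero, add_comm, hs]
        subst this
        have h2 : pmapFun σ h (-P) = - pmapFun σ h P :=
          ext_pt hQ' (neg_ne_zero.mpr hP') (by simp [px_pmapFun]) (by simp [py_pmapFun])
        rw [h2]; simp [pmapFun]
      · have hPQ : P = Q := ((px_eq_iff hP hQ).mp hx).resolve_right
          fun h' => hs (by rw [h', neg_add_cancel])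
        subst hPQ
        have hy : py P ≠ 0 := fun h' => hs (by
          nth_rw 1 [(eq_neg_self_iff hP).mpr h', neg_add_cancel])
        obtain ⟨h1, h2, h3⟩ := add_self_of_py_ne hy
        have hy' : py (pmapFun σ h P) ≠ 0 := by rw [py_pmapFun]; simpa using hy
        obtain ⟨h1', h2', h3'⟩ := add_self_of_py_ne hy'
        have e : px (pmapFun σ h (P + P)) = px (pmapFun σ h P + pmapFun σ h P) := by
          rw [px_pmapFun, h2, h2', px_pmapFun, py_pmapFun]; simp [h.1, map_ofNat]
        refine ext_pt (pmapFun_ne h h1) h1' e ?_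
        rw [h3', ← e, px_pmapFun, py_pmapFun, h3, px_pmapFun, py_pmapFun]; simp [h.1, map_ofNat]
    · have hx' : px (pmapFun σ h P) ≠ px (pmapFun σ h Q) := by
        rw [px_pmapFun, px_pmapFun]; exact fun h' => hx (σ.injective h')
      obtain ⟨h1, h2, h3⟩ := add_of_px_ne hP hQ hx
      obtain ⟨h1', h2', h3'⟩ := add_of_px_ne hP' hQ' hx'
      have e : px (pmapFun σ h (P + Q)) = px (pmapFun σ h P + pmapFun σ h Q) := by
        rw [px_pmapFun, h2, h2']; simp [px_pmapFun, py_pmapFun]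
      refine ext_pt (pmapFun_ne h h1) h1' e ?_
      rw [h3', ← e, px_pmapFun, py_pmapFun, h3]; simp [px_pmapFun, py_pmapFun]

@[simp] lemma px_pmap (σ : F →+* F') (h : Compat σ W W') (P : W.Pt) :
    px (pmap σ h P) = σ (px P) := px_pmapFun σ h P

@[simp] lemma py_pmap (σ : F →+* F') (h : Compat σ W W') (P : W.Pt) :
    py (pmap σ h P) = σ (py P) := py_pmapFun σ h P

lemma pmap_eq_zero {σ : F →+* F'} {h : Compat σ W W'} {P : W.Pt} : pmap σ h P = 0 ↔ P = 0 :=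
  ⟨fun h' => by_contra fun hP => pmapFun_ne h hP h', fun h' => by rw [h', map_zero]⟩

lemma pmap_injective (σ : F →+* F') (h : Compat σ W W') : Function.Injective (pmap σ h) :=
  (injective_iff_map_eq_zero _).mpr fun _ => pmap_eq_zero.mp

lemma pmap_unique {σ : F →+* F'} {h : Compat σ W W'} {P : W.Pt} {Q : W'.Pt} (hP : P ≠ 0)
    (hQ : Q ≠ 0) (hx : σ (px P) = px Q) (hy : σ (py P) = py Q) : pmap σ h P = Q :=
  ext_pt (pmap_eq_zero.not.mpr hP) hQ (by simpa) (by simpa)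

lemma pmap_pmap {σ : F →+* F'} {τ : F' →+* F''} (h : Compat σ W W') (h' : Compat τ W' W'')
    (h'' : Compat (τ.comp σ) W W'') (P : W.Pt) : pmap τ h' (pmap σ h P) = pmap (τ.comp σ) h'' P := by
  by_cases hP : P = 0
  · simp [hP]
  · exact pmap_unique (pmap_eq_zero.not.mpr hP) (pmap_eq_zero.not.mpr hP) (by simp) (by simp)

/-- A point whose coordinates are in the image of `σ` is in the image of `pmap σ`. -/
lemma exists_pmap_eq {σ : F →+* F'} (h : Compat σ W W') {P : W'.Pt} (hx : px P ∈ σ.range)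
    (hy : py P ∈ σ.range) : ∃ Q, pmap σ h Q = P := by
  by_cases hP : P = 0
  · exact ⟨0, by simp [hP]⟩
  obtain ⟨x, hx⟩ := hx
  obtain ⟨y, hy⟩ := hy
  have : y ^ 2 = W.f x := σ.injective (by rw [map_pow, h.f, hx, hy, py_sq hP])
  exact ⟨pt x y this, pmap_unique (pt_ne_zero _) hP hx hy⟩

end Map

section BaseChange

variable {k : Type} [Field k] (W : ShortCurve k)

/-- Base change of a short Weierstrass curve to a field extension. -/
def bc (L : Type) [Field L] [Algebra k L] : ShortCurve L where
  A := algebraMap k L W.A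
  B := algebraMap k L W.B
  disc h := W.disc ((algebraMap k L).injective (by simpa [map_ofNat] using h))
  two h := W.two ((algebraMap k L).injective (by simpa [map_ofNat] using h))

/-- The points of a curve over a field extension. -/
abbrev P (L : Type) [Field L] [Algebra k L] : Type := (W.bc L).Pt

variable {W} {L L' L'' : Type} [Field L] [Field L'] [Field L''] [Algebra k L] [Algebra k L']
  [Algebra k L'']

lemma compat_algHom (ψ : L →ₐ[k] L') : Compat (ψ : L →+* L') (W.bc L) (W.bc L') :=
  ⟨ψ.commutes _, ψ.commutes _⟩

/-- The map on points induced by a homomorphism of field extensions. -/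
noncomputable def pm (ψ : L →ₐ[k] L') : W.P L →+ W.P L' := pmap (ψ : L →+* L') (compat_algHom ψ)

@[simp] lemma px_pm (ψ : L →ₐ[k] L') (P : W.P L) : px (pm ψ P) = ψ (px P) := px_pmap _ _ _
@[simp] lemma py_pm (ψ : L →ₐ[k] L') (P : W.P L) : py (pm ψ P) = ψ (py P) := py_pmap _ _ _

lemma pm_injective (ψ : L →ₐ[k] L') : Function.Injective (pm (W := W) ψ) := pmap_injective _ _

lemma pm_eq_zero {ψ : L →ₐ[k] L'} {P : W.P L} : pm ψ P = 0 ↔ P = 0 := pmap_eq_zero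

lemma pm_unique {ψ : L →ₐ[k] L'} {P : W.P L} {Q : W.P L'} (hP : P ≠ 0)
    (hQ : Q ≠ 0) (hx : ψ (px P) = px Q) (hy : ψ (py P) = py Q) : pm ψ P = Q :=
  pmap_unique hP hQ hx hy

lemma pm_pm (ψ : L →ₐ[k] L') (ψ' : L' →ₐ[k] L'') (P : W.P L) :
    pm ψ' (pm ψ P) = pm (ψ'.comp ψ) P := pmap_pmap _ _ (compat_algHom (ψ'.comp ψ)) P

lemma pm_id (P : W.P L) : pm (AlgHom.id k L) P = P := by
  by_cases hP : P = 0
  · simp [hP]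
  · exact pm_unique hP hP rfl rfl

/-- Constant points. -/
noncomputable def incl (W : ShortCurve k) (L : Type) [Field L] [Algebra k L] : W.P k →+ W.P L :=
  pm (Algebra.ofId k L)

lemma incl_injective : Function.Injective (W.incl L) := pm_injective _

@[simp] lemma px_incl (P : W.P k) : px (W.incl L P) = algebraMap k L (px P) := px_pm _ _
@[simp] lemma py_incl (P : W.P k) : py (W.incl L P) = algebraMap k L (py P) := py_pm _ _

@[simp] lemma pm_incl (ψ : L →ₐ[k] L') (P : W.P k) : pm ψ (W.incl L P) = W.incl L' P := by
  rw [incl, incl, pm_pm, Subsingleton.elim (ψ.comp (Algebra.ofId k L)) (Algebra.ofId k L')]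

/-- Over an algebraically closed field, a point with constant first coordinate is constant. -/
lemma exists_incl_eq [IsAlgClosed k] {P : W.P L} (hx : px P ∈ (algebraMap k L).range) :
    ∃ Q, W.incl L Q = P := by
  by_cases hP : P = 0
  · exact ⟨0, by simp [hP]⟩
  refine exists_pmap_eq _ hx ?_
  obtain ⟨x, hx⟩ := hx
  obtain ⟨z, hz⟩ := IsAlgClosed.exists_pow_nat_eq (W.f x) (n := 2) two_pos
  have h1 := py_sq hP
  have h2 : (W.bc L).f (px P) = (algebraMap k L z) ^ 2 := by
    rw [← hx, ← map_pow, hz]; simp [f, bc]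
  rw [h2, sq_eq_sq_iff_eq_or_eq_neg] at h1
  rcases h1 with h1 | h1
  · exact ⟨z, h1.symm⟩
  · exact ⟨-z, by rw [h1]; exact map_neg _ _⟩

end BaseChange

end Points

section FunctionField

variable {k : Type} [Field k] (W : ShortCurve k)

/-- The cubic `x³ + Ax + B` as a polynomial. -/
noncomputable def fP : k[X] := X ^ 3 + C W.A * X + C W.B

/-- The cubic `x³ + Ax + B` as a rational function. -/
noncomputable def fX : RatFunc k := (W.bc (RatFunc k)).f RatFunc.X

lemma fX_eq : W.fX = algebraMap k[X] (RatFunc k) W.fP := by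
  simp [fX, fP, f, bc, RatFunc.algebraMap_X, RatFunc.algebraMap_eq_C]

lemma natDegree_fP : W.fP.natDegree = 3 := by
  unfold fP; compute_degree!

lemma eval_fP (x : k) : W.fP.eval x = W.f x := by simp [fP, f]

lemma fP_ne_zero : W.fP ≠ 0 := fun h => by simpa [h] using W.natDegree_fP

lemma fX_ne_sq (r : RatFunc k) : r ^ 2 ≠ W.fX := by
  intro h
  have h0 : r ≠ 0 := by
    rintro rfl
    have : W.fX = 0 := by rw [← h]; simp
    rw [fX_eq] at this
    exact W.fP_ne_zero (by simpa using this)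
  have h1 : (r ^ 2).intDegree = 3 := by
    rw [h, fX_eq, RatFunc.intDegree_polynomial, natDegree_fP]; rfl
  rw [sq, RatFunc.intDegree_mul h0 h0] at h1
  omega

/-- The function field of a short Weierstrass curve. -/
def FF : Type := QuadraticAlgebra (RatFunc k) W.fX 0

instance : Fact (∀ r : RatFunc k, r ^ 2 ≠ W.fX + 0 * r) :=
  ⟨fun r => by simpa using W.fX_ne_sq r⟩

noncomputable instance : Field W.FF :=
  inferInstanceAs (Field (QuadraticAlgebra (RatFunc k) W.fX 0))
noncomputable instance : Algebra (RatFunc k) W.FF :=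
  inferInstanceAs (Algebra (RatFunc k) (QuadraticAlgebra (RatFunc k) W.fX 0))
noncomputable instance : Algebra k W.FF :=
  ((algebraMap (RatFunc k) W.FF).comp (algebraMap k (RatFunc k))).toAlgebra

instance : IsScalarTower k (RatFunc k) W.FF := IsScalarTower.of_algebraMap_eq fun _ => rfl

variable {W}

/-- The inclusion of the rational function field. -/
noncomputable def io : RatFunc k →ₐ[k] W.FF := IsScalarTower.toAlgHom k (RatFunc k) W.FF

/-- The function `y`. -/
noncomputable def yy : W.FF := (⟨0, 1⟩ : QuadraticAlgebra (RatFunc k) W.fX 0)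

/-- The function `x`. -/
noncomputable def xx : W.FF := io RatFunc.X

lemma mk_eq (a b : RatFunc k) :
    (io a + io b * yy : W.FF) = (⟨a, b⟩ : QuadraticAlgebra (RatFunc k) W.fX 0) := by
  change (⟨a, 0⟩ + ⟨b, 0⟩ * ⟨0, 1⟩ : QuadraticAlgebra (RatFunc k) W.fX 0) = _
  ext <;> simp

lemma exists_rep (z : W.FF) : ∃ a b, z = io a + io b * yy := by
  obtain ⟨a, b⟩ : QuadraticAlgebra (RatFunc k) W.fX 0 := z
  exact ⟨a, b, (mk_eq a b).symm⟩

lemma rep_inj {a b a' b' : RatFunc k} (h : (io a + io b * yy : W.FF) = io a' + io b' * yy) :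
    a = a' ∧ b = b' := by
  rw [mk_eq, mk_eq] at h
  exact ⟨congrArg QuadraticAlgebra.re h, congrArg QuadraticAlgebra.im h⟩

lemma yy_sq : (yy : W.FF) ^ 2 = io W.fX := by
  rw [sq]
  change (⟨0, 1⟩ * ⟨0, 1⟩ : QuadraticAlgebra (RatFunc k) W.fX 0) = ⟨W.fX, 0⟩
  ext <;> simp

lemma io_injective : Function.Injective (io : RatFunc k → W.FF) := io.toRingHom.injective

lemma io_fX : (io W.fX : W.FF) = (W.bc W.FF).f xx := by
  simp only [fX, f, bc, xx, map_add, map_mul, map_pow, AlgHom.commutes]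

/-- The generic point. -/
noncomputable def gen : W.P W.FF := pt xx yy (by rw [yy_sq, io_fX])

@[simp] lemma px_gen : px (gen : W.P W.FF) = xx := rfl
@[simp] lemma py_gen : py (gen : W.P W.FF) = yy := rfl
lemma gen_ne_zero : (gen : W.P W.FF) ≠ 0 := pt_ne_zero _

lemma yy_ne_zero : (yy : W.FF) ≠ 0 := by
  intro h
  have := @rep_inj _ _ W 0 1 0 0 (by simp [h])
  simp at this

section Lift

section

variable {L : Type} [CommRing L] [Algebra k L]

lemma liftAux_mul (g : RatFunc k →ₐ[k] L) (v : L) (h : v ^ 2 = g W.fX)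
    (z w : QuadraticAlgebra (RatFunc k) W.fX 0) :
    g (z * w).re + g (z * w).im * v = (g z.re + g z.im * v) * (g w.re + g w.im * v) := by
  rw [QuadraticAlgebra.re_mul, QuadraticAlgebra.im_mul]
  simp only [map_add, map_mul, zero_mul, map_zero, ← h]
  ring

/-- The homomorphism determined by a homomorphism on the rational functions and the image of `y`. -/
noncomputable def liftAux (g : RatFunc k →ₐ[k] L) (v : L) (h : v ^ 2 = g W.fX) : W.FF →ₐ[k] L where
  toFun z := g (QuadraticAlgebra.re z) + g (QuadraticAlgebra.im z) * v
  map_one' := by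
    change g 1 + g 0 * v = 1
    simp
  map_zero' := by
    change g 0 + g 0 * v = 0
    simp
  map_add' z w := by
    change g (z.re + w.re) + g (z.im + w.im) * v = _
    simp only [map_add]; ring
  map_mul' z w := liftAux_mul g v h z w
  commutes' r := by
    change g (algebraMap k (RatFunc k) r) + g 0 * v = _
    rw [g.commutes, map_zero, zero_mul, add_zero]

lemma liftAux_io (g : RatFunc k →ₐ[k] L) (v : L) (h : v ^ 2 = g W.fX) (a : RatFunc k) :
    liftAux g v h (io a) = g a := by
  change g a + g 0 * v = _
  simp

lemma liftAux_yy (g : RatFunc k →ₐ[k] L) (v : L) (h : v ^ 2 = g W.fX) :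
    liftAux g v h yy = v := by
  change g 0 + g 1 * v = _
  simp

end

variable {L : Type} [Field L] [Algebra k L]

lemma algHom_ext_ratFunc {g g' : RatFunc k →ₐ[k] L} (h : g RatFunc.X = g' RatFunc.X) : g = g' := by
  have h1 : ∀ p : k[X], g (algebraMap k[X] (RatFunc k) p) = g' (algebraMap k[X] (RatFunc k) p) := by
    intro p
    have := Polynomial.algHom_ext (f := g.comp (IsScalarTower.toAlgHom k k[X] (RatFunc k)))
      (g := g'.comp (IsScalarTower.toAlgHom k k[X] (RatFunc k)))
      (by simpa [RatFunc.algebraMap_X] using h)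
    exact DFunLike.congr_fun this p
  ext z
  induction z using RatFunc.induction_on with
  | f p q hq => rw [map_div₀, map_div₀, h1, h1]

lemma algHom_ext_FF {g g' : W.FF →ₐ[k] L} (h : pm g gen = pm g' (gen : W.P W.FF)) : g = g' := by
  have hx : g xx = g' xx := by simpa using congrArg px h
  have hy : g yy = g' yy := by simpa using congrArg py h
  have h1 : g.comp io = g'.comp io := algHom_ext_ratFunc (by simpa [xx] using hx)
  ext z
  obtain ⟨a, b, rfl⟩ := exists_rep z
  have := fun a => DFunLike.congr_fun h1 a
  simp only [AlgHom.comp_apply] at this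
  simp only [map_add, map_mul, this, hy]

variable [IsAlgClosed k]

lemma transcendental_of_notMem {u : L} (hu : u ∉ (algebraMap k L).range) : Transcendental k u := by
  intro h
  exact hu (minpoly.mem_range_of_degree_eq_one k u
    (IsAlgClosed.degree_eq_one_of_irreducible k (minpoly.irreducible h.isIntegral)))

/-- Substitution of a nonconstant element in rational functions. -/
lemma exists_subst {u : L} (hu : u ∉ (algebraMap k L).range) :
    ∃ g : RatFunc k →ₐ[k] L, g RatFunc.X = u := by
  have hi : Function.Injective (Polynomial.aeval (R := k) u) :=
    transcendental_iff_injective.mp (transcendental_of_notMem hu)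
  refine ⟨RatFunc.liftAlgHom (Polynomial.aeval u)
    (nonZeroDivisors_le_comap_nonZeroDivisors_of_injective _ hi), ?_⟩
  rw [← RatFunc.algebraMap_X, ← div_one (algebraMap k[X] (RatFunc k) X),
    ← map_one (algebraMap k[X] (RatFunc k)),
    RatFunc.liftAlgHom_apply_div]
  simp

/-- A nonconstant point over `L` is the image of the generic point. -/
lemma exists_lift {Q : W.P L} (hQ : px Q ∉ (algebraMap k L).range) :
    ∃ φ : W.FF →ₐ[k] L, pm φ gen = Q := by
  obtain ⟨g, hg⟩ := exists_subst hQ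
  have hQ0 : Q ≠ 0 := by rintro rfl; exact hQ ⟨0, by simp⟩
  have h : py Q ^ 2 = g W.fX := by
    rw [py_sq hQ0, ← hg]
    simp only [fX, f, bc, map_add, map_mul, map_pow, AlgHom.commutes]
  refine ⟨liftAux g (py Q) h, pm_unique gen_ne_zero hQ0 ?_ ?_⟩
  · rw [px_gen, xx, liftAux_io, hg]
  · rw [py_gen, liftAux_yy]

end Lift

section Translations

/-- Constants of the function field. -/
abbrev Const (W : ShortCurve k) (z : W.FF) : Prop := z ∈ (algebraMap k W.FF).range

lemma const_io {a : RatFunc k} : W.Const (io a) ↔ a ∈ (algebraMap k (RatFunc k)).range := by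
  constructor
  · rintro ⟨c, hc⟩
    exact ⟨c, io_injective (by rw [AlgHom.commutes, hc])⟩
  · rintro ⟨c, rfl⟩; exact ⟨c, by rw [AlgHom.commutes]⟩

lemma X_notMem : (RatFunc.X : RatFunc k) ∉ (algebraMap k (RatFunc k)).range := by
  rintro ⟨c, hc⟩
  rw [RatFunc.algebraMap_eq_C, ← RatFunc.algebraMap_C, ← RatFunc.algebraMap_X] at hc
  have := RatFunc.algebraMap_injective k hc
  have := congrArg Polynomial.natDegree this
  simp at this

lemma not_const_xx : ¬ W.Const xx := fun h => X_notMem (const_io.mp h)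

/-- The hyperelliptic involution on functions. -/
noncomputable def conj : W.FF →ₐ[k] W.FF :=
  liftAux io (-yy) (by rw [neg_sq, yy_sq])

@[simp] lemma conj_io (a : RatFunc k) : conj (io a : W.FF) = io a := liftAux_io _ _ _ _
@[simp] lemma conj_yy : conj (yy : W.FF) = -yy := liftAux_yy _ _ _
@[simp] lemma conj_xx : conj (xx : W.FF) = xx := conj_io _

lemma pm_conj_gen : pm conj (gen : W.P W.FF) = -gen :=
  pm_unique gen_ne_zero (neg_ne_zero.mpr gen_ne_zero) (by simp) (by simp)

lemma conj_conj (z : W.FF) : conj (conj z) = z := by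
  obtain ⟨a, b, rfl⟩ := exists_rep z; simp

lemma conj_eq_self {z : W.FF} (h2 : (2 : k) ≠ 0) (h : conj z = z) : ∃ a, z = io a := by
  obtain ⟨a, b, rfl⟩ := exists_rep z
  simp only [map_add, map_mul, conj_io, conj_yy] at h
  have h0 := rep_inj (a := a) (b := -b) (a' := a) (b' := b) (W := W)
    (by rw [map_neg]; linear_combination h)
  have h3 : (2 : RatFunc k) * b = 0 := by linear_combination -h0.2
  have h4 : (2 : RatFunc k) ≠ 0 := fun h5 => h2 <| (algebraMap k (RatFunc k)).injective (by
    simpa [map_ofNat] using h5)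
  exact ⟨a, by rw [(mul_eq_zero.mp h3).resolve_left h4]; simp⟩

lemma conj_eq_neg {z : W.FF} (h2 : (2 : k) ≠ 0) (h : conj z = -z) : ∃ b, z = io b * yy := by
  obtain ⟨a, b, rfl⟩ := exists_rep z
  simp only [map_add, map_mul, conj_io, conj_yy] at h
  have h0 := rep_inj (a := a) (b := -b) (a' := -a) (b' := -b) (W := W)
    (by rw [map_neg, map_neg]; linear_combination h)
  have h3 : (2 : RatFunc k) * a = 0 := by linear_combination h0.1
  have h4 : (2 : RatFunc k) ≠ 0 := fun h5 => h2 <| (algebraMap k (RatFunc k)).injective (by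
    simpa [map_ofNat] using h5)
  exact ⟨b, by rw [(mul_eq_zero.mp h3).resolve_left h4]; simp⟩

variable [IsAlgClosed k]

lemma px_gen_add_not_const (P : W.P k) : ¬ W.Const (px (gen + W.incl W.FF P)) := by
  intro h
  obtain ⟨Q, hQ⟩ := exists_incl_eq h
  have : gen = W.incl W.FF (Q - P) := by rw [map_sub, hQ]; abel
  apply not_const_xx (W := W)
  rw [← px_gen, this, px_incl]; exact ⟨_, rfl⟩

/-- Translation by a constant point, on functions. -/
noncomputable def tau (P : W.P k) : W.FF →ₐ[k] W.FF :=
  (exists_lift (px_gen_add_not_const P)).choose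

@[simp] lemma pm_tau_gen (P : W.P k) : pm (tau P) gen = gen + W.incl W.FF P :=
  (exists_lift (px_gen_add_not_const P)).choose_spec

lemma tau_comp (P Q : W.P k) : (tau P).comp (tau Q) = tau (P + Q) := by
  apply algHom_ext_FF
  rw [← pm_pm]; simp [add_assoc]

lemma tau_tau (P Q : W.P k) (z : W.FF) : tau P (tau Q z) = tau (P + Q) z := by
  rw [← tau_comp]; rfl

@[simp] lemma tau_zero (z : W.FF) : tau 0 z = z := by
  have : (tau (0 : W.P k)) = AlgHom.id k _ := algHom_ext_FF (by simp [pm_id])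
  rw [this]; rfl

lemma conj_tau (P : W.P k) (z : W.FF) : conj (tau P z) = tau (-P) (conj z) := by
  have : conj.comp (tau P) = (tau (-P)).comp conj := algHom_ext_FF (by
    rw [← pm_pm, ← pm_pm]; simp [pm_conj_gen, add_comm])
  exact DFunLike.congr_fun this z

end Translations

end FunctionField

section Log

variable {k : Type} [Field k] {W : ShortCurve k} {L : Type} [Field L] [Algebra k L]

lemma aeval_fP (u : L) : Polynomial.aeval u W.fP = (W.bc L).f u := by simp [fP, f, bc]

lemma const_of_py_eq_zero [IsAlgClosed k] {P : W.P L} (h : py P = 0) : ∃ Q, W.incl L Q = P := by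
  by_cases hP : P = 0
  · exact ⟨0, by simp [hP]⟩
  refine exists_incl_eq ?_
  by_contra hx
  have h1 := py_sq hP
  rw [h, ← aeval_fP] at h1
  have := transcendental_iff.mp (transcendental_of_notMem hx) W.fP (by rw [← h1]; ring)
  exact W.fP_ne_zero this

variable (D : Derivation k L L)

/-- The logarithmic derivative of a point: the ratio of `D x` to `2y`. -/
noncomputable def cFun (P : W.P L) : L := D (px P) / (2 * py P)

variable {D}

lemma cFun_neg (P : W.P L) : cFun D (-P) = -cFun D P := by
  simp [cFun, div_neg]

lemma cFun_incl (P : W.P k) : cFun D (W.incl L P) = 0 := by simp [cFun]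

lemma D_px [IsAlgClosed k] (P : W.P L) : D (px P) = 2 * py P * cFun D P := by
  by_cases hy : py P = 0
  · obtain ⟨Q, rfl⟩ := const_of_py_eq_zero hy
    simp [cFun]
  · have := (W.bc L).two
    rw [cFun]; field_simp

lemma D_py [IsAlgClosed k] {P : W.P L} : D (py P) = (3 * px P ^ 2 + (W.bc L).A) * cFun D P := by
  by_cases hy : py P = 0
  · obtain ⟨Q, rfl⟩ := const_of_py_eq_zero hy
    simp [cFun]
  · have h2 := (W.bc L).two
    have hP : P ≠ 0 := by rintro rfl; simp at hy
    have h := congrArg D (py_sq hP)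
    have hA : D (W.bc L).A = 0 := D.map_algebraMap _
    have hB : D (W.bc L).B = 0 := D.map_algebraMap _
    simp only [f, map_add, Derivation.leibniz_pow, Derivation.leibniz, hA, hB, smul_eq_mul] at h
    rw [D_px] at h
    refine mul_left_cancel₀ (mul_ne_zero h2 hy) ?_
    simp only [nsmul_eq_mul] at h
    push_cast at h
    linear_combination h

lemma cFun_add_of_ne [IsAlgClosed k] {P Q : W.P L} (hP : P ≠ 0) (hQ : Q ≠ 0) (hx : px P ≠ px Q)
    (hy : py (P + Q) ≠ 0) : cFun D (P + Q) = cFun D P + cFun D Q := by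
  obtain ⟨h1, h2, h3⟩ := add_of_px_ne hP hQ hx
  have t := (W.bc L).two
  have eP := D_px (D := D) P
  have eQ := D_px (D := D) Q
  have eP' := D_py (D := D) (P := P)
  have eQ' := D_py (D := D) (P := Q)
  have cP := py_sq hP
  have cQ := py_sq hQ
  rw [cFun, div_eq_iff (mul_ne_zero t hy)]
  generalize cFun D P = c₁ at *
  generalize cFun D Q = c₂ at *
  have hx' : px P - px Q ≠ 0 := sub_ne_zero.mpr hx
  obtain ⟨l, hl⟩ : ∃ l, l = (py P - py Q) / (px P - px Q) := ⟨_, rfl⟩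
  rw [← hl] at h2 h3
  have hl' : l * (px P - px Q) = py P - py Q := by rw [hl]; field_simp
  have hd := congrArg D hl'
  simp only [Derivation.leibniz, map_sub, smul_eq_mul] at hd
  rw [eP, eQ, eP', eQ'] at hd
  have hDl : D l = (px P - px (P + Q)) * c₁ + (px Q - px (P + Q)) * c₂ := by
    refine mul_right_cancel₀ (pow_ne_zero 2 hx') ?_
    rw [h2]
    simp only [f] at cP cQ
    have e3 : (px P - px Q) ^ 2 * l ^ 2 = (py P - py Q) ^ 2 := by rw [← hl']; ring
    linear_combination (px P - px Q) * hd + (c₁ + c₂) * e3 - (2 * py P * c₁ - 2 * py Q * c₂) * hl' - (c₁ - c₂) * cP + (c₁ - c₂) * cQ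
  rw [h3, h2]
  simp only [map_sub, Derivation.leibniz_pow, hDl, eP, eQ, h2, smul_eq_mul, nsmul_eq_mul]
  push_cast
  linear_combination -2 * c₂ * hl'

lemma cFun_double [IsAlgClosed k] {P : W.P L} (hP : py P ≠ 0) (hy : py (P + P) ≠ 0) :
    cFun D (P + P) = cFun D P + cFun D P := by
  obtain ⟨h1, h2, h3⟩ := add_self_of_py_ne hP
  have t := (W.bc L).two
  have eP := D_px (D := D) P
  have eP' := D_py (D := D) (P := P)
  rw [cFun, div_eq_iff (mul_ne_zero t hy)]
  generalize cFun D P = c₁ at *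
  obtain ⟨l, hl⟩ : ∃ l, l = (3 * px P ^ 2 + (W.bc L).A) / (2 * py P) := ⟨_, rfl⟩
  rw [← hl] at h2 h3
  have hl' : l * (2 * py P) = 3 * px P ^ 2 + (W.bc L).A := by rw [hl]; field_simp
  have hA : D (W.bc L).A = 0 := D.map_algebraMap _
  have hD2 : D (2 : L) = 0 := by simpa [map_ofNat] using D.map_algebraMap 2
  have hD3 : D (3 : L) = 0 := by simpa [map_ofNat] using D.map_algebraMap 3
  have hd := congrArg D hl'
  simp only [Derivation.leibniz, Derivation.leibniz_pow, map_add, hA, hD2, hD3, smul_eq_mul,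
    nsmul_eq_mul] at hd
  rw [eP, eP'] at hd
  have hDl : D l = (6 * px P - 2 * l ^ 2) * c₁ := by
    refine mul_right_cancel₀ (mul_ne_zero t hP) ?_
    push_cast at hd
    linear_combination hd + 2 * l * c₁ * hl'
  rw [h3, h2]
  simp only [map_sub, Derivation.leibniz_pow, Derivation.leibniz, hD2, hDl, eP, smul_eq_mul,
    nsmul_eq_mul]
  push_cast
  ring

lemma cFun_of_py_eq_zero {P : W.P L} (h : py P = 0) : cFun D P = 0 := by simp [cFun, h]

lemma cFun_add_of_py_ne [IsAlgClosed k] {P Q : W.P L} (hy : py (P + Q) ≠ 0) :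
    cFun D (P + Q) = cFun D P + cFun D Q := by
  by_cases hP : P = 0
  · subst hP; rw [zero_add, cFun_of_py_eq_zero (P := 0) (by simp), zero_add]
  by_cases hQ : Q = 0
  · subst hQ; rw [add_zero, cFun_of_py_eq_zero (P := 0) (by simp), add_zero]
  by_cases hx : px P = px Q
  · rcases (px_eq_iff hP hQ).mp hx with rfl | rfl
    · refine cFun_double (fun h => hy ?_) hy
      nth_rw 1 [(eq_neg_self_iff hP).mpr h, neg_add_cancel, py_zero]
    · simp at hy
  · exact cFun_add_of_ne hP hQ hx hy

lemma cFun_add [IsAlgClosed k] (P Q : W.P L) : cFun D (P + Q) = cFun D P + cFun D Q := by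
  by_cases hy : py (P + Q) = 0
  · rw [cFun_of_py_eq_zero hy]
    by_cases hQ : py Q = 0
    · by_cases hP : py P = 0
      · simp [cFun_of_py_eq_zero hP, cFun_of_py_eq_zero hQ]
      · have : P = (P + Q) + -Q := by abel
        have h := cFun_add_of_py_ne (D := D) (P := P + Q) (Q := -Q) (by rwa [← this])
        rw [← this, cFun_of_py_eq_zero hy, cFun_neg] at h
        rw [h]; ring
    · have : Q = (P + Q) + -P := by abel
      have h := cFun_add_of_py_ne (D := D) (P := P + Q) (Q := -P) (by rwa [← this])
      rw [← this, cFun_of_py_eq_zero hy, cFun_neg] at h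
      rw [h]; ring
  · exact cFun_add_of_py_ne hy

variable (D) in
/-- The logarithmic derivative as a homomorphism. -/
noncomputable def cc [IsAlgClosed k] (W : ShortCurve k) : W.P L →+ L where
  toFun := cFun D
  map_zero' := cFun_of_py_eq_zero (by simp)
  map_add' := cFun_add

end Log

section Invariant

variable {k : Type} [Field k] {W : ShortCurve k}

noncomputable def polyDual (W : ShortCurve k) : k[X] →ₐ[k] DualNumber W.FF :=
  Polynomial.aeval (TrivSqZeroExt.inl xx + TrivSqZeroExt.inr (2 * yy))

lemma aeval_dual (p : k[X]) (u v : W.FF) :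
    Polynomial.aeval (TrivSqZeroExt.inl u + TrivSqZeroExt.inr v : DualNumber W.FF) p =
      TrivSqZeroExt.inl (Polynomial.aeval u p) +
        TrivSqZeroExt.inr (Polynomial.aeval u (derivative p) * v) := by
  induction p using Polynomial.induction_on' with
  | add p q hp hq =>
    simp only [map_add, hp, hq, TrivSqZeroExt.inl_add, add_mul, TrivSqZeroExt.inr_add]
    ring
  | monomial n a =>
    have h : ∀ n : ℕ, (TrivSqZeroExt.inl u + TrivSqZeroExt.inr v : DualNumber W.FF) ^ n =
        TrivSqZeroExt.inl (u ^ n) + TrivSqZeroExt.inr ((n : W.FF) * u ^ (n - 1) * v) := by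
      intro n
      induction n with
      | zero => simp
      | succ n ih =>
        rw [pow_succ, ih]
        refine TrivSqZeroExt.ext ?_ ?_
        · simp [pow_succ]
        · rcases n with _ | n
          · simp
          · simp; ring
    rw [aeval_monomial, h, derivative_monomial, aeval_monomial, aeval_monomial]
    refine TrivSqZeroExt.ext ?_ ?_
    · simp [TrivSqZeroExt.algebraMap_eq_inl']
    · simp [TrivSqZeroExt.algebraMap_eq_inl']; ring

lemma io_algebraMap (p : k[X]) :
    (io (algebraMap k[X] (RatFunc k) p) : W.FF) = Polynomial.aeval xx p := by
  rw [xx, ← RatFunc.algebraMap_X, aeval_algHom_apply, aeval_algebraMap_apply, aeval_X_left_apply]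

lemma aeval_xx_injective : Function.Injective (Polynomial.aeval (xx : W.FF) : k[X] → W.FF) := by
  intro p q h
  rw [← io_algebraMap, ← io_algebraMap] at h
  exact RatFunc.algebraMap_injective k (io_injective h)

lemma isUnit_polyDual (p : nonZeroDivisors k[X]) : IsUnit (polyDual W p) := by
  rw [TrivSqZeroExt.isUnit_iff_isUnit_fst, polyDual, aeval_dual]
  simp only [TrivSqZeroExt.fst_add, TrivSqZeroExt.fst_inl, TrivSqZeroExt.fst_inr, add_zero]
  refine isUnit_iff_ne_zero.mpr fun h => nonZeroDivisors.coe_ne_zero p (aeval_xx_injective (W := W) ?_)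
  rw [h, map_zero]

noncomputable def ratDual (W : ShortCurve k) : RatFunc k →ₐ[k] DualNumber W.FF :=
  IsLocalization.liftAlgHom (M := nonZeroDivisors k[X]) (f := polyDual W) isUnit_polyDual

lemma ratDual_algebraMap (p : k[X]) :
    ratDual W (algebraMap k[X] (RatFunc k) p) = polyDual W p := by
  rw [ratDual, IsLocalization.liftAlgHom_apply, IsLocalization.lift_eq]; rfl

noncomputable def dual (W : ShortCurve k) : W.FF →ₐ[k] DualNumber W.FF :=
  liftAux (ratDual W)
    (TrivSqZeroExt.inl yy + TrivSqZeroExt.inr (3 * xx ^ 2 + algebraMap k W.FF W.A)) (by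
      rw [fX_eq, ratDual_algebraMap, polyDual, aeval_dual]
      have h := aeval_fP (W := W) (L := W.FF) xx
      rw [h, ← io_fX, ← yy_sq]
      refine TrivSqZeroExt.ext ?_ ?_
      · simp
      · simp [pow_two, fP, map_ofNat (algebraMap k W.FF)]; ring)

lemma dual_xx : dual W xx = TrivSqZeroExt.inl xx + TrivSqZeroExt.inr (2 * yy) := by
  refine (liftAux_io _ _ _ RatFunc.X).trans ?_
  rw [← RatFunc.algebraMap_X, ratDual_algebraMap, polyDual, aeval_X]

lemma dual_yy : dual W yy =
    TrivSqZeroExt.inl yy + TrivSqZeroExt.inr (3 * xx ^ 2 + algebraMap k W.FF W.A) :=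
  liftAux_yy _ _ _

lemma fst_dual (z : W.FF) : (dual W z).fst = z := by
  have : (TrivSqZeroExt.fstHom k W.FF W.FF).comp (dual W) = AlgHom.id k W.FF := by
    apply algHom_ext_FF
    have h0 : (gen : W.P W.FF) ≠ 0 := gen_ne_zero
    rw [pm_unique (ψ := (TrivSqZeroExt.fstHom k W.FF W.FF).comp (dual W)) h0 h0
      (by simp [dual_xx]) (by simp [dual_yy]), pm_unique (ψ := AlgHom.id k W.FF) h0 h0 rfl rfl]
  exact DFunLike.congr_fun this z

/-- The invariant derivation of the function field, dual to the invariant differential. -/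
noncomputable def DD : Derivation k W.FF W.FF where
  toFun z := (dual W z).snd
  map_add' a b := by simp
  map_smul' c a := by simp
  map_one_eq_zero' := by simp
  leibniz' a b := by
    simp only [map_mul, TrivSqZeroExt.snd_mul, fst_dual, smul_eq_mul, LinearMap.coe_mk,
      AddHom.coe_mk]
    simp [mul_comm]

lemma DD_xx : DD (xx : W.FF) = 2 * yy := by
  change (dual W xx).snd = _
  rw [dual_xx]; simp

lemma DD_yy : DD (yy : W.FF) = 3 * xx ^ 2 + algebraMap k W.FF W.A := by
  change (dual W yy).snd = _
  rw [dual_yy]; simp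

lemma DD_aeval (p : k[X]) : DD (Polynomial.aeval (xx : W.FF) p) =
    Polynomial.aeval xx (derivative p) * (2 * yy) := by
  rw [Derivation.map_aeval, DD_xx, smul_eq_mul]

lemma DD_io_div (p q : k[X]) :
    DD (io (algebraMap k[X] (RatFunc k) p / algebraMap k[X] (RatFunc k) q) : W.FF) =
      io (algebraMap k[X] (RatFunc k) (derivative p * q - p * derivative q) /
        algebraMap k[X] (RatFunc k) q ^ 2) * (2 * yy) := by
  by_cases hq : q = 0
  · simp [hq]
  have hq' : (Polynomial.aeval (xx : W.FF) q) ≠ 0 := by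
    intro h; exact hq (aeval_xx_injective (W := W) (by rw [h, map_zero]))
  rw [map_div₀ io, map_div₀ io, map_pow io]
  simp only [io_algebraMap]
  rw [Derivation.leibniz_div, DD_aeval, DD_aeval]
  simp only [map_sub, map_mul, smul_eq_mul]
  field_simp

variable {k : Type} [Field k] {W W' : ShortCurve k}

/-- Any two derivation-like maps agreeing with `c` on the generators agree. -/
lemma DD_comp (φ : W.FF →ₐ[k] W'.FF) (c : W'.FF) (hx : DD (φ xx) = c * φ (DD xx))
    (hy : DD (φ yy) = c * φ (DD yy)) (z : W.FF) : DD (φ z) = c * φ (DD z) := by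
  have h1 : ∀ p : k[X], DD (φ (Polynomial.aeval xx p)) = c * φ (DD (Polynomial.aeval xx p)) := by
    intro p
    rw [← aeval_algHom_apply, Derivation.map_aeval, hx, Derivation.map_aeval, aeval_algHom_apply]
    simp only [smul_eq_mul, map_mul]; ring
  have h2 : ∀ a : RatFunc k, DD (φ (io a)) = c * φ (DD (io a)) := by
    intro a
    induction a using RatFunc.induction_on with
    | f p q hq =>
      have hq' : (Polynomial.aeval (xx : W.FF) q) ≠ 0 := by
        intro h; exact hq (aeval_xx_injective (W := W) (by rw [h, map_zero]))
      have hq2 : φ (Polynomial.aeval (xx : W.FF) q) ≠ 0 := by simpa using hq'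
      rw [map_div₀, io_algebraMap, io_algebraMap, map_div₀, Derivation.leibniz_div,
        Derivation.leibniz_div, h1, h1]
      simp only [smul_eq_mul, map_mul, map_sub, map_pow, map_inv₀]
      field_simp
  obtain ⟨a, b, rfl⟩ := exists_rep z
  simp only [map_add, map_mul, Derivation.leibniz, smul_eq_mul, h2, hy]
  ring

end Invariant

section CC

variable {k : Type} [Field k] [IsAlgClosed k] {W W' W'' : ShortCurve k}

/-- The multiplier of a point on the function field with respect to the invariant differentials. -/
noncomputable abbrev cF : W'.P W.FF →+ W.FF := cc DD W'

lemma cF_gen : cF (gen : W.P W.FF) = 1 := by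
  change cFun DD gen = 1
  have h2 : (2 : W.FF) ≠ 0 := (W.bc W.FF).two
  have := yy_ne_zero (W := W)
  rw [cFun, px_gen, py_gen, DD_xx, div_self (mul_ne_zero h2 this)]

lemma DD_map (φ : W.FF →ₐ[k] W'.FF) (z : W.FF) : DD (φ z) = cF (pm φ gen) * φ (DD z) := by
  refine DD_comp φ _ ?_ ?_ z
  · have := D_px (D := DD (W := W')) (pm φ (gen : W.P W.FF))
    rw [px_pm, px_gen, py_pm, py_gen] at this
    rw [this, DD_xx]
    simp only [map_mul, map_ofNat]; ring_nf; rfl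
  · have := D_py (D := DD (W := W')) (P := pm φ (gen : W.P W.FF))
    rw [px_pm, px_gen, py_pm, py_gen] at this
    rw [this, DD_yy]
    change _ * cF (pm φ gen) = _
    simp only [map_mul, map_ofNat, map_add, map_pow, AlgHom.commutes]
    rw [mul_comm]; rfl

lemma cF_pm (φ : W.FF →ₐ[k] W'.FF) (ψ : W''.P W.FF) :
    cF (pm φ ψ) = cF (pm φ gen) * φ (cF ψ) := by
  change cFun DD (pm φ ψ) = _ * φ (cFun DD ψ)
  rw [cFun, px_pm, py_pm, DD_map, cFun, map_div₀, map_mul, map_ofNat]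
  ring

lemma cF_incl (P : W'.P k) : cF (W'.incl W.FF P) = 0 := cFun_incl P

end CC

section FourSquares

variable {k : Type} [Field k] [IsAlgClosed k]

lemma isSquare_of_mul {a b c : k[X]} (hab : IsCoprime a b) (h : a * b = c ^ 2) : IsSquare a := by
  obtain ⟨d, u, hu⟩ := exists_associated_pow_of_mul_eq_pow' hab h
  obtain ⟨r, hr, hr'⟩ := Polynomial.isUnit_iff.mp u.isUnit
  obtain ⟨s, hs⟩ := IsAlgClosed.exists_pow_nat_eq r (n := 2) (by norm_num)
  refine ⟨d * C s, ?_⟩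
  rw [← hu, ← hr', ← hs, C_pow]; ring

lemma isSquare_C (a : k) : IsSquare (C a : k[X]) := by
  obtain ⟨s, hs⟩ := IsAlgClosed.exists_pow_nat_eq a (n := 2) (by norm_num)
  exact ⟨C s, by rw [← hs, C_pow]; ring⟩

lemma nds (s : k[X]) : (s * s).natDegree = 2 * s.natDegree := by rw [← pow_two, natDegree_pow]

/-- Two coprime polynomials spanning four pairwise independent squares are constant. -/
lemma four_squares (h2 : (2 : k) ≠ 0) (n : ℕ) : ∀ (P Q : k[X]) (a b : k), P.natDegree ≤ n →
    Q.natDegree ≤ n → IsCoprime P Q → IsSquare P → IsSquare Q → IsSquare (P + C a * Q) →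
    IsSquare (P + C b * Q) → a ≠ 0 → b ≠ 0 → a ≠ b → P.natDegree = 0 ∧ Q.natDegree = 0 := by
  induction n using Nat.strong_induction_on with
  | _ n ih =>
  intro P Q a b hPn hQn hPQ hP hQ ha hb ha0 hb0 hab
  rcases Nat.eq_zero_or_pos n with rfl | hn
  · exact ⟨by omega, by omega⟩
  have hCa : IsUnit (C (2 : k)) := isUnit_C.mpr h2.isUnit
  obtain ⟨s, rfl⟩ := hP
  obtain ⟨t, rfl⟩ := hQ
  have hst : IsCoprime s t := hPQ.of_mul_left_left.of_mul_right_left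
  -- the factors
  have key : ∀ l : k, l ≠ 0 → IsSquare (s * s + C (-l ^ 2) * (t * t)) →
      IsCoprime (s + C l * t) (s + C (-l) * t) := by
    intro l hl _
    obtain ⟨u, v, huv⟩ := hst
    have h2l : C (2 * l)⁻¹ * C (2 * l) = (1 : k[X]) := by
      rw [← C_mul, inv_mul_cancel₀ (mul_ne_zero h2 hl), C_1]
    have h22 : C (2 : k)⁻¹ * C (2 : k) = (1 : k[X]) := by
      rw [← C_mul, inv_mul_cancel₀ h2, C_1]
    refine ⟨C (2 : k)⁻¹ * u + C (2 * l)⁻¹ * v, C (2 : k)⁻¹ * u - C (2 * l)⁻¹ * v, ?_⟩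
    rw [C_neg]
    rw [C_mul] at h2l
    have e2 : (C (2 : k) : k[X]) = 2 := map_ofNat C 2
    rw [e2] at h2l h22
    have h2l' : C ((2 : k) * l)⁻¹ * (2 * C l) = (1 : k[X]) := by rw [← h2l]
    linear_combination (u * s) * h22 + (v * t) * h2l' + huv
  have sq : ∀ l : k, l ≠ 0 → IsSquare (s * s + C (-l ^ 2) * (t * t)) →
      IsSquare (s + C l * t) ∧ IsSquare (s + C (-l) * t) := by
    intro l hl h
    have hc := key l hl h
    obtain ⟨w, hw⟩ := h
    refine ⟨isSquare_of_mul (c := w) hc ?_, isSquare_of_mul (c := w) hc.symm ?_⟩ <;>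
    · simp only [C_neg, C_pow] at hw ⊢
      linear_combination hw
  obtain ⟨l, hl⟩ := IsAlgClosed.exists_pow_nat_eq (-a) (n := 2) (by norm_num)
  obtain ⟨m, hm⟩ := IsAlgClosed.exists_pow_nat_eq (-b) (n := 2) (by norm_num)
  have hl0 : l ≠ 0 := by rintro rfl; apply ha0; linear_combination hl
  have hm0 : m ≠ 0 := by rintro rfl; apply hb0; linear_combination hm
  have hlm : l ^ 2 ≠ m ^ 2 := by rw [hl, hm]; simpa using hab
  have ha' : a = -l ^ 2 := by rw [hl]; ring
  have hb' : b = -m ^ 2 := by rw [hm]; ring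
  rw [ha'] at ha
  rw [hb'] at hb
  obtain ⟨q1, q2⟩ := sq l hl0 ha
  obtain ⟨q3, q4⟩ := sq m hm0 hb
  have hlm1 : l + m ≠ 0 := fun h => hlm (by linear_combination (l - m) * h)
  have hlm2 : l - m ≠ 0 := fun h => hlm (by linear_combination (l + m) * h)
  -- s + m t = ((l+m)/(2l)) (s + l t) + ((l-m)/(2l)) (s - l t)
  have comb : ∀ m' : k, l + m' ≠ 0 → IsSquare (s + C m' * t) →
      IsSquare ((s + C l * t) + C ((l - m') / (l + m')) * (s + C (-l) * t)) := by
    intro m' h h'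
    obtain ⟨r, hr⟩ := h'
    obtain ⟨e, he⟩ := isSquare_C (2 * l / (l + m'))
    refine ⟨e * r, ?_⟩
    have : (s + C l * t) + C ((l - m') / (l + m')) * (s + C (-l) * t) =
        C (2 * l / (l + m')) * (s + C m' * t) := by
      have e1 : (l - m') / (l + m') = 2 * l / (l + m') - 1 := by field_simp; ring
      have e2 : C (2 * l / (l + m')) * C m' = C (2 * l / (l + m')) * (- C l) + C (2 * l) := by
        rw [← C_mul, ← C_neg, ← C_mul, ← C_add]
        congr 1; field_simp; ring
      rw [e1, C_sub, C_1, C_neg]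
      have e3 : C (2 * l) = 2 * C l := by rw [C_mul, map_ofNat C 2]
      rw [e3] at e2
      linear_combination (-t) * e2
    rw [this, he, hr]; ring
  have d1 : ∀ l : k, (s + C l * t).natDegree ≤ n / 2 := by
    intro l
    rw [nds] at hPn hQn
    refine (natDegree_add_le _ _).trans (max_le (by omega) ?_)
    exact (natDegree_C_mul_le _ _).trans (by omega)
  have hne : (l - m) / (l + m) ≠ (l - -m) / (l + -m) := by
    intro h
    rw [div_eq_div_iff hlm1 (by simpa [sub_eq_add_neg] using hlm2)] at h
    have : 2 * 2 * (l * m) = 0 := by linear_combination -h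
    simp [h2, hl0, hm0] at this
  obtain ⟨f1, f2⟩ := ih (n / 2) (by omega) (s + C l * t) (s + C (-l) * t) _ _ (d1 _) (d1 _)
    (key l hl0 ha) q1 q2 (comb m hlm1 q3) (comb (-m) (by simpa [sub_eq_add_neg] using hlm2) q4)
    (div_ne_zero hlm2 hlm1) (div_ne_zero (by simpa using hlm1) (by simpa [sub_eq_add_neg] using hlm2))
    hne
  obtain ⟨c1, hc1⟩ := natDegree_eq_zero.mp f1
  obtain ⟨c2, hc2⟩ := natDegree_eq_zero.mp f2
  have hs : s = C ((c1 + c2) / 2) := by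
    have e2 : (C (2 : k) : k[X]) = 2 := map_ofNat C 2
    have : C (2 : k) * s = C (2 : k) * C ((c1 + c2) / 2) := by
      rw [← C_mul, mul_div_cancel₀ _ h2, C_add, hc1, hc2, e2, C_neg]; ring
    exact mul_left_cancel₀ (C_ne_zero.mpr h2) this
  have ht : t = C ((c1 - c2) / (2 * l)) := by
    have : C (2 * l) * t = C (2 * l) * C ((c1 - c2) / (2 * l)) := by
      rw [← C_mul, mul_div_cancel₀ _ (mul_ne_zero h2 hl0), C_sub, hc1, hc2, C_neg, C_mul]
      have e2 : (C (2 : k) : k[X]) = 2 := map_ofNat C 2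
      rw [e2]; ring
    exact mul_left_cancel₀ (C_ne_zero.mpr (mul_ne_zero h2 hl0)) this
  rw [nds, nds, hs, ht]; simp

end FourSquares

section P1

variable {k : Type} [Field k] [IsAlgClosed k] (W : ShortCurve k)

/-- The two-torsion abscissas. -/
lemma exists_roots : ∃ e1 e2 e3 : k, e1 ≠ e2 ∧ e1 ≠ e3 ∧ e2 ≠ e3 ∧
    W.fP = (X - C e1) * (X - C e2) * (X - C e3) := by
  obtain ⟨e1, h1⟩ := IsAlgClosed.exists_root W.fP (by
    rw [degree_eq_natDegree W.fP_ne_zero, W.natDegree_fP]; norm_num)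
  have h1' : e1 ^ 3 + W.A * e1 + W.B = 0 := by simpa [fP] using h1
  obtain ⟨s, hs⟩ := IsAlgClosed.exists_pow_nat_eq (-3 * e1 ^ 2 - 4 * W.A) (n := 2) (by norm_num)
  have h2 := W.two
  have hB : W.B = -(e1 ^ 3 + W.A * e1) := by linear_combination h1'
  have hd := W.disc
  have hs' : W.A = -(3 * e1 ^ 2 + s ^ 2) / 4 := by
    have : (4 : k) ≠ 0 := by
      have : (4 : k) = 2 * 2 := by norm_num
      rw [this]; exact mul_ne_zero h2 h2
    field_simp; linear_combination hs
  have h4 : (4 : k) = 2 * 2 := by norm_num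
  refine ⟨e1, (-e1 + s) / 2, (-e1 - s) / 2, ?_, ?_, ?_, ?_⟩
  · intro h
    have : s = 3 * e1 := by field_simp at h; linear_combination -h
    apply hd
    rw [hB, hs', this, h4]; field_simp; ring
  · intro h
    have : s = -3 * e1 := by field_simp at h; linear_combination h
    apply hd
    rw [hB, hs', this, h4]; field_simp; ring
  · intro h
    have : s = 0 := by
      have : 2 * s = 0 := by field_simp at h; linear_combination h
      simpa [h2] using this
    apply hd
    rw [hB, hs', this, h4]; field_simp; ring
  · have e1' : W.A = ((-e1 + s) / 2) * ((-e1 - s) / 2) - e1 ^ 2 := by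
      rw [hs', h4]; field_simp; ring
    have e2' : W.B = - e1 * ((-e1 + s) / 2) * ((-e1 - s) / 2) := by
      rw [hB, e1']; ring
    have e3' : (0 : k) = e1 + ((-e1 + s) / 2) + ((-e1 - s) / 2) := by field_simp; ring
    generalize (-e1 + s) / 2 = u at *
    generalize (-e1 - s) / 2 = v at *
    have e3'' : C (0 : k) = C (e1 + u + v) := by rw [← e3']
    rw [fP, e1', e2']
    simp only [map_sub, map_mul, map_neg, map_pow, map_add, map_zero] at e3'' ⊢
    linear_combination (-X ^ 2 + C e1 * X) * e3''

variable {W}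

/-- A rational function whose image under the cubic is a square is constant. -/
lemma const_of_ratFunc_point {u v : RatFunc k} (h : v ^ 2 = (W.bc (RatFunc k)).f u) :
    u ∈ (algebraMap k (RatFunc k)).range := by
  obtain ⟨e1, e2, e3, h12, h13, h23, hf⟩ := W.exists_roots
  set a := u.num
  set b := u.denom
  have hab : IsCoprime a b := RatFunc.isCoprime_num_denom u
  have hb0 : b ≠ 0 := RatFunc.denom_ne_zero u
  have hu : u = algebraMap k[X] (RatFunc k) a / algebraMap k[X] (RatFunc k) b :=
    (RatFunc.num_div_denom u).symm
  have hb' : algebraMap k[X] (RatFunc k) b ≠ 0 := RatFunc.algebraMap_ne_zero hb0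
  have hsq : (v * algebraMap k[X] (RatFunc k) b ^ 2) ^ 2 = algebraMap k[X] (RatFunc k)
      (b * ((a - C e1 * b) * (a - C e2 * b) * (a - C e3 * b))) := by
    have hC : ∀ c : k, algebraMap k[X] (RatFunc k) (C c) = algebraMap k (RatFunc k) c := fun c => rfl
    rw [mul_pow, h, ← aeval_fP, hf]
    simp only [map_mul, map_sub, aeval_X, aeval_C, hC]
    rw [hu]; field_simp
  obtain ⟨w, hw⟩ : ∃ w : k[X], algebraMap k[X] (RatFunc k) w = v * algebraMap k[X] (RatFunc k) b ^ 2 := by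
    apply IsIntegrallyClosed.exists_algebraMap_eq_of_isIntegral_pow (n := 2) (by norm_num)
    rw [hsq]; exact isIntegral_algebraMap
  rw [← hw, ← map_pow] at hsq
  replace hsq := RatFunc.algebraMap_injective k hsq
  have c0 : ∀ e : k, IsCoprime b (a - C e * b) := by
    intro e
    have := (IsCoprime.add_mul_right_left hab (-C e)).symm
    simpa [sub_eq_add_neg] using this
  have cc : ∀ e e' : k, e ≠ e' → IsCoprime (a - C e * b) (a - C e' * b) := by
    intro e e' hee
    obtain ⟨x, y, hxy⟩ := c0 e'
    have hi : C (e - e')⁻¹ * (C e - C e') = (1 : k[X]) := by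
      rw [← C_sub, ← C_mul, inv_mul_cancel₀ (sub_ne_zero.mpr hee), C_1]
    refine ⟨-(x * C (e - e')⁻¹), y + x * C (e - e')⁻¹, ?_⟩
    linear_combination hxy + (x * b) * hi
  have s0 : IsSquare b := isSquare_of_mul (((c0 e1).mul_right (c0 e2)).mul_right (c0 e3)) hsq.symm
  have s1 : IsSquare (a - C e1 * b) := isSquare_of_mul (c := w) (b := b * (a - C e2 * b) * (a - C e3 * b))
    (((c0 e1).symm.mul_right (cc _ _ h12)).mul_right (cc _ _ h13)) (by rw [hsq]; ring)
  have s2 : IsSquare (a - C e2 * b) := isSquare_of_mul (c := w) (b := b * (a - C e1 * b) * (a - C e3 * b))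
    (((c0 e2).symm.mul_right (cc _ _ h12.symm)).mul_right (cc _ _ h23)) (by rw [hsq]; ring)
  have s3 : IsSquare (a - C e3 * b) := isSquare_of_mul (c := w) (b := b * (a - C e1 * b) * (a - C e2 * b))
    (((c0 e3).symm.mul_right (cc _ _ h13.symm)).mul_right (cc _ _ h23.symm)) (by rw [hsq]; ring)
  obtain ⟨d1, d2⟩ := four_squares W.two (max (a - C e1 * b).natDegree b.natDegree) (a - C e1 * b) b
    (e1 - e2) (e1 - e3) (le_max_left _ _) (le_max_right _ _) (c0 e1).symm s1 s0
    (by convert s2 using 1; rw [C_sub]; ring) (by convert s3 using 1; rw [C_sub]; ring)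
    (sub_ne_zero.mpr h12) (sub_ne_zero.mpr h13) (fun h => h23 (by linear_combination -h))
  obtain ⟨q1, hq1⟩ := natDegree_eq_zero.mp d1
  obtain ⟨q2, hq2⟩ := natDegree_eq_zero.mp d2
  have ha : a = C (q1 + e1 * q2) := by rw [C_add, C_mul, hq1, hq2]; ring
  refine ⟨(q1 + e1 * q2) / q2, ?_⟩
  rw [hu, ha, ← hq2, map_div₀]; rfl

/-- Halving over an algebraically closed field. -/
lemma exists_half (P : W.Pt) : ∃ Q, Q + Q = P := by
  by_cases hP : P = 0
  · exact ⟨0, by simp [hP]⟩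
  have h2 := W.two
  set a := px P
  set q : k[X] := X ^ 4 - C (4 * a) * X ^ 3 - C (2 * W.A) * X ^ 2 - C (8 * W.B + 4 * a * W.A) * X +
    C (W.A ^ 2 - 4 * a * W.B) with hq
  have hdeg : q.natDegree = 4 := by rw [hq]; compute_degree!
  obtain ⟨x, hx⟩ := IsAlgClosed.exists_root q (by
    rw [degree_eq_natDegree (by intro h; rw [h] at hdeg; simp at hdeg), hdeg]; norm_num)
  have hx' : x ^ 4 - 2 * W.A * x ^ 2 - 8 * W.B * x + W.A ^ 2 = 4 * a * W.f x := by
    have : q.eval x = 0 := hx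
    simp only [hq, eval_sub, eval_add, eval_mul, eval_pow, eval_C, eval_X] at this
    rw [f]; linear_combination this
  have hf : W.f x ≠ 0 := by
    intro h0
    rw [h0, mul_zero] at hx'
    have h3 : 3 * x ^ 2 + W.A = 0 := by
      have : (3 * x ^ 2 + W.A) ^ 2 = 0 := by rw [f] at h0; linear_combination hx' + 8 * x * h0
      exact pow_eq_zero_iff (two_ne_zero) |>.mp this
    apply W.disc
    rw [f] at h0
    have hA : W.A = -3 * x ^ 2 := by linear_combination h3
    have hB : W.B = 2 * x ^ 3 := by rw [hA] at h0; linear_combination h0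
    rw [hA, hB]; ring
  obtain ⟨y, hy⟩ := IsAlgClosed.exists_pow_nat_eq (W.f x) (n := 2) (by norm_num)
  have hy0 : y ≠ 0 := by rintro rfl; apply hf; rw [← hy]; ring
  set Q : W.Pt := pt x y hy
  obtain ⟨g1, g2, -⟩ := add_self_of_py_ne (P := Q) (by simpa [Q] using hy0)
  have hpx : px (Q + Q) = px P := by
    rw [g2]
    simp only [Q, px_pt, py_pt]
    change _ = a
    have h4 : (4 : k) ≠ 0 := by
      have : (4 : k) = 2 * 2 := by norm_num
      rw [this]; exact mul_ne_zero h2 h2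
    have : (2 * y) ^ 2 ≠ 0 := pow_ne_zero 2 (mul_ne_zero h2 hy0)
    rw [div_pow, div_sub' this, div_eq_iff this]
    rw [← hy] at hx'
    rw [f] at hy
    linear_combination hx' - 8 * x * hy
  rcases (px_eq_iff g1 hP).mp hpx with h | h
  · exact ⟨Q, h⟩
  · exact ⟨-Q, by rw [← neg_add, h, neg_neg]⟩

end P1

section Height

variable {k : Type} [Field k] [IsAlgClosed k]

/-- The height (degree) of a rational function. -/
noncomputable def ht (u : RatFunc k) : ℕ := max u.num.natDegree u.denom.natDegree

variable {W W' W'' : ShortCurve k}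

instance : Infinite (W.P k) := by
  refine Infinite.of_surjective (px : W.P k → k) fun x => ?_
  obtain ⟨y, hy⟩ := IsAlgClosed.exists_pow_nat_eq ((W.bc k).f x) (n := 2) (by norm_num)
  exact ⟨pt x y hy, px_pt _⟩

lemma tau_xx_injective : Function.Injective fun P : W.P k => tau P (xx : W.FF) := by
  intro P Q h
  have h' : px (gen + W.incl W.FF P) = px (gen + W.incl W.FF Q) := by
    rw [← pm_tau_gen, ← pm_tau_gen, px_pm, px_pm, px_gen]; exact h
  have hne : ∀ P : W.P k, gen + W.incl W.FF P ≠ 0 := by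
    intro P hP
    apply px_gen_add_not_const P
    rw [hP]; exact ⟨0, by simp⟩
  rcases (px_eq_iff (hne P) (hne Q)).mp h' with h | h
  · exact incl_injective (add_left_cancel h)
  · exfalso
    have : gen + gen = -W.incl W.FF (P + Q) := by
      rw [map_add]
      have : gen = -(gen + W.incl W.FF Q) - W.incl W.FF P := eq_sub_of_add_eq h
      nth_rw 1 [this]; abel
    have := congrArg (cF (W := W)) this
    rw [map_neg, cF_incl, map_add, cF_gen, neg_zero] at this
    apply (W.bc W.FF).two
    rw [← one_add_one_eq_two]; exact this

lemma aeval_num_eq {L : Type} [Field L] [Algebra k L] (g : RatFunc k →ₐ[k] L) (u : RatFunc k) :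
    Polynomial.aeval (g RatFunc.X) u.num = g u * Polynomial.aeval (g RatFunc.X) u.denom := by
  have h1 : ∀ p : k[X], Polynomial.aeval (g RatFunc.X) p = g (algebraMap k[X] (RatFunc k) p) := by
    intro p
    rw [aeval_algHom_apply, ← RatFunc.algebraMap_X, aeval_algebraMap_apply, aeval_X_left_apply]
  have h2 : algebraMap k[X] (RatFunc k) u.denom ≠ 0 :=
    RatFunc.algebraMap_ne_zero (RatFunc.denom_ne_zero u)
  rw [h1, h1, ← map_mul]
  congr 1
  nth_rw 2 [← RatFunc.num_div_denom u]
  field_simp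

/-- A nonconstant rational function takes any given value at few substitutions. -/
lemma card_le_ht {L : Type} [Field L] [Algebra k L] {u : RatFunc k} {c : L}
    (hu : c ∉ (algebraMap k L).range) (S : Finset L)
    (hS : ∀ x ∈ S, Polynomial.aeval x u.num = c * Polynomial.aeval x u.denom) :
    S.card ≤ ht u := by
  classical
  set q : L[X] := u.num.map (algebraMap k L) - C c * u.denom.map (algebraMap k L) with hq
  have hq0 : q ≠ 0 := by
    intro h0
    have hl := RatFunc.monic_denom u
    have h1 := congrArg (fun p => p.coeff u.denom.natDegree) h0
    simp only [hq, coeff_sub, coeff_map, coeff_C_mul, coeff_zero] at h1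
    rw [hl.coeff_natDegree, map_one, mul_one] at h1
    exact hu ⟨_, sub_eq_zero.mp h1⟩
  have hdeg : q.natDegree ≤ ht u := by
    refine (natDegree_sub_le _ _).trans (max_le_max natDegree_map_le ?_)
    exact (natDegree_C_mul_le _ _).trans natDegree_map_le
  refine le_trans ?_ ((card_roots' q).trans hdeg)
  refine (Finset.card_le_card (t := q.roots.toFinset) fun x hx => ?_).trans
    (Multiset.toFinset_card_le _)
  rw [Multiset.mem_toFinset, mem_roots hq0, IsRoot, hq, eval_sub, eval_mul, eval_C, eval_map_algebraMap,
    eval_map_algebraMap, hS x hx, sub_self]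

lemma card_le_of_invariant {u : RatFunc k} (hu : u ∉ (algebraMap k (RatFunc k)).range)
    (S : Finset (W.P k)) (hS : ∀ P ∈ S, tau P (io u : W.FF) = io u) : S.card ≤ ht u := by
  classical
  rw [← Finset.card_image_of_injective S (tau_xx_injective (W := W))]
  refine card_le_ht (c := (io u : W.FF)) (fun h => hu (const_io.mp h)) _ fun x hx => ?_
  obtain ⟨P, hP, rfl⟩ := Finset.mem_image.mp hx
  have := aeval_num_eq ((tau P).comp (io (W := W))) u
  simp only [AlgHom.comp_apply, hS P hP] at this
  exact this

lemma const_of_invariant {u : RatFunc k} (h : ∀ P : W.P k, tau P (io u : W.FF) = io u) :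
    u ∈ (algebraMap k (RatFunc k)).range := by
  by_contra hu
  obtain ⟨S, hS⟩ := Infinite.exists_subset_card_eq (W.P k) (ht u + 1)
  have := card_le_of_invariant (W := W) hu S fun P _ => h P
  omega

end Height

section Alg

variable {k : Type} [Field k] [IsAlgClosed k] {W W' W'' : ShortCurve k}

lemma exists_incl_of_conj {ψ : W'.P W.FF} (h : pm conj ψ = ψ) : ∃ P, W'.incl W.FF P = ψ := by
  by_cases h0 : ψ = 0
  · exact ⟨0, by simp [h0]⟩
  refine exists_incl_eq ?_
  have hx : conj (px ψ) = px ψ := by rw [← px_pm, h]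
  have hy : conj (py ψ) = py ψ := by rw [← py_pm, h]
  obtain ⟨u, hu⟩ := conj_eq_self W.two hx
  obtain ⟨v, hv⟩ := conj_eq_self W.two hy
  have h1 := py_sq h0
  rw [hu]
  refine const_io.mpr (const_of_ratFunc_point (W := W') (v := v) ?_)
  apply io_injective (W := W)
  rw [map_pow, ← hv, h1, hu, ← aeval_fP, ← aeval_fP, aeval_algHom_apply]

lemma exists_translate (φ : W'.P W.FF) (P : W.P k) :
    ∃ Q, pm (tau P) φ = φ + W'.incl W.FF Q := by
  obtain ⟨s, hs⟩ : ∃ s, W'.incl W.FF s = φ + pm conj φ := by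
    refine exists_incl_of_conj ?_
    rw [map_add, pm_pm, add_comm]
    congr 1
    rw [show (conj (W := W)).comp conj = AlgHom.id k _ from AlgHom.ext conj_conj, pm_id]
  obtain ⟨H, hH⟩ := exists_half (W := W.bc k) P
  have hc : pm conj φ = W'.incl W.FF s - φ := by rw [hs]; abel
  have ct : ∀ R : W.P k, pm conj (pm (tau R) φ) = W'.incl W.FF s - pm (tau (-R)) φ := by
    intro R
    rw [pm_pm, show (conj (W := W)).comp (tau R) = (tau (-R)).comp conj from
      AlgHom.ext (conj_tau R), ← pm_pm, hc, map_sub, pm_incl]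
  obtain ⟨t, ht⟩ : ∃ t, W'.incl W.FF t = pm (tau H) φ - pm (tau (-H)) φ := by
    refine exists_incl_of_conj ?_
    rw [map_sub, ct, ct, neg_neg]; abel
  refine ⟨t, ?_⟩
  have h1 := congrArg (pm (tau H)) ht
  rw [map_sub, pm_pm, pm_pm, tau_comp, tau_comp, hH, add_neg_cancel,
    show tau (0 : W.P k) = AlgHom.id k _ from AlgHom.ext tau_zero, pm_id, pm_incl] at h1
  rw [h1]; abel

/-- The odd point `φ` of `W'` over the function field of `W` represents the homomorphism `α`. -/
def Rep (α : W.P k →+ W'.P k) (φ : W'.P W.FF) : Prop :=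
  pm conj φ = -φ ∧ ∀ P, pm (tau P) φ = φ + W'.incl W.FF (α P)

/-- Algebraic homomorphisms between curves. -/
def IsAlg (α : W.P k →+ W'.P k) : Prop := ∃ φ, Rep α φ

lemma exists_rep_of_odd {φ : W'.P W.FF} (h : pm conj φ = -φ) : ∃ α, Rep α φ := by
  choose α hα using exists_translate φ
  refine ⟨⟨⟨α, ?_⟩, ?_⟩, h, hα⟩
  · have := hα 0
    rw [show tau (0 : W.P k) = AlgHom.id k _ from AlgHom.ext tau_zero, pm_id] at this
    exact incl_injective (by rw [map_zero]; exact (left_eq_add.mp this))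
  · intro P Q
    have := hα (P + Q)
    rw [← tau_comp, ← pm_pm, hα Q, map_add, pm_incl, hα P, add_assoc, ← map_add] at this
    exact incl_injective (add_left_cancel this).symm

lemma Rep.zero : Rep (0 : W.P k →+ W'.P k) 0 := ⟨by simp, by simp⟩

lemma Rep.id : Rep (AddMonoidHom.id (W.P k)) gen := ⟨pm_conj_gen, by simp⟩

lemma Rep.neg {α : W.P k →+ W'.P k} {φ} (h : Rep α φ) : Rep (-α) (-φ) :=
  ⟨by rw [map_neg, h.1], fun P => by rw [map_neg, h.2, AddMonoidHom.neg_apply, map_neg]; abel⟩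

lemma Rep.add {α β : W.P k →+ W'.P k} {φ ψ} (h : Rep α φ) (h' : Rep β ψ) :
    Rep (α + β) (φ + ψ) :=
  ⟨by rw [map_add, h.1, h'.1]; abel, fun P => by
    rw [map_add, h.2, h'.2, AddMonoidHom.add_apply, map_add]; abel⟩

lemma Rep.sub {α β : W.P k →+ W'.P k} {φ ψ} (h : Rep α φ) (h' : Rep β ψ) :
    Rep (α - β) (φ - ψ) := by
  rw [sub_eq_add_neg, sub_eq_add_neg]; exact h.add h'.neg

lemma Rep.zsmul {α : W.P k →+ W'.P k} {φ} (h : Rep α φ) (n : ℤ) : Rep (n • α) (n • φ) :=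
  ⟨by rw [map_zsmul, h.1, smul_neg], fun P => by
    rw [map_zsmul, h.2, smul_add, AddMonoidHom.smul_apply, map_zsmul]⟩

lemma Rep.px_eq {α : W.P k →+ W'.P k} {φ} (h : Rep α φ) : ∃ u, px φ = io u :=
  conj_eq_self W.two (by rw [← px_pm, h.1, px_neg])

lemma Rep.py_eq {α : W.P k →+ W'.P k} {φ} (h : Rep α φ) : ∃ v, py φ = io v * yy :=
  conj_eq_neg W.two (by rw [← py_pm, h.1, py_neg])

lemma Rep.eq_zero_of_const {α : W.P k →+ W'.P k} {φ} (h : Rep α φ) (hφ : W.Const (px φ)) :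
    α = 0 := by
  obtain ⟨Q, rfl⟩ := exists_incl_eq hφ
  ext1 P
  have := h.2 P
  rw [pm_incl] at this
  exact incl_injective (L := W.FF) (by
    rw [AddMonoidHom.zero_apply, map_zero]; exact left_eq_add.mp this)

lemma Rep.const {φ : W'.P W.FF} (h : Rep 0 φ) : W.Const (px φ) := by
  obtain ⟨u, hu⟩ := h.px_eq
  rw [hu]
  refine const_io.mpr (const_of_invariant (W := W) fun P => ?_)
  rw [← hu, ← px_pm, h.2]; simp

lemma Rep.not_const {α : W.P k →+ W'.P k} {φ} (h : Rep α φ) (hα : α ≠ 0) : ¬ W.Const (px φ) :=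
  fun hc => hα (h.eq_zero_of_const hc)

/-- The function field homomorphism attached to a nonconstant point, with its equivariance. -/
lemma Rep.exists_hom {α : W.P k →+ W'.P k} {φ} (h : Rep α φ) (hα : α ≠ 0) :
    ∃ g : W'.FF →ₐ[k] W.FF, pm g gen = φ ∧ (∀ z, conj (g z) = g (conj z)) ∧
      ∀ P z, tau P (g z) = g (tau (α P) z) := by
  obtain ⟨g, hg⟩ := exists_lift (h.not_const hα)
  refine ⟨g, hg, fun z => ?_, fun P z => ?_⟩
  · have : conj.comp g = g.comp conj := algHom_ext_FF (by
      rw [← pm_pm, ← pm_pm, hg, h.1, pm_conj_gen, map_neg, hg])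
    exact DFunLike.congr_fun this z
  · have : (tau P).comp g = g.comp (tau (α P)) := algHom_ext_FF (by
      rw [← pm_pm, ← pm_pm, hg, h.2, pm_tau_gen, map_add, hg, pm_incl])
    exact DFunLike.congr_fun this z

lemma Rep.comp {α : W.P k →+ W'.P k} {β : W'.P k →+ W''.P k} {φ ψ} (h : Rep α φ) (h' : Rep β ψ)
    {g : W'.FF →ₐ[k] W.FF} (hg : pm g gen = φ) : Rep (β.comp α) (pm g ψ) := by
  have e1 : conj.comp g = g.comp conj := algHom_ext_FF (by
    rw [← pm_pm, ← pm_pm, hg, h.1, pm_conj_gen, map_neg, hg])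
  have e2 : ∀ P, (tau P).comp g = g.comp (tau (α P)) := fun P => algHom_ext_FF (by
    rw [← pm_pm, ← pm_pm, hg, h.2, pm_tau_gen, map_add, hg, pm_incl])
  refine ⟨by rw [pm_pm, e1, ← pm_pm, h'.1, map_neg], fun P => ?_⟩
  rw [pm_pm, e2, ← pm_pm, h'.2, map_add, pm_incl]; rfl

lemma IsAlg.zero : IsAlg (0 : W.P k →+ W'.P k) := ⟨_, Rep.zero⟩
lemma IsAlg.id : IsAlg (AddMonoidHom.id (W.P k)) := ⟨_, Rep.id⟩
lemma IsAlg.neg {α : W.P k →+ W'.P k} (h : IsAlg α) : IsAlg (-α) := ⟨_, h.choose_spec.neg⟩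
lemma IsAlg.add {α β : W.P k →+ W'.P k} (h : IsAlg α) (h' : IsAlg β) : IsAlg (α + β) :=
  ⟨_, h.choose_spec.add h'.choose_spec⟩
lemma IsAlg.sub {α β : W.P k →+ W'.P k} (h : IsAlg α) (h' : IsAlg β) : IsAlg (α - β) :=
  ⟨_, h.choose_spec.sub h'.choose_spec⟩
lemma IsAlg.zsmul {α : W.P k →+ W'.P k} (h : IsAlg α) (n : ℤ) : IsAlg (n • α) :=
  ⟨_, h.choose_spec.zsmul n⟩

lemma IsAlg.comp {β : W'.P k →+ W''.P k} {α : W.P k →+ W'.P k} (h' : IsAlg β) (h : IsAlg α) :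
    IsAlg (β.comp α) := by
  by_cases h0 : α = 0
  · subst h0; rw [AddMonoidHom.comp_zero]; exact IsAlg.zero
  obtain ⟨φ, hφ⟩ := h
  obtain ⟨ψ, hψ⟩ := h'
  obtain ⟨g, hg, -⟩ := hφ.exists_hom h0
  exact ⟨_, hφ.comp hψ hg⟩

lemma const_of_const_map {L L' : Type} [Field L] [Field L'] [Algebra k L] [Algebra k L']
    (g : L →ₐ[k] L') {z : L} (h : g z ∈ (algebraMap k L').range) : z ∈ (algebraMap k L).range := by
  obtain ⟨c, hc⟩ := h
  exact ⟨c, g.toRingHom.injective (by simpa using hc)⟩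

lemma IsAlg.comp_ne_zero {β : W'.P k →+ W''.P k} {α : W.P k →+ W'.P k} (h' : IsAlg β)
    (h : IsAlg α) (hβ : β ≠ 0) (hα : α ≠ 0) : β.comp α ≠ 0 := by
  obtain ⟨φ, hφ⟩ := h
  obtain ⟨ψ, hψ⟩ := h'
  obtain ⟨g, hg, -⟩ := hφ.exists_hom hα
  intro h0
  have h1 := hφ.comp hψ hg
  rw [h0] at h1
  have h2 := h1.const
  rw [px_pm] at h2
  exact hψ.not_const hβ (const_of_const_map g h2)

/-- The kernel of a nonzero algebraic homomorphism is bounded by the height. -/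
lemma Rep.card_ker_le {α : W.P k →+ W'.P k} {φ} (h : Rep α φ) (hα : α ≠ 0) {u : RatFunc k}
    (hu : px φ = io u) (S : Finset (W.P k)) (hS : ∀ P ∈ S, α P = 0) : S.card ≤ ht u := by
  refine card_le_of_invariant (W := W) (fun hc => h.not_const hα ?_) S fun P hP => ?_
  · rw [hu]; exact const_io.mpr hc
  · rw [← hu, ← px_pm, h.2, hS P hP]; simp

lemma Rep.exists_cF {α : W.P k →+ W'.P k} {φ} (h : Rep α φ) :
    ∃ c : k, cF φ = algebraMap k W.FF c := by
  have h1 : conj (cF φ) = cF φ := by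
    have := cF_pm conj φ
    rw [h.1, pm_conj_gen, map_neg, map_neg, cF_gen] at this
    linear_combination this
  obtain ⟨u, hu⟩ := conj_eq_self W.two h1
  obtain ⟨c, hc⟩ := const_of_invariant (W := W) (u := u) fun P => by
    rw [← hu]
    have := cF_pm (tau P) φ
    rw [h.2, pm_tau_gen, map_add, map_add, cF_incl, cF_incl, cF_gen] at this
    simpa using this.symm
  exact ⟨c, by rw [hu, ← hc, AlgHom.commutes]⟩

lemma Rep.cF_eq {α : W.P k →+ W'.P k} {φ ψ} (h : Rep α φ) (h' : Rep α ψ) : cF φ = cF ψ := by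
  have h1 := h.sub h'
  rw [sub_self] at h1
  obtain ⟨Q, hQ⟩ := exists_incl_eq h1.const
  rw [← sub_eq_zero, ← map_sub, ← hQ, cF_incl]

end Alg

section HtComp

open scoped IntermediateField

variable {k : Type} [Field k]

lemma ht_eq_finrank (u : RatFunc k) :
    ht u = Module.finrank (IntermediateField.adjoin k {u}) (RatFunc k) :=
  (RatFunc.finrank_eq_max_natDegree u).symm

lemma map_adjoin_X (g : RatFunc k →ₐ[k] RatFunc k) :
    (⊤ : IntermediateField k (RatFunc k)).map g =
      IntermediateField.adjoin k {g RatFunc.X} := by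
  rw [← RatFunc.adjoin_X, IntermediateField.adjoin_map, Set.image_singleton]

lemma ht_comp (g : RatFunc k →ₐ[k] RatFunc k) (v : RatFunc k) :
    ht (g v) = ht v * ht (g RatFunc.X) := by
  have h1 : (IntermediateField.adjoin k {v}).map g = IntermediateField.adjoin k {g v} := by
    rw [IntermediateField.adjoin_map, Set.image_singleton]
  have h2 : IntermediateField.adjoin k {g v} ≤ IntermediateField.adjoin k {g RatFunc.X} := by
    rw [← h1, ← map_adjoin_X]; exact IntermediateField.map_mono _ le_top
  rw [ht_eq_finrank, ht_eq_finrank, ht_eq_finrank,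
    ← IntermediateField.relfinrank_mul_finrank_top h2, ← h1, ← map_adjoin_X,
    IntermediateField.relfinrank_map_map, IntermediateField.relfinrank_top_right]

end HtComp

section Triple

variable {k : Type} [Field k]

lemma primitive_triple {n d n' d' : k[X]} (h : IsCoprime n d) (h' : IsCoprime n' d') :
    ∃ e0 e1 e2, e0 * (d * d') + e1 * (n * d' + n' * d) + e2 * (n * n') = 1 := by
  obtain ⟨x, y, hxy⟩ := h
  obtain ⟨x', y', hxy'⟩ := h'
  have e : (x * n + y * d) ^ 2 * (x' * n' + y' * d') ^ 2 = 1 := by rw [hxy, hxy']; norm_num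
  refine ⟨2 * x * y * y' ^ 2 * n * d' + 2 * y ^ 2 * x' * y' * d * n' + y ^ 2 * y' ^ 2 * d * d'
      - y ^ 2 * x' ^ 2 * n * n',
    x ^ 2 * y' ^ 2 * d' * n + y ^ 2 * x' ^ 2 * n' * d,
    x ^ 2 * n * (x' ^ 2 * n' + 2 * x' * y' * d') + 2 * x * y * x' ^ 2 * d * n'
      + 4 * x * y * x' * y' * d * d' - x ^ 2 * y' ^ 2 * d * d', ?_⟩
  linear_combination e

lemma max_natDegree_mul (n d n' d' : k[X]) (hd : d ≠ 0) (hd' : d' ≠ 0) :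
    max n.natDegree d.natDegree + max n'.natDegree d'.natDegree ≤
      max (d * d').natDegree (max (n * d' + n' * d).natDegree (n * n').natDegree) := by
  rw [natDegree_mul hd hd']
  by_cases h1 : n.natDegree ≤ d.natDegree
  · by_cases h2 : n'.natDegree ≤ d'.natDegree
    · omega
    · have hn' : n' ≠ 0 := by rintro rfl; simp at h2
      by_cases h3 : n.natDegree = d.natDegree ∧ n ≠ 0
      · rw [natDegree_mul h3.2 hn']; omega
      · have : (n * d' + n' * d).natDegree = n'.natDegree + d.natDegree := by
          rw [natDegree_add_eq_right_of_natDegree_lt, natDegree_mul hn' hd]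
          rw [natDegree_mul hn' hd]
          by_cases hn : n = 0
          · simp [hn]; omega
          · rw [natDegree_mul hn hd']; have : ¬ n.natDegree = d.natDegree := fun h => h3 ⟨h, hn⟩
            omega
        omega
  · have hn : n ≠ 0 := by rintro rfl; simp at h1
    by_cases h2 : d'.natDegree ≤ n'.natDegree ∧ n' ≠ 0
    · rw [natDegree_mul hn h2.2]; omega
    · have : (n * d' + n' * d).natDegree = n.natDegree + d'.natDegree := by
        rw [natDegree_add_eq_left_of_natDegree_lt, natDegree_mul hn hd']
        rw [natDegree_mul hn hd']
        by_cases hn' : n' = 0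
        · simp [hn']; omega
        · rw [natDegree_mul hn' hd]; have : ¬ d'.natDegree ≤ n'.natDegree := fun h => h2 ⟨h, hn'⟩
          omega
      have h3 : n'.natDegree ≤ d'.natDegree := by
        by_cases hn' : n' = 0
        · simp [hn']
        · by_contra h; exact h2 ⟨by omega, hn'⟩
      omega

/-- Heights of two rational functions are controlled by any representation of their symmetric
functions. -/
lemma ht_add_ht_le {u v : RatFunc k} {p0 p1 p2 : k[X]} {N : ℕ} (h0 : p0 ≠ 0)
    (h1 : algebraMap k[X] (RatFunc k) p1 = (u + v) * algebraMap k[X] (RatFunc k) p0)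
    (h2 : algebraMap k[X] (RatFunc k) p2 = (u * v) * algebraMap k[X] (RatFunc k) p0)
    (d0 : p0.natDegree ≤ N) (d1 : p1.natDegree ≤ N) (d2 : p2.natDegree ≤ N) :
    ht u + ht v ≤ N := by
  have hdu := RatFunc.denom_ne_zero u
  have hdv := RatFunc.denom_ne_zero v
  have hdu' : algebraMap k[X] (RatFunc k) u.denom ≠ 0 := RatFunc.algebraMap_ne_zero hdu
  have hdv' : algebraMap k[X] (RatFunc k) v.denom ≠ 0 := RatFunc.algebraMap_ne_zero hdv
  have eu : u * algebraMap k[X] (RatFunc k) u.denom = algebraMap k[X] (RatFunc k) u.num := by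
    nth_rw 1 [← RatFunc.num_div_denom u]; field_simp
  have ev : v * algebraMap k[X] (RatFunc k) v.denom = algebraMap k[X] (RatFunc k) v.num := by
    nth_rw 1 [← RatFunc.num_div_denom v]; field_simp
  obtain ⟨e0, e1, e2, he⟩ := primitive_triple (RatFunc.isCoprime_num_denom u)
    (RatFunc.isCoprime_num_denom v)
  set c := e0 * p0 + e1 * p1 + e2 * p2 with hc
  have q1 : p1 * (u.denom * v.denom) = p0 * (u.num * v.denom + v.num * u.denom) := by
    apply RatFunc.algebraMap_injective k
    simp only [map_mul, map_add, h1, ← eu, ← ev]; ring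
  have q2 : p2 * (u.denom * v.denom) = p0 * (u.num * v.num) := by
    apply RatFunc.algebraMap_injective k
    simp only [map_mul, h2, ← eu, ← ev]; ring
  have hdd : u.denom * v.denom ≠ 0 := mul_ne_zero hdu hdv
  have r0 : p0 = c * (u.denom * v.denom) := by
    rw [hc]
    linear_combination (-p0) * he - e1 * q1 - e2 * q2
  have r1 : p1 = c * (u.num * v.denom + v.num * u.denom) := by
    apply mul_right_cancel₀ hdd
    rw [q1]; nth_rw 1 [r0]; ring
  have r2 : p2 = c * (u.num * v.num) := by
    apply mul_right_cancel₀ hdd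
    rw [q2]; nth_rw 1 [r0]; ring
  have hc0 : c ≠ 0 := by rintro h; rw [h, zero_mul] at r0; exact h0 r0
  have key : ∀ p q : k[X], p = c * q → p.natDegree ≤ N → q.natDegree ≤ N := by
    rintro p q rfl hp
    by_cases hq : q = 0
    · simp [hq]
    · rw [natDegree_mul hc0 hq] at hp; omega
  exact (max_natDegree_mul _ _ _ _ hdu hdv).trans
    (max_le (key _ _ r0 d0) (max_le (key _ _ r1 d1) (key _ _ r2 d2)))

/-- Height of a fraction with coprime numerator and denominator. -/
lemma ht_div {p q : k[X]} (hq : q ≠ 0) (h : IsCoprime p q) :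
    ht (algebraMap k[X] (RatFunc k) p / algebraMap k[X] (RatFunc k) q) =
      max p.natDegree q.natDegree := by
  set u := algebraMap k[X] (RatFunc k) p / algebraMap k[X] (RatFunc k) q with hu
  have h1 : u.num * q = p * u.denom := RatFunc.num_mul_eq_mul_denom_iff hq |>.mpr hu
  have hc := RatFunc.isCoprime_num_denom u
  obtain ⟨s, hs⟩ := h.symm.dvd_of_dvd_mul_left (show q ∣ p * u.denom from ⟨u.num, by rw [← h1]; ring⟩)
  have hdu := RatFunc.denom_ne_zero u
  have h2 : u.num = p * s := by
    apply mul_right_cancel₀ hq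
    rw [h1, hs]; ring
  have hsu : IsUnit s := by
    rw [h2, hs] at hc
    exact hc.of_mul_left_right.of_mul_right_right.isUnit_of_dvd' dvd_rfl dvd_rfl
  have : s.natDegree = 0 := natDegree_eq_zero_of_isUnit hsu
  have hs0 : s ≠ 0 := hsu.ne_zero
  rw [ht, h2, hs, natDegree_mul hq hs0, this]
  by_cases hp : p = 0
  · simp [hp]
  · rw [natDegree_mul hp hs0, this]; simp

end Triple

section Formulas

variable {F : Type} [Field F] {W : ShortCurve F}

lemma px_add_sub {P Q : W.Pt} (hP : P ≠ 0) (hQ : Q ≠ 0) (h : px P ≠ px Q) :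
    (px (P + Q) + px (P - Q)) * (px P - px Q) ^ 2 =
      2 * (px P * px Q + W.A) * (px P + px Q) + 4 * W.B ∧
    px (P + Q) * px (P - Q) * (px P - px Q) ^ 2 =
      (px P * px Q - W.A) ^ 2 - 4 * W.B * (px P + px Q) := by
  obtain ⟨-, h1, -⟩ := add_of_px_ne hP hQ h
  obtain ⟨-, h2, -⟩ := add_of_px_ne hP (neg_ne_zero.mpr hQ) (by simpa using h)
  rw [← sub_eq_add_neg, px_neg, py_neg] at h2
  have e1 := py_sq hP
  have e2 := py_sq hQ
  rw [f] at e1 e2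
  have hne : px P - px Q ≠ 0 := sub_ne_zero.mpr h
  generalize px P = x1 at *
  generalize px Q = x2 at *
  generalize py P = y1 at *
  generalize py Q = y2 at *
  have g1 : px (P + Q) * (x1 - x2) ^ 2 = (y1 - y2) ^ 2 - (x1 + x2) * (x1 - x2) ^ 2 := by
    rw [h1]; field_simp; ring
  have g2 : px (P - Q) * (x1 - x2) ^ 2 = (y1 + y2) ^ 2 - (x1 + x2) * (x1 - x2) ^ 2 := by
    rw [h2]; field_simp; ring
  constructor
  · linear_combination g1 + g2 + 2 * e1 + 2 * e2
  · apply mul_right_cancel₀ (pow_ne_zero 2 hne)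
    have : px (P + Q) * px (P - Q) * (x1 - x2) ^ 2 * (x1 - x2) ^ 2 =
      ((y1 - y2) ^ 2 - (x1 + x2) * (x1 - x2) ^ 2) * ((y1 + y2) ^ 2 - (x1 + x2) * (x1 - x2) ^ 2) := by
      rw [← g1, ← g2]; ring
    rw [this]
    have f1 : (y1 - y2) ^ 2 * (y1 + y2) ^ 2 = (y1 ^ 2 - y2 ^ 2) ^ 2 := by ring
    have f2 : (y1 - y2) ^ 2 + (y1 + y2) ^ 2 = 2 * (y1 ^ 2 + y2 ^ 2) := by ring
    have : ((y1 - y2) ^ 2 - (x1 + x2) * (x1 - x2) ^ 2) * ((y1 + y2) ^ 2 - (x1 + x2) * (x1 - x2) ^ 2)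
      = (y1 ^ 2 - y2 ^ 2) ^ 2 - (x1 + x2) * (x1 - x2) ^ 2 * (2 * (y1 ^ 2 + y2 ^ 2)) +
        ((x1 + x2) * (x1 - x2) ^ 2) ^ 2 := by rw [← f1, ← f2]; ring
    rw [this, e1, e2]; ring

lemma px_double {P : W.Pt} (h : py P ≠ 0) :
    px (P + P) * (4 * W.f (px P)) =
      px P ^ 4 - 2 * W.A * px P ^ 2 - 8 * W.B * px P + W.A ^ 2 := by
  have hP : P ≠ 0 := by rintro rfl; simp at h
  obtain ⟨-, h1, -⟩ := add_self_of_py_ne h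
  have h2 := W.two
  have e := py_sq hP
  have : px (P + P) * (4 * py P ^ 2) = (3 * px P ^ 2 + W.A) ^ 2 - 8 * px P * py P ^ 2 := by
    rw [h1]
    have h4 : (4 : F) = 2 * 2 := by norm_num
    have h8 : (8 : F) = 2 * 2 * 2 := by norm_num
    rw [h4, h8]
    field_simp
  rw [e] at this
  rw [this, f]; ring

end Formulas

section HP

variable {k : Type} [Field k] [IsAlgClosed k] {W W' : ShortCurve k}

/-- The first coordinate of an element of the function field in the basis `1, y`. -/
noncomputable def evenPart (z : W.FF) : RatFunc k := QuadraticAlgebra.re z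

lemma evenPart_io (a : RatFunc k) : evenPart (io a : W.FF) = a := rfl

/-- The height of a point of the function field whose abscissa is even. -/
noncomputable def hp (φ : W'.P W.FF) : ℕ := ht (evenPart (px φ))

lemma hp_of {φ : W'.P W.FF} {u : RatFunc k} (h : px φ = io u) : hp φ = ht u := by
  rw [hp, h, evenPart_io]

lemma ht_C (c : k) : ht (algebraMap k (RatFunc k) c) = 0 := by
  rw [ht, RatFunc.algebraMap_eq_C, RatFunc.num_C, RatFunc.denom_C]; simp

lemma hp_const {φ : W'.P W.FF} (h : W.Const (px φ)) : hp φ = 0 := by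
  obtain ⟨c, hc⟩ := h
  rw [hp_of (u := algebraMap k (RatFunc k) c) (by rw [← hc, AlgHom.commutes]), ht_C]

lemma hp_zero : hp (0 : W'.P W.FF) = 0 := hp_const ⟨0, by simp⟩

lemma hp_incl (P : W'.P k) : hp (W'.incl W.FF P) = 0 := hp_const ⟨px P, by simp⟩

lemma hp_neg (φ : W'.P W.FF) : hp (-φ) = hp φ := by rw [hp, hp, px_neg]

lemma px_of_odd {φ : W'.P W.FF} (h : pm conj φ = -φ) : ∃ u, px φ = io u :=
  conj_eq_self W.two (by rw [← px_pm, h, px_neg])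

lemma ht_X : ht (RatFunc.X : RatFunc k) = 1 := by
  rw [ht, RatFunc.num_X, RatFunc.denom_X]; simp

lemma hp_gen : hp (gen : W.P W.FF) = 1 := by
  rw [hp_of (u := RatFunc.X) (by rw [px_gen]; rfl), ht_X]

lemma io_algebraMap_const (a : k) : (io (algebraMap k (RatFunc k) a) : W.FF) = algebraMap k W.FF a :=
  io.commutes a

lemma four_ne (W : ShortCurve k) : (4 : k) ≠ 0 := by
  have h4 : (4 : k) = 2 * 2 := by norm_num
  rw [h4]; exact mul_ne_zero W.two W.two

/-- The numerator of the duplication formula. -/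
noncomputable def dupN (W : ShortCurve k) : k[X] :=
  X ^ 4 - C (2 * W.A) * X ^ 2 - C (8 * W.B) * X + C (W.A ^ 2)

lemma isCoprime_dup : IsCoprime (dupN W) (C 4 * W.fP) := by
  refine (Polynomial.isCoprime_iff_aeval_ne_zero_of_isAlgClosed k k _ _).mpr fun x => ?_
  by_contra! h
  obtain ⟨h1, h2⟩ := h
  have h3 : W.f x = 0 := by
    simpa [four_ne W, aeval_def, eval₂_eq_eval_map, eval_fP] using h2
  have h4 : x ^ 4 - 2 * W.A * x ^ 2 - 8 * W.B * x + W.A ^ 2 = 0 := by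
    simpa [dupN] using h1
  rw [f] at h3
  have h5 : 3 * x ^ 2 + W.A = 0 := by
    have : (3 * x ^ 2 + W.A) ^ 2 = 0 := by linear_combination h4 + 8 * x * h3
    exact pow_eq_zero_iff (two_ne_zero) |>.mp this
  apply W.disc
  have hA : W.A = -3 * x ^ 2 := by linear_combination h5
  have hB : W.B = 2 * x ^ 3 := by rw [hA] at h3; linear_combination h3
  rw [hA, hB]; ring

lemma hp_double {φ : W'.P W.FF} (h : pm conj φ = -φ) : hp (φ + φ) = 4 * hp φ := by
  by_cases hc : W.Const (px φ)
  · obtain ⟨P, rfl⟩ := exists_incl_eq hc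
    rw [← map_add, hp_incl, hp_incl]
  have hy : py φ ≠ 0 := by
    intro h0
    obtain ⟨Q, rfl⟩ := const_of_py_eq_zero h0
    exact hc ⟨px Q, by simp⟩
  have h2 : pm conj (φ + φ) = -(φ + φ) := by rw [map_add, h, neg_add]
  obtain ⟨u, hu⟩ := px_of_odd h
  obtain ⟨v, hv⟩ := px_of_odd h2
  have hun : u ∉ (algebraMap k (RatFunc k)).range := by
    intro h; exact hc (by rw [hu]; exact const_io.mpr h)
  obtain ⟨g, hg⟩ := exists_subst hun
  have key := px_double hy
  rw [hu, hv, ← aeval_fP, aeval_algHom_apply] at key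
  have key2 : v * (4 * Polynomial.aeval u W'.fP) = Polynomial.aeval u (dupN W') := by
    apply io_injective (W := W)
    rw [map_mul, map_mul, map_ofNat, key, ← aeval_algHom_apply]
    simp only [dupN, map_add, map_sub, map_mul, map_pow, aeval_X, aeval_C, bc, map_ofNat]
  have h4 : (4 : RatFunc k) ≠ 0 := by
    intro h5; apply four_ne W
    apply (algebraMap k (RatFunc k)).injective
    rw [map_ofNat, h5, map_zero]
  have hfu : Polynomial.aeval u W'.fP ≠ 0 := by
    intro h0
    exact W'.fP_ne_zero (transcendental_iff.mp (transcendental_of_notMem hun) _ h0)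
  have hv2 : v = g (algebraMap k[X] (RatFunc k) (dupN W') /
      algebraMap k[X] (RatFunc k) (C 4 * W'.fP)) := by
    have hga : ∀ p : k[X], g (algebraMap k[X] (RatFunc k) p) = Polynomial.aeval u p := by
      intro p
      rw [← hg, aeval_algHom_apply, ← RatFunc.algebraMap_X, aeval_algebraMap_apply,
        aeval_X_left_apply]
    rw [map_div₀, hga, hga, ← key2, map_mul, aeval_C, map_ofNat]
    field_simp
  have hdeg : (dupN W').natDegree = 4 := by rw [dupN]; compute_degree!
  have hdeg2 : (C 4 * W'.fP).natDegree = 3 := by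
    rw [natDegree_C_mul (four_ne W), natDegree_fP]
  rw [hp_of hu, hp_of hv, hv2, ht_comp, hg,
    ht_div (mul_ne_zero (C_ne_zero.mpr (four_ne W)) W'.fP_ne_zero) isCoprime_dup, hdeg, hdeg2]
  norm_num

lemma hp_add_sub_le {φ ψ : W'.P W.FF} (h : pm conj φ = -φ) (h' : pm conj ψ = -ψ) :
    hp (φ + ψ) + hp (φ - ψ) ≤ 2 * hp φ + 2 * hp ψ := by
  by_cases h0 : φ = 0
  · rw [h0, zero_add, zero_sub, hp_neg, hp_zero]; omega
  by_cases h0' : ψ = 0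
  · rw [h0', add_zero, sub_zero, hp_zero]; omega
  by_cases hx : px φ = px ψ
  · rcases (px_eq_iff h0 h0').mp hx with rfl | rfl
    · rw [hp_double h, sub_self, hp_zero]; omega
    · rw [neg_add_cancel, ← neg_add', hp_neg, hp_neg, hp_double h', hp_zero]; omega
  obtain ⟨u, hu⟩ := px_of_odd h
  obtain ⟨v, hv⟩ := px_of_odd h'
  obtain ⟨s, hs⟩ := px_of_odd (φ := φ + ψ) (by rw [map_add, h, h']; abel)
  obtain ⟨t, ht'⟩ := px_of_odd (φ := φ - ψ) (by rw [map_sub, h, h']; abel)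
  obtain ⟨k1, k2⟩ := px_add_sub h0 h0' hx
  rw [hp_of hu, hp_of hv, hp_of hs, hp_of ht']
  rw [hu, hv] at hx
  have huv : u ≠ v := fun e => hx (by rw [e])
  rw [hu, hv, hs, ht'] at k1 k2
  have eA : (W'.bc W.FF).A = io (algebraMap k (RatFunc k) W'.A) := (io_algebraMap_const _).symm
  have eB : (W'.bc W.FF).B = io (algebraMap k (RatFunc k) W'.B) := (io_algebraMap_const _).symm
  rw [eA, eB] at k1 k2
  have k1' : (s + t) * (u - v) ^ 2 = 2 * (u * v + algebraMap k (RatFunc k) W'.A) * (u + v) +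
      4 * algebraMap k (RatFunc k) W'.B := by
    apply io_injective (W := W); simpa [map_ofNat] using k1
  have k2' : s * t * (u - v) ^ 2 = (u * v - algebraMap k (RatFunc k) W'.A) ^ 2 -
      4 * algebraMap k (RatFunc k) W'.B * (u + v) := by
    apply io_injective (W := W); simpa [map_ofNat] using k2
  have ea : algebraMap k[X] (RatFunc k) u.num = u * algebraMap k[X] (RatFunc k) u.denom := by
    have h0 := RatFunc.algebraMap_ne_zero (RatFunc.denom_ne_zero u)
    nth_rw 2 [← RatFunc.num_div_denom u]; rw [div_mul_cancel₀ _ h0]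
  have ec : algebraMap k[X] (RatFunc k) v.num = v * algebraMap k[X] (RatFunc k) v.denom := by
    have h0 := RatFunc.algebraMap_ne_zero (RatFunc.denom_ne_zero v)
    nth_rw 2 [← RatFunc.num_div_denom v]; rw [div_mul_cancel₀ _ h0]
  set a := u.num
  set b := u.denom
  set c := v.num
  set d := v.denom
  have hb : b ≠ 0 := RatFunc.denom_ne_zero u
  have hd : d ≠ 0 := RatFunc.denom_ne_zero v
  have hb' : algebraMap k[X] (RatFunc k) b ≠ 0 := RatFunc.algebraMap_ne_zero hb
  have hd' : algebraMap k[X] (RatFunc k) d ≠ 0 := RatFunc.algebraMap_ne_zero hd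
  have hC : ∀ c : k, algebraMap k[X] (RatFunc k) (C c) = algebraMap k (RatFunc k) c := fun c => rfl
  have ha1 : a.natDegree ≤ ht u := le_max_left _ _
  have hb1 : b.natDegree ≤ ht u := le_max_right _ _
  have hc1 : c.natDegree ≤ ht v := le_max_left _ _
  have hd1 : d.natDegree ≤ ht v := le_max_right _ _
  have dm : ∀ {p q : k[X]} {m n : ℕ}, p.natDegree ≤ m → q.natDegree ≤ n →
      (p * q).natDegree ≤ m + n := fun hp hq => natDegree_mul_le.trans (add_le_add hp hq)
  have da : ∀ {p q : k[X]} {m : ℕ}, p.natDegree ≤ m → q.natDegree ≤ m →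
      (p + q).natDegree ≤ m := fun hp hq => (natDegree_add_le _ _).trans (max_le hp hq)
  have ds : ∀ {p q : k[X]} {m : ℕ}, p.natDegree ≤ m → q.natDegree ≤ m →
      (p - q).natDegree ≤ m := fun hp hq => (natDegree_sub_le _ _).trans (max_le hp hq)
  have dC : ∀ {p : k[X]} {m : ℕ} (e : k), p.natDegree ≤ m → (C e * p).natDegree ≤ m :=
    fun e hp => (natDegree_C_mul_le _ _).trans hp
  have d1 : (a * d - c * b).natDegree ≤ ht u + ht v := ds (dm ha1 hd1) (by
    rw [mul_comm]; exact dm hb1 hc1)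
  have d2 : (a * d + c * b).natDegree ≤ ht u + ht v := da (dm ha1 hd1) (by
    rw [mul_comm c]; exact dm hb1 hc1)
  have d3 := dm hb1 hd1
  have d4 := dm ha1 hc1
  refine (ht_add_ht_le (N := (ht u + ht v) + (ht u + ht v)) (p0 := (a * d - c * b) * (a * d - c * b))
    (p1 := C 2 * ((a * c + C W'.A * (b * d)) * (a * d + c * b)) + C (4 * W'.B) * ((b * d) * (b * d)))
    (p2 := (a * c - C W'.A * (b * d)) * (a * c - C W'.A * (b * d)) -
      C (4 * W'.B) * ((a * d + c * b) * (b * d))) ?_ ?_ ?_ ?_ ?_ ?_).trans (by omega)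
  · rw [mul_self_ne_zero]
    intro h0
    apply huv
    have := congrArg (algebraMap k[X] (RatFunc k)) h0
    simp only [map_sub, map_mul, map_zero, ea, ec] at this
    apply mul_right_cancel₀ (mul_ne_zero hb' hd')
    linear_combination this
  · simp only [map_sub, map_mul, map_add, ea, ec, hC, map_ofNat]
    linear_combination (-(algebraMap k[X] (RatFunc k) b * algebraMap k[X] (RatFunc k) d) ^ 2) * k1'
  · simp only [map_sub, map_mul, map_add, ea, ec, hC, map_ofNat]
    linear_combination (-(algebraMap k[X] (RatFunc k) b * algebraMap k[X] (RatFunc k) d) ^ 2) * k2'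
  · exact dm d1 d1
  · exact da (dC _ (dm (da d4 (dC _ d3)) d2)) (dC _ (dm d3 d3))
  · exact ds (dm (ds d4 (dC _ d3)) (ds d4 (dC _ d3))) (dC _ (dm d2 d3))

lemma hp_add_sub {φ ψ : W'.P W.FF} (h : pm conj φ = -φ) (h' : pm conj ψ = -ψ) :
    hp (φ + ψ) + hp (φ - ψ) = 2 * hp φ + 2 * hp ψ := by
  have h1 := hp_add_sub_le h h'
  have h2 := hp_add_sub_le (φ := φ + ψ) (ψ := φ - ψ) (by rw [map_add, h, h']; abel)
    (by rw [map_sub, h, h']; abel)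
  rw [show φ + ψ + (φ - ψ) = φ + φ by abel, show φ + ψ - (φ - ψ) = ψ + ψ by abel, hp_double h,
    hp_double h'] at h2
  omega

lemma hp_add_le {φ ψ : W'.P W.FF} (h : pm conj φ = -φ) (h' : pm conj ψ = -ψ) :
    hp (φ + ψ) ≤ 2 * hp φ + 2 * hp ψ := by
  have := hp_add_sub h h'; omega

lemma hp_nsmul {φ : W'.P W.FF} (h : pm conj φ = -φ) (n : ℕ) : hp (n • φ) = n ^ 2 * hp φ := by
  induction n using Nat.strong_induction_on with
  | _ n ih =>
    match n with
    | 0 => rw [zero_smul, hp_zero]; simp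
    | 1 => rw [one_smul]; simp
    | n + 2 =>
      have h1 := hp_add_sub (φ := (n + 1) • φ) (ψ := φ) (by rw [map_nsmul, h, smul_neg]) h
      rw [← succ_nsmul, show (n + 1) • φ - φ = n • φ by rw [succ_nsmul]; abel, ih n (by omega),
        ih (n + 1) (by omega)] at h1
      zify at h1 ⊢
      linear_combination h1

lemma hp_zsmul {φ : W'.P W.FF} (h : pm conj φ = -φ) (n : ℤ) :
    hp (n • φ) = n.natAbs ^ 2 * hp φ := by
  rcases Int.natAbs_eq n with e | e
  · nth_rw 1 [e]; rw [natCast_zsmul, hp_nsmul h]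
  · nth_rw 1 [e]; rw [neg_smul, natCast_zsmul, hp_neg, hp_nsmul h]

end HP

section Separability

variable {k : Type} [Field k] [IsAlgClosed k] {W W' : ShortCurve k}

lemma exists_pow_of_derivative_eq_zero {p : ℕ} [Fact p.Prime] [CharP k p] {q : k[X]}
    (h : derivative q = 0) : ∃ r : k[X], q = r ^ p := by
  have hp : p ≠ 0 := (Fact.out : p.Prime).ne_zero
  obtain ⟨r, hr⟩ := Polynomial.map_surjective (frobenius k p)
    (fun x => by
      obtain ⟨y, hy⟩ := IsAlgClosed.exists_pow_nat_eq x (Nat.pos_of_ne_zero hp)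
      exact ⟨y, hy⟩) (contract p q)
  refine ⟨r, ?_⟩
  rw [← expand_contract p h hp, ← hr, ← map_expand, map_frobenius_expand]

lemma derivative_eq_zero_of_coprime {n d : k[X]} (h : IsCoprime n d)
    (h' : derivative n * d - n * derivative d = 0) : derivative n = 0 ∧ derivative d = 0 := by
  have aux : ∀ a b : k[X], IsCoprime a b → a ∣ derivative a * b → derivative a = 0 := by
    intro a b hab hd
    have h1 := hab.dvd_of_dvd_mul_right hd
    by_contra h0
    have h2 := natDegree_le_of_dvd h1 h0
    have h3 : a.natDegree ≠ 0 := by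
      intro h3
      rw [eq_C_of_natDegree_eq_zero h3] at h0
      simp at h0
    have := natDegree_derivative_lt h3
    omega
  refine ⟨aux n d h ⟨derivative d, sub_eq_zero.mp h'⟩, aux d n h.symm ⟨derivative n, ?_⟩⟩
  linear_combination -h'

lemma ht_pow (u : RatFunc k) (n : ℕ) : ht (u ^ n) = n * ht u := by
  have h : u ^ n = algebraMap k[X] (RatFunc k) (u.num ^ n) /
      algebraMap k[X] (RatFunc k) (u.denom ^ n) := by
    rw [map_pow, map_pow, ← div_pow, RatFunc.num_div_denom]
  rw [h, ht_div (pow_ne_zero _ (RatFunc.denom_ne_zero u)) (RatFunc.isCoprime_num_denom u).pow,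
    natDegree_pow, natDegree_pow, ht, Nat.mul_max_mul_left]

lemma DD_io (u : RatFunc k) : DD (io u : W.FF) =
    io (algebraMap k[X] (RatFunc k) (derivative u.num * u.denom - u.num * derivative u.denom) /
      algebraMap k[X] (RatFunc k) u.denom ^ 2) * (2 * yy) := by
  conv_lhs => rw [← RatFunc.num_div_denom u]
  exact DD_io_div _ _

lemma derivative_eq_zero_of_DD {u : RatFunc k} (h : DD (io u : W.FF) = 0) :
    derivative u.num = 0 ∧ derivative u.denom = 0 := by
  refine derivative_eq_zero_of_coprime (RatFunc.isCoprime_num_denom u) ?_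
  rw [DD_io] at h
  have h2 : (2 * yy : W.FF) ≠ 0 := mul_ne_zero (W.bc W.FF).two yy_ne_zero
  have h3 := (mul_eq_zero.mp h).resolve_right h2
  rw [map_eq_zero, div_eq_zero_iff] at h3
  rcases h3 with h3 | h3
  · exact (map_eq_zero_iff _ (RatFunc.algebraMap_injective k)).mp h3
  · exact absurd h3 (pow_ne_zero _ (RatFunc.algebraMap_ne_zero (RatFunc.denom_ne_zero u)))

lemma exists_pow_of_DD {p : ℕ} [Fact p.Prime] [CharP k p] {u : RatFunc k}
    (h : DD (io u : W.FF) = 0) : ∃ v, u = v ^ p := by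
  obtain ⟨h1, h2⟩ := derivative_eq_zero_of_DD h
  obtain ⟨r, hr⟩ := exists_pow_of_derivative_eq_zero (p := p) h1
  obtain ⟨s, hs⟩ := exists_pow_of_derivative_eq_zero (p := p) h2
  refine ⟨algebraMap _ _ r / algebraMap _ _ s, ?_⟩
  rw [div_pow, ← map_pow, ← map_pow, ← hr, ← hs, RatFunc.num_div_denom]

/-- An inseparable algebraic homomorphism has a small kernel. -/
lemma Rep.mul_card_ker_le {p : ℕ} [Fact p.Prime] [CharP k p] {α : W.P k →+ W'.P k} {φ}
    (h : Rep α φ) (hα : α ≠ 0) (hc : cF φ = 0) (S : Finset (W.P k)) (hS : ∀ P ∈ S, α P = 0) :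
    p * S.card ≤ hp φ := by
  obtain ⟨u, hu⟩ := h.px_eq
  have h0 : DD (io u : W.FF) = 0 := by
    have := D_px (D := DD) φ
    rw [hu] at this
    rw [this]
    exact mul_eq_zero_of_right _ hc
  obtain ⟨v, rfl⟩ := exists_pow_of_DD (p := p) h0
  rw [hp_of hu, ht_pow]
  refine Nat.mul_le_mul_left _ (card_le_of_invariant (W := W) (fun hv => ?_) S fun P hP => ?_)
  · apply h.not_const hα
    rw [hu]
    obtain ⟨c, rfl⟩ := hv
    exact const_io.mpr ⟨c ^ p, map_pow _ _ _⟩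
  · have h1 : tau P (io (v ^ p) : W.FF) = io (v ^ p) := by
      rw [← hu, ← px_pm, h.2, hS P hP]; simp
    rw [map_pow, map_pow] at h1
    have : CharP W.FF p := charP_of_injective_algebraMap (algebraMap k W.FF).injective p
    exact frobenius_inj W.FF p h1

end Separability

section Frobenius

variable {k : Type} [Field k] [IsAlgClosed k] {p : ℕ} [Fact p.Prime] [CharP k p]
  [Algebra (ZMod p) k] (W : ShortCurve (ZMod p))

lemma charP_of_algebra (k : Type) [Field k] (p : ℕ) [CharP k p] (L : Type) [Field L] [Algebra k L] :
    CharP L p := charP_of_injective_algebraMap (algebraMap k L).injective p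

/-- The Frobenius map on points. -/
noncomputable def frob (L : Type) [Field L] [Algebra k L] : (W.bc k).P L →+ (W.bc k).P L :=
  haveI := charP_of_algebra k p L
  pmap (frobenius L p) ⟨by
      change (algebraMap k L (algebraMap (ZMod p) k W.A)) ^ p = _
      rw [← map_pow, ← map_pow, ZMod.pow_card]; rfl, by
      change (algebraMap k L (algebraMap (ZMod p) k W.B)) ^ p = _
      rw [← map_pow, ← map_pow, ZMod.pow_card]; rfl⟩

variable {L L' : Type} [Field L] [Algebra k L] [Field L'] [Algebra k L']

lemma px_frob (P : (W.bc k).P L) : px (frob W L P) = px P ^ p := px_pmap _ _ _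
lemma py_frob (P : (W.bc k).P L) : py (frob W L P) = py P ^ p := py_pmap _ _ _
lemma frob_eq_zero {P : (W.bc k).P L} : frob W L P = 0 ↔ P = 0 := by
  have := charP_of_algebra k p L
  exact pmap_eq_zero

lemma pm_frob (ψ : L →ₐ[k] L') (P : (W.bc k).P L) : pm ψ (frob W L P) = frob W L' (pm ψ P) := by
  by_cases h0 : P = 0
  · simp [h0]
  refine pm_unique (mt (frob_eq_zero W).mp h0) (mt (frob_eq_zero W).mp (mt pm_eq_zero.mp h0)) ?_ ?_
  · rw [px_frob, px_frob, px_pm, map_pow]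
  · rw [py_frob, py_frob, py_pm, map_pow]

lemma Rep.frob {V : ShortCurve k} {α : V.P k →+ (W.bc k).P k} {φ} (h : Rep α φ) :
    Rep ((frob W k).comp α) (frob W V.FF φ) :=
  ⟨by rw [pm_frob, h.1, map_neg], fun P => by
    rw [pm_frob, h.2, map_add, incl, ← pm_frob]; rfl⟩

lemma cF_frob {V : ShortCurve k} (φ : (W.bc k).P V.FF) : cF (frob W V.FF φ) = 0 := by
  have := charP_of_algebra k p V.FF
  change _ / _ = (0 : V.FF)
  rw [px_frob, Derivation.leibniz_pow]
  simp

lemma hp_frob {V : ShortCurve k} {φ : (W.bc k).P V.FF} (h : pm conj φ = -φ) :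
    hp (frob W V.FF φ) = p * hp φ := by
  obtain ⟨u, hu⟩ := px_of_odd h
  rw [hp_of hu, hp_of (u := u ^ p) (by rw [px_frob, hu, map_pow]), ht_pow]

lemma mem_range_of_pow_eq {x : k} (h : x ^ p = x) : ∃ z : ZMod p, algebraMap (ZMod p) k z = x := by
  have h1 := (Subfield.mem_bot_iff_pow_eq_self k p).mpr h
  obtain ⟨n, hn⟩ := (mem_bot_iff_intCast p k).mp h1
  exact ⟨n, by rw [map_intCast]; exact hn⟩

open Finset in
/-- The points fixed and negated by Frobenius. -/
lemma exists_fixed (W : ShortCurve (ZMod p)) : ∃ S S' : Finset ((W.bc k).P k),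
    (∀ P, P ∈ S ↔ frob W k P = P) ∧ (∀ P, P ∈ S' ↔ frob W k P = -P) ∧
    S.card = (univ.filter fun z : ZMod p × ZMod p => z.2 ^ 2 = W.f z.1).card + 1 ∧
    S.card + S'.card = 2 * p + 2 := by
  classical
  have hQ : ∀ x : ZMod p, ∃ Q : (W.bc k).P k, Q ≠ 0 ∧ px Q = algebraMap (ZMod p) k x := by
    intro x
    obtain ⟨y, hy⟩ := IsAlgClosed.exists_pow_nat_eq (((W.bc k).bc k).f (algebraMap (ZMod p) k x)) (n := 2)
      (by norm_num)
    exact ⟨pt _ y hy, pt_ne_zero _, px_pt _⟩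
  choose Q hQ0 hQx using hQ
  have hinj := (algebraMap (ZMod p) k).injective
  -- each point over `x` is fixed or negated
  have hfix : ∀ x, frob W k (Q x) = Q x ∨ frob W k (Q x) = -Q x := by
    intro x
    refine (px_eq_iff (mt (frob_eq_zero W).mp (hQ0 x)) (hQ0 x)).mp ?_
    rw [px_frob, hQx, ← map_pow, ZMod.pow_card]
  have hall : ∀ P : (W.bc k).P k, P ≠ 0 → (frob W k P = P ∨ frob W k P = -P) →
      ∃ x, px P = algebraMap (ZMod p) k x := by
    intro P hP h
    obtain ⟨z, hz⟩ := mem_range_of_pow_eq (p := p) (x := px P) (by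
      rw [← px_frob]; rcases h with h | h <;> rw [h]; rw [px_neg])
    exact ⟨z, hz.symm⟩
  set V : Finset ((W.bc k).P k) := univ.image Q ∪ univ.image fun x => -Q x with hV
  have hVmem : ∀ P x, P ≠ 0 → px P = algebraMap (ZMod p) k x → P = Q x ∨ P = -Q x := by
    intro P x hP hx
    exact (px_eq_iff hP (hQ0 x)).mp (by rw [hx, hQx])
  set S := V.filter fun P => frob W k P = P with hS
  set S' := V.filter fun P => frob W k P = -P with hS'
  have hV0 : ∀ P ∈ V, P ≠ 0 ∧ ∃ x, px P = algebraMap (ZMod p) k x := by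
    intro P hP
    rcases mem_union.mp hP with h | h <;> obtain ⟨x, -, rfl⟩ := mem_image.mp h
    · exact ⟨hQ0 x, x, hQx x⟩
    · exact ⟨neg_ne_zero.mpr (hQ0 x), x, by rw [px_neg, hQx]⟩
  have hVm : ∀ P x, P ≠ 0 → px P = algebraMap (ZMod p) k x → P ∈ V := by
    intro P x hP hx
    rcases hVmem P x hP hx with h | h <;> rw [h]
    · exact mem_union_left _ (mem_image_of_mem _ (mem_univ _))
    · exact mem_union_right _ (mem_image.mpr ⟨x, mem_univ _, rfl⟩)
  have m1 : ∀ P, P ∈ insert 0 S ↔ frob W k P = P := by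
    intro P
    rw [mem_insert, hS, mem_filter]
    constructor
    · rintro (rfl | ⟨-, h⟩)
      · simp
      · exact h
    · intro h
      by_cases hP : P = 0
      · exact Or.inl hP
      · obtain ⟨x, hx⟩ := hall P hP (Or.inl h)
        exact Or.inr ⟨hVm P x hP hx, h⟩
  have m2 : ∀ P, P ∈ insert 0 S' ↔ frob W k P = -P := by
    intro P
    rw [mem_insert, hS', mem_filter]
    constructor
    · rintro (rfl | ⟨-, h⟩)
      · simp
      · exact h
    · intro h
      by_cases hP : P = 0
      · exact Or.inl hP
      · obtain ⟨x, hx⟩ := hall P hP (Or.inr h)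
        exact Or.inr ⟨hVm P x hP hx, h⟩
  have n1 : (0 : (W.bc k).P k) ∉ S := fun h => (hV0 0 (mem_filter.mp h).1).1 rfl
  have n2 : (0 : (W.bc k).P k) ∉ S' := fun h => (hV0 0 (mem_filter.mp h).1).1 rfl
  refine ⟨insert 0 S, insert 0 S', m1, m2, ?_, ?_⟩
  · rw [card_insert_of_notMem n1]
    congr 1
    symm
    refine card_bij (fun z hz => pt (W := (W.bc k).bc k) (algebraMap (ZMod p) k z.1) (algebraMap (ZMod p) k z.2) ?_)
      ?_ ?_ ?_
    · have := congrArg (algebraMap (ZMod p) k) (mem_filter.mp hz).2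
      rw [← map_pow, this]
      simp [ShortCurve.f, bc]
    · intro z hz
      refine mem_filter.mpr ⟨hVm _ z.1 (pt_ne_zero _) (px_pt _), ?_⟩
      refine ext_pt (mt (frob_eq_zero W).mp (pt_ne_zero _)) (pt_ne_zero _) ?_ ?_
      · rw [px_frob, px_pt, ← map_pow, ZMod.pow_card]
      · rw [py_frob, py_pt, ← map_pow, ZMod.pow_card]
    · intro z hz z' hz' h
      have h1 := congrArg px h
      have h2 := congrArg py h
      rw [px_pt, px_pt] at h1
      rw [py_pt, py_pt] at h2
      exact Prod.ext (hinj h1) (hinj h2)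
    · intro P hP
      obtain ⟨hPV, hPf⟩ := mem_filter.mp hP
      obtain ⟨hP0, x, hx⟩ := hV0 P hPV
      obtain ⟨y, hy⟩ := mem_range_of_pow_eq (p := p) (x := py P) (by rw [← py_frob, hPf])
      refine ⟨(x, y), ?_, ?_⟩
      · rw [mem_filter]
        refine ⟨mem_univ _, hinj ?_⟩
        have := py_sq hP0
        rw [hx, ← hy, ← map_pow] at this
        rw [this]
        simp [ShortCurve.f, bc]
      · refine ext_pt (pt_ne_zero _) hP0 ?_ ?_
        · rw [px_pt, hx]
        · rw [py_pt, hy]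
  · rw [card_insert_of_notMem n1, card_insert_of_notMem n2]
    have e : ∀ R : Finset ((W.bc k).P k), R ⊆ V →
        R.card = ∑ x : ZMod p, (R.filter fun P => px P = algebraMap (ZMod p) k x).card := by
      intro R hR
      rw [← card_biUnion]
      · congr 1
        ext P
        simp only [mem_biUnion, mem_univ, true_and, mem_filter]
        constructor
        · intro h
          obtain ⟨-, x, hx⟩ := hV0 P (hR h)
          exact ⟨x, h, hx⟩
        · rintro ⟨x, h, -⟩; exact h
      · intro x _ y _ hxy
        rw [Function.onFun, disjoint_left]
        intro P h1 h2
        exact hxy (hinj ((mem_filter.mp h1).2.symm.trans (mem_filter.mp h2).2))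
    have key : S.card + S'.card = 2 * p := by
      rw [e S (filter_subset _ _), e S' (filter_subset _ _), ← sum_add_distrib]
      rw [sum_congr rfl (g := fun _ => 2), sum_const, card_univ, ZMod.card, smul_eq_mul, mul_comm]
      intro x _
      have hneg : frob W k (-Q x) = -frob W k (Q x) := map_neg _ _
      by_cases h2 : Q x = - Q x
      · have e1 : (S.filter fun P => px P = algebraMap (ZMod p) k x) = {Q x} := by
          ext P
          rw [mem_filter, mem_singleton]
          constructor
          · rintro ⟨h1, h3⟩
            rcases hVmem P x (hV0 P (mem_filter.mp h1).1).1 h3 with h | h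
            · exact h
            · rw [h, ← h2]
          · rintro rfl
            refine ⟨mem_filter.mpr ⟨hVm _ x (hQ0 x) (hQx x), ?_⟩, hQx x⟩
            rcases hfix x with h | h
            · exact h
            · rw [h, ← h2]
        have e2 : (S'.filter fun P => px P = algebraMap (ZMod p) k x) = {Q x} := by
          ext P
          rw [mem_filter, mem_singleton]
          constructor
          · rintro ⟨h1, h3⟩
            rcases hVmem P x (hV0 P (mem_filter.mp h1).1).1 h3 with h | h
            · exact h
            · rw [h, ← h2]
          · rintro rfl
            refine ⟨mem_filter.mpr ⟨hVm _ x (hQ0 x) (hQx x), ?_⟩, hQx x⟩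
            rcases hfix x with h | h
            · rw [h, ← h2]
            · exact h
        rw [e1, e2]; rfl
      · have hcard : ({Q x, -Q x} : Finset ((W.bc k).P k)).card = 2 := card_pair h2
        rcases hfix x with h | h
        · have e1 : (S.filter fun P => px P = algebraMap (ZMod p) k x) = {Q x, -Q x} := by
            ext P
            rw [mem_filter, mem_insert, mem_singleton]
            constructor
            · rintro ⟨h1, h3⟩
              exact hVmem P x (hV0 P (mem_filter.mp h1).1).1 h3
            · rintro (rfl | rfl)
              · exact ⟨mem_filter.mpr ⟨hVm _ x (hQ0 x) (hQx x), h⟩, hQx x⟩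
              · refine ⟨mem_filter.mpr ⟨hVm _ x (neg_ne_zero.mpr (hQ0 x)) ?_, ?_⟩, ?_⟩
                · rw [px_neg, hQx]
                · rw [hneg, h]
                · rw [px_neg, hQx]
          have e2 : (S'.filter fun P => px P = algebraMap (ZMod p) k x) = ∅ := by
            rw [filter_eq_empty_iff]
            intro P hP h3
            obtain ⟨h1, h4⟩ := mem_filter.mp hP
            rcases hVmem P x (hV0 P h1).1 h3 with rfl | rfl
            · exact h2 (h.symm.trans h4)
            · rw [hneg, h, neg_neg] at h4; exact h2 h4.symm
          rw [e1, e2, hcard]; rfl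
        · have e1 : (S'.filter fun P => px P = algebraMap (ZMod p) k x) = {Q x, -Q x} := by
            ext P
            rw [mem_filter, mem_insert, mem_singleton]
            constructor
            · rintro ⟨h1, h3⟩
              exact hVmem P x (hV0 P (mem_filter.mp h1).1).1 h3
            · rintro (rfl | rfl)
              · exact ⟨mem_filter.mpr ⟨hVm _ x (hQ0 x) (hQx x), h⟩, hQx x⟩
              · refine ⟨mem_filter.mpr ⟨hVm _ x (neg_ne_zero.mpr (hQ0 x)) ?_, ?_⟩, ?_⟩
                · rw [px_neg, hQx]
                · rw [hneg, h]
                · rw [px_neg, hQx]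
          have e2 : (S.filter fun P => px P = algebraMap (ZMod p) k x) = ∅ := by
            rw [filter_eq_empty_iff]
            intro P hP h3
            obtain ⟨h1, h4⟩ := mem_filter.mp hP
            rcases hVmem P x (hV0 P h1).1 h3 with rfl | rfl
            · exact h2 (h4.symm.trans h)
            · rw [hneg, h, neg_neg] at h4; exact h2 h4
          rw [e1, e2, hcard]; rfl
    omega

end Frobenius

section

variable {k : Type} [Field k] [IsAlgClosed k] {W W' : ShortCurve k}

lemma Rep.ne_zero_of_cF {α : W.P k →+ W'.P k} {φ} (h : Rep α φ) (hc : cF φ ≠ 0) : α ≠ 0 := by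
  rintro rfl
  obtain ⟨Q, rfl⟩ := exists_incl_eq h.const
  exact hc (cF_incl Q)

lemma Rep.card_ker_le_hp {α : W.P k →+ W'.P k} {φ} (h : Rep α φ) (hα : α ≠ 0)
    (S : Finset (W.P k)) (hS : ∀ P ∈ S, α P = 0) : S.card ≤ hp φ := by
  obtain ⟨u, hu⟩ := h.px_eq
  rw [hp_of hu]
  exact h.card_ker_le hα hu S hS

lemma cF_zsmul_gen (n : ℤ) : cF (n • gen : W.P W.FF) = n := by
  rw [map_zsmul, cF_gen, zsmul_eq_mul, mul_one]

lemma zsmul_id_ne_zero (n : ℤ) (hn : (n : k) ≠ 0) :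
    n • AddMonoidHom.id (W.P k) ≠ 0 := by
  refine (Rep.id.zsmul n).ne_zero_of_cF ?_
  rw [cF_zsmul_gen]
  intro h
  apply hn
  apply (algebraMap k W.FF).injective
  rw [map_intCast, h, map_zero]

lemma card_torsion_le (n : ℤ) (hn : (n : k) ≠ 0) (S : Finset (W.P k)) (hS : ∀ P ∈ S, n • P = 0) :
    S.card ≤ n.natAbs ^ 2 := by
  have := (Rep.id.zsmul n).card_ker_le_hp (zsmul_id_ne_zero (W := W) n hn) S hS
  rwa [hp_zsmul pm_conj_gen, hp_gen, mul_one] at this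

end

section Frobenius

variable {k : Type} [Field k] [IsAlgClosed k] {p : ℕ} [Fact p.Prime] [CharP k p]
  [Algebra (ZMod p) k] (W : ShortCurve (ZMod p))

/-- The characteristic polynomial of Frobenius annihilates it. -/
theorem frob_char (hp200 : 200 < p) (a : ℤ)
    (ha : a = p - (Finset.univ.filter fun z : ZMod p × ZMod p => z.2 ^ 2 = W.f z.1).card)
    (hlt : a ^ 2 < 4 * p) (P : (W.bc k).P k) :
    frob W k (frob W k P) - a • frob W k P + (p : ℤ) • P = 0 := by
  classical
  set V := W.bc k with hV
  set φ1 := frob W V.FF (gen : V.P V.FF) with hφ1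
  set φ2 := frob W V.FF φ1 with hφ2
  have r1 := Rep.frob W (Rep.id (W := V))
  have r2 := Rep.frob W r1
  have r := (r2.sub (r1.zsmul a)).add ((Rep.id (W := V)).zsmul p)
  set γ := (frob W k).comp ((frob W k).comp (AddMonoidHom.id (V.P k))) -
    a • (frob W k).comp (AddMonoidHom.id (V.P k)) + (p : ℤ) • AddMonoidHom.id (V.P k) with hγ
  have hγP : ∀ P, γ P = frob W k (frob W k P) - a • frob W k P + (p : ℤ) • P := fun P => rfl
  rw [← hγP]
  by_contra hne
  have hγ0 : γ ≠ 0 := fun h => hne (by rw [h]; rfl)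
  have hc : cF (φ2 - a • φ1 + (p : ℤ) • gen) = 0 := by
    rw [map_add, map_sub, map_zsmul, cF_frob, cF_frob, cF_zsmul_gen]
    have := charP_of_algebra k p V.FF
    simp
  have hh1 : hp φ1 = p := by rw [hφ1, hp_frob W pm_conj_gen, hp_gen, mul_one]
  have hh2 : hp φ2 = p * p := by rw [hφ2, hp_frob W r1.1, hh1]
  have hh : hp (φ2 - a • φ1 + (p : ℤ) • gen) ≤ 22 * p * p := by
    refine (hp_add_le (r2.sub (r1.zsmul a)).1 ((Rep.id (W := V)).zsmul p).1).trans ?_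
    have h1 := hp_add_le r2.1 (r1.zsmul a).neg.1
    rw [← sub_eq_add_neg, hp_neg, hp_zsmul r1.1, hh2, hh1] at h1
    rw [hp_zsmul pm_conj_gen, hp_gen, Int.natAbs_natCast]
    have h2 : a.natAbs ^ 2 ≤ 4 * p := by
      zify; rw [sq_abs]; exact hlt.le
    have h3 : a.natAbs ^ 2 * p ≤ 4 * p * p := Nat.mul_le_mul_right _ h2
    nlinarith
  obtain ⟨S, S', hS, hS', hcard, hsum⟩ := exists_fixed (k := k) W
  have hker : ∀ (H : AddSubgroup (V.P k)) (R : Finset (V.P k)), (∀ P, P ∈ R ↔ P ∈ H) →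
      ∀ P ∈ R, R.card • P = 0 := by
    intro H R hR P hP
    have h1 : Nat.card H = R.card := Nat.subtype_card R hR
    have h2 : Nat.card H • (⟨P, (hR P).mp hP⟩ : H) = 0 := card_nsmul_eq_zero'
    rw [h1] at h2
    exact congrArg Subtype.val h2
  have hk1 : ∀ P ∈ S, γ P = 0 := by
    intro P hP
    have h1 := hker ((frob W k - AddMonoidHom.id (V.P k)).ker) S (fun P => by
      rw [hS, AddMonoidHom.mem_ker, AddMonoidHom.sub_apply, sub_eq_zero]; rfl) P hP
    have h2 := (hS P).mp hP
    rw [hγP, h2, h2]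
    have h3 : ((1 : ℤ) - a + p) = (S.card : ℤ) := by rw [hcard, ha]; push_cast; ring
    calc P - a • P + (p : ℤ) • P = ((1 : ℤ) - a + p) • P := by rw [add_smul, sub_smul, one_smul]
      _ = 0 := by rw [h3, natCast_zsmul, h1]
  have hk2 : ∀ P ∈ S', γ P = 0 := by
    intro P hP
    have h1 := hker ((frob W k + AddMonoidHom.id (V.P k)).ker) S' (fun P => by
      rw [hS', AddMonoidHom.mem_ker, AddMonoidHom.add_apply, add_eq_zero_iff_eq_neg]; rfl) P hP
    have h2 := (hS' P).mp hP
    rw [hγP, h2, map_neg, h2, neg_neg, smul_neg, sub_neg_eq_add]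
    have h3 : ((1 : ℤ) + a + p) = (S'.card : ℤ) := by
      have : (S.card : ℤ) + S'.card = 2 * p + 2 := by exact_mod_cast hsum
      rw [hcard] at this
      push_cast at this
      rw [ha]
      linear_combination -this
    calc P + a • P + (p : ℤ) • P = ((1 : ℤ) + a + p) • P := by rw [add_smul, add_smul, one_smul]
      _ = 0 := by rw [h3, natCast_zsmul, h1]
  -- the kernel is large
  set R := (S ×ˢ S').image fun z => z.1 + z.2 with hR
  have hRk : ∀ P ∈ R, γ P = 0 := by
    intro P hP
    obtain ⟨z, hz, rfl⟩ := Finset.mem_image.mp hP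
    obtain ⟨hz1, hz2⟩ := Finset.mem_product.mp hz
    rw [map_add, hk1 _ hz1, hk2 _ hz2, add_zero]
  have hR4 : (S ×ˢ S').card ≤ 4 * R.card := by
    refine Finset.card_le_mul_card_image _ 4 fun Q hQ => ?_
    obtain ⟨z0, hz0, hz0'⟩ := Finset.mem_image.mp hQ
    obtain ⟨h01, h02⟩ := Finset.mem_product.mp hz0
    set F := (S ×ˢ S').filter fun z => z.1 + z.2 = Q
    have h1 : F.card = (F.image fun z => z.1 - z0.1).card := by
      refine (Finset.card_image_of_injOn fun z hz z' hz' h => ?_).symm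
      have e1 := (Finset.mem_filter.mp hz).2
      have e2 := (Finset.mem_filter.mp hz').2
      have e3 : z.1 = z'.1 := sub_left_injective h
      rw [e3] at e1
      exact Prod.ext e3 (add_left_cancel (e1.trans e2.symm))
    rw [h1]
    have h2k : ((2 : ℤ) : k) ≠ 0 := by exact_mod_cast V.two
    refine card_torsion_le (W := V) 2 h2k _ fun P hP => ?_
    obtain ⟨z, hz, rfl⟩ := Finset.mem_image.mp hP
    obtain ⟨hz', e1⟩ := Finset.mem_filter.mp hz
    obtain ⟨hz1, hz2⟩ := Finset.mem_product.mp hz'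
    have e : z.1 - z0.1 = z0.2 - z.2 := by
      rw [sub_eq_sub_iff_add_eq_add, e1, ← hz0', add_comm]
    have f1 : frob W k (z.1 - z0.1) = z.1 - z0.1 := by
      rw [map_sub, (hS _).mp hz1, (hS _).mp h01]
    have f2 : frob W k (z.1 - z0.1) = -(z.1 - z0.1) := by
      rw [e, map_sub, (hS' _).mp hz2, (hS' _).mp h02]; abel
    rw [f1] at f2
    rw [two_smul]
    nth_rw 1 [f2]
    rw [neg_add_cancel]
  have hfin := r.mul_card_ker_le (p := p) hγ0 hc R hRk
  have hp0 : 0 < p := (Fact.out : p.Prime).pos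
  have h22 : R.card ≤ 22 * p := by
    have : p * R.card ≤ p * (22 * p) := hfin.trans (hh.trans (by nlinarith))
    exact Nat.le_of_mul_le_mul_left this hp0
  rw [Finset.card_product] at hR4
  have e1 : (S.card : ℤ) = p + 1 - a := by rw [hcard, ha]; push_cast; ring
  have e2 : (S'.card : ℤ) = p + 1 + a := by
    have : (S.card : ℤ) + S'.card = 2 * p + 2 := by exact_mod_cast hsum
    linear_combination this - e1
  have hR4' : (S.card : ℤ) * S'.card ≤ 4 * R.card := by exact_mod_cast hR4
  have h22' : (R.card : ℤ) ≤ 22 * p := by exact_mod_cast h22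
  have h200 : (200 : ℤ) < p := by exact_mod_cast hp200
  rw [e1, e2] at hR4'
  nlinarith

/-- The reduction carries an endomorphism whose square is `a² - 4p`. -/
theorem exists_endo (hp200 : 200 < p) (a : ℤ)
    (ha : a = p - (Finset.univ.filter fun z : ZMod p × ZMod p => z.2 ^ 2 = W.f z.1).card)
    (hlt : a ^ 2 < 4 * p) : ∃ α : (W.bc k).P k →+ (W.bc k).P k, IsAlg α ∧
      ∀ P, α (α P) = (a ^ 2 - 4 * p) • P := by
  have r1 := Rep.frob W (Rep.id (W := W.bc k))
  refine ⟨_, ⟨_, (r1.zsmul 2).sub (Rep.id.zsmul a)⟩, fun P => ?_⟩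
  have h := frob_char W hp200 a ha hlt P
  change (2 : ℤ) • frob W k ((2 : ℤ) • frob W k P - a • P) - a • ((2 : ℤ) • frob W k P - a • P) = _
  rw [map_sub, map_zsmul, map_zsmul]
  have h' : frob W k (frob W k P) = a • frob W k P - (p : ℤ) • P := by
    rw [sub_eq_neg_add, ← sub_eq_zero, ← h]; abel
  rw [h']
  module

end Frobenius

section Torsion

variable {k : Type} [Field k] [IsAlgClosed k] {W W' W'' : ShortCurve k}

lemma natDegree_fiber {L : Type} [Field L] [Algebra k L] {u : RatFunc k} {c : L}
    (hc : c ∉ (algebraMap k L).range) :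
    (u.num.map (algebraMap k L) - C c * u.denom.map (algebraMap k L)).natDegree = ht u := by
  refine le_antisymm ?_ ?_
  · refine (natDegree_sub_le _ _).trans (max_le_max natDegree_map_le ?_)
    exact (natDegree_C_mul_le _ _).trans natDegree_map_le
  · refine le_natDegree_of_ne_zero fun h => ?_
    simp only [coeff_sub, coeff_map, coeff_C_mul] at h
    by_cases hd : u.denom.coeff (ht u) = 0
    · rw [hd, map_zero, mul_zero, sub_zero] at h
      have hn : u.num.coeff (ht u) = 0 := (algebraMap k L).injective (by rw [h, map_zero])
      rcases max_choice u.num.natDegree u.denom.natDegree with e | e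
      · have e' : ht u = u.num.natDegree := e
        rw [e', coeff_natDegree, leadingCoeff_eq_zero] at hn
        rw [e', hn, natDegree_zero] at hd
        have hle : u.denom.natDegree ≤ 0 := by
          have : u.denom.natDegree ≤ ht u := le_max_right _ _
          rwa [e', hn, natDegree_zero] at this
        have := (RatFunc.monic_denom u).coeff_natDegree
        rw [Nat.le_zero.mp hle, hd] at this
        exact zero_ne_one this
      · have e' : ht u = u.denom.natDegree := e
        rw [e', (RatFunc.monic_denom u).coeff_natDegree] at hd
        exact one_ne_zero hd
    · apply hc
      refine ⟨u.num.coeff (ht u) / u.denom.coeff (ht u), ?_⟩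
      have hd' : algebraMap k L (u.denom.coeff (ht u)) ≠ 0 := by
        rwa [Ne, map_eq_zero]
      rw [map_div₀, div_eq_iff hd', ← sub_eq_zero, h]

/-- The `n`-torsion has full order when `n` is invertible. -/
theorem exists_torsion (n : ℤ) (hn : (n : k) ≠ 0) :
    ∃ S : Finset (W.P k), (∀ P ∈ S, n • P = 0) ∧ S.card = n.natAbs ^ 2 := by
  classical
  have hrep := (Rep.id (W := W)).zsmul n
  have hcF := cF_zsmul_gen (W := W) n
  set φ : W.P W.FF := n • gen with hφ
  have hn' : (n : W.FF) ≠ 0 := by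
    intro h; apply hn; apply (algebraMap k W.FF).injective
    rw [map_intCast, h, map_zero]
  have hα := zsmul_id_ne_zero (W := W) n hn
  obtain ⟨u, hu⟩ := hrep.px_eq
  have hht : ht u = n.natAbs ^ 2 := by
    rw [← hp_of hu, hφ, hp_zsmul pm_conj_gen, hp_gen, mul_one]
  have hφ0 : φ ≠ 0 := by
    intro h; rw [h, map_zero] at hcF; exact hn' hcF.symm
  let M := AlgebraicClosure W.FF
  let ι : W.FF →ₐ[k] M := IsScalarTower.toAlgHom k W.FF M
  set c : M := ι (io u) with hc
  have hcn : c ∉ (algebraMap k M).range := by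
    intro h
    exact hrep.not_const hα (by rw [hu]; exact const_of_const_map ι h)
  set q : M[X] := u.num.map (algebraMap k M) - C c * u.denom.map (algebraMap k M) with hq
  have hqd : q.natDegree = ht u := natDegree_fiber hcn
  have hroot : ∀ ρ : M, q.IsRoot ρ ↔ aeval ρ u.num = c * aeval ρ u.denom := by
    intro ρ
    rw [IsRoot, hq, eval_sub, eval_mul, eval_C, eval_map_algebraMap, eval_map_algebraMap,
      sub_eq_zero]
  have hρ : ∀ ρ : M, q.IsRoot ρ → ρ ∉ (algebraMap k M).range := by
    rintro ρ hr ⟨a, rfl⟩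
    rw [hroot, aeval_algebraMap_apply, aeval_algebraMap_apply] at hr
    by_cases hd : aeval a u.denom = 0
    · have hn0 : aeval a u.num = 0 := (algebraMap k M).injective (by
        rw [hr, hd, map_zero, mul_zero])
      obtain ⟨s, t, hst⟩ := RatFunc.isCoprime_num_denom u
      have := congrArg (aeval a) hst
      simp only [map_add, map_mul, hd, hn0, mul_zero, add_zero, map_one] at this
      exact zero_ne_one this
    · apply hcn
      have hd' : algebraMap k M (aeval a u.denom) ≠ 0 := by rwa [Ne, map_eq_zero]
      exact ⟨aeval a u.num / aeval a u.denom, by rw [map_div₀, div_eq_iff hd', hr]⟩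
  have hlift : ∀ ρ : M, q.IsRoot ρ → ∃ σ : W.FF →ₐ[k] M, σ xx = ρ ∧ σ (io u) = c := by
    intro ρ hr
    obtain ⟨η, hη⟩ := IsAlgClosed.exists_pow_nat_eq ((W.bc M).f ρ) (n := 2) (by norm_num)
    obtain ⟨σ, hσ⟩ := exists_lift (Q := (pt ρ η hη : W.P M)) (by rw [px_pt]; exact hρ ρ hr)
    have hx : σ xx = ρ := by rw [← px_gen, ← px_pm, hσ, px_pt]
    refine ⟨σ, hx, ?_⟩
    have h1 := aeval_num_eq (σ.comp io) u
    have h2 : (σ.comp io) (RatFunc.X : RatFunc k) = ρ := hx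
    rw [h2, (hroot ρ).mp hr] at h1
    have h3 : aeval ρ u.denom ≠ 0 := by
      intro h0
      exact RatFunc.denom_ne_zero u
        ((transcendental_iff.mp (transcendental_of_notMem (hρ ρ hr))) _ h0)
    exact (mul_right_cancel₀ h3 h1).symm
  have hpt : ∀ ρ : M, q.IsRoot ρ → ∃ P : W.P k, n • P = 0 ∧ ι (tau P xx) = ρ := by
    intro ρ hr
    obtain ⟨σ, hx, hc'⟩ := hlift ρ hr
    have h1 : px (pm σ φ) = px (pm ι φ) := by rw [px_pm, px_pm, hu, hc']
    obtain ⟨R, hR, hRx⟩ : ∃ R : W.P M, n • R = n • pm ι gen ∧ px R = ρ := by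
      have hgx : px (pm σ (gen : W.P W.FF)) = ρ := by rw [px_pm, px_gen, hx]
      rcases (px_eq_iff (mt pm_eq_zero.mp hφ0) (mt pm_eq_zero.mp hφ0)).mp h1 with h | h
      · exact ⟨pm σ gen, by rw [hφ, map_zsmul, map_zsmul] at h; exact h, hgx⟩
      · refine ⟨-pm σ gen, ?_, by rw [px_neg, hgx]⟩
        rw [hφ, map_zsmul, map_zsmul] at h
        rw [smul_neg, h, neg_neg]
    have h2 : n • (R - pm ι gen) = 0 := by rw [smul_sub, hR, sub_self]
    have h3 : px (R - pm ι gen) ∈ (algebraMap k M).range := by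
      by_contra hne
      obtain ⟨s, hs⟩ := exists_lift hne
      apply hφ0
      refine (pm_eq_zero (ψ := s)).mp ?_
      rw [hφ, map_zsmul, hs, h2]
    obtain ⟨P, hP⟩ := exists_incl_eq h3
    refine ⟨P, ?_, ?_⟩
    · apply incl_injective (L := M)
      rw [map_zsmul, hP, h2, map_zero]
    · rw [← px_gen, ← px_pm, ← px_pm, pm_tau_gen, map_add, pm_incl, hP, add_sub_cancel, hRx]
  have hder : ∀ ρ : M, q.IsRoot ρ → ¬ (derivative q).IsRoot ρ := by
    intro ρ hr hd
    obtain ⟨σ, hx, hc'⟩ := hlift ρ hr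
    rw [IsRoot, hq, derivative_sub, derivative_C_mul, eval_sub, eval_mul, eval_C, derivative_map,
      derivative_map, eval_map_algebraMap, eval_map_algebraMap, ← hx, ← hc', aeval_algHom_apply,
      aeval_algHom_apply, ← map_mul, ← map_sub] at hd
    have hd' := σ.toRingHom.injective (hd.trans (map_zero σ).symm)
    rw [← io_algebraMap, ← io_algebraMap, ← map_mul, ← map_sub] at hd'
    have hd2 := io_injective (hd'.trans (map_zero io).symm)
    have h5 : DD (io u : W.FF) = 0 := by
      rw [DD_io, map_sub, map_mul, map_mul]
      have hden := RatFunc.algebraMap_ne_zero (RatFunc.denom_ne_zero u)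
      have hnum : algebraMap k[X] (RatFunc k) u.num =
          u * algebraMap k[X] (RatFunc k) u.denom := by
        nth_rw 2 [← RatFunc.num_div_denom u]; field_simp
      rw [hnum]
      have : algebraMap k[X] (RatFunc k) (derivative u.num) *
          algebraMap k[X] (RatFunc k) u.denom - u * algebraMap k[X] (RatFunc k) u.denom *
          algebraMap k[X] (RatFunc k) (derivative u.denom) = 0 := by
        linear_combination (algebraMap k[X] (RatFunc k) u.denom) * hd2
      rw [this]; simp
    have h6 := D_px (D := DD) φ
    rw [hu, h5] at h6
    have h7 : cF φ ≠ 0 := by rw [hcF]; exact hn'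
    rcases mul_eq_zero.mp h6.symm with h8 | h8
    · rcases mul_eq_zero.mp h8 with h9 | h9
      · exact (W.bc W.FF).two h9
      · obtain ⟨Q, hQ⟩ := const_of_py_eq_zero h9
        exact hrep.not_const hα ⟨px Q, by rw [← hQ, px_incl]⟩
    · exact h7 h8
  have hq0 : q ≠ 0 := by
    intro h0
    have h1 : q.IsRoot 0 := by rw [h0]; simp
    exact hρ 0 h1 ⟨0, map_zero _⟩
  have hnodup : q.roots.Nodup := by
    refine nodup_roots ?_
    rw [Polynomial.Separable, Polynomial.isCoprime_iff_aeval_ne_zero_of_isAlgClosed M M]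
    intro ρ
    by_contra! h
    simp only [coe_aeval_eq_eval] at h
    exact hder ρ h.1 h.2
  have hcard : q.roots.toFinset.card = ht u := by
    rw [Multiset.toFinset_card_of_nodup hnodup, IsAlgClosed.card_roots_eq_natDegree, hqd]
  choose! Pt hP1 hP2 using hpt
  have hmem : ∀ ρ, ρ ∈ q.roots.toFinset → q.IsRoot ρ := fun ρ h =>
    (mem_roots hq0).mp (Multiset.mem_toFinset.mp h)
  refine ⟨q.roots.toFinset.image Pt, fun P hP => ?_, ?_⟩
  · obtain ⟨ρ, h, rfl⟩ := Finset.mem_image.mp hP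
    exact hP1 ρ (hmem ρ h)
  · rw [Finset.card_image_of_injOn, hcard, hht]
    intro ρ h ρ' h' he
    rw [← hP2 ρ (hmem ρ h), ← hP2 ρ' (hmem ρ' h'), he]

end Torsion

section Invariants

variable {k : Type} [Field k] [IsAlgClosed k] {W W' W'' : ShortCurve k}

lemma ht_pos {u : RatFunc k} (hu : u ∉ (algebraMap k (RatFunc k)).range) : 0 < ht u := by
  rw [Nat.pos_iff_ne_zero]
  intro h
  have h1 : u.num.natDegree = 0 := Nat.le_zero.mp ((le_max_left _ _).trans h.le)
  have h2 : u.denom.natDegree = 0 := Nat.le_zero.mp ((le_max_right _ _).trans h.le)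
  obtain ⟨a, ha⟩ := natDegree_eq_zero.mp h1
  obtain ⟨b, hb⟩ := natDegree_eq_zero.mp h2
  apply hu
  refine ⟨a / b, ?_⟩
  rw [← RatFunc.num_div_denom u, ← ha, ← hb, map_div₀]
  rfl

/-- A rational function invariant under as many translations as the height of `u` is a rational
function of `u`. -/
theorem exists_eq_subst {u w : RatFunc k} (hu : u ∉ (algebraMap k (RatFunc k)).range)
    (S : Finset (W.P k)) (hS : ∀ P ∈ S, tau P (io u : W.FF) = io u) (hcard : ht u ≤ S.card)
    (hw : ∀ P ∈ S, tau P (io w : W.FF) = io w) :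
    w ∈ IntermediateField.adjoin k {u} := by
  classical
  set F := IntermediateField.adjoin k {u} with hF
  have hfr : Module.finrank F (RatFunc k) = ht u := (ht_eq_finrank u).symm
  have hfin : FiniteDimensional F (RatFunc k) :=
    Module.finite_of_finrank_pos (by rw [hfr]; exact ht_pos hu)
  have hisInt : IsIntegral F (RatFunc.X : RatFunc k) := IsIntegral.of_finite _ _
  have hdeg : (minpoly F (RatFunc.X : RatFunc k)).natDegree ≤ ht u := by
    rw [← hfr]; exact minpoly.natDegree_le _
  have htop : IntermediateField.adjoin F {(RatFunc.X : RatFunc k)} = ⊤ := by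
    have h1 : (⊤ : IntermediateField k (RatFunc k)) ≤
        (IntermediateField.adjoin F {(RatFunc.X : RatFunc k)}).restrictScalars k := by
      rw [← RatFunc.adjoin_X, IntermediateField.adjoin_le_iff]
      rintro _ rfl
      exact IntermediateField.mem_adjoin_simple_self F _
    exact eq_top_iff.mpr fun z _ => h1 (IntermediateField.mem_top (x := z))
  obtain ⟨s, hs⟩ : ∃ s : F[X], aeval (RatFunc.X : RatFunc k) s = w := by
    have h1 : w ∈ (IntermediateField.adjoin F {(RatFunc.X : RatFunc k)}).toSubalgebra := by
      rw [htop]; trivial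
    rw [IntermediateField.adjoin_simple_toSubalgebra_of_isAlgebraic hisInt.isAlgebraic,
      Algebra.adjoin_singleton_eq_range_aeval] at h1
    exact h1
  set r := s %ₘ minpoly F (RatFunc.X : RatFunc k) with hr
  have hm := minpoly.monic hisInt
  have hrw : aeval (RatFunc.X : RatFunc k) r = w := by
    rw [hr, aeval_modByMonic_eq_self_of_root (minpoly.aeval _ _), hs]
  have hrd : r.degree < ht u := by
    refine (degree_modByMonic_lt s hm).trans_le ?_
    rw [degree_eq_natDegree hm.ne_zero]
    exact_mod_cast hdeg
  have hfix : ∀ P ∈ S, ∀ z : F, tau P (io (z : RatFunc k) : W.FF) = io (z : RatFunc k) := by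
    intro P hP z
    obtain ⟨a, b, hab⟩ := (IntermediateField.mem_adjoin_simple_iff k _).mp z.2
    have h1 : ∀ c : k[X], tau P (io (aeval u c) : W.FF) = io (aeval u c) := by
      intro c
      rw [← aeval_algHom_apply, ← aeval_algHom_apply, hS P hP]
    rw [hab, map_div₀, map_div₀, h1, h1]
  let j : F →+* W.FF := (io (W := W)).toRingHom.comp (algebraMap F (RatFunc k))
  have hroots : ∀ P ∈ S, (r.map j - C (io w)).eval (tau P (xx : W.FF)) = 0 := by
    intro P hP
    rw [eval_sub, eval_C, eval_map, sub_eq_zero]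
    have h1 := congrArg (fun z => tau P (io z : W.FF)) hrw
    simp only [hw P hP] at h1
    rw [← h1, aeval_def]
    refine Eq.trans ?_ (hom_eval₂ r _ ((tau P).comp (io (W := W)) : RatFunc k →+* W.FF) _).symm
    refine eval₂_congr ?_ rfl rfl
    ext z
    exact (hfix P hP z).symm
  have hzero : r.map j - C (io w : W.FF) = 0 := by
    refine eq_zero_of_degree_lt_of_eval_index_eq_zero (s := S) (v := fun P => tau P (xx : W.FF))
      (tau_xx_injective (W := W)).injOn ?_ hroots
    have hS0 : 0 < S.card := (ht_pos hu).trans_le hcard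
    refine (degree_sub_le _ _).trans_lt (max_lt ?_ (degree_C_le.trans_lt (by exact_mod_cast hS0)))
    refine degree_map_le.trans_lt (hrd.trans_le ?_)
    exact_mod_cast hcard
  have h0 := congrArg (fun p => p.coeff 0) hzero
  simp only [coeff_sub, coeff_map, coeff_C_zero, coeff_zero, sub_eq_zero] at h0
  have := io_injective (W := W) h0
  rw [← this]
  exact (r.coeff 0).2

lemma exists_subst_eq {u w : RatFunc k} (h : w ∈ IntermediateField.adjoin k {u}) {L : Type} [Field L] [Algebra k L]
    (f : RatFunc k →ₐ[k] L) (g : RatFunc k →ₐ[k] L) (hg : g RatFunc.X = f u) :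
    ∃ v, f w = g v := by
  obtain ⟨a, b, hab⟩ := (IntermediateField.mem_adjoin_simple_iff k _).mp h
  refine ⟨aeval RatFunc.X a / aeval RatFunc.X b, ?_⟩
  rw [hab, map_div₀, map_div₀, ← aeval_algHom_apply, ← aeval_algHom_apply, ← aeval_algHom_apply,
    ← aeval_algHom_apply, hg]

/-- Algebraic homomorphisms factor through separable quotients. -/
theorem IsAlg.factor {κ : W.P k →+ W'.P k} {φ} (h : Rep κ φ) (hκ : κ ≠ 0)
    (S : Finset (W.P k)) (hS : ∀ P ∈ S, κ P = 0) (hcard : hp φ ≤ S.card)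
    {β : W.P k →+ W''.P k} (hβ : IsAlg β) (hβS : ∀ P ∈ S, β P = 0) :
    ∃ β1 : W'.P k →+ W''.P k, IsAlg β1 ∧ β1.comp κ = β := by
  obtain ⟨ψ, hψ⟩ := hβ
  by_cases hβ0 : β = 0
  · exact ⟨0, IsAlg.zero, by rw [hβ0, AddMonoidHom.zero_comp]⟩
  obtain ⟨g, hg, hgc, hgt⟩ := h.exists_hom hκ
  obtain ⟨u, hu⟩ := h.px_eq
  obtain ⟨v, hv⟩ := h.py_eq
  obtain ⟨w, hw⟩ := hψ.px_eq
  obtain ⟨z, hz⟩ := hψ.py_eq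
  have hun : u ∉ (algebraMap k (RatFunc k)).range := fun hc =>
    h.not_const hκ (by rw [hu]; exact const_io.mpr hc)
  have hv0 : (io v : W.FF) ≠ 0 := by
    intro h0
    obtain ⟨Q, rfl⟩ := const_of_py_eq_zero (P := φ) (by rw [hv, h0, zero_mul])
    exact h.not_const hκ ⟨px Q, by rw [px_incl]⟩
  have hut : ∀ P ∈ S, tau P (px φ) = px φ := fun P hP => by
    rw [← px_pm, h.2, hS P hP, map_zero, add_zero]
  have hvt : ∀ P ∈ S, tau P (py φ) = py φ := fun P hP => by
    rw [← py_pm, h.2, hS P hP, map_zero, add_zero]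
  have hwt : ∀ P ∈ S, tau P (px ψ) = px ψ := fun P hP => by
    rw [← px_pm, hψ.2, hβS P hP, map_zero, add_zero]
  have hzt : ∀ P ∈ S, tau P (py ψ) = py ψ := fun P hP => by
    rw [← py_pm, hψ.2, hβS P hP, map_zero, add_zero]
  have hc : ht u ≤ S.card := by rwa [← hp_of hu]
  have hgX : (g.comp io) (RatFunc.X : RatFunc k) = io u := by
    rw [← hu, ← hg, px_pm, px_gen]; rfl
  have hgy : g yy = io v * yy := by rw [← hv, ← hg, py_pm, py_gen]
  obtain ⟨a, ha⟩ := exists_subst_eq (exists_eq_subst hun S (fun P hP => by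
    rw [← hu, hut P hP]) hc (w := w) fun P hP => by rw [← hw, hwt P hP]) io (g.comp io) hgX
  have hzv : (io (z / v) : W.FF) = py ψ / py φ := by
    rw [map_div₀, hz, hv, mul_div_mul_right _ _ yy_ne_zero]
  obtain ⟨b, hb⟩ := exists_subst_eq (exists_eq_subst hun S (fun P hP => by
    rw [← hu, hut P hP]) hc (w := z / v) fun P hP => by
      rw [hzv, map_div₀, hzt P hP, hvt P hP]) io (g.comp io) hgX
  have hψ0 : ψ ≠ 0 := by
    rintro rfl
    exact hψ.not_const hβ0 ⟨0, by simp⟩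
  have hx : g (io a) = px ψ := by rw [hw, ha]; rfl
  have hy : g (io b * yy) = py ψ := by
    have : g (io b) = io (z / v) := hb.symm
    rw [map_mul, this, hgy, ← mul_assoc, ← map_mul, hz]
    congr 2
    rw [div_mul_cancel₀]
    rintro rfl; exact hv0 (map_zero _)
  have heq : (io b * yy : W'.FF) ^ 2 = (W''.bc W'.FF).f (io a) := by
    apply g.toRingHom.injective
    change g _ = g _
    rw [map_pow, hy, py_sq hψ0, ← aeval_fP, ← aeval_fP, ← aeval_algHom_apply, hx]
  set ψ1 : W''.P W'.FF := pt (io a) (io b * yy) heq with hψ1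
  have hpm : pm g ψ1 = ψ := by
    refine pm_unique (pt_ne_zero _) hψ0 ?_ ?_
    · rw [hψ1, px_pt, hx]
    · rw [hψ1, py_pt, hy]
  have hodd : pm conj ψ1 = -ψ1 := by
    refine pm_unique (pt_ne_zero _) (neg_ne_zero.mpr (pt_ne_zero _)) ?_ ?_
    · rw [px_neg, hψ1, px_pt, conj_io]
    · rw [py_neg, hψ1, py_pt, map_mul, conj_io, conj_yy, mul_neg]
  obtain ⟨β1, hβ1⟩ := exists_rep_of_odd hodd
  refine ⟨β1, ⟨ψ1, hβ1⟩, ?_⟩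
  have h1 := (h.comp hβ1 hg)
  rw [hpm] at h1
  ext1 P
  apply incl_injective (L := W.FF)
  exact add_left_cancel ((h1.2 P).symm.trans (hψ.2 P))

/-- An algebraic homomorphism killing the `n`-torsion is divisible by `n`. -/
theorem IsAlg.exists_zsmul {n : ℤ} (hn : (n : k) ≠ 0) {β : W.P k →+ W''.P k} (hβ : IsAlg β)
    (h : ∀ P, n • P = 0 → β P = 0) : ∃ β1 : W.P k →+ W''.P k, IsAlg β1 ∧ n • β1 = β := by
  obtain ⟨S, hS, hcard⟩ := exists_torsion (W := W) n hn
  obtain ⟨β1, h1, h2⟩ := hβ.factor (Rep.id.zsmul n) (zsmul_id_ne_zero n hn) S hS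
    (by rw [hp_zsmul pm_conj_gen, hp_gen, mul_one, hcard]) fun P hP => h P (hS P hP)
  refine ⟨β1, h1, ?_⟩
  rw [← h2]
  ext1 P
  exact (map_zsmul β1 n P).symm

end Invariants

section Normalize

variable {k : Type} [Field k] [IsAlgClosed k] {W W' W'' : ShortCurve k}

/-- The differential equation satisfied by the abscissa of a point of the function field. -/
lemma Rep.ode {α : W.P k →+ W'.P k} {φ} (h : Rep α φ) (hα : α ≠ 0) {u : RatFunc k}
    (hu : px φ = io u) {c : k} (hc : cF φ = algebraMap k W.FF c) :
    (derivative u.num * u.denom - u.num * derivative u.denom) ^ 2 * W.fP =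
      C (c ^ 2) * (u.denom * (u.num ^ 3 + C W'.A * u.num * u.denom ^ 2 + C W'.B * u.denom ^ 3)) := by
  have hφ0 : φ ≠ 0 := by
    rintro rfl
    exact h.not_const hα ⟨0, by simp⟩
  have h6 := D_px (D := DD) φ
  rw [hu, DD_io] at h6
  set d := algebraMap k[X] (RatFunc k) u.denom with hd
  set w := algebraMap k[X] (RatFunc k) (derivative u.num * u.denom - u.num * derivative u.denom)
    with hw
  have hd0 : d ≠ 0 := RatFunc.algebraMap_ne_zero (RatFunc.denom_ne_zero u)
  change cF φ = _ at hc
  change _ = 2 * py φ * cF φ at h6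
  have h7 : (io (w / d ^ 2) : W.FF) * yy = py φ * cF φ :=
    mul_left_cancel₀ (W.bc W.FF).two (by linear_combination h6)
  have h8 : (io ((w / d ^ 2) ^ 2 * W.fX) : W.FF) =
      io (algebraMap k (RatFunc k) (c ^ 2) * aeval u W'.fP) := by
    rw [map_mul, map_mul, map_pow, ← yy_sq, ← mul_pow, h7, mul_pow, py_sq hφ0, hc,
      io_algebraMap_const, ← aeval_algHom_apply, aeval_fP, hu, map_pow]
    ring
  have h9 := io_injective h8
  apply RatFunc.algebraMap_injective k
  have hn : algebraMap k[X] (RatFunc k) u.num = u * d := by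
    conv_rhs => rw [← RatFunc.num_div_denom u, ← hd]
    field_simp
  rw [map_mul, map_pow, ← hw, ← fX_eq]
  have hC : ∀ a : k, algebraMap k[X] (RatFunc k) (C a) = algebraMap k (RatFunc k) a := fun a => rfl
  simp only [map_mul, map_add, map_pow, hC, hn, ← hd]
  have h10 : aeval u W'.fP = u ^ 3 + algebraMap k (RatFunc k) W'.A * u +
      algebraMap k (RatFunc k) W'.B := by simp [fP]
  rw [h10] at h9
  have h11 : w ^ 2 * W.fX = algebraMap k (RatFunc k) (c ^ 2) * (u ^ 3 + algebraMap k (RatFunc k) W'.A * u +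
      algebraMap k (RatFunc k) W'.B) * d ^ 4 := by
    rw [← h9]; field_simp
  rw [h11, map_pow]
  ring

lemma Rep.add_two_torsion {α : W.P k →+ W'.P k} {φ} (h : Rep α φ) {Q : W'.P k} (hQ : Q + Q = 0) :
    Rep α (φ + W'.incl W.FF Q) := by
  have hQ' : -Q = Q := neg_eq_of_add_eq_zero_left hQ
  refine ⟨?_, fun P => ?_⟩
  · rw [map_add, h.1, pm_incl, neg_add, ← map_neg, hQ']
  · rw [map_add, h.2, pm_incl]; abel

lemma hp_add_two_torsion {φ : W'.P W.FF} (h : pm conj φ = -φ) {Q : W'.P k} (hQ : Q + Q = 0) :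
    hp (φ + W'.incl W.FF Q) = hp φ := by
  have hQ' : -Q = Q := neg_eq_of_add_eq_zero_left hQ
  have h1 := hp_add_sub h (ψ := W'.incl W.FF Q) (by rw [pm_incl, ← map_neg, hQ'])
  rw [hp_incl, sub_eq_add_neg, ← map_neg, hQ'] at h1
  omega

lemma natDegree_wronskian_lt {n d : k[X]} (h : n.natDegree ≤ d.natDegree) (hd : 0 < d.natDegree) :
    (derivative n * d - n * derivative d).natDegree ≤ 2 * d.natDegree - 2 := by
  set m := d.natDegree with hm
  rw [natDegree_le_iff_coeff_eq_zero]
  intro N hN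
  rw [coeff_sub]
  have h1 : (derivative n).natDegree ≤ m - 1 := (natDegree_derivative_le n).trans (by omega)
  have h2 : (derivative d).natDegree ≤ m - 1 := natDegree_derivative_le d
  by_cases hN' : N = (m - 1) + m
  · rw [hN', coeff_mul_add_eq_of_natDegree_le h1 le_rfl, add_comm (m - 1) m,
      coeff_mul_add_eq_of_natDegree_le h h2, coeff_derivative, coeff_derivative,
      Nat.sub_add_cancel hd]
    ring
  · rw [coeff_eq_zero_of_natDegree_lt, coeff_eq_zero_of_natDegree_lt, sub_zero]
    · exact (natDegree_mul_le_of_le h h2).trans_lt (by omega)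
    · exact (natDegree_mul_le_of_le h1 le_rfl).trans_lt (by omega)

/-- Data of a representative with a pole at infinity. -/
lemma Rep.normalize_aux {α : W.P k →+ W'.P k} {φ} (h : Rep α φ) (hα : α ≠ 0) (hc : cF φ ≠ 0) :
    ∃ Q : W'.P k, Q + Q = 0 ∧ ∃ u, px (φ + W'.incl W.FF Q) = io u ∧
      u.denom.natDegree < u.num.natDegree := by
  obtain ⟨u, hu⟩ := h.px_eq
  by_cases hdeg : u.denom.natDegree < u.num.natDegree
  · exact ⟨0, add_zero 0, u, by rw [map_zero, add_zero, hu], hdeg⟩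
  push Not at hdeg
  obtain ⟨c, hc'⟩ := h.exists_cF
  have hc0 : c ≠ 0 := by rintro rfl; exact hc (by rw [hc', map_zero])
  have hun : u ∉ (algebraMap k (RatFunc k)).range := fun hcc =>
    h.not_const hα (by rw [hu]; exact const_io.mpr hcc)
  have hm : 0 < u.denom.natDegree := by
    have := ht_pos hun
    rwa [ht, max_eq_right hdeg] at this
  set m := u.denom.natDegree with hmd
  set e := u.num.coeff m with he
  have hdm : u.denom.coeff m = 1 := (RatFunc.monic_denom u).coeff_natDegree
  have hode := h.ode hα hu hc'
  have hge : W'.f e = 0 := by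
    have hl : ((derivative u.num * u.denom - u.num * derivative u.denom) ^ 2 * W.fP).natDegree
        < m + 3 * m := by
      refine (natDegree_mul_le_of_le (natDegree_pow_le_of_le 2
        (natDegree_wronskian_lt hdeg hm)) W.natDegree_fP.le).trans_lt ?_
      omega
    have h1 := congrArg (fun p => p.coeff (m + 3 * m)) hode
    simp only [coeff_C_mul] at h1
    have p1 : (u.num ^ 3).natDegree ≤ 3 * m := natDegree_pow_le_of_le 3 hdeg
    have p2 : (u.num * u.denom ^ 2).natDegree ≤ m + 2 * m :=
      natDegree_mul_le_of_le hdeg (natDegree_pow_le_of_le 2 le_rfl)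
    have p3 : (u.denom ^ 3).natDegree ≤ 3 * m := natDegree_pow_le_of_le 3 le_rfl
    have p4 : (u.num ^ 3 + C W'.A * u.num * u.denom ^ 2 + C W'.B * u.denom ^ 3).natDegree ≤ 3 * m := by
      refine natDegree_add_le_of_degree_le (natDegree_add_le_of_degree_le p1 ?_)
        ((natDegree_C_mul_le _ _).trans p3)
      rw [mul_assoc]
      exact (natDegree_C_mul_le _ _).trans (p2.trans (by omega))
    rw [coeff_eq_zero_of_natDegree_lt hl, coeff_mul_add_eq_of_natDegree_le le_rfl p4, hdm, one_mul,
      coeff_add, coeff_add, mul_assoc, coeff_C_mul, coeff_C_mul,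
      coeff_pow_of_natDegree_le hdeg, coeff_pow_of_natDegree_le le_rfl, hdm,
      show 3 * m = m + 2 * m by ring,
      coeff_mul_add_eq_of_natDegree_le hdeg (natDegree_pow_le_of_le 2 le_rfl),
      coeff_pow_of_natDegree_le le_rfl, hdm, ← he] at h1
    have h2 := (mul_eq_zero.mp h1.symm).resolve_left (pow_ne_zero 2 hc0)
    rw [f, ← h2]; ring
  have h3e : 3 * e ^ 2 + W'.A ≠ 0 := by
    intro h0
    have hB : W'.B = 2 * e ^ 3 := by rw [f] at hge; linear_combination hge - e * h0
    apply W'.disc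
    have hA : W'.A = -3 * e ^ 2 := by linear_combination h0
    rw [hA, hB]; ring
  set Q : W'.P k := pt e 0 (by rw [zero_pow two_ne_zero]; exact hge.symm) with hQ
  have hQ0 : Q ≠ 0 := pt_ne_zero _
  have hQ2 : Q + Q = 0 := by
    rw [add_eq_zero_iff_eq_neg]
    exact (eq_neg_self_iff hQ0).mpr (by rw [hQ, py_pt])
  refine ⟨Q, hQ2, ?_⟩
  have hφ0 : φ ≠ 0 := by
    rintro rfl
    exact h.not_const hα ⟨0, by simp⟩
  have hue : u - algebraMap k (RatFunc k) e ≠ 0 := fun h0 => hun ⟨e, (sub_eq_zero.mp h0).symm⟩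
  have hne : px φ ≠ px (W'.incl W.FF Q) := by
    rw [px_incl, hQ, px_pt, hu, ← io_algebraMap_const]
    exact fun h0 => hue (sub_eq_zero.mpr (io_injective h0))
  have hsum := (add_of_px_ne hφ0 ((map_ne_zero_iff _ incl_injective).mpr hQ0) hne).2.1
  set w : RatFunc k := algebraMap k _ e + algebraMap k _ (3 * e ^ 2 + W'.A) /
    (u - algebraMap k _ e) with hw
  have hpx : px (φ + W'.incl W.FF Q) = io w := by
    rw [hsum, px_incl, py_incl, hQ, px_pt, py_pt, map_zero, sub_zero, div_pow, py_sq hφ0, hu, hw,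
      ← io_algebraMap_const, ← aeval_fP, aeval_algHom_apply, ← map_sub, ← map_pow, ← map_div₀,
      ← map_sub, ← map_sub]
    congr 1
    have h10 : aeval u W'.fP = (u - algebraMap k (RatFunc k) e) *
        (u ^ 2 + algebraMap k _ e * u + algebraMap k _ (e ^ 2 + W'.A)) := by
      have hB : W'.B = - (e ^ 3 + W'.A * e) := by rw [f] at hge; linear_combination hge
      simp only [fP, hB, aeval_C, map_pow, aeval_X, map_neg, map_add, map_mul]
      ring
    rw [h10]
    simp only [map_add, map_mul, map_pow, map_ofNat]
    field_simp
    ring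
  refine ⟨w, hpx, ?_⟩
  -- the degree at infinity
  set r : k[X] := u.num - C e * u.denom with hr
  have hrd : r.natDegree < m := by
    have : r.natDegree ≤ m - 1 := by
      rw [natDegree_le_iff_coeff_eq_zero]
      intro N hN
      rw [hr, coeff_sub, coeff_C_mul]
      rcases (show m ≤ N by omega).eq_or_lt with rfl | hlt
      · rw [hdm, he]; ring
      · rw [coeff_eq_zero_of_natDegree_lt (hdeg.trans_lt hlt), coeff_eq_zero_of_natDegree_lt hlt]
        ring
    omega
  have hd0 : algebraMap k[X] (RatFunc k) u.denom ≠ 0 :=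
    RatFunc.algebraMap_ne_zero (RatFunc.denom_ne_zero u)
  have hn : algebraMap k[X] (RatFunc k) u.num = u * algebraMap k[X] (RatFunc k) u.denom := by
    exact (div_eq_iff hd0).mp (RatFunc.num_div_denom u)
  have hC : ∀ a : k, algebraMap k[X] (RatFunc k) (C a) = algebraMap k (RatFunc k) a := fun a => rfl
  have hru : algebraMap k[X] (RatFunc k) r =
      (u - algebraMap k _ e) * algebraMap k[X] (RatFunc k) u.denom := by
    rw [hr, map_sub, map_mul, hn, hC]; ring
  have hr0 : algebraMap k[X] (RatFunc k) r ≠ 0 := by rw [hru]; exact mul_ne_zero hue hd0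
  set s : k[X] := C e * r + C (3 * e ^ 2 + W'.A) * u.denom with hs
  have hsd : s.natDegree = m := by
    refine le_antisymm ?_ (le_natDegree_of_ne_zero ?_)
    · exact natDegree_add_le_of_degree_le ((natDegree_C_mul_le _ _).trans hrd.le)
        (natDegree_C_mul_le _ _)
    · rw [hs, coeff_add, coeff_C_mul, coeff_C_mul, coeff_eq_zero_of_natDegree_lt hrd, hdm]
      simpa using h3e
  have hs0 : algebraMap k[X] (RatFunc k) s ≠ 0 := by
    refine RatFunc.algebraMap_ne_zero fun h0 => ?_
    rw [h0, natDegree_zero] at hsd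
    omega
  have hws : w = algebraMap k[X] (RatFunc k) s / algebraMap k[X] (RatFunc k) r := by
    rw [eq_div_iff hr0, hs, map_add, map_mul, map_mul, hC, hC, hru, hw]
    field_simp
  have h1 : w.intDegree = (m : ℤ) - r.natDegree := by
    rw [hws, RatFunc.intDegree_div hs0 hr0, RatFunc.intDegree_polynomial,
      RatFunc.intDegree_polynomial, hsd]
  rw [RatFunc.intDegree] at h1
  omega

/-- Every nonzero separable algebraic homomorphism has a representative whose abscissa has a
simple leading behaviour at infinity. -/
theorem Rep.normalize {α : W.P k →+ W'.P k} {φ} (h : Rep α φ) (hα : α ≠ 0) {c : k}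
    (hc : cF φ = algebraMap k W.FF c) (hc0 : c ≠ 0) :
    ∃ φ', Rep α φ' ∧ hp φ' = hp φ ∧ cF φ' = algebraMap k W.FF c ∧ ∃ u, px φ' = io u ∧
      u.num.natDegree = u.denom.natDegree + 1 ∧ c ^ 2 * u.num.leadingCoeff = 1 := by
  have hc' : cF φ ≠ 0 := by rwa [hc, Ne, map_eq_zero]
  obtain ⟨Q, hQ, u, hu, hdeg⟩ := h.normalize_aux hα hc'
  have h' := h.add_two_torsion hQ
  have hcF : cF (φ + W'.incl W.FF Q) = algebraMap k W.FF c := by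
    rw [map_add, cF_incl, add_zero, hc]
  refine ⟨_, h', hp_add_two_torsion h.1 hQ, hcF, u, hu, ?_⟩
  have hode := h'.ode hα hu hcF
  set n := u.num.natDegree with hn
  set d := u.denom.natDegree with hd
  have hdc : u.denom.coeff d = 1 := (RatFunc.monic_denom u).coeff_natDegree
  have hn0 : u.num.leadingCoeff ≠ 0 := by
    rw [Ne, leadingCoeff_eq_zero]
    intro h0
    rw [hn, h0, natDegree_zero] at hdeg
    omega
  have p1 : (u.num ^ 3).natDegree ≤ 3 * n := natDegree_pow_le_of_le 3 le_rfl
  have p2 : (C W'.A * u.num * u.denom ^ 2 + C W'.B * u.denom ^ 3).natDegree < 3 * n := by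
    refine (natDegree_add_le_of_degree_le (n := n + 2 * d) ?_ ?_).trans_lt (by omega)
    · rw [mul_assoc]
      exact (natDegree_C_mul_le _ _).trans
        (natDegree_mul_le_of_le le_rfl (natDegree_pow_le_of_le 2 le_rfl))
    · exact (natDegree_C_mul_le _ _).trans ((natDegree_pow_le_of_le 3 le_rfl).trans (by omega))
  have hR : (C (c ^ 2) * (u.denom * (u.num ^ 3 + C W'.A * u.num * u.denom ^ 2 +
      C W'.B * u.denom ^ 3))).coeff (d + 3 * n) = c ^ 2 * u.num.leadingCoeff ^ 3 := by
    rw [coeff_C_mul, add_assoc, coeff_mul_add_eq_of_natDegree_le le_rfl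
      (natDegree_add_le_of_degree_le p1 p2.le), coeff_add, coeff_eq_zero_of_natDegree_lt p2,
      coeff_pow_of_natDegree_le le_rfl, hdc]
    rw [coeff_natDegree, one_mul, add_zero]
  have hR0 : c ^ 2 * u.num.leadingCoeff ^ 3 ≠ 0 := mul_ne_zero (pow_ne_zero 2 hc0) (pow_ne_zero 3 hn0)
  have q1 : (derivative u.num * u.denom - u.num * derivative u.denom).natDegree ≤ n + d - 1 := by
    by_cases h0 : d = 0
    · rw [derivative_of_natDegree_zero (hd.symm.trans h0), mul_zero, sub_zero]
      exact (natDegree_mul_le_of_le (natDegree_derivative_le _) le_rfl).trans (by omega)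
    · refine (natDegree_sub_le_of_le (natDegree_mul_le_of_le (natDegree_derivative_le _) le_rfl)
        (natDegree_mul_le_of_le le_rfl (natDegree_derivative_le _))).trans ?_
      omega
  have hL : ((derivative u.num * u.denom - u.num * derivative u.denom) ^ 2 * W.fP).natDegree ≤
      2 * (n + d - 1) + 3 :=
    natDegree_mul_le_of_le (natDegree_pow_le_of_le 2 q1) W.natDegree_fP.le
  have hnd : n = d + 1 := by
    have : d + 3 * n ≤ 2 * (n + d - 1) + 3 := by
      refine (le_natDegree_of_ne_zero ?_).trans hL
      rw [hode, hR]; exact hR0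
    omega
  refine ⟨hnd, ?_⟩
  have h3 : (W.fP).coeff 3 = 1 := by simp [fP]
  have h2 : (derivative u.num * u.denom - u.num * derivative u.denom).coeff (d + d) =
      u.num.leadingCoeff := by
    have hnl : u.num.coeff (d + 1) = u.num.leadingCoeff := by rw [← hnd, hn, coeff_natDegree]
    rw [coeff_sub, coeff_mul_add_eq_of_natDegree_le ((natDegree_derivative_le _).trans (by omega))
      le_rfl, hdc, coeff_derivative, hnl]
    by_cases h0 : d = 0
    · rw [derivative_of_natDegree_zero (hd.symm.trans h0), h0]; simp
    · rw [show d + d = (d + 1) + (d - 1) by omega, coeff_mul_add_eq_of_natDegree_le hnd.le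
        (natDegree_derivative_le _), hnl, coeff_derivative, Nat.sub_add_cancel (by omega), hdc,
        Nat.cast_sub (by omega)]
      push_cast; ring
  have h1 := congrArg (fun p => p.coeff (2 * (d + d) + 3)) hode
  have e1 : d + 3 * n = 2 * (d + d) + 3 := by omega
  rw [← e1] at h1
  simp only [hR] at h1
  have e2 : n + d - 1 = d + d := by omega
  rw [e2] at q1
  rw [e1, coeff_mul_add_eq_of_natDegree_le (natDegree_pow_le_of_le 2 q1) W.natDegree_fP.le,
    coeff_pow_of_natDegree_le q1, h2, h3, mul_one] at h1
  have h4 : u.num.leadingCoeff ^ 2 ≠ 0 := pow_ne_zero 2 hn0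
  exact mul_left_cancel₀ h4 (by linear_combination -h1)

end Normalize

section JInvariant

variable {k : Type} [Field k] [IsAlgClosed k] {W W' W'' : ShortCurve k}

lemma hp_pm {φ : W'.P W.FF} {g : W'.FF →ₐ[k] W.FF} (hg : pm g gen = φ) {u : RatFunc k}
    (hu : px φ = io u) {ψ : W''.P W'.FF} (hψ : pm conj ψ = -ψ) :
    hp (pm g ψ) = hp ψ * hp φ := by
  obtain ⟨v, hv⟩ := px_of_odd hψ
  have hgx : g xx = io u := by rw [← hu, ← hg, px_pm, px_gen]
  have hun : u ∉ (algebraMap k (RatFunc k)).range := fun hc => by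
    refine not_const_xx (W := W') (const_of_const_map g ?_)
    rw [hgx]; exact const_io.mpr hc
  obtain ⟨s, hs⟩ := exists_subst hun
  have hcomp : g.comp io = io.comp s := algHom_ext_ratFunc (by
    rw [AlgHom.comp_apply, AlgHom.comp_apply, hs, ← hgx]; rfl)
  have h1 : px (pm g ψ) = io (s v) := by
    rw [px_pm, hv]; exact DFunLike.congr_fun hcomp v
  rw [hp_of h1, hp_of hv, hp_of hu, ht_comp, hs]

/-- The `j`-invariant, up to normalization. -/
noncomputable def jinv (W : ShortCurve k) : k := W.A ^ 3 / (4 * W.A ^ 3 + 27 * W.B ^ 2)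

lemma Rep.id_eq {φ : W.P W.FF} (h : Rep (AddMonoidHom.id (W.P k)) φ) :
    hp φ = 1 ∧ cF φ = 1 := by
  have h1 := h.sub Rep.id
  rw [sub_self] at h1
  obtain ⟨Q, hQ⟩ := exists_incl_eq h1.const
  have hφ : φ = gen + W.incl W.FF Q := by rw [hQ]; abel
  have hQ2 : Q + Q = 0 := by
    have h2 := h1.1
    rw [← hQ, pm_incl, ← map_neg] at h2
    have := incl_injective h2
    nth_rw 1 [this]; exact neg_add_cancel Q
  rw [hφ]
  exact ⟨by rw [hp_add_two_torsion pm_conj_gen hQ2, hp_gen], by rw [map_add, cF_gen, cF_incl, add_zero]⟩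

lemma IsAlg.eq_scale {β : W.P k →+ W'.P k} {β' : W'.P k →+ W.P k} (h : IsAlg β) (h' : IsAlg β')
    (hc : β'.comp β = AddMonoidHom.id _) (h3 : (3 : k) ≠ 0) :
    ∃ a : k, a ≠ 0 ∧ W'.A = a ^ 2 * W.A ∧ W'.B = a ^ 3 * W.B := by
  have hβ : β ≠ 0 := by
    rintro rfl
    obtain ⟨P, hP⟩ := exists_ne (0 : W.P k)
    exact hP (by simpa using (DFunLike.congr_fun hc P).symm)
  obtain ⟨φ, hφ⟩ := h
  obtain ⟨ψ, hψ⟩ := h'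
  obtain ⟨g, hg, -⟩ := hφ.exists_hom hβ
  obtain ⟨u, hu⟩ := hφ.px_eq
  have h1 := hφ.comp hψ hg
  rw [hc] at h1
  obtain ⟨e1, e2⟩ := h1.id_eq
  rw [hp_pm hg hu hψ.1] at e1
  rw [cF_pm, hg] at e2
  obtain ⟨c, hcφ⟩ := hφ.exists_cF
  have hc0 : c ≠ 0 := by
    rintro rfl
    rw [hcφ, map_zero, zero_mul] at e2
    exact zero_ne_one e2
  obtain ⟨φ', hφ', hhp, hcF, v, hv, hdeg, hlead⟩ := hφ.normalize hβ hcφ hc0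
  have hht : ht v = 1 := by rw [← hp_of hv, hhp]; exact Nat.eq_one_of_mul_eq_one_left e1
  have hD0 : v.denom.natDegree = 0 := by
    rw [ht] at hht; omega
  have hD : v.denom = 1 := by
    have := (RatFunc.monic_denom v)
    exact this.natDegree_eq_zero.mp hD0
  have hN1 : v.num.natDegree = 1 := by omega
  obtain ⟨ν, b, hN⟩ : ∃ ν b, v.num = C ν * X + C b := ⟨_, _, eq_X_add_C_of_natDegree_le_one hN1.le⟩
  have hν : v.num.leadingCoeff = ν := by
    rw [leadingCoeff, hN1, hN]; simp
  rw [hν] at hlead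
  have hν0 : ν ≠ 0 := by
    rintro rfl
    simp at hlead
  have hode := hφ'.ode hβ hv hcF
  rw [hD, hN] at hode
  have hpoly : C (ν ^ 2) * X ^ 3 + C (ν ^ 2 * W.A) * X + C (ν ^ 2 * W.B) =
      C (c ^ 2 * ν ^ 3) * X ^ 3 + C (c ^ 2 * (3 * ν ^ 2 * b)) * X ^ 2 +
      C (c ^ 2 * (3 * ν * b ^ 2 + W'.A * ν)) * X + C (c ^ 2 * (b ^ 3 + W'.A * b + W'.B)) := by
    simp only [derivative_add, derivative_mul, derivative_C, derivative_X, derivative_one, fP] at hode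
    simp only [C_mul, C_add, C_pow, map_ofNat] at hode ⊢
    linear_combination hode
  have k2 := congrArg (fun p => p.coeff 2) hpoly
  have k1 := congrArg (fun p => p.coeff 1) hpoly
  have k0 := congrArg (fun p => p.coeff 0) hpoly
  simp only [coeff_add, coeff_C_mul, coeff_X_pow, coeff_X, coeff_C] at k2 k1 k0
  norm_num at k2 k1 k0
  have hb : b = 0 := by
    rcases k2 with h | (h | h) | h
    · exact absurd h hc0
    · exact absurd h h3
    · exact absurd h hν0
    · exact h
  subst hb
  refine ⟨ν, hν0, ?_, ?_⟩
  · linear_combination -k1 - W'.A * hlead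
  · have e : W'.B = c ^ 2 * ν * W'.B := by rw [hlead, one_mul]
    have k0' : ν ^ 2 * W.B = c ^ 2 * W'.B := by linear_combination k0
    linear_combination e - ν * k0'

lemma IsAlg.jinv_eq {β : W.P k →+ W'.P k} {β' : W'.P k →+ W.P k} (h : IsAlg β) (h' : IsAlg β')
    (hc : β'.comp β = AddMonoidHom.id _) (h3 : (3 : k) ≠ 0) : jinv W = jinv W' := by
  obtain ⟨a, ha, hA, hB⟩ := h.eq_scale h' hc h3
  rw [jinv, jinv, hA, hB, show 4 * (a ^ 2 * W.A) ^ 3 + 27 * (a ^ 3 * W.B) ^ 2 =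
    a ^ 6 * (4 * W.A ^ 3 + 27 * W.B ^ 2) by ring, show (a ^ 2 * W.A) ^ 3 = a ^ 6 * W.A ^ 3 by ring,
    mul_div_mul_left _ _ (pow_ne_zero 6 ha)]

lemma exists_scale_point {s : k} (hA : W'.A = s ^ 4 * W.A) (hB : W'.B = s ^ 6 * W.B) :
    ∃ φ : W'.P W.FF, φ ≠ 0 ∧ px φ = algebraMap k W.FF (s ^ 2) * xx ∧
      py φ = algebraMap k W.FF (s ^ 3) * yy ∧ ∃ α, Rep α φ := by
  have h : (algebraMap k W.FF (s ^ 3) * yy) ^ 2 =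
      (W'.bc W.FF).f (algebraMap k W.FF (s ^ 2) * xx) := by
    have h1 : (yy : W.FF) ^ 2 = (W.bc W.FF).f xx := by rw [yy_sq, io_fX]
    rw [mul_pow, h1]
    simp only [f, bc, hA, hB, map_mul, map_pow]
    ring
  have hodd : pm conj (pt _ _ h : W'.P W.FF) = -pt _ _ h := by
    refine pm_unique (pt_ne_zero _) (neg_ne_zero.mpr (pt_ne_zero _)) ?_ ?_
    · rw [px_neg, px_pt, map_mul, AlgHom.commutes, conj_xx]
    · rw [py_neg, py_pt, map_mul, AlgHom.commutes, conj_yy]; ring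
  exact ⟨pt _ _ h, pt_ne_zero _, px_pt _, py_pt _, exists_rep_of_odd hodd⟩

lemma Rep.unique {α β : W.P k →+ W'.P k} {φ} (h : Rep α φ) (h' : Rep β φ) : α = β := by
  ext1 P
  have := h.2 P
  rw [h'.2 P] at this
  exact (incl_injective (add_left_cancel this)).symm

lemma scale_comp {s t : k} (hst : s * t = 1) {α : W.P k →+ W'.P k} {β : W'.P k →+ W.P k} {φ ψ}
    (hα : Rep α φ) (hβ : Rep β ψ) (h0' : ψ ≠ 0)
    (hx : px φ = algebraMap k W.FF (s ^ 2) * xx) (hy : py φ = algebraMap k W.FF (s ^ 3) * yy)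
    (hx' : px ψ = algebraMap k W'.FF (t ^ 2) * xx) (hy' : py ψ = algebraMap k W'.FF (t ^ 3) * yy) :
    β.comp α = AddMonoidHom.id _ := by
  have hs : s ≠ 0 := left_ne_zero_of_mul_eq_one hst
  have hα0 : α ≠ 0 := by
    rintro rfl
    have := hα.const
    rw [hx] at this
    obtain ⟨c, hc⟩ := this
    refine not_const_xx (W := W) ⟨c / s ^ 2, ?_⟩
    have h2 : algebraMap k W.FF (s ^ 2) ≠ 0 := by simpa using hs
    rw [map_div₀, hc]; field_simp
  obtain ⟨g, hg, -⟩ := hα.exists_hom hα0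
  have h1 := hα.comp hβ hg
  have hgx : g xx = px φ := by rw [← hg, px_pm, px_gen]
  have hgy : g yy = py φ := by rw [← hg, py_pm, py_gen]
  have : pm g ψ = gen := by
    refine pm_unique h0' gen_ne_zero ?_ ?_
    · rw [hx', map_mul, AlgHom.commutes, hgx, hx, px_gen, ← mul_assoc, ← map_mul, ← mul_pow,
        mul_comm t, hst, one_pow, map_one, one_mul]
    · rw [hy', map_mul, AlgHom.commutes, hgy, hy, py_gen, ← mul_assoc, ← map_mul, ← mul_pow,
        mul_comm t, hst, one_pow, map_one, one_mul]
  rw [this] at h1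
  exact h1.unique Rep.id

lemma exists_iso_of_scale {s : k} (hs : s ≠ 0) (hA : W'.A = s ^ 4 * W.A) (hB : W'.B = s ^ 6 * W.B) :
    ∃ (α : W.P k →+ W'.P k) (β : W'.P k →+ W.P k), IsAlg α ∧ IsAlg β ∧
      β.comp α = AddMonoidHom.id _ ∧ α.comp β = AddMonoidHom.id _ := by
  obtain ⟨φ, h0, hx, hy, α, hα⟩ := exists_scale_point hA hB
  obtain ⟨ψ, h0', hx', hy', β, hβ⟩ := exists_scale_point (W := W') (W' := W) (s := s⁻¹)
    (by rw [hA]; field_simp) (by rw [hB]; field_simp)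
  exact ⟨α, β, ⟨φ, hα⟩, ⟨ψ, hβ⟩, scale_comp (mul_inv_cancel₀ hs) hα hβ h0' hx hy hx' hy',
    scale_comp (inv_mul_cancel₀ hs) hβ hα h0 hx' hy' hx hy⟩

lemma exists_scale_of_jinv (h3 : (3 : k) ≠ 0) (h : jinv W = jinv W') :
    ∃ s : k, s ≠ 0 ∧ W'.A = s ^ 4 * W.A ∧ W'.B = s ^ 6 * W.B := by
  have h27 : (27 : k) ≠ 0 := by
    rw [show (27 : k) = 3 ^ 3 by norm_num]; exact pow_ne_zero 3 h3
  rw [jinv, jinv, div_eq_div_iff W.disc W'.disc] at h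
  have hcross : W.A ^ 3 * W'.B ^ 2 = W'.A ^ 3 * W.B ^ 2 :=
    mul_left_cancel₀ h27 (by linear_combination h)
  have hd := W.disc
  have hd' := W'.disc
  have key : ∃ a : k, a ≠ 0 ∧ W'.A = a ^ 2 * W.A ∧ W'.B = a ^ 3 * W.B := by
    by_cases hA : W.A = 0
    · have hB : W.B ≠ 0 := by rintro hB; exact hd (by rw [hA, hB]; ring)
      have hA' : W'.A = 0 := by
        rw [hA] at hcross
        have : W'.A ^ 3 * W.B ^ 2 = 0 := by rw [← hcross]; ring
        simpa [hB] using this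
      have hB' : W'.B ≠ 0 := by rintro hB; exact hd' (by rw [hA', hB]; ring)
      obtain ⟨a, ha⟩ := IsAlgClosed.exists_pow_nat_eq (W'.B / W.B) (n := 3) (by norm_num)
      refine ⟨a, ?_, by rw [hA', hA, mul_zero], by rw [ha]; field_simp⟩
      rintro rfl
      rw [zero_pow three_ne_zero] at ha
      exact div_ne_zero hB' hB ha.symm
    · by_cases hB : W.B = 0
      · have hB' : W'.B = 0 := by
          rw [hB] at hcross
          have : W.A ^ 3 * W'.B ^ 2 = 0 := by rw [hcross]; ring
          simpa [hA] using this
        have hA' : W'.A ≠ 0 := by rintro hA; exact hd' (by rw [hB', hA]; ring)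
        obtain ⟨a, ha⟩ := IsAlgClosed.exists_pow_nat_eq (W'.A / W.A) (n := 2) (by norm_num)
        refine ⟨a, ?_, by rw [ha]; field_simp, by rw [hB', hB, mul_zero]⟩
        rintro rfl
        rw [zero_pow two_ne_zero] at ha
        exact div_ne_zero hA' hA ha.symm
      · have hA' : W'.A ≠ 0 := by
          intro h0
          rw [h0] at hcross
          have : W.A ^ 3 * W'.B ^ 2 = 0 := by rw [hcross]; ring
          have hB' : W'.B = 0 := by simpa [hA] using this
          exact hd' (by rw [h0, hB']; ring)
        have hB' : W'.B ≠ 0 := by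
          intro h0
          rw [h0] at hcross
          have : W'.A ^ 3 * W.B ^ 2 = 0 := by rw [← hcross]; ring
          simp [hA', hB] at this
        refine ⟨W'.B * W.A / (W.B * W'.A), div_ne_zero (mul_ne_zero hB' hA) (mul_ne_zero hB hA'),
          ?_, ?_⟩
        · field_simp
          linear_combination -hcross
        · field_simp
          linear_combination -hcross
  obtain ⟨a, ha, h1, h2⟩ := key
  obtain ⟨s, hs⟩ := IsAlgClosed.exists_pow_nat_eq a (n := 2) (by norm_num)
  refine ⟨s, by rintro rfl; exact ha (by rw [← hs]; ring), ?_, ?_⟩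
  · rw [h1, ← hs]; ring
  · rw [h2, ← hs]; ring

end JInvariant

section Homog

variable {k : Type} [Field k]

/-- The homogenization of `p`, evaluated at two polynomials. -/
noncomputable def homog (p N D : k[X]) : k[X] :=
  ∑ i ∈ Finset.range (p.natDegree + 1), C (p.coeff i) * (N ^ i * D ^ (p.natDegree - i))

lemma algebraMap_homog (p : k[X]) {N D : k[X]} {u : RatFunc k}
    (h : algebraMap k[X] (RatFunc k) N = u * algebraMap k[X] (RatFunc k) D) :
    algebraMap k[X] (RatFunc k) (homog p N D) =
      algebraMap k[X] (RatFunc k) D ^ p.natDegree * aeval u p := by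
  rw [homog, map_sum, aeval_eq_sum_range, Finset.mul_sum]
  refine Finset.sum_congr rfl fun i hi => ?_
  have hi' : i ≤ p.natDegree := by rw [Finset.mem_range] at hi; omega
  rw [map_mul, map_mul, map_pow, map_pow, h, Algebra.smul_def]
  have e : algebraMap k[X] (RatFunc k) D ^ p.natDegree =
      algebraMap k[X] (RatFunc k) D ^ (p.natDegree - i) * algebraMap k[X] (RatFunc k) D ^ i := by
    rw [← pow_add, Nat.sub_add_cancel hi']
  rw [e, show algebraMap k[X] (RatFunc k) (C (p.coeff i)) = algebraMap k _ (p.coeff i) from rfl]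
  ring

lemma eval_homog (p : k[X]) {N D : k[X]} {x β : k} (h : N.eval x = β * D.eval x) :
    (homog p N D).eval x = D.eval x ^ p.natDegree * p.eval β := by
  rw [homog, eval_finsetSum, eval_eq_sum_range (p := p), Finset.mul_sum]
  refine Finset.sum_congr rfl fun i hi => ?_
  have hi' : i ≤ p.natDegree := by rw [Finset.mem_range] at hi; omega
  rw [eval_mul, eval_mul, eval_pow, eval_pow, eval_C, h]
  have e : D.eval x ^ p.natDegree = D.eval x ^ (p.natDegree - i) * D.eval x ^ i := by
    rw [← pow_add, Nat.sub_add_cancel hi']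
  rw [e]
  ring

lemma natDegree_homog {p N D : k[X]} (hp : p ≠ 0) (hDN : D.natDegree < N.natDegree) :
    (homog p N D).natDegree = p.natDegree * N.natDegree := by
  rw [homog, Finset.sum_range_succ, Nat.sub_self, pow_zero, mul_one, coeff_natDegree]
  have hN : N ≠ 0 := by rintro rfl; simp at hDN
  have h1 : (C p.leadingCoeff * N ^ p.natDegree).natDegree = p.natDegree * N.natDegree := by
    rw [natDegree_C_mul (leadingCoeff_ne_zero.mpr hp), natDegree_pow]
  have h0 : (C p.leadingCoeff * N ^ p.natDegree) ≠ 0 :=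
    mul_ne_zero (C_ne_zero.mpr (leadingCoeff_ne_zero.mpr hp)) (pow_ne_zero _ hN)
  refine (natDegree_eq_of_degree_eq (degree_add_eq_right_of_degree_lt ?_)).trans h1
  refine (degree_sum_le _ _).trans_lt ?_
  rw [degree_eq_natDegree h0, h1, Finset.sup_lt_iff (WithBot.bot_lt_coe _)]
  intro i hi
  rw [Finset.mem_range] at hi
  refine (degree_le_natDegree).trans_lt ?_
  rw [Nat.cast_lt]
  refine (natDegree_C_mul_le _ _).trans_lt ((natDegree_mul_le_of_le (natDegree_pow_le_of_le i le_rfl)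
    (natDegree_pow_le_of_le _ le_rfl)).trans_lt ?_)
  obtain ⟨j, hj⟩ : ∃ j, p.natDegree = i + (j + 1) := ⟨p.natDegree - i - 1, by omega⟩
  rw [hj, Nat.add_sub_cancel_left, add_mul i]
  have : (j + 1) * D.natDegree < (j + 1) * N.natDegree := Nat.mul_lt_mul_of_pos_left hDN (by omega)
  omega

end Homog

section Cubic

variable {k : Type} [Field k] [IsAlgClosed k] {W : ShortCurve k}

lemma natDegree_wronskian {N D : k[X]} {n : ℕ} (hN : N.natDegree = n + 1) (hD : D.natDegree = n)
    (hDm : D.Monic) :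
    (derivative N * D - N * derivative D).coeff (n + n) = N.leadingCoeff ∧
      (derivative N * D - N * derivative D).natDegree = n + n := by
  have h1 : (derivative N * D - N * derivative D).coeff (n + n) = N.leadingCoeff := by
    have e1 : N.coeff (n + 1) = N.leadingCoeff := by rw [leadingCoeff, hN]
    have e2 : D.coeff n = 1 := by rw [← hD]; exact hDm.coeff_natDegree
    rw [coeff_sub, coeff_mul_add_eq_of_natDegree_le
      ((natDegree_derivative_le _).trans (by omega)) hD.le, coeff_derivative, e1, e2]
    rcases n.eq_zero_or_pos with rfl | hn
    · rw [derivative_of_natDegree_zero hD]; simp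
    · rw [show n + n = (n + 1) + (n - 1) by omega, coeff_mul_add_eq_of_natDegree_le hN.le
        ((natDegree_derivative_le _).trans (by omega)), coeff_derivative, Nat.sub_add_cancel hn, e1,
        e2, Nat.cast_sub hn]
      push_cast; ring
  refine ⟨h1, le_antisymm ?_ (le_natDegree_of_ne_zero ?_)⟩
  · rcases n.eq_zero_or_pos with rfl | hn
    · rw [derivative_of_natDegree_zero hD, mul_zero, sub_zero]
      exact (natDegree_mul_le_of_le (natDegree_derivative_le _) le_rfl).trans (by omega)
    · refine (natDegree_sub_le_of_le (natDegree_mul_le_of_le (natDegree_derivative_le _) le_rfl)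
        (natDegree_mul_le_of_le le_rfl (natDegree_derivative_le _))).trans ?_
      omega
  · rw [h1]
    refine leadingCoeff_ne_zero.mpr ?_
    rintro rfl; simp at hN

/-- A ratio of polynomials which is a rational function of `u` and has no poles outside those of
`u` is a cubic polynomial in `u`. -/
lemma exists_cubic {u w : RatFunc k} {n : ℕ} (hN : u.num.natDegree = n + 1)
    (hD : u.denom.natDegree = n) (h : w ∈ IntermediateField.adjoin k {u})
    (hw : w * algebraMap k[X] (RatFunc k) u.denom ^ 4 = algebraMap k[X] (RatFunc k)
      ((derivative u.num * u.denom - u.num * derivative u.denom) ^ 2 * W.fP)) :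
    ∃ p : k[X], p.natDegree = 3 ∧ w = aeval u p ∧
      (derivative u.num * u.denom - u.num * derivative u.denom) ^ 2 * W.fP =
        u.denom * homog p u.num u.denom := by
  set N := u.num
  set D := u.denom
  set R := derivative N * D - N * derivative D
  have hD0 : D ≠ 0 := RatFunc.denom_ne_zero u
  have hDR : algebraMap k[X] (RatFunc k) D ≠ 0 := RatFunc.algebraMap_ne_zero hD0
  have hn : algebraMap k[X] (RatFunc k) N = u * algebraMap k[X] (RatFunc k) D :=
    (div_eq_iff hDR).mp (RatFunc.num_div_denom u)
  have hcop : IsCoprime N D := RatFunc.isCoprime_num_denom u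
  have hun : u ∉ (algebraMap k (RatFunc k)).range := by
    rintro ⟨c, rfl⟩
    have : N.natDegree = 0 := by
      change (RatFunc.num (RatFunc.C c)).natDegree = 0
      rw [RatFunc.num_C, natDegree_C]
    omega
  obtain ⟨g, hg⟩ := exists_subst hun
  obtain ⟨G, hG⟩ := exists_subst_eq h (AlgHom.id k _) g (by rw [hg]; rfl)
  rw [AlgHom.id_apply] at hG
  have hpq := aeval_num_eq g G
  rw [hg, ← hG] at hpq
  set p := G.num
  set q := G.denom
  have hcop' : IsCoprime p q := RatFunc.isCoprime_num_denom G
  obtain ⟨hRc, hRd⟩ := natDegree_wronskian hN hD (RatFunc.monic_denom u)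
  have hN0 : N ≠ 0 := by
    intro h0
    rw [h0, natDegree_zero] at hN
    omega
  have hR0 : R ≠ 0 := by
    intro h0
    change R.coeff _ = _ at hRc
    rw [h0, coeff_zero] at hRc
    exact hN0 (leadingCoeff_eq_zero.mp hRc.symm)
  have hid : homog p N D * D ^ q.natDegree * D ^ 4 = R ^ 2 * W.fP * homog q N D * D ^ p.natDegree := by
    apply RatFunc.algebraMap_injective k
    rw [map_mul _ (R ^ 2 * W.fP * homog q N D), map_mul _ (R ^ 2 * W.fP), ← hw]
    simp only [map_mul, map_pow, algebraMap_homog _ hn, hpq]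
    ring
  have hq : q.natDegree = 0 := by
    by_contra hq
    obtain ⟨β, hβ⟩ := IsAlgClosed.exists_root q (by
      rw [degree_eq_natDegree (RatFunc.denom_ne_zero G)]; exact_mod_cast hq)
    have hMd : (N - C β * D).natDegree = n + 1 := by
      rw [natDegree_sub_eq_left_of_natDegree_lt, hN]
      exact (natDegree_C_mul_le _ _).trans_lt (by omega)
    obtain ⟨x, hx⟩ := IsAlgClosed.exists_root (N - C β * D) (by
      rw [degree_eq_natDegree (by rintro h0; rw [h0, natDegree_zero] at hMd; omega), hMd]
      exact_mod_cast (Nat.succ_ne_zero n))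
    rw [IsRoot, eval_sub, eval_mul, eval_C, sub_eq_zero] at hx
    have hDx : D.eval x ≠ 0 := by
      intro h0
      obtain ⟨a, b, hab⟩ := hcop
      have := congrArg (eval x) hab
      rw [eval_add, eval_mul, eval_mul, hx, h0] at this
      simp at this
    have h1 := congrArg (eval x) hid
    simp only [eval_mul, eval_homog _ hx, eval_pow, hβ.eq_zero] at h1
    have hp0 : p.eval β = 0 := by simpa [hDx] using h1
    obtain ⟨a, b, hab⟩ := hcop'
    have := congrArg (eval β) hab
    rw [eval_add, eval_mul, eval_mul, hp0, hβ.eq_zero] at this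
    simp at this
  have hq1 : q = 1 := (RatFunc.monic_denom G).natDegree_eq_zero.mp hq
  have hw' : w = aeval u p := by rw [hpq, hq1, map_one, mul_one]
  have hid' : homog p N D * D ^ 4 = R ^ 2 * W.fP * D ^ p.natDegree := by
    have e1 : homog (1 : k[X]) N D = 1 := by simp [homog]
    rw [hq1, e1, natDegree_one, pow_zero] at hid
    linear_combination hid
  have hp0 : p ≠ 0 := by
    intro h0
    rw [h0] at hid'
    have e1 : homog (0 : k[X]) N D = 0 := by simp [homog]
    rw [e1, zero_mul] at hid'
    exact mul_ne_zero (mul_ne_zero (pow_ne_zero 2 hR0) W.fP_ne_zero) (pow_ne_zero _ hD0) hid'.symm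
  have hhd := natDegree_homog (N := N) (D := D) hp0 (by omega)
  have hh0 : homog p N D ≠ 0 := by
    intro h0
    rw [h0, zero_mul] at hid'
    exact mul_ne_zero (mul_ne_zero (pow_ne_zero 2 hR0) W.fP_ne_zero) (pow_ne_zero _ hD0) hid'.symm
  have hdeg := congrArg natDegree hid'
  rw [natDegree_mul hh0 (pow_ne_zero _ hD0),
    natDegree_mul (mul_ne_zero (pow_ne_zero 2 hR0) W.fP_ne_zero) (pow_ne_zero _ hD0),
    natDegree_mul (pow_ne_zero 2 hR0) W.fP_ne_zero, natDegree_pow, natDegree_pow, natDegree_pow, hhd,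
    hRd, W.natDegree_fP, hN, hD] at hdeg
  have hp3 : p.natDegree = 3 := by
    have : p.natDegree * (n + 1) = p.natDegree * n + p.natDegree := by ring
    omega
  refine ⟨p, hp3, hw', ?_⟩
  rw [hp3] at hid'
  exact mul_right_cancel₀ (pow_ne_zero 3 hD0) (by linear_combination -hid')

/-- A Wronskian square times a squarefree cubic has no repeated factors beyond the expected ones. -/
lemma no_double_root {N D T : k[X]} {n : ℕ} (hM : N.natDegree = n + 1)
    (hcop : IsCoprime N D) (hchar : ∀ m : ℕ, 0 < m → m ≤ n + 1 → (m : k) ≠ 0) :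
    (derivative N * D - N * derivative D) ^ 2 * W.fP ≠ N ^ 2 * T := by
  intro h
  have hN0 : N ≠ 0 := by
    intro h0
    rw [h0, natDegree_zero] at hM
    omega
  obtain ⟨x, hx⟩ := IsAlgClosed.exists_root N (by
    rw [degree_eq_natDegree hN0, hM]; exact_mod_cast (Nat.succ_ne_zero n))
  obtain ⟨S, hS, hSx⟩ := exists_eq_pow_rootMultiplicity_mul_and_not_dvd N hN0 x
  set m := N.rootMultiplicity x with hm
  have hm0 : 0 < m := (rootMultiplicity_pos hN0).mpr hx
  have hmn : m ≤ n + 1 := by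
    have := congrArg natDegree hS
    have hS0 : S ≠ 0 := by rintro rfl; simp at hSx
    rw [natDegree_mul (pow_ne_zero _ (X_sub_C_ne_zero x)) hS0, natDegree_pow, natDegree_X_sub_C,
      hM] at this
    omega
  obtain ⟨j, hj⟩ : ∃ j, m = j + 1 := ⟨m - 1, by omega⟩
  rw [hj] at hS
  have hDx : D.eval x ≠ 0 := by
    intro h0
    obtain ⟨a, b, hab⟩ := hcop
    have := congrArg (eval x) hab
    rw [eval_add, eval_mul, eval_mul, hx.eq_zero, h0] at this
    simp at this
  have hSx' : S.eval x ≠ 0 := fun h0 => hSx (dvd_iff_isRoot.mpr h0)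
  set L : k[X] := C ((j + 1 : ℕ) : k) * S * D + (X - C x) * (derivative S * D - S * derivative D) with hL
  have e1 : derivative N * D - N * derivative D = (X - C x) ^ j * L := by
    rw [hS, derivative_mul, derivative_X_sub_C_pow, hL, Nat.add_sub_cancel]
    simp only [map_natCast]
    ring
  have hLx : L.eval x ≠ 0 := by
    rw [hL]
    simp only [eval_add, eval_mul, eval_C, eval_sub, eval_X, sub_self, zero_mul, add_zero]
    exact mul_ne_zero (mul_ne_zero (hchar _ (by omega) (by omega)) hSx') hDx
  have e2 : L ^ 2 * W.fP = (X - C x) ^ 2 * (S ^ 2 * T) := by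
    refine mul_left_cancel₀ (pow_ne_zero (2 * j) (X_sub_C_ne_zero x)) ?_
    rw [e1] at h
    have h' := h
    rw [hS] at h'
    linear_combination h'
  have h0 := congrArg (eval x) e2
  have h1 := congrArg (fun q => eval x (derivative q)) e2
  simp only [eval_mul, eval_pow, eval_sub, eval_X, eval_C, sub_self, zero_pow two_ne_zero, zero_mul] at h0
  have hf0 : W.fP.eval x = 0 := (mul_eq_zero.mp h0).resolve_left (pow_ne_zero 2 hLx)
  simp only [derivative_mul, derivative_X_sub_C_pow, eval_add, eval_mul, eval_pow, eval_sub, eval_X,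
    eval_C, sub_self, hf0] at h1
  have hf1 : (derivative W.fP).eval x = 0 := by simpa [hLx] using h1
  rw [eval_fP, f] at hf0
  simp [fP] at hf1
  apply W.disc
  have hA : W.A = -3 * x ^ 2 := by linear_combination hf1
  have hB : W.B = 2 * x ^ 3 := by linear_combination hf0 - x * hf1
  rw [hA, hB]; ring

end Cubic

section Velu

variable {k : Type} [Field k] [IsAlgClosed k] {W : ShortCurve k}

/-- The numerator of the trace of a translate of the first coordinate. -/
noncomputable def trN (W : ShortCurve k) (a : k) : k[X] :=
  (C a * X + C W.A) * (X + C a) + C (2 * W.B)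

lemma natDegree_trN (a : k) : (trN W a).natDegree ≤ 2 := by
  rw [trN]; compute_degree

lemma tau_xx_add_neg {Q : W.P k} (hQ : Q ≠ 0) :
    (tau Q xx + tau (-Q) xx : W.FF) * (xx - algebraMap k W.FF (px Q)) ^ 2 =
      2 * aeval xx (trN W (px Q)) := by
  have h1 : (tau Q xx : W.FF) = px (gen + W.incl W.FF Q) := by
    rw [← pm_tau_gen, px_pm, px_gen]
  have h2 : (tau (-Q) xx : W.FF) = px (gen - W.incl W.FF Q) := by
    rw [sub_eq_add_neg, ← map_neg, ← pm_tau_gen, px_pm, px_gen]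
  have hQ' : W.incl W.FF Q ≠ 0 := fun h => hQ (incl_injective (h.trans (map_zero _).symm))
  have hne : px (gen : W.P W.FF) ≠ px (W.incl W.FF Q) := by
    rw [px_gen, px_incl]
    intro h
    exact not_const_xx ⟨_, h.symm⟩
  obtain ⟨h, -⟩ := px_add_sub (gen_ne_zero (W := W)) hQ' hne
  rw [h1, h2]
  rw [px_gen, px_incl] at h
  rw [h, trN]
  simp only [map_add, map_mul, aeval_C, aeval_X, map_ofNat]
  change 2 * (_ + algebraMap k W.FF W.A) * _ + 4 * algebraMap k W.FF W.B = _
  ring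

/-- The polynomial vanishing at the first coordinates of the nonzero points. -/
noncomputable def kerD [DecidableEq (W.P k)] (H : Finset (W.P k)) : k[X] :=
  ∏ Q ∈ H.erase 0, (X - C (px Q))

variable [DecidableEq (W.P k)]

lemma natDegree_kerD (H : Finset (W.P k)) (h0 : 0 ∈ H) : (kerD H).natDegree + 1 = H.card := by
  rw [kerD, natDegree_finsetProd_X_sub_C_eq_card, Finset.card_erase_add_one h0]

lemma monic_kerD (H : Finset (W.P k)) : (kerD H).Monic := monic_prod_X_sub_C _ _

lemma exists_trM (H : Finset (W.P k)) (h0 : 0 ∈ H) (hneg : ∀ P ∈ H, -P ∈ H) {Q : W.P k}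
    (hQ : Q ∈ H) (hQ0 : Q ≠ 0) : ∃ M : k[X], M.natDegree + 1 ≤ H.card ∧
      (tau Q xx + tau (-Q) xx : W.FF) * aeval xx (kerD H) = 2 * aeval xx M := by
  have hk := natDegree_kerD H h0
  have hx0 : (xx : W.FF) - algebraMap k W.FF (px Q) ≠ 0 := fun h =>
    not_const_xx ⟨_, (sub_eq_zero.mp h).symm⟩
  have ht := tau_xx_add_neg hQ0
  have hmem : Q ∈ H.erase 0 := Finset.mem_erase.mpr ⟨hQ0, hQ⟩
  by_cases hself : Q = -Q
  · have hy : W.f (px Q) = 0 := by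
      have := (eq_neg_self_iff hQ0).mp hself
      have h2 := py_sq hQ0
      rw [this] at h2
      have h3 : (W.bc k).f (px Q) = 0 := by rw [← h2]; ring
      exact h3
    have hE : kerD H = (X - C (px Q)) * ∏ R ∈ (H.erase 0).erase Q, (X - C (px R)) :=
      (Finset.mul_prod_erase _ _ hmem).symm
    set E := ∏ R ∈ (H.erase 0).erase Q, (X - C (px R)) with hEd
    have hEm : E.Monic := monic_prod_X_sub_C _ _
    have hdeg : (kerD H).natDegree = 1 + E.natDegree := by
      rw [hE, natDegree_mul (X_sub_C_ne_zero _) hEm.ne_zero, natDegree_X_sub_C]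
    refine ⟨(C (px Q) * X + C (2 * px Q ^ 2 + W.A)) * E, ?_, ?_⟩
    · have : ((C (px Q) * X + C (2 * px Q ^ 2 + W.A)) : k[X]).natDegree ≤ 1 := by compute_degree
      have := natDegree_mul_le_of_le this (le_refl E.natDegree)
      omega
    · have e : trN W (px Q) = (X - C (px Q)) * (C (px Q) * X + C (2 * px Q ^ 2 + W.A)) := by
        have : W.B = -(px Q ^ 3 + W.A * px Q) := by rw [f] at hy; linear_combination hy
        rw [trN, this]
        simp only [C_add, C_mul, C_neg, C_pow, map_ofNat]
        ring
      rw [e] at ht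
      rw [hE]
      simp only [map_mul, map_sub, aeval_X, aeval_C] at ht ⊢
      refine mul_right_cancel₀ hx0 ?_
      linear_combination aeval (xx : W.FF) E * ht
  · have hmem' : -Q ∈ (H.erase 0).erase Q := Finset.mem_erase.mpr
      ⟨fun h => hself h.symm, Finset.mem_erase.mpr ⟨neg_ne_zero.mpr hQ0, hneg _ hQ⟩⟩
    have hE : kerD H = (X - C (px Q)) * ((X - C (px Q)) *
        ∏ R ∈ ((H.erase 0).erase Q).erase (-Q), (X - C (px R))) := by
      rw [kerD, ← Finset.mul_prod_erase _ _ hmem, ← Finset.mul_prod_erase _ _ hmem', px_neg]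
    set E := ∏ R ∈ ((H.erase 0).erase Q).erase (-Q), (X - C (px R)) with hEd
    have hEm : E.Monic := monic_prod_X_sub_C _ _
    have hdeg : (kerD H).natDegree = 1 + (1 + E.natDegree) := by
      rw [hE, natDegree_mul (X_sub_C_ne_zero _) (mul_ne_zero (X_sub_C_ne_zero _) hEm.ne_zero),
        natDegree_mul (X_sub_C_ne_zero _) hEm.ne_zero, natDegree_X_sub_C]
    refine ⟨trN W (px Q) * E, ?_, ?_⟩
    · have := natDegree_mul_le_of_le (natDegree_trN (W := W) (px Q)) (le_refl E.natDegree)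
      omega
    · rw [hE]
      simp only [map_mul, map_sub, aeval_X, aeval_C] at ht ⊢
      linear_combination aeval (xx : W.FF) E * ht

/-- The trace of the first coordinate along a finite subgroup. -/
lemma exists_trace (H : Finset (W.P k)) (h0 : 0 ∈ H) (hneg : ∀ P ∈ H, -P ∈ H)
    (hadd : ∀ P ∈ H, ∀ Q ∈ H, P + Q ∈ H) : ∃ u : RatFunc k,
      u.num.natDegree = H.card ∧ u.denom.natDegree + 1 = H.card ∧
      ∀ P ∈ H, tau P (io u : W.FF) = io u := by
  have hk := natDegree_kerD H h0
  have hM : ∀ Q : W.P k, ∃ M : k[X], Q ∈ H.erase 0 → M.natDegree + 1 ≤ H.card ∧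
      (tau Q xx + tau (-Q) xx : W.FF) * aeval xx (kerD H) = 2 * aeval xx M := by
    intro Q
    by_cases hQ : Q ∈ H.erase 0
    · obtain ⟨M, hM⟩ := exists_trM H h0 hneg (Finset.mem_of_mem_erase hQ) (Finset.ne_of_mem_erase hQ)
      exact ⟨M, fun _ => hM⟩
    · exact ⟨0, fun h => absurd h hQ⟩
  choose M hM using hM
  set N : k[X] := X * kerD H + ∑ Q ∈ H.erase 0, M Q with hN
  have hD0 : kerD H ≠ 0 := (monic_kerD H).ne_zero
  have hXD : (X * kerD H).natDegree = H.card := by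
    rw [natDegree_mul X_ne_zero hD0, natDegree_X]; omega
  have hlt : (∑ Q ∈ H.erase 0, M Q).degree < (X * kerD H).degree := by
    refine (degree_sum_le _ _).trans_lt ?_
    rw [degree_eq_natDegree (mul_ne_zero X_ne_zero hD0), hXD,
      Finset.sup_lt_iff (WithBot.bot_lt_coe _)]
    intro Q hQ
    refine (degree_le_natDegree).trans_lt ?_
    rw [Nat.cast_lt]
    have := (hM Q hQ).1
    omega
  have hNd : N.natDegree = H.card :=
    (natDegree_eq_of_degree_eq (degree_add_eq_left_of_degree_lt hlt)).trans hXD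
  have hN0 : N ≠ 0 := by
    intro h
    rw [h, natDegree_zero] at hNd
    omega
  set u : RatFunc k := algebraMap k[X] (RatFunc k) N / algebraMap k[X] (RatFunc k) (kerD H) with hu
  have hDR : algebraMap k[X] (RatFunc k) (kerD H) ≠ 0 := RatFunc.algebraMap_ne_zero hD0
  have hDF : aeval (xx : W.FF) (kerD H) ≠ 0 := by
    rw [← io_algebraMap]
    exact fun h => hDR (io_injective (h.trans (map_zero _).symm))
  have hiou : (io u : W.FF) * aeval xx (kerD H) = aeval xx N := by
    rw [← io_algebraMap, ← io_algebraMap, ← map_mul, hu, div_mul_cancel₀ _ hDR]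
  have hsum : (io u : W.FF) = ∑ Q ∈ H, tau Q xx := by
    have e1 : (∑ Q ∈ H, tau Q xx : W.FF) = ∑ Q ∈ H, tau (-Q) xx := by
      refine Finset.sum_bij' (fun Q _ => -Q) (fun Q _ => -Q) hneg hneg ?_ ?_ ?_ <;>
        intros <;> simp only [neg_neg]
    have e2 : (2 : W.FF) * ((∑ Q ∈ H, tau Q xx) * aeval xx (kerD H)) = 2 * aeval xx N := by
      calc _ = (∑ Q ∈ H, (tau Q xx + tau (-Q) xx)) * aeval xx (kerD H) := by
            rw [Finset.sum_add_distrib, ← e1]; ring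
        _ = _ := by
            rw [← Finset.add_sum_erase _ _ h0, add_mul, Finset.sum_mul,
              Finset.sum_congr rfl fun Q hQ => (hM Q hQ).2, ← Finset.mul_sum, hN, neg_zero,
              tau_zero, map_add, map_mul, map_sum, aeval_X]
            ring
    have h2 : (2 : W.FF) ≠ 0 := (W.bc W.FF).two
    have e3 := mul_left_cancel₀ h2 e2
    rw [← hiou] at e3
    exact (mul_right_cancel₀ hDF e3).symm
  have hinv : ∀ P ∈ H, tau P (io u : W.FF) = io u := by
    intro P hP
    rw [hsum, map_sum]
    refine Finset.sum_bij' (fun Q _ => P + Q) (fun Q _ => -P + Q) (fun Q hQ => hadd _ hP _ hQ)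
      (fun Q hQ => hadd _ (hneg _ hP) _ hQ) ?_ ?_ ?_
    · intros; abel
    · intros; abel
    · intro Q _
      rw [tau_tau]
  have hcross : N * u.denom = u.num * kerD H := by
    have h1 : algebraMap k[X] (RatFunc k) u.num = u * algebraMap k[X] (RatFunc k) u.denom :=
      (div_eq_iff (RatFunc.algebraMap_ne_zero (RatFunc.denom_ne_zero u))).mp (RatFunc.num_div_denom u)
    apply RatFunc.algebraMap_injective k
    have h2 : u * algebraMap k[X] (RatFunc k) (kerD H) = algebraMap k[X] (RatFunc k) N := by
      rw [hu, div_mul_cancel₀ _ hDR]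
    rw [map_mul, map_mul, h1, ← h2]
    ring
  have hu0 : u.num ≠ 0 := by
    intro h
    rw [h, zero_mul] at hcross
    exact mul_ne_zero hN0 (RatFunc.denom_ne_zero u) hcross
  have hdd := congrArg natDegree hcross
  rw [natDegree_mul hN0 (RatFunc.denom_ne_zero u), natDegree_mul hu0 hD0] at hdd
  have hdle : u.denom.natDegree ≤ (kerD H).natDegree :=
    natDegree_le_of_dvd (RatFunc.denom_div_dvd N (kerD H)) hD0
  have hnc : u ∉ (algebraMap k (RatFunc k)).range := by
    rintro ⟨c, hc⟩
    have h1 : u.num.natDegree = 0 := by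
      rw [← hc]
      change (RatFunc.num (RatFunc.C c)).natDegree = 0
      rw [RatFunc.num_C, natDegree_C]
    omega
  have hht := card_le_of_invariant (W := W) hnc H hinv
  rw [ht, le_max_iff] at hht
  exact ⟨u, by omega, by omega, hinv⟩

end Velu

section Quotient

variable {k : Type} [Field k] [IsAlgClosed k] {W : ShortCurve k}

lemma ht_affine {a : k} (ha : a ≠ 0) (b : k) {u : RatFunc k}
    (hu : u ∉ (algebraMap k (RatFunc k)).range) :
    ht (algebraMap k (RatFunc k) a * u + algebraMap k (RatFunc k) b) = ht u := by
  obtain ⟨g, hg⟩ := exists_subst hu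
  have h1 : g (algebraMap k[X] (RatFunc k) (C a * X + C b) / algebraMap k[X] (RatFunc k) 1) =
      algebraMap k (RatFunc k) a * u + algebraMap k (RatFunc k) b := by
    rw [map_one, div_one, map_add, map_mul, RatFunc.algebraMap_X,
      show ∀ c : k, algebraMap k[X] (RatFunc k) (C c) = algebraMap k _ c from fun _ => rfl,
      show ∀ c : k, algebraMap k[X] (RatFunc k) (C c) = algebraMap k _ c from fun _ => rfl,
      map_add, map_mul, AlgHom.commutes, AlgHom.commutes, hg]
  rw [← h1, ht_comp, hg, ht_div one_ne_zero isCoprime_one_right, natDegree_linear ha]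
  simp

/-- A cubic equation satisfied by `w = v ^ 2 f` in terms of `u` defines an elliptic curve. -/
lemma exists_curve_of_cubic (h3 : (3 : k) ≠ 0) {u w : RatFunc k} {n : ℕ}
    (hN : u.num.natDegree = n + 1) (hD : u.denom.natDegree = n)
    (hchar : ∀ m : ℕ, 0 < m → m ≤ n + 1 → (m : k) ≠ 0)
    (h : w ∈ IntermediateField.adjoin k {u})
    (hw : w * algebraMap k[X] (RatFunc k) u.denom ^ 4 = algebraMap k[X] (RatFunc k)
      ((derivative u.num * u.denom - u.num * derivative u.denom) ^ 2 * W.fP)) :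
    ∃ (W1 : ShortCurve k) (a b : k), a ≠ 0 ∧
      algebraMap k (RatFunc k) a ^ 2 * w =
        (W1.bc (RatFunc k)).f (algebraMap k (RatFunc k) a * u + algebraMap k (RatFunc k) b) := by
  obtain ⟨p, hp, hwp, -⟩ := exists_cubic hN hD h hw
  obtain ⟨a, ha⟩ : ∃ a, a = p.coeff 3 := ⟨_, rfl⟩
  obtain ⟨b, hb⟩ : ∃ b, p.coeff 2 = 3 * b := ⟨p.coeff 2 / 3, by field_simp⟩
  obtain ⟨c, hc⟩ : ∃ c, c = p.coeff 1 := ⟨_, rfl⟩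
  obtain ⟨e, he⟩ : ∃ e, e = p.coeff 0 := ⟨_, rfl⟩
  have ha0 : a ≠ 0 := by
    rw [ha, ← hp]
    exact leadingCoeff_ne_zero.mpr (by rintro rfl; simp at hp)
  set ι := algebraMap k (RatFunc k) with hι
  have hw1 : w = ι a * u ^ 3 + 3 * ι b * u ^ 2 + ι c * u + ι e := by
    rw [hwp, aeval_eq_sum_range, hp]
    simp only [Finset.sum_range_succ, Finset.sum_range_zero, Algebra.smul_def, ← ha, hb, ← hc, ← he,
      map_mul, map_ofNat]
    ring
  set A1 := c * a - 3 * b ^ 2 with hA1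
  set B1 := e * a ^ 2 - b ^ 3 - A1 * b with hB1
  have hw2 : ι a ^ 2 * w = (ι a * u + ι b) ^ 3 + ι A1 * (ι a * u + ι b) + ι B1 := by
    rw [hw1, hB1, hA1]
    simp only [map_sub, map_mul, map_pow, map_ofNat]
    ring
  have h2 : (2 : k) ≠ 0 := W.two
  have hdisc : 4 * A1 ^ 3 + 27 * B1 ^ 2 ≠ 0 := by
    intro h0
    obtain ⟨r, hrA, hrB⟩ : ∃ r, A1 = -3 * r ^ 2 ∧ B1 = 2 * r ^ 3 := by
      by_cases hA0 : A1 = 0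
      · rw [hA0] at h0
        have h27 : (27 : k) ≠ 0 := by
          rw [show (27 : k) = 3 ^ 3 by norm_num]; exact pow_ne_zero 3 h3
        have : B1 = 0 := by simpa [h27] using h0
        exact ⟨0, by rw [hA0]; ring, by rw [this]; ring⟩
      · refine ⟨-(3 * B1) / (2 * A1), ?_, ?_⟩
        · field_simp
          linear_combination h0
        · field_simp
          linear_combination B1 * h0
    obtain ⟨ρ, hρ⟩ : ∃ ρ, r = a * ρ + b := ⟨(r - b) / a, by field_simp; ring⟩
    set N := u.num
    set D := u.denom
    have hDR : algebraMap k[X] (RatFunc k) D ≠ 0 :=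
      RatFunc.algebraMap_ne_zero (RatFunc.denom_ne_zero u)
    have hn : algebraMap k[X] (RatFunc k) N = u * algebraMap k[X] (RatFunc k) D :=
      (div_eq_iff hDR).mp (RatFunc.num_div_denom u)
    have hιa : ι a ≠ 0 := (map_ne_zero ι).mpr ha0
    have hw3 : w = (u - ι ρ) ^ 2 * (ι a * u + ι (b + 2 * r)) := by
      refine mul_left_cancel₀ (pow_ne_zero 2 hιa) ?_
      rw [hw2, hrA, hrB, hρ]
      simp only [map_add, map_mul, map_pow, map_neg, map_ofNat]
      ring
    have hMd : (N - C ρ * D).natDegree = n + 1 := by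
      rw [natDegree_sub_eq_left_of_natDegree_lt, hN]
      exact (natDegree_C_mul_le _ _).trans_lt (by omega)
    have hcop : IsCoprime (N - C ρ * D) D := by
      obtain ⟨x, y, hxy⟩ := RatFunc.isCoprime_num_denom u
      exact ⟨x, y + x * C ρ, by linear_combination hxy⟩
    refine no_double_root (W := W) (T := D * (C a * N + C (b + 2 * r) * D)) hMd hcop hchar ?_
    apply RatFunc.algebraMap_injective k
    have e1 : derivative (N - C ρ * D) * D - (N - C ρ * D) * derivative D =
        derivative N * D - N * derivative D := by
      simp only [derivative_sub, derivative_C_mul]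
      ring
    rw [e1, ← hw, hw3]
    simp only [map_mul, map_pow, map_sub, map_add, hn,
      show ∀ x : k, algebraMap k[X] (RatFunc k) (C x) = ι x from fun _ => rfl]
    ring
  exact ⟨⟨A1, B1, hdisc, h2⟩, a, b, ha0, hw2⟩

/-- The quotient of an elliptic curve by a finite subgroup. -/
lemma exists_quotient (h3 : (3 : k) ≠ 0) (H : Finset (W.P k)) (h0 : 0 ∈ H) (hneg : ∀ P ∈ H, -P ∈ H)
    (hadd : ∀ P ∈ H, ∀ Q ∈ H, P + Q ∈ H)
    (hchar : ∀ m : ℕ, 0 < m → m ≤ H.card → (m : k) ≠ 0) :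
    ∃ (W1 : ShortCurve k) (κ : W.P k →+ W1.P k) (φ : W1.P W.FF), Rep κ φ ∧ hp φ = H.card ∧
      ∀ P, κ P = 0 ↔ P ∈ H := by
  classical
  obtain ⟨u, hN, hD, hinv⟩ := exists_trace H h0 hneg hadd
  obtain ⟨n, hn⟩ : ∃ n, H.card = n + 1 := ⟨u.denom.natDegree, hD.symm⟩
  have hnc : u ∉ (algebraMap k (RatFunc k)).range := by
    rintro ⟨c, hc⟩
    have h1 : u.num.natDegree = 0 := by
      rw [← hc]
      change (RatFunc.num (RatFunc.C c)).natDegree = 0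
      rw [RatFunc.num_C, natDegree_C]
    omega
  have hht : ht u = H.card := by rw [ht]; omega
  set v : RatFunc k := algebraMap k[X] (RatFunc k)
    (derivative u.num * u.denom - u.num * derivative u.denom) /
      algebraMap k[X] (RatFunc k) u.denom ^ 2 with hv
  have hDR : algebraMap k[X] (RatFunc k) u.denom ≠ 0 :=
    RatFunc.algebraMap_ne_zero (RatFunc.denom_ne_zero u)
  have h2F : (2 : W.FF) ≠ 0 := (W.bc W.FF).two
  have hvinv : ∀ P ∈ H, tau P (io v * yy : W.FF) = io v * yy := by
    intro P hP
    have h1 := DD_map (tau P) (io u : W.FF)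
    rw [hinv P hP, pm_tau_gen, map_add, cF_gen, cF_incl, add_zero, one_mul, DD_io, ← hv, map_mul,
      map_mul, map_ofNat] at h1
    rw [map_mul]
    refine mul_left_cancel₀ h2F ?_
    linear_combination -h1
  set w : RatFunc k := v ^ 2 * W.fX with hwd
  have hiow : (io w : W.FF) = (io v * yy) ^ 2 := by
    rw [hwd, map_mul, map_pow, mul_pow, yy_sq]
  have hwinv : ∀ P ∈ H, tau P (io w : W.FF) = io w := by
    intro P hP
    rw [hiow, map_pow, hvinv P hP]
  have hmem := exists_eq_subst hnc H hinv (by rw [hht]) hwinv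
  obtain ⟨W1, a, b, ha, hW1⟩ := exists_curve_of_cubic (W := W) h3 (n := n) (by omega) (by omega)
    (fun m h1 h2 => hchar m h1 (by omega)) hmem (by
      rw [hwd, hv, fX_eq, map_mul, map_pow]
      field_simp)
  have hcurve : (io (algebraMap k (RatFunc k) a * v) * yy : W.FF) ^ 2 =
      (W1.bc W.FF).f (io (algebraMap k (RatFunc k) a * u + algebraMap k (RatFunc k) b)) := by
    have := congrArg (io (W := W)) hW1
    simp only [f, map_mul, map_pow, map_add, hiow] at this ⊢
    change _ = _ + io (algebraMap k (RatFunc k) W1.A) * _ + io (algebraMap k (RatFunc k) W1.B) at this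
    change _ = _ + algebraMap k W.FF W1.A * _ + algebraMap k W.FF W1.B
    simp only [AlgHom.commutes] at this ⊢
    linear_combination this
  set φ : W1.P W.FF := pt _ _ hcurve with hφ
  have hφ0 : φ ≠ 0 := pt_ne_zero hcurve
  have hpx : px φ = io (algebraMap k (RatFunc k) a * u + algebraMap k (RatFunc k) b) := px_pt hcurve
  have hpy : py φ = io (algebraMap k (RatFunc k) a * v) * yy := py_pt hcurve
  obtain ⟨κ, hκ⟩ := exists_rep_of_odd (φ := φ) (pm_unique hφ0 (neg_ne_zero.mpr hφ0)
    (by rw [px_neg, hpx, conj_io]) (by rw [py_neg, hpy, map_mul, conj_io, conj_yy, mul_neg]))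
  have hker : ∀ P ∈ H, κ P = 0 := by
    intro P hP
    have h1 : pm (tau P) φ = φ := by
      refine pm_unique hφ0 hφ0 ?_ ?_
      · rw [hpx]
        simp only [map_add, map_mul, AlgHom.commutes, hinv P hP]
      · have := hvinv P hP
        rw [map_mul] at this
        rw [hpy]
        simp only [map_mul, AlgHom.commutes, mul_assoc]
        rw [this]
    rw [hκ.2 P] at h1
    exact incl_injective ((add_eq_left.mp h1).trans (map_zero _).symm)
  have hκ0 : κ ≠ 0 := by
    rintro rfl
    refine hnc ?_
    have := hκ.const
    rw [hpx] at this
    obtain ⟨c, hc⟩ := const_io.mp this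
    refine ⟨(c - b) / a, ?_⟩
    have ha' : algebraMap k (RatFunc k) a ≠ 0 := (_root_.map_ne_zero _).mpr ha
    rw [map_div₀, map_sub, hc]
    field_simp
    ring
  have hhp : hp φ = H.card := by
    rw [hp_of hpx, ← hht]
    exact ht_affine ha b hnc
  refine ⟨W1, κ, φ, hκ, hhp, fun P => ⟨fun hP => ?_, hker P⟩⟩
  by_contra hPH
  have := hκ.card_ker_le_hp hκ0 (insert P H) (by
    intro Q hQ
    rcases Finset.mem_insert.mp hQ with rfl | hQ
    · exact hP
    · exact hker Q hQ)
  rw [Finset.card_insert_of_notMem hPH] at this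
  omega

end Quotient

section Subgroups

/-- A finite set which is a subgroup. -/
def IsSub {G : Type} [AddCommGroup G] (H : Finset G) : Prop :=
  0 ∈ H ∧ (∀ P ∈ H, -P ∈ H) ∧ ∀ P ∈ H, ∀ Q ∈ H, P + Q ∈ H

variable {G G' : Type} [AddCommGroup G] [AddCommGroup G']

lemma IsSub.card_dvd {H T : Finset G} (h : IsSub H) (h' : IsSub T) (hle : H ⊆ T) :
    H.card ∣ T.card := by
  let H1 : AddSubgroup G := ⟨⟨⟨(H : Set G), fun {a b} ha hb => h.2.2 a ha b hb⟩, h.1⟩, fun {a} ha => h.2.1 a ha⟩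
  let T1 : AddSubgroup G := ⟨⟨⟨(T : Set G), fun {a b} ha hb => h'.2.2 a ha b hb⟩, h'.1⟩, fun {a} ha => h'.2.1 a ha⟩
  have : H1 ≤ T1 := fun x hx => hle hx
  have h1 := AddSubgroup.card_dvd_of_le this
  have e1 : Nat.card H1 = H.card :=
    (Nat.card_coe_set_eq (H : Set G)).trans (Set.ncard_coe_finset H)
  have e2 : Nat.card T1 = T.card :=
    (Nat.card_coe_set_eq (T : Set G)).trans (Set.ncard_coe_finset T)
  rwa [e1, e2] at h1

lemma IsSub.image [DecidableEq G'] {H : Finset G} (h : IsSub H) (f : G →+ G') : IsSub (H.image f) := by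
  refine ⟨Finset.mem_image.mpr ⟨0, h.1, map_zero f⟩, ?_, ?_⟩
  · intro P hP
    obtain ⟨Q, hQ, rfl⟩ := Finset.mem_image.mp hP
    exact Finset.mem_image.mpr ⟨-Q, h.2.1 Q hQ, map_neg f Q⟩
  · intro P hP P' hP'
    obtain ⟨Q, hQ, rfl⟩ := Finset.mem_image.mp hP
    obtain ⟨Q', hQ', rfl⟩ := Finset.mem_image.mp hP'
    exact Finset.mem_image.mpr ⟨Q + Q', h.2.2 Q hQ Q' hQ', map_add f Q Q'⟩

lemma IsSub.inter [DecidableEq G] {H H' : Finset G} (h : IsSub H) (h' : IsSub H') : IsSub (H ∩ H') := by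
  simp only [IsSub, Finset.mem_inter]
  exact ⟨⟨h.1, h'.1⟩, fun P hP => ⟨h.2.1 P hP.1, h'.2.1 P hP.2⟩,
    fun P hP Q hQ => ⟨h.2.2 P hP.1 Q hQ.1, h'.2.2 P hP.2 Q hQ.2⟩⟩

/-- The kernel and the image of a homomorphism on a finite subgroup. -/
lemma IsSub.card_image_mul [DecidableEq G] [DecidableEq G'] {T : Finset G} (h : IsSub T) (f : G →+ G') :
    (T.image f).card * (T.filter fun P => f P = 0).card = T.card := by
  rw [Finset.card_eq_sum_card_image f T, ← smul_eq_mul, ← Finset.sum_const]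
  refine Finset.sum_congr rfl fun Q hQ => ?_
  obtain ⟨P, hP, rfl⟩ := Finset.mem_image.mp hQ
  refine Finset.card_bij' (fun R _ => P + R) (fun R _ => -P + R) ?_ ?_ ?_ ?_
  · intro R hR
    rw [Finset.mem_filter] at hR ⊢
    exact ⟨h.2.2 _ hP _ hR.1, by rw [map_add, hR.2, add_zero]⟩
  · intro R hR
    rw [Finset.mem_filter] at hR ⊢
    exact ⟨h.2.2 _ (h.2.1 _ hP) _ hR.1, by rw [map_add, hR.2, map_neg, neg_add_cancel]⟩
  · intros; abel
  · intros; abel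

lemma card_subgroups_le {ℓ : ℕ} (hℓ : ℓ.Prime) {T : Finset G} (hT : IsSub T) (hTc : T.card = ℓ ^ 2)
    (𝓗 : Finset (Finset G)) (h𝓗 : ∀ H ∈ 𝓗, IsSub H ∧ H ⊆ T) : 𝓗.card ≤ ℓ + 3 := by
  classical
  set 𝓗' := 𝓗.filter fun H => H.card = ℓ with h𝓗'
  have hsub : 𝓗 ⊆ insert {0} (insert T 𝓗') := by
    intro H hH
    obtain ⟨h1, h2⟩ := h𝓗 H hH
    have hd := h1.card_dvd hT h2
    rw [hTc] at hd
    obtain ⟨i, hi, hc⟩ := (Nat.dvd_prime_pow hℓ).mp hd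
    rw [Finset.mem_insert, Finset.mem_insert]
    interval_cases i
    · left
      exact (Finset.eq_of_subset_of_card_le (Finset.singleton_subset_iff.mpr h1.1) (by simp [hc])).symm
    · right; right
      exact Finset.mem_filter.mpr ⟨hH, by rw [hc, pow_one]⟩
    · right; left
      exact Finset.eq_of_subset_of_card_le h2 (by rw [hc, hTc])
  have hcard : ∀ H ∈ 𝓗', H.card = ℓ := fun H hH => (Finset.mem_filter.mp hH).2
  have hsubT : ∀ H ∈ 𝓗', IsSub H ∧ H ⊆ T := fun H hH => h𝓗 H (Finset.mem_filter.mp hH).1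
  have hdisj : ((𝓗' : Finset (Finset G)) : Set (Finset G)).PairwiseDisjoint fun H => H.erase 0 := by
    intro H hH H' hH' hne
    rw [Function.onFun, Finset.disjoint_left]
    intro x hx hx'
    rw [Finset.mem_erase] at hx hx'
    have hi := (hsubT H hH).1.inter (hsubT H' hH').1
    have hd := hi.card_dvd (hsubT H hH).1 Finset.inter_subset_left
    rw [hcard H hH] at hd
    rcases (Nat.dvd_prime hℓ).mp hd with h1 | h1
    · obtain ⟨y, hy⟩ := Finset.card_eq_one.mp h1
      have e1 : x = y := Finset.mem_singleton.mp (hy ▸ Finset.mem_inter.mpr ⟨hx.2, hx'.2⟩)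
      have e2 : 0 = y := Finset.mem_singleton.mp (hy ▸ hi.1)
      exact hx.1 (e1.trans e2.symm)
    · refine hne ?_
      rw [← Finset.eq_of_subset_of_card_le (Finset.inter_subset_left (s₁ := H) (s₂ := H'))
        (by rw [h1, hcard H hH])]
      exact Finset.eq_of_subset_of_card_le (Finset.inter_subset_right) (by rw [h1, hcard H' hH'])
  have hle : 𝓗'.card * (ℓ - 1) ≤ ℓ ^ 2 - 1 := by
    rw [← smul_eq_mul, ← Finset.sum_const]
    calc ∑ H ∈ 𝓗', (ℓ - 1) = ∑ H ∈ 𝓗', (H.erase 0).card := by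
          refine Finset.sum_congr rfl fun H hH => ?_
          rw [Finset.card_erase_of_mem (hsubT H hH).1.1, hcard H hH]
      _ = (𝓗'.biUnion fun H => H.erase 0).card := (Finset.card_biUnion hdisj).symm
      _ ≤ (T.erase 0).card := by
          refine Finset.card_le_card (Finset.biUnion_subset.mpr fun H hH => ?_)
          exact Finset.erase_subset_erase 0 (hsubT H hH).2
      _ = ℓ ^ 2 - 1 := by rw [Finset.card_erase_of_mem hT.1, hTc]
  have h2 := hℓ.two_le
  have hc' : 𝓗'.card ≤ ℓ + 1 := by
    obtain ⟨m, rfl⟩ : ∃ m, ℓ = m + 1 := ⟨ℓ - 1, by omega⟩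
    have : (m + 1) ^ 2 - 1 = (m + 1 + 1) * m := by
      rw [show (m + 1) ^ 2 = (m + 1 + 1) * m + 1 by ring, Nat.add_sub_cancel]
    rw [this, Nat.add_sub_cancel] at hle
    exact Nat.le_of_mul_le_mul_right hle (by omega)
  have := (Finset.card_le_card hsub).trans (Finset.card_insert_le _ _)
  have h3 := Finset.card_insert_le T 𝓗'
  omega

end Subgroups

section Descent

variable {k : Type} [Field k] [IsAlgClosed k] {W W' W'' W0 : ShortCurve k}

lemma Rep.hp_unique {α : W.P k →+ W'.P k} {φ φ'} (h : Rep α φ) (h' : Rep α φ') : hp φ = hp φ' := by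
  have h0 := h.sub h'
  rw [sub_self] at h0
  obtain ⟨Q, hQ⟩ := exists_incl_eq h0.const
  have hQQ : Q + Q = 0 := by
    have h1 := h0.1
    rw [← hQ, pm_incl, eq_neg_iff_add_eq_zero, ← map_add] at h1
    exact incl_injective (h1.trans (map_zero _).symm)
  rw [show φ = φ' + W'.incl W.FF Q by rw [hQ]; abel]
  exact hp_add_two_torsion h'.1 hQQ

/-- A quotient of an elliptic curve by a finite set of points. -/
def IsQuot (κ : W.P k →+ W'.P k) (H : Finset (W.P k)) : Prop :=
  IsAlg κ ∧ κ ≠ 0 ∧ (∀ P ∈ H, κ P = 0) ∧ ∀ (W'' : ShortCurve k) (β : W.P k →+ W''.P k), IsAlg β →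
    (∀ P ∈ H, β P = 0) → ∃ β1 : W'.P k →+ W''.P k, IsAlg β1 ∧ β1.comp κ = β

lemma Rep.isQuot {κ : W.P k →+ W'.P k} {φ} (h : Rep κ φ) (hκ : κ ≠ 0) {H : Finset (W.P k)}
    (hH : ∀ P ∈ H, κ P = 0) (hcard : hp φ ≤ H.card) : IsQuot κ H :=
  ⟨⟨φ, h⟩, hκ, hH, fun _ _ hβ hβS => IsAlg.factor h hκ H hH hcard hβ hβS⟩

lemma IsAlg.eq_of_comp_eq {κ : W.P k →+ W'.P k} (hκ : IsAlg κ) (hκ0 : κ ≠ 0)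
    {β β' : W'.P k →+ W''.P k} (h : IsAlg β) (h' : IsAlg β') (he : β.comp κ = β'.comp κ) : β = β' := by
  by_contra hne
  refine (h.sub h').comp_ne_zero hκ (sub_ne_zero.mpr hne) hκ0 ?_
  ext1 P
  have := DFunLike.congr_fun he P
  simpa [sub_eq_zero] using this

lemma IsAlg.eq_of_zsmul_eq {n : ℤ} (hn : (n : k) ≠ 0) {β β' : W.P k →+ W'.P k} (h : IsAlg β)
    (h' : IsAlg β') (he : ∀ P, n • β P = n • β' P) : β = β' := by
  by_contra hne
  refine (IsAlg.id.zsmul n).comp_ne_zero (h.sub h') (zsmul_id_ne_zero n hn) (sub_ne_zero.mpr hne) ?_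
  ext1 P
  have := he P
  simp only [AddMonoidHom.comp_apply, AddMonoidHom.sub_apply, AddMonoidHom.zero_apply, map_sub,
    AddMonoidHom.smul_apply, AddMonoidHom.id_apply]
  rw [this, sub_self]

lemma IsQuot.jinv_eq (h3 : (3 : k) ≠ 0) {κ : W.P k →+ W'.P k} {κ' : W.P k →+ W''.P k}
    {H : Finset (W.P k)} (h : IsQuot κ H) (h' : IsQuot κ' H) : jinv W' = jinv W'' := by
  obtain ⟨β, hβ, e⟩ := h.2.2.2 _ _ h'.1 h'.2.2.1
  obtain ⟨β', hβ', e'⟩ := h'.2.2.2 _ _ h.1 h.2.2.1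
  refine hβ.jinv_eq hβ' (h.1.eq_of_comp_eq h.2.1 (hβ'.comp hβ) IsAlg.id ?_) h3
  rw [AddMonoidHom.comp_assoc, e, e', AddMonoidHom.id_comp]

lemma IsQuot.comp_iso [DecidableEq (W0.P k)] {κ : W.P k →+ W'.P k} {H : Finset (W.P k)}
    (h : IsQuot κ H) {ι : W0.P k →+ W.P k} {ι' : W.P k →+ W0.P k} (hι : IsAlg ι) (hι' : IsAlg ι')
    (e : ι.comp ι' = AddMonoidHom.id _) (e' : ι'.comp ι = AddMonoidHom.id _) :
    IsQuot (κ.comp ι) (H.image ι') := by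
  have e1 : ∀ P, ι (ι' P) = P := fun P => DFunLike.congr_fun e P
  refine ⟨h.1.comp hι, ?_, ?_, ?_⟩
  · intro h0
    refine h.2.1 ?_
    rw [← AddMonoidHom.comp_id κ, ← e, ← AddMonoidHom.comp_assoc, h0, AddMonoidHom.zero_comp]
  · intro P hP
    obtain ⟨Q, hQ, rfl⟩ := Finset.mem_image.mp hP
    rw [AddMonoidHom.comp_apply, e1, h.2.2.1 Q hQ]
  · intro W2 β hβ hβH
    obtain ⟨β1, h1, h2⟩ := h.2.2.2 W2 (β.comp ι') (hβ.comp hι') fun P hP =>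
      hβH _ (Finset.mem_image_of_mem _ hP)
    refine ⟨β1, h1, ?_⟩
    rw [← AddMonoidHom.comp_assoc, h2, AddMonoidHom.comp_assoc, e', AddMonoidHom.comp_id]

variable (W) in
/-- The full `n`-torsion subgroup. -/
lemma exists_full_torsion {n : ℕ} (hn : ((n : ℤ) : k) ≠ 0) : ∃ T : Finset (W.P k),
    IsSub T ∧ T.card = n ^ 2 ∧ ∀ P, P ∈ T ↔ (n : ℤ) • P = 0 := by
  classical
  obtain ⟨T, hT, hc⟩ := exists_torsion (W := W) n hn
  have key : ∀ P, P ∈ T ↔ (n : ℤ) • P = 0 := by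
    refine fun P => ⟨hT P, fun hP => ?_⟩
    by_contra hPT
    have := card_torsion_le (W := W) n hn (insert P T) (by
      intro Q hQ
      rcases Finset.mem_insert.mp hQ with rfl | hQ
      · exact hP
      · exact hT Q hQ)
    rw [Finset.card_insert_of_notMem hPT] at this
    omega
  refine ⟨T, ⟨(key _).mpr (smul_zero _), ?_, ?_⟩, by simpa using hc, key⟩
  · intro P hP
    rw [key] at hP ⊢
    rw [smul_neg, hP, neg_zero]
  · intro P hP Q hQ
    rw [key] at hP hQ ⊢
    rw [smul_add, hP, hQ, zero_add]

/-- Descent of an endomorphism along an isogeny whose degree divides its conductor. -/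
theorem exists_descent (h3 : (3 : k) ≠ 0) {ℓ : ℕ} (hℓ : 0 < ℓ)
    (hchar : ∀ m : ℕ, 0 < m → m ≤ ℓ → (m : k) ≠ 0) {d r : ℤ} {α : W.P k →+ W.P k} (hα : IsAlg α)
    (hαα : ∀ P, α (α P) = (d * (ℓ * r) ^ 2) • P) :
    ∃ (W1 : ShortCurve k) (α1 : W1.P k →+ W1.P k) (κ : W1.P k →+ W.P k) (H : Finset (W1.P k)),
      IsAlg α1 ∧ (∀ P, α1 (α1 P) = (d * r ^ 2) • P) ∧ IsSub H ∧ (∀ P ∈ H, (ℓ : ℤ) • P = 0) ∧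
        IsQuot κ H := by
  classical
  have hℓk : ((ℓ : ℤ) : k) ≠ 0 := by
    rw [Int.cast_natCast]; exact hchar ℓ hℓ le_rfl
  obtain ⟨T, hTs, hTc, hT⟩ := exists_full_torsion W hℓk
  set H := T.image α with hH
  have hHs : IsSub H := hTs.image α
  have hαT : ∀ P ∈ T, α (α P) = 0 := by
    intro P hP
    rw [hαα, show d * (ℓ * r) ^ 2 = d * ℓ * r ^ 2 * ℓ by ring, mul_smul, (hT P).mp hP, smul_zero]
  have hHT : ∀ P ∈ H, (ℓ : ℤ) • P = 0 := by
    intro P hP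
    obtain ⟨Q, hQ, rfl⟩ := Finset.mem_image.mp hP
    rw [← map_zsmul, (hT Q).mp hQ, map_zero]
  have hHle : H.card ≤ ℓ := by
    have h1 := hTs.card_image_mul α
    have h2 : H.card ≤ (T.filter fun P => α P = 0).card := by
      refine Finset.card_le_card fun P hP => Finset.mem_filter.mpr ⟨(hT P).mpr (hHT P hP), ?_⟩
      obtain ⟨Q, hQ, rfl⟩ := Finset.mem_image.mp hP
      exact hαT Q hQ
    rw [hTc] at h1
    have h4 : H.card * H.card ≤ ℓ ^ 2 := (Nat.mul_le_mul_left _ h2).trans h1.le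
    rw [← sq] at h4
    exact (Nat.pow_le_pow_iff_left two_ne_zero).mp h4
  obtain ⟨W1, κ, φ, hκ, hhp, hker⟩ := exists_quotient h3 H hHs.1 hHs.2.1 hHs.2.2
    fun m h1 h2 => hchar m h1 (h2.trans hHle)
  have hκ0 : κ ≠ 0 := by
    rintro rfl
    have := hp_const hκ.const
    have h5 := Finset.card_pos.mpr ⟨0, hHs.1⟩
    omega
  have hκq : IsQuot κ H := hκ.isQuot hκ0 (fun P hP => (hker P).mpr hP) hhp.le
  have hκa : IsAlg κ := ⟨φ, hκ⟩
  -- the induced endomorphism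
  obtain ⟨κ', hκ', hκ'e⟩ := IsAlg.exists_zsmul hℓk (hκa.comp hα) (fun P hP =>
    (hker _).mpr (Finset.mem_image_of_mem α ((hT P).mpr hP)))
  have hκ'e : ∀ P, (ℓ : ℤ) • κ' P = κ (α P) := fun P => DFunLike.congr_fun hκ'e P
  have hκ'α : κ'.comp α = (d * ℓ * r ^ 2) • κ := by
    refine (hκ'.comp hα).eq_of_zsmul_eq hℓk (hκa.zsmul _) fun P => ?_
    rw [AddMonoidHom.comp_apply, hκ'e, hαα, map_zsmul, AddMonoidHom.smul_apply, smul_smul]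
    congr 1; ring
  obtain ⟨α1, hα1, hα1e⟩ := hκq.2.2.2 _ κ' hκ' (by
    intro P hP
    obtain ⟨Q, hQ, rfl⟩ := Finset.mem_image.mp hP
    have := DFunLike.congr_fun hκ'α Q
    rw [AddMonoidHom.comp_apply] at this
    rw [this, AddMonoidHom.smul_apply, ← map_zsmul, show d * ℓ * r ^ 2 = d * r ^ 2 * ℓ by ring,
      mul_smul, (hT Q).mp hQ, smul_zero, map_zero])
  have hα1e : ∀ P, α1 (κ P) = κ' P := fun P => DFunLike.congr_fun hα1e P
  have hα1α1 : α1.comp α1 = (d * r ^ 2) • AddMonoidHom.id _ := by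
    refine hκa.eq_of_comp_eq hκ0 (hα1.comp hα1) (IsAlg.id.zsmul _) ?_
    refine IsAlg.eq_of_zsmul_eq hℓk ((hα1.comp hα1).comp hκa) ((IsAlg.id.zsmul _).comp hκa) fun P => ?_
    have := DFunLike.congr_fun hκ'α P
    simp only [AddMonoidHom.comp_apply, AddMonoidHom.smul_apply, AddMonoidHom.id_apply] at this ⊢
    rw [← map_zsmul, hα1e, hκ'e, hα1e, this, smul_smul]
    congr 1; ring
  -- the dual isogeny
  obtain ⟨δ, hδ, hδe⟩ := hκq.2.2.2 _ _ (IsAlg.id.zsmul (ℓ : ℤ)) (fun P hP => hHT P hP)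
  have hδ0 : δ ≠ 0 := by
    rintro rfl
    rw [AddMonoidHom.zero_comp] at hδe
    exact zsmul_id_ne_zero (W := W) _ hℓk hδe.symm
  have hδe' : ∀ P, δ (κ P) = (ℓ : ℤ) • P := fun P => DFunLike.congr_fun hδe P
  obtain ⟨ψ, hψ⟩ := hδ
  obtain ⟨g, hg, hgc, hgt⟩ := hκ.exists_hom hκ0
  have hcomp := hκ.comp hψ hg
  rw [hδe] at hcomp
  obtain ⟨u, hu⟩ := hκ.px_eq
  have hdeg := hp_pm hg hu hψ.1
  rw [hcomp.hp_unique (Rep.id.zsmul (ℓ : ℤ)), hp_zsmul pm_conj_gen, hp_gen, mul_one, hhp,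
    Int.natAbs_natCast] at hdeg
  have hcard := hTs.card_image_mul κ
  rw [hTc, hdeg] at hcard
  have hfil : (T.filter fun P => κ P = 0) = H := by
    ext P
    rw [Finset.mem_filter, hker, hT]
    exact ⟨fun h => h.2, fun h => ⟨hHT P h, h⟩⟩
  rw [hfil] at hcard
  have hcard' := Nat.eq_of_mul_eq_mul_right (Finset.card_pos.mpr ⟨0, hHs.1⟩) hcard
  refine ⟨W1, α1, δ, T.image κ, hα1, fun P => DFunLike.congr_fun hα1α1 P, hTs.image κ, ?_,
    hψ.isQuot hδ0 ?_ hcard'.ge⟩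
  · intro P hP
    obtain ⟨Q, hQ, rfl⟩ := Finset.mem_image.mp hP
    rw [← map_zsmul, (hT Q).mp hQ, map_zero]
  · intro P hP
    obtain ⟨Q, hQ, rfl⟩ := Finset.mem_image.mp hP
    rw [hδe', (hT Q).mp hQ]

end Descent

section Counting

variable {k : Type} [Field k] [IsAlgClosed k]

variable (k) in
/-- The invariants of the curves with an algebraic endomorphism of square `d r²`. -/
def cmSet (d r : ℤ) : Set k :=
  {j | ∃ (W : ShortCurve k) (α : W.P k →+ W.P k), IsAlg α ∧ (∀ P, α (α P) = (d * r ^ 2) • P) ∧ jinv W = j}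

lemma card_cmSet_mul (h3 : (3 : k) ≠ 0) {ℓ : ℕ} (hℓ : ℓ.Prime)
    (hchar : ∀ m : ℕ, 0 < m → m ≤ ℓ → (m : k) ≠ 0) {d r : ℤ} {N : ℕ}
    (hN : ∀ J : Finset k, (∀ j ∈ J, j ∈ cmSet k d r) → J.card ≤ N) (J : Finset k)
    (hJ : ∀ j ∈ J, j ∈ cmSet k d (ℓ * r)) : J.card ≤ (ℓ + 3) * N := by
  classical
  have hℓk : ((ℓ : ℤ) : k) ≠ 0 := by
    rw [Int.cast_natCast]; exact hchar ℓ hℓ.pos le_rfl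
  have hdata : ∀ j : J, ∃ (W W1 : ShortCurve k) (α1 : W1.P k →+ W1.P k) (κ : W1.P k →+ W.P k)
      (H : Finset (W1.P k)), jinv W = j ∧ IsAlg α1 ∧ (∀ P, α1 (α1 P) = (d * r ^ 2) • P) ∧ IsSub H ∧
        (∀ P ∈ H, (ℓ : ℤ) • P = 0) ∧ IsQuot κ H := by
    rintro ⟨j, hj⟩
    obtain ⟨W, α, hα, hαα, hjW⟩ := hJ j hj
    obtain ⟨W1, α1, κ, H, h⟩ := exists_descent h3 hℓ.pos hchar hα hαα
    exact ⟨W, W1, α1, κ, H, hjW, h⟩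
  choose W W1 α1 κ H hjW hα1 hα1α1 hHs hHℓ hκ using hdata
  have h1 : ((J.attach.image fun j => jinv (W1 j)).card) ≤ N := by
    refine hN _ fun j hj => ?_
    obtain ⟨i, -, rfl⟩ := Finset.mem_image.mp hj
    exact ⟨W1 i, α1 i, hα1 i, hα1α1 i, rfl⟩
  have h2 : J.attach.card ≤ (ℓ + 3) * (J.attach.image fun j => jinv (W1 j)).card := by
    refine Finset.card_le_mul_card_image _ _ fun j1 hj1 => ?_
    obtain ⟨i, -, hi⟩ := Finset.mem_image.mp hj1
    obtain ⟨T, hTs, hTc, hT⟩ := exists_full_torsion (W1 i) hℓk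
    have hiso : ∀ j : J, ∃ (ι : (W1 i).P k →+ (W1 j).P k) (ι' : (W1 j).P k →+ (W1 i).P k),
        jinv (W1 j) = j1 → IsAlg ι ∧ IsAlg ι' ∧ ι'.comp ι = AddMonoidHom.id _ ∧
          ι.comp ι' = AddMonoidHom.id _ := by
      intro j
      by_cases hj : jinv (W1 j) = j1
      · obtain ⟨s, hs, hA, hB⟩ := exists_scale_of_jinv h3 (hi.trans hj.symm)
        obtain ⟨ι, ι', h⟩ := exists_iso_of_scale hs hA hB
        exact ⟨ι, ι', fun _ => h⟩
      · exact ⟨0, 0, fun h => absurd h hj⟩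
    choose ι ι' hιι using hiso
    have hinj : Set.InjOn (fun j => (H j).image (ι' j))
        ((J.attach.filter fun j => jinv (W1 j) = j1 : Finset J) : Set J) := by
      intro j hj j' hj' he
      rw [Finset.mem_coe, Finset.mem_filter] at hj hj'
      obtain ⟨e1, e2, e3, e4⟩ := hιι j hj.2
      obtain ⟨e1', e2', e3', e4'⟩ := hιι j' hj'.2
      have q := (hκ j).comp_iso e1 e2 e4 e3
      have q' := (hκ j').comp_iso e1' e2' e4' e3'
      simp only at he
      rw [← he] at q'
      have := q.jinv_eq h3 q'
      rw [hjW, hjW] at this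
      exact Subtype.ext this
    rw [← Finset.card_image_of_injOn hinj]
    refine card_subgroups_le hℓ hTs hTc _ fun S hS => ?_
    obtain ⟨j, -, rfl⟩ := Finset.mem_image.mp hS
    refine ⟨(hHs j).image _, fun P hP => ?_⟩
    obtain ⟨Q, hQ, rfl⟩ := Finset.mem_image.mp hP
    rw [hT, ← map_zsmul, hHℓ j Q hQ, map_zero]
  rw [Finset.card_attach] at h2
  exact h2.trans (Nat.mul_le_mul_left _ h1)

end Counting

/-- The completely multiplicative function with value `ℓ + 3` at a prime `ℓ`. -/
def growth (r : ℕ) : ℕ := (r.primeFactorsList.map (· + 3)).prod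

lemma growth_mul {a b : ℕ} (ha : a ≠ 0) (hb : b ≠ 0) : growth (a * b) = growth a * growth b := by
  rw [growth, growth, growth, ← List.prod_append, ← List.map_append]
  exact ((Nat.perm_primeFactorsList_mul ha hb).map _).prod_eq

lemma growth_prime {ℓ : ℕ} (hℓ : ℓ.Prime) : growth ℓ = ℓ + 3 := by
  rw [growth, Nat.primeFactorsList_prime hℓ]; simp

lemma growth_one : growth 1 = 1 := by simp [growth]

lemma card_cmSet_le {k : Type} [Field k] [IsAlgClosed k] (h3 : (3 : k) ≠ 0) {d : ℤ} {N : ℕ}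
    (hN : ∀ J : Finset k, (∀ j ∈ J, j ∈ cmSet k d 1) → J.card ≤ N) (r : ℕ) (hr : r ≠ 0)
    (hchar : ∀ m : ℕ, 0 < m → m ≤ r → (m : k) ≠ 0) (J : Finset k)
    (hJ : ∀ j ∈ J, j ∈ cmSet k d r) : J.card ≤ growth r * N := by
  induction r using induction_on_primes generalizing J with
  | zero => exact absurd rfl hr
  | one =>
    rw [growth_one, one_mul]
    exact hN J (by simpa using hJ)
  | prime_mul ℓ a hℓ ih =>
    have ha : a ≠ 0 := by rintro rfl; simp at hr
    rw [growth_mul hℓ.ne_zero ha, growth_prime hℓ, mul_assoc]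
    refine card_cmSet_mul h3 hℓ (fun m h1 h2 => hchar m h1 (h2.trans
      (Nat.le_mul_of_pos_right _ (Nat.pos_of_ne_zero ha)))) (r := a) (d := d) (fun J' hJ' =>
      ih ha (fun m h1 h2 => hchar m h1 (h2.trans (Nat.le_mul_of_pos_left _ hℓ.pos))) J' hJ') J ?_
    intro j hj
    have := hJ j hj
    rwa [Nat.cast_mul] at this

theorem exists_factor_at {k : Type} [Field k] (s : k) {R : k[X]} (hR : R ≠ 0) :
    ∃ (a : ℕ) (R1 : k[X]), a ≤ R.natDegree ∧ R = (X - C s) ^ a * R1 ∧ R1.eval s ≠ 0 ∧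
      (X - C s) * derivative R = (X - C s) ^ a * (C (a : k) * R1 + (X - C s) * derivative R1) := by
  obtain ⟨R1, h1, h2⟩ := exists_eq_pow_rootMultiplicity_mul_and_not_dvd R hR s
  set a := rootMultiplicity s R with ha
  have h3 : R1 ≠ 0 := by
    rintro rfl
    exact h2 (dvd_zero _)
  refine ⟨a, R1, ?_, h1, ?_, ?_⟩
  · rw [h1, natDegree_mul (pow_ne_zero _ (X_sub_C_ne_zero s)) h3, natDegree_pow,
      natDegree_X_sub_C]
    omega
  · intro h
    exact h2 (dvd_iff_isRoot.mpr h)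
  · rw [h1, derivative_mul, derivative_X_sub_C_pow]
    rcases Nat.eq_zero_or_pos a with h | h
    · rw [h]
      simp
    · obtain ⟨b, hb⟩ : ∃ b, a = b + 1 := ⟨a - 1, by omega⟩
      rw [hb, Nat.add_sub_cancel, C_eq_natCast]
      ring

/-- The multiplicative group version of the isogeny differential equation forces the multiplier
to be an integer. -/
theorem exists_nat_sq_of_nodal {k : Type} [Field k] [IsAlgClosed k] (h2 : (2 : k) ≠ 0)
    (h3 : (3 : k) ≠ 0) {c : k} (hc : c ≠ 0) {m : ℕ} {N D : k[X]} (hN : N.natDegree ≤ m)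
    (hD : D.natDegree ≤ m) (hD0 : D ≠ 0) (h1 : N ≠ D) (hn2 : N + 2 * D ≠ 0)
    (h : (derivative N * D - N * derivative D) ^ 2 * ((X - 1) ^ 2 * (X + 2))
      = C c * (D * ((N - D) ^ 2 * (N + 2 * D)))) :
    ∃ e : ℕ, e ≤ 2 * m ∧ c = (e : k) ^ 2 := by
  obtain ⟨γ, hγ⟩ := IsAlgClosed.exists_pow_nat_eq c (n := 2) (by norm_num)
  obtain ⟨s, hs⟩ := IsAlgClosed.exists_pow_nat_eq (3 : k) (n := 2) (by norm_num)
  have hs0 : s ≠ 0 := by rintro rfl; apply h3; rw [← hs]; ring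
  have hγ0 : γ ≠ 0 := by rintro rfl; apply hc; rw [← hγ]; ring
  set v : k[X] := X ^ 2 - C 2 with hv
  have hvd : v.natDegree = 2 := natDegree_X_pow_sub_C
  have hinj : ∀ p : k[X], p.comp v = 0 → p = 0 := by
    intro p hp
    rcases comp_eq_zero_iff.mp hp with h | h
    · exact h
    · exfalso
      have := congrArg natDegree h.2
      rw [hvd, natDegree_C] at this
      omega
  have hvd' : derivative v = C 2 * X := by
    rw [hv, derivative_sub, derivative_C, derivative_X_pow, sub_zero]
    norm_num
  set n := N.comp v with hn
  set Q := D.comp v with hQ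
  have hQ0 : Q ≠ 0 := fun e => hD0 (hinj _ e)
  have hnQ : n - Q ≠ 0 := by
    intro e
    rw [hn, hQ, ← sub_comp] at e
    exact h1 (sub_eq_zero.mp (hinj _ e))
  have hM0 : n + 2 * Q ≠ 0 := by
    intro e
    apply hn2
    apply hinj
    rw [add_comp, mul_comp, ofNat_comp]
    exact e
  have hdn : derivative n = (C 2 * X) * (derivative N).comp v := by
    rw [hn, derivative_comp, hvd']
  have hdQ : derivative Q = (C 2 * X) * (derivative D).comp v := by
    rw [hQ, derivative_comp, hvd']
  have hC2 : (C 2 : k[X]) = 2 := rfl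
  have hmain : (derivative n * Q - n * derivative Q) ^ 2 * (X ^ 2 - 3) ^ 2
      = (C (2 * γ) * (n - Q)) ^ 2 * (Q * (n + 2 * Q)) := by
    have e := congrArg (fun p : k[X] => p.comp v) h
    simp only [mul_comp, pow_comp, sub_comp, add_comp, X_comp, C_comp, one_comp, ofNat_comp,
      ← hn, ← hQ] at e
    rw [hdn, hdQ, C_mul]
    rw [← hγ, C_pow] at e
    generalize (derivative N).comp v = N1 at e ⊢
    generalize (derivative D).comp v = D1 at e ⊢
    rw [hv, hC2] at e
    rw [hC2]
    push_cast at e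
    linear_combination 4 * e
  have hg0 : C (2 * γ) * (n - Q) ≠ 0 :=
    mul_ne_zero (C_ne_zero.mpr (mul_ne_zero h2 hγ0)) hnQ
  obtain ⟨P, hP⟩ : C (2 * γ) * (n - Q) ∣ (derivative n * Q - n * derivative Q) * (X ^ 2 - 3) := by
    rw [← IsIntegrallyClosed.pow_dvd_pow_iff two_ne_zero,
      mul_pow (derivative n * Q - n * derivative Q), hmain]
    exact dvd_mul_right _ _
  have hP2 : P ^ 2 = Q * (n + 2 * Q) := by
    apply mul_left_cancel₀ (pow_ne_zero 2 hg0)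
    rw [← hmain, ← mul_pow, ← mul_pow, hP]
  have hP0 : P ≠ 0 := by
    rintro rfl
    exact mul_ne_zero hQ0 hM0 (by rw [← hP2]; ring)
  have hdP : 2 * P * derivative P
      = derivative Q * (n + 2 * Q) + Q * (derivative n + 2 * derivative Q) := by
    have e := congrArg derivative hP2
    rw [sq, derivative_mul, derivative_mul, derivative_add, derivative_mul, derivative_ofNat] at e
    linear_combination e
  have hC2' : (2 : k[X]) ≠ 0 := by rw [← hC2]; exact C_ne_zero.mpr h2
  have hode : (derivative P * Q - P * derivative Q) * (X ^ 2 - 3) = C γ * (P ^ 2 - 3 * Q ^ 2) := by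
    apply mul_left_cancel₀ (mul_ne_zero hC2' hP0)
    rw [C_mul, hC2] at hP
    linear_combination Q * (X ^ 2 - 3) * hdP + Q * hP - 2 * (X ^ 2 - 3) * derivative Q * hP2
      - 2 * C γ * P * hP2
  have hCs : C s ^ 2 = (3 : k[X]) := by rw [← C_pow, hs]; rfl
  set R := P - C s * Q with hR
  set T := P + C s * Q with hT
  have hRT : R * T = P ^ 2 - 3 * Q ^ 2 := by
    rw [hR, hT]
    linear_combination - Q ^ 2 * hCs
  have hRT0 : R * T ≠ 0 := by
    have : R * T = Q * (n - Q) := by rw [hRT, hP2]; ring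
    rw [this]
    exact mul_ne_zero hQ0 hnQ
  have hW : (derivative R * T - R * derivative T) * (X ^ 2 - 3) = C (2 * s * γ) * (R * T) := by
    rw [hRT, C_mul, C_mul, hC2, hR, hT, derivative_sub, derivative_add, derivative_C_mul]
    linear_combination 2 * C s * hode
  obtain ⟨a, R1, ha, hR1, hR1s, hR1d⟩ := exists_factor_at s (left_ne_zero_of_mul hRT0)
  obtain ⟨b, T1, hb, hT1, hT1s, hT1d⟩ := exists_factor_at s (right_ne_zero_of_mul hRT0)
  have hfin : ((C (a : k) * R1 + (X - C s) * derivative R1) * T1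
      - R1 * (C (b : k) * T1 + (X - C s) * derivative T1)) * (X + C s)
      = C (2 * s * γ) * (R1 * T1) := by
    have hne : (X - C s) ^ (a + b) ≠ 0 := pow_ne_zero _ (X_sub_C_ne_zero s)
    apply mul_left_cancel₀ hne
    have e1 : (X - C s) ^ (a + b) * (R1 * T1) = R * T := by
      rw [hR1, hT1]; ring
    have e3 : (X - C s) ^ (a + b) * (C (2 * s * γ) * (R1 * T1)) = C (2 * s * γ) * (R * T) := by
      rw [← e1]; ring
    rw [e3, ← hW]
    have e2 : (X ^ 2 - 3 : k[X]) = (X - C s) * (X + C s) := by linear_combination hCs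
    rw [e2]
    linear_combination - (X + C s) * T * hR1d + (X + C s) * R * hT1d
      - (X + C s) * (X - C s) ^ a * (C (a : k) * R1 + (X - C s) * derivative R1) * hT1
      + (X + C s) * (X - C s) ^ b * (C (b : k) * T1 + (X - C s) * derivative T1) * hR1
  have hev := congrArg (eval s) hfin
  simp only [eval_mul, eval_sub, eval_add, eval_C, eval_X, sub_self, zero_mul, add_zero] at hev
  have hγab : γ = (a : k) - b := by
    apply mul_left_cancel₀ (mul_ne_zero (mul_ne_zero h2 hs0) (mul_ne_zero hR1s hT1s))
    linear_combination -hev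
  have hQd : Q.natDegree ≤ 2 * m := by
    rw [hQ, natDegree_comp, hvd]; omega
  have hnd : n.natDegree ≤ 2 * m := by
    rw [hn, natDegree_comp, hvd]; omega
  have hPd : P.natDegree ≤ 2 * m := by
    have e := congrArg natDegree hP2
    rw [natDegree_pow] at e
    have e1 : (Q * (n + 2 * Q)).natDegree ≤ 2 * m + 2 * m := by
      refine natDegree_mul_le_of_le hQd (natDegree_add_le_of_degree_le hnd ?_)
      rw [← hC2]
      exact (natDegree_C_mul_le _ _).trans hQd
    omega
  have hsQ : (C s * Q).natDegree ≤ 2 * m := (natDegree_C_mul_le _ _).trans hQd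
  have hRd : R.natDegree ≤ 2 * m := natDegree_sub_le_of_le hPd hsQ |>.trans (by simp)
  have hTd : T.natDegree ≤ 2 * m := natDegree_add_le_of_degree_le hPd hsQ
  rcases le_total a b with hab | hab
  · refine ⟨b - a, by omega, ?_⟩
    rw [← hγ, hγab, Nat.cast_sub hab]
    ring
  · refine ⟨a - b, by omega, ?_⟩
    rw [← hγ, hγab, Nat.cast_sub hab]

section Series
variable {R : Type} [CommRing R]

/-- The differential equation of a normalized isogeny, in the local parameter at infinity. -/
noncomputable def PhiS (a b c : R) (V : PowerSeries R) : PowerSeries R :=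
  (1 + PowerSeries.C a * PowerSeries.X ^ 2 + PowerSeries.C b * PowerSeries.X ^ 3)
      * (V - PowerSeries.X * PowerSeries.derivative R V) ^ 2
    - PowerSeries.C c * (V ^ 3 + PowerSeries.C a * PowerSeries.X ^ 2 * V
      + PowerSeries.C b * PowerSeries.X ^ 3)

theorem PhiS_add (a b c v0 : R) (hv : c * v0 = 1) (s : ℕ) (hs : s ≠ 0) (V G : PowerSeries R)
    (hV : PowerSeries.constantCoeff V = v0) :
    ∃ K, PhiS a b c (V + PowerSeries.X ^ s * G) = PhiS a b c V + PowerSeries.X ^ s * K ∧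
      PowerSeries.constantCoeff K = -((2 * s + 1 : ℕ) : R) * v0 * PowerSeries.constantCoeff G := by
  set H : PowerSeries R := (1 - (s : PowerSeries R)) * G
    - PowerSeries.X * PowerSeries.derivative R G with hH
  have hd : PowerSeries.X * PowerSeries.derivative R (PowerSeries.X ^ s * G)
      = PowerSeries.X ^ s * ((s : PowerSeries R) * G
        + PowerSeries.X * PowerSeries.derivative R G) := by
    obtain ⟨q, rfl⟩ : ∃ q, s = q + 1 := ⟨s - 1, by omega⟩
    rw [Derivation.leibniz, Derivation.leibniz_pow, PowerSeries.derivative_X]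
    simp only [smul_eq_mul, nsmul_eq_mul, Nat.add_sub_cancel]
    ring
  set f : PowerSeries R := 1 + PowerSeries.C a * PowerSeries.X ^ 2
    + PowerSeries.C b * PowerSeries.X ^ 3 with hf
  set W := V - PowerSeries.X * PowerSeries.derivative R V with hW
  refine ⟨f * (2 * W * H + PowerSeries.X ^ s * H ^ 2) - PowerSeries.C c * (3 * V ^ 2 * G
    + 3 * V * PowerSeries.X ^ s * G ^ 2 + PowerSeries.X ^ (2 * s) * G ^ 3
    + PowerSeries.C a * PowerSeries.X ^ 2 * G), ?_, ?_⟩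
  · have e : V + PowerSeries.X ^ s * G
        - PowerSeries.X * PowerSeries.derivative R (V + PowerSeries.X ^ s * G)
        = W + PowerSeries.X ^ s * H := by
      rw [map_add, mul_add, hd, hW, hH]
      ring
    rw [PhiS, PhiS, e, ← hf, ← hW]
    ring
  · simp only [hf, hW, hH, map_sub, map_add, map_mul, map_pow, map_one, map_ofNat, map_natCast,
      PowerSeries.constantCoeff_X, PowerSeries.constantCoeff_C, hV]
    rw [zero_pow hs, zero_pow (show 2 * s ≠ 0 by omega)]
    push_cast
    linear_combination (-3 * v0 * PowerSeries.constantCoeff G) * hv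

theorem map_derivative {R' : Type} [CommRing R'] (g : R →+* R') (V : PowerSeries R) :
    PowerSeries.map g (PowerSeries.derivative R V)
      = PowerSeries.derivative R' (PowerSeries.map g V) := by
  ext n
  rw [PowerSeries.coeff_map, PowerSeries.coeff_derivative, PowerSeries.coeff_derivative,
    PowerSeries.coeff_map, map_mul, map_add, map_natCast, map_one]

theorem map_PhiS {R' : Type} [CommRing R'] (g : R →+* R') (a b c : R) (V : PowerSeries R) :
    PowerSeries.map g (PhiS a b c V) = PhiS (g a) (g b) (g c) (PowerSeries.map g V) := by
  simp only [PhiS, map_sub, map_add, map_mul, map_pow, map_one, PowerSeries.map_C,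
    PowerSeries.map_X, map_derivative]

end Series

section Unique
variable {k : Type} [Field k]

theorem PhiS_unique {a b c v0 : k} (hv : c * v0 = 1) {S : ℕ}
    (hS : ∀ s, s ≤ S → ((2 * s + 1 : ℕ) : k) ≠ 0) {V P : PowerSeries k}
    (hV0 : PowerSeries.constantCoeff V = v0) (hP0 : PowerSeries.constantCoeff P = v0)
    (hV : PowerSeries.X ^ (S + 1) ∣ PhiS a b c V) (hP : PowerSeries.X ^ (S + 1) ∣ PhiS a b c P) :
    PowerSeries.X ^ (S + 1) ∣ V - P := by
  have key : ∀ s, s ≤ S → PowerSeries.X ^ (s + 1) ∣ V - P := by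
    intro s
    induction s with
    | zero =>
      intro _
      rw [zero_add, pow_one, PowerSeries.X_dvd_iff, map_sub, hV0, hP0, sub_self]
    | succ s ih =>
      intro hs
      obtain ⟨G, hG⟩ := ih (by omega)
      obtain ⟨K, hK, hK0⟩ := PhiS_add a b c v0 hv (s + 1) (by omega) P G hP0
      have e : V = P + PowerSeries.X ^ (s + 1) * G := by rw [← hG]; ring
      rw [← e] at hK
      have h1 : PowerSeries.X ^ (s + 1) * PowerSeries.X ∣ PowerSeries.X ^ (s + 1) * K := by
        have e2 : PowerSeries.X ^ (s + 1) * K = PhiS a b c V - PhiS a b c P := by rw [hK]; ring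
        rw [e2, ← pow_succ]
        exact dvd_sub ((pow_dvd_pow _ (by omega)).trans hV) ((pow_dvd_pow _ (by omega)).trans hP)
      have h2 := (mul_dvd_mul_iff_left (pow_ne_zero (s + 1) PowerSeries.X_ne_zero)).mp h1
      rw [PowerSeries.X_dvd_iff, hK0] at h2
      have hv0 : v0 ≠ 0 := right_ne_zero_of_mul_eq_one hv
      have hG0 : PowerSeries.constantCoeff G = 0 := by
        rcases mul_eq_zero.mp h2 with h | h
        · exact absurd h (mul_ne_zero (neg_ne_zero.mpr (hS _ hs)) hv0)
        · exact h
      rw [hG, pow_succ _ (s + 1)]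
      exact mul_dvd_mul_left _ (PowerSeries.X_dvd_iff.mpr hG0)
  exact key S le_rfl

/-- Power series whose `i`-th coefficient has degree at most `i`. -/
def Graded (P : PowerSeries k[X]) : Prop := ∀ i, (PowerSeries.coeff i P).natDegree ≤ i

theorem Graded.add {P Q : PowerSeries k[X]} (hP : Graded P) (hQ : Graded Q) : Graded (P + Q) := by
  intro i
  rw [map_add]
  exact natDegree_add_le_of_degree_le (hP i) (hQ i)

theorem Graded.sub {P Q : PowerSeries k[X]} (hP : Graded P) (hQ : Graded Q) : Graded (P - Q) := by
  intro i
  rw [map_sub]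
  exact (natDegree_sub_le_of_le (hP i) (hQ i)).trans (by simp)

theorem Graded.mul {P Q : PowerSeries k[X]} (hP : Graded P) (hQ : Graded Q) : Graded (P * Q) := by
  intro i
  rw [PowerSeries.coeff_mul]
  refine natDegree_sum_le_of_forall_le _ _ fun x hx => ?_
  rw [← Finset.HasAntidiagonal.mem_antidiagonal.mp hx]
  exact natDegree_mul_le_of_le (hP _) (hQ _)

theorem Graded.monomial {c : k[X]} {n : ℕ} (hc : c.natDegree ≤ n) :
    Graded (PowerSeries.C c * PowerSeries.X ^ n) := by
  intro i
  rw [PowerSeries.coeff_C_mul, PowerSeries.coeff_X_pow]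
  split_ifs with h
  · rw [mul_one, h]; exact hc
  · simp

theorem Graded.const {c : k[X]} (hc : c.natDegree = 0) : Graded (PowerSeries.C c) := by
  have := Graded.monomial (n := 0) hc.le
  rwa [pow_zero, mul_one] at this

theorem Graded.pow {P : PowerSeries k[X]} (hP : Graded P) (n : ℕ) : Graded (P ^ n) := by
  induction n with
  | zero =>
    rw [pow_zero, ← map_one PowerSeries.C]
    exact Graded.const natDegree_one
  | succ n ih => rw [pow_succ]; exact ih.mul hP

theorem Graded.theta {P : PowerSeries k[X]} (hP : Graded P) :
    Graded (PowerSeries.X * PowerSeries.derivative k[X] P) := by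
  intro i
  rcases i with _ | i
  · simp
  · rw [mul_comm, PowerSeries.coeff_succ_mul_X, PowerSeries.coeff_derivative]
    have : ((i : k[X]) + 1) = C ((i : k) + 1) := by simp
    rw [this, mul_comm]
    exact (natDegree_C_mul_le _ _).trans (hP _)

theorem Graded.PhiS {a b c : k[X]} {V : PowerSeries k[X]} (ha : a.natDegree ≤ 2)
    (hb : b.natDegree ≤ 3) (hc : c.natDegree = 0) (hV : Graded V) : Graded (PhiS a b c V) := by
  have h1 : Graded (1 : PowerSeries k[X]) := by
    have := hV.pow 0
    rwa [pow_zero] at this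
  exact (((h1.add (.monomial ha)).add (.monomial hb)).mul ((hV.sub hV.theta).pow 2)).sub
    ((Graded.const hc).mul (((hV.pow 3).add ((Graded.monomial ha).mul hV)).add (.monomial hb)))

theorem exists_graded {a b : k[X]} (ha : a.natDegree ≤ 2) (hb : b.natDegree ≤ 3) {c v0 : k}
    (hv : c * v0 = 1) (S : ℕ) (hS : ∀ s, s ≤ S → ((2 * s + 1 : ℕ) : k) ≠ 0) :
    ∃ P : PowerSeries k[X], Graded P ∧ PowerSeries.constantCoeff P = C v0 ∧
      PowerSeries.X ^ (S + 1) ∣ ShortCurve.PhiS a b (C c) P := by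
  have hv' : (C c : k[X]) * C v0 = 1 := by rw [← C_mul, hv, C_1]
  induction S with
  | zero =>
    refine ⟨PowerSeries.C (C v0), Graded.const (natDegree_C _), PowerSeries.constantCoeff_C _, ?_⟩
    rw [zero_add, pow_one, PowerSeries.X_dvd_iff]
    simp only [ShortCurve.PhiS, map_sub, map_add, map_mul, map_pow, map_one,
      PowerSeries.constantCoeff_X, PowerSeries.constantCoeff_C]
    linear_combination (- C v0 ^ 2) * hv'
  | succ S ih =>
    obtain ⟨P, hP, hP0, hd⟩ := ih fun s hs => hS s (by omega)
    have hcoe : ∀ m, m < S + 1 → PowerSeries.coeff m (ShortCurve.PhiS a b (C c) P) = 0 :=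
      PowerSeries.X_pow_dvd_iff.mp hd
    obtain ⟨L, hL⟩ := hd
    set l := PowerSeries.constantCoeff L with hl
    have hld : l.natDegree ≤ S + 1 := by
      have := Graded.PhiS ha hb (natDegree_C c) hP (S + 1)
      rw [hL] at this
      have e := PowerSeries.coeff_X_pow_mul L (S + 1) 0
      rw [zero_add, PowerSeries.coeff_zero_eq_constantCoeff_apply] at e
      rwa [e, ← hl] at this
    set w : k := (((2 * (S + 1) + 1 : ℕ) : k))⁻¹ with hw
    have hw1 : ((2 * (S + 1) + 1 : ℕ) : k) * w = 1 := mul_inv_cancel₀ (hS _ le_rfl)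
    have hw' : ((2 * (S + 1) + 1 : ℕ) : k[X]) * C w = 1 := by
      rw [← C_eq_natCast, ← C_mul, hw1, C_1]
    set ν : k[X] := C (c * w) * l with hν
    have hνd : ν.natDegree ≤ S + 1 := (natDegree_C_mul_le _ _).trans hld
    obtain ⟨K, hK, hK0⟩ := PhiS_add a b (C c) (C v0) hv' (S + 1) (by omega) P (PowerSeries.C ν) hP0
    refine ⟨P + PowerSeries.X ^ (S + 1) * PowerSeries.C ν, ?_, ?_, ?_⟩
    · refine hP.add ?_
      rw [mul_comm]
      exact .monomial hνd
    · rw [map_add, map_mul, map_pow, PowerSeries.constantCoeff_X, hP0, zero_pow (by omega),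
        zero_mul, add_zero]
    · rw [hK, hL, ← mul_add, pow_succ _ (S + 1)]
      refine mul_dvd_mul_left _ (PowerSeries.X_dvd_iff.mpr ?_)
      rw [map_add, hK0, ← hl, PowerSeries.constantCoeff_C, hν, C_mul]
      linear_combination (-l * C w * ((2 * (S + 1) + 1 : ℕ) : k[X])) * hv' - l * hw'

end Unique

section Elimination
variable {k : Type} [Field k]

theorem natDegree_det_le {m S : ℕ} (M : Matrix (Fin m) (Fin m) k[X])
    (h : ∀ i j, (M i j).natDegree ≤ S) : M.det.natDegree ≤ m * S := by
  rw [Matrix.det_apply]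
  refine natDegree_sum_le_of_forall_le _ _ fun σ _ => ?_
  refine (natDegree_smul_le _ _).trans ((natDegree_prod_le _ _).trans ?_)
  refine (Finset.sum_le_card_nsmul _ _ S fun i _ => h _ _).trans ?_
  simp

theorem card_le_of_elimination {r m S : ℕ} (M : Matrix (Fin r) (Fin m) k[X])
    (hM : ∀ i j, (M i j).natDegree ≤ S) (t : k)
    (ht : ∀ v : Fin m → k, (M.map (eval t)).mulVec v = 0 → v = 0) (J : Finset k)
    (hJ : ∀ τ ∈ J, ∃ v : Fin m → k, v ≠ 0 ∧ (M.map (eval τ)).mulVec v = 0) :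
    J.card ≤ m * S := by
  obtain ⟨g, hg⟩ := LinearMap.exists_leftInverse_of_injective (Matrix.toLin' (M.map (eval t)))
    (LinearMap.ker_eq_bot'.mpr fun v hv => ht v (by rwa [Matrix.toLin'_apply] at hv))
  set L := LinearMap.toMatrix' g with hL
  have hLM : L * M.map (eval t) = 1 := by
    have := congrArg LinearMap.toMatrix' hg
    rwa [LinearMap.toMatrix'_comp, LinearMap.toMatrix'_toLin', LinearMap.toMatrix'_id] at this
  set D := (L.map C * M).det with hD
  have hev : ∀ τ, D.eval τ = (L * M.map (eval τ)).det := by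
    intro τ
    rw [hD, ← coe_evalRingHom, RingHom.map_det, RingHom.mapMatrix_apply, Matrix.map_mul,
      Matrix.map_map]
    congr 3
    ext i j
    simp
  have hD0 : D ≠ 0 := by
    intro h
    have := hev t
    rw [hLM, h, eval_zero, Matrix.det_one] at this
    exact zero_ne_one this
  have hdeg : D.natDegree ≤ m * S := by
    refine natDegree_det_le _ fun i j => ?_
    rw [Matrix.mul_apply]
    refine natDegree_sum_le_of_forall_le _ _ fun x _ => ?_
    rw [Matrix.map_apply]
    exact (natDegree_C_mul_le _ _).trans (hM _ _)
  classical
  refine le_trans ?_ hdeg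
  refine le_trans (Finset.card_le_card (t := D.roots.toFinset) fun τ hτ => ?_)
    ((Multiset.toFinset_card_le _).trans (card_roots' _))
  rw [Multiset.mem_toFinset, mem_roots hD0, IsRoot.def, hev]
  obtain ⟨v, hv, hv0⟩ := hJ τ hτ
  refine Matrix.exists_mulVec_eq_zero_iff.mp ⟨v, hv, ?_⟩
  rw [← Matrix.mulVec_mulVec, hv0, Matrix.mulVec_zero]

theorem eval_reflect {m : ℕ} {N : k[X]} (hN : N.natDegree ≤ m) {y : k} (hy : y ≠ 0) :
    eval y (reflect m N) = y ^ m * eval y⁻¹ N := by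
  let _ : Invertible y⁻¹ := invertibleOfNonzero (inv_ne_zero hy)
  have := eval₂_reflect_mul_pow (RingHom.id k) y⁻¹ m N hN
  rw [invOf_eq_inv, inv_inv] at this
  rw [eval, eval, ← this, mul_left_comm, ← mul_pow, mul_inv_cancel₀ hy, one_pow, mul_one]

theorem coeff_X_mul_derivative (p : k[X]) (i : ℕ) :
    (X * derivative p).coeff i = i * p.coeff i := by
  rcases i with _ | i
  · simp
  · rw [coeff_X_mul, coeff_derivative]
    push_cast
    ring

theorem X_mul_derivative_reflect {m : ℕ} {N : k[X]} (hN : N.natDegree ≤ m) :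
    X * derivative (reflect m N) = C (m : k) * reflect m N - reflect m (X * derivative N) := by
  ext i
  rw [coeff_X_mul_derivative, coeff_sub, coeff_C_mul, coeff_reflect, coeff_reflect,
    coeff_X_mul_derivative]
  rcases le_or_gt i m with h | h
  · rw [revAt_le h, Nat.cast_sub h]
    ring
  · rw [revAt_eq_self_of_lt h, coeff_eq_zero_of_natDegree_lt (by omega)]
    ring

theorem eval_derivative_reflect {m : ℕ} {N : k[X]} (hN : N.natDegree ≤ m) {y : k} (hy : y ≠ 0) :
    y * eval y (derivative (reflect m N))
      = m * (y ^ m * eval y⁻¹ N) - y ^ m * (y⁻¹ * eval y⁻¹ (derivative N)) := by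
  have h := congrArg (eval y) (X_mul_derivative_reflect hN)
  have hd : (X * derivative N).natDegree ≤ m := by
    refine natDegree_le_iff_coeff_eq_zero.mpr fun i hi => ?_
    rw [coeff_X_mul_derivative, coeff_eq_zero_of_natDegree_lt (by omega), mul_zero]
  rwa [eval_mul, eval_sub, eval_mul, eval_X, eval_C, eval_reflect hN hy, eval_reflect hd hy,
    eval_mul, eval_X] at h

/-- The isogeny differential equation for a fraction `N / D`. -/
noncomputable def odeX (a b c : k) (N D : k[X]) : k[X] :=
  (derivative N * D - N * derivative D) ^ 2 * (X ^ 3 + C a * X + C b)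
    - C c * (D * (N ^ 3 + C a * N * D ^ 2 + C b * D ^ 3))

/-- The isogeny differential equation in the coordinate at infinity. -/
noncomputable def odeZ (a b c : k) (n δ : k[X]) : k[X] :=
  (1 + C a * X ^ 2 + C b * X ^ 3) * (n * δ - X * derivative n * δ + n * (X * derivative δ)) ^ 2
    - C c * (δ * (n ^ 3 + C a * X ^ 2 * n * δ ^ 2 + C b * X ^ 3 * δ ^ 3))

theorem eval_odeZ (a b c : k) {q : ℕ} {N D : k[X]} (hN : N.natDegree ≤ q + 1)
    (hD : D.natDegree ≤ q) {y : k} (hy : y ≠ 0) :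
    eval y (odeZ a b c (reflect (q + 1) N) (reflect q D))
      = y ^ (4 * q + 3) * eval y⁻¹ (odeX a b c N D) := by
  have h1 := eval_derivative_reflect hN hy
  have h2 := eval_derivative_reflect hD hy
  simp only [odeZ, odeX, eval_sub, eval_mul, eval_add, eval_pow, eval_one, eval_C, eval_X]
  rw [h1, h2, eval_reflect hN hy, eval_reflect hD hy]
  have hxy : y * y⁻¹ = 1 := mul_inv_cancel₀ hy
  generalize eval y⁻¹ N = N0
  generalize eval y⁻¹ D = D0
  generalize eval y⁻¹ (derivative N) = N1
  generalize eval y⁻¹ (derivative D) = D1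
  generalize y⁻¹ = x at *
  have e1 : y ^ (q + 1) * N0 * (y ^ q * D0) - (((q + 1 : ℕ) : k) * (y ^ (q + 1) * N0)
      - y ^ (q + 1) * (x * N1)) * (y ^ q * D0)
      + y ^ (q + 1) * N0 * (q * (y ^ q * D0) - y ^ q * (x * D1))
      = y ^ (2 * q) * (N1 * D0 - N0 * D1) := by
    push_cast
    linear_combination (y ^ (2 * q) * (N1 * D0 - N0 * D1)) * hxy
  rw [e1]
  have e2 : y ^ (4 * q + 3) = y ^ (4 * q) * y ^ 3 := pow_add _ _ _
  have e3 : y ^ 3 * (x ^ 3 + a * x + b) = 1 + a * y ^ 2 + b * y ^ 3 := by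
    linear_combination ((y * x) ^ 2 + y * x + 1 + a * y ^ 2) * hxy
  rw [← e3]
  ring

theorem odeZ_reflect_eq_zero [Infinite k] {a b c : k} {q : ℕ} {N D : k[X]}
    (hN : N.natDegree ≤ q + 1) (hD : D.natDegree ≤ q) :
    odeZ a b c (reflect (q + 1) N) (reflect q D) = 0 ↔ odeX a b c N D = 0 := by
  constructor <;> intro h
  · refine (mul_eq_zero.mp (?_ : X * odeX a b c N D = 0)).resolve_left X_ne_zero
    refine Polynomial.funext fun x => ?_
    rw [eval_mul, eval_X, eval_zero]
    by_cases hx : x = 0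
    · rw [hx, zero_mul]
    · have := eval_odeZ a b c hN hD (inv_ne_zero hx)
      rw [h, inv_inv, eval_zero] at this
      rw [(mul_eq_zero.mp this.symm).resolve_left (pow_ne_zero _ (inv_ne_zero hx)), mul_zero]
  · refine (mul_eq_zero.mp (?_ : (X : k[X]) * odeZ a b c (reflect (q + 1) N) (reflect q D)
      = 0)).resolve_left X_ne_zero
    refine Polynomial.funext fun x => ?_
    rw [eval_mul, eval_X, eval_zero]
    by_cases hx : x = 0
    · rw [hx, zero_mul]
    · rw [eval_odeZ a b c hN hD hx, h, eval_zero, mul_zero, mul_zero]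

/-- `odeZ` on power series. -/
noncomputable def odeS (a b c : k) (n δ : PowerSeries k) : PowerSeries k :=
  (1 + PowerSeries.C a * PowerSeries.X ^ 2 + PowerSeries.C b * PowerSeries.X ^ 3)
      * (n * δ - PowerSeries.X * PowerSeries.derivative k n * δ
        + n * (PowerSeries.X * PowerSeries.derivative k δ)) ^ 2
    - PowerSeries.C c * (δ * (n ^ 3 + PowerSeries.C a * PowerSeries.X ^ 2 * n * δ ^ 2
      + PowerSeries.C b * PowerSeries.X ^ 3 * δ ^ 3))

theorem coe_odeZ (a b c : k) (n δ : k[X]) :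
    ((odeZ a b c n δ : k[X]) : PowerSeries k) = odeS a b c n δ := by
  simp only [odeZ, odeS, coe_sub, coe_add, coe_mul, coe_pow, coe_one, coe_C, coe_X,
    PowerSeries.derivative_coe]

theorem odeS_mul (a b c : k) (V δ : PowerSeries k) :
    odeS a b c (V * δ) δ = δ ^ 4 * PhiS a b c V := by
  rw [odeS, PhiS, Derivation.leibniz]
  simp only [smul_eq_mul]
  ring

theorem dvd_odeS_sub (a b c : k) (n δ g : PowerSeries k) (s : ℕ) :
    PowerSeries.X ^ (s + 1) ∣
      odeS a b c (n + PowerSeries.X ^ (s + 1) * g) δ - odeS a b c n δ := by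
  rw [odeS, odeS, map_add, Derivation.leibniz, Derivation.leibniz_pow, PowerSeries.derivative_X]
  simp only [smul_eq_mul, nsmul_eq_mul, Nat.add_sub_cancel]
  set E := n * δ - PowerSeries.X * PowerSeries.derivative k n * δ
        + n * (PowerSeries.X * PowerSeries.derivative k δ) with hE
  set E' := g * δ - (((s + 1 : ℕ) : PowerSeries k) * g
    + PowerSeries.X * PowerSeries.derivative k g) * δ
        + g * (PowerSeries.X * PowerSeries.derivative k δ) with hE'
  have e : (n + PowerSeries.X ^ (s + 1) * g) * δ - PowerSeries.X * (PowerSeries.derivative k n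
      + (PowerSeries.X ^ (s + 1) * PowerSeries.derivative k g
        + g * (((s + 1 : ℕ) : PowerSeries k) * (PowerSeries.X ^ s * 1)))) * δ
        + (n + PowerSeries.X ^ (s + 1) * g) * (PowerSeries.X * PowerSeries.derivative k δ)
      = E + PowerSeries.X ^ (s + 1) * E' := by
    rw [hE, hE']
    ring
  rw [e]
  generalize (PowerSeries.X : PowerSeries k) ^ (s + 1) = Y
  refine ⟨(1 + PowerSeries.C a * PowerSeries.X ^ 2 + PowerSeries.C b * PowerSeries.X ^ 3)
    * (2 * E * E' + Y * E' ^ 2) - PowerSeries.C c * (δ * (3 * n ^ 2 * g + 3 * n * Y * g ^ 2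
      + Y ^ 2 * g ^ 3 + PowerSeries.C a * PowerSeries.X ^ 2 * g * δ ^ 2)), ?_⟩
  ring

theorem natDegree_odeZ_le (a b c : k) {q : ℕ} {n δ : k[X]} (hn : n.natDegree ≤ q + 1)
    (hδ : δ.natDegree ≤ q) : (odeZ a b c n δ).natDegree ≤ 4 * q + 5 := by
  have hX : ∀ (p : k[X]) (i : ℕ), p.natDegree ≤ i → (X * derivative p).natDegree ≤ i := by
    intro p i hp
    refine natDegree_le_iff_coeff_eq_zero.mpr fun j hj => ?_
    rw [coeff_X_mul_derivative, coeff_eq_zero_of_natDegree_lt (by omega), mul_zero]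
  have hC : ∀ (x : k) (i : ℕ), (C x * X ^ i : k[X]).natDegree ≤ i := fun x i =>
    (natDegree_C_mul_le x (X ^ i)).trans (natDegree_X_pow_le i)
  have h1 : (n * δ - X * derivative n * δ + n * (X * derivative δ)).natDegree ≤ 2 * q + 1 := by
    refine natDegree_add_le_of_degree_le ((natDegree_sub_le_of_le
      (natDegree_mul_le_of_le hn hδ) (natDegree_mul_le_of_le (hX n _ hn) hδ)).trans ?_)
      ((natDegree_mul_le_of_le hn (hX δ _ hδ)).trans ?_) <;> omega
  have h2 : (1 + C a * X ^ 2 + C b * X ^ 3 : k[X]).natDegree ≤ 3 :=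
    natDegree_add_le_of_degree_le (natDegree_add_le_of_degree_le (by simp)
      ((hC _ _).trans (by norm_num))) (hC _ _)
  refine (natDegree_sub_le_of_le (natDegree_mul_le_of_le h2 (natDegree_pow_le_of_le 2 h1))
    ((natDegree_C_mul_le _ _).trans (natDegree_mul_le_of_le (m := q) (n := 3 * q + 3) hδ
      (natDegree_add_le_of_degree_le (natDegree_add_le_of_degree_le
        ((natDegree_pow_le_of_le 3 hn).trans (by omega))
        ((natDegree_mul_le_of_le (natDegree_mul_le_of_le (hC _ _) hn)
          (natDegree_pow_le_of_le 2 hδ)).trans (by omega)))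
        ((natDegree_mul_le_of_le (hC _ _) (natDegree_pow_le_of_le 3 hδ)).trans (by omega)))))).trans
    ?_
  rw [max_le_iff]
  constructor <;> omega

end Elimination

section SeriesCount
variable {k : Type} [Field k]

theorem coeff_series_mul (P : PowerSeries k) {δ : k[X]} {q : ℕ} (hδ : δ.natDegree ≤ q) {s : ℕ}
    (hs : q ≤ s) : PowerSeries.coeff s (P * (δ : PowerSeries k))
      = ∑ j : Fin (q + 1), PowerSeries.coeff (s - j) P * δ.coeff j := by
  rw [mul_comm, PowerSeries.coeff_mul, Finset.Nat.sum_antidiagonal_eq_sum_range_succ_mk,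
    ← Finset.sum_range (f := fun j => PowerSeries.coeff (s - j) P * δ.coeff j)]
  symm
  refine Finset.sum_subset_zero_on_sdiff (Finset.range_subset_range.mpr (by omega)) ?_ ?_
  · intro j hj
    rw [Finset.mem_sdiff, Finset.mem_range, Finset.mem_range] at hj
    dsimp only
    rw [coeff_coe, coeff_eq_zero_of_natDegree_lt (by omega), zero_mul]
  · intro j _
    dsimp only
    rw [coeff_coe, mul_comm]

theorem coe_eq_zero_of_dvd {p : k[X]} {s : ℕ} (hp : p.natDegree < s)
    (h : PowerSeries.X ^ s ∣ (p : PowerSeries k)) : p = 0 := by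
  rw [PowerSeries.X_pow_dvd_iff] at h
  ext i
  rw [coeff_zero]
  rcases lt_or_ge i s with hi | hi
  · rw [← coeff_coe]; exact h i hi
  · exact coeff_eq_zero_of_natDegree_lt (by omega)

theorem card_ode_le [IsAlgClosed k] (h2 : (2 : k) ≠ 0) (h3 : (3 : k) ≠ 0) {q : ℕ} {c : k}
    (hc : c ≠ 0) (hsep : ∀ e : ℕ, e ≤ 2 * (q + 1) → c ≠ (e : k) ^ 2)
    (hS : ∀ s, s ≤ 4 * q + 5 → ((2 * s + 1 : ℕ) : k) ≠ 0) (J : Finset k)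
    (hJ : ∀ τ ∈ J, ∃ N D : k[X], N.natDegree ≤ q + 1 ∧ D.natDegree ≤ q ∧ D.coeff q = 1 ∧
      c * N.coeff (q + 1) = 1 ∧ odeX (-3 * τ) (2 * τ) c N D = 0) :
    J.card ≤ (q + 1) * (4 * q + 5) := by
  set S := 4 * q + 5 with hSdef
  have hv0 : c * c⁻¹ = 1 := mul_inv_cancel₀ hc
  obtain ⟨P, hP, hP0, hPd⟩ := exists_graded (k := k) (a := C (-3) * X) (b := C 2 * X)
    ((natDegree_C_mul_le _ _).trans (natDegree_X_le.trans (by norm_num)))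
    ((natDegree_C_mul_le _ _).trans (natDegree_X_le.trans (by norm_num))) hv0 S hS
  set PP : k → PowerSeries k := fun τ => PowerSeries.map (evalRingHom τ) P with hPP
  have hPP0 : ∀ τ, PowerSeries.constantCoeff (PP τ) = c⁻¹ := by
    intro τ
    rw [hPP, ← PowerSeries.coeff_zero_eq_constantCoeff_apply, PowerSeries.coeff_map,
      PowerSeries.coeff_zero_eq_constantCoeff_apply, hP0, coe_evalRingHom, eval_C]
  have hPPd : ∀ τ, PowerSeries.X ^ (S + 1) ∣ PhiS (-3 * τ) (2 * τ) c (PP τ) := by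
    intro τ
    have := map_dvd (PowerSeries.map (evalRingHom τ)) hPd
    rw [map_PhiS, map_pow, PowerSeries.map_X] at this
    simpa using this
  set M : Matrix (Fin (S - (q + 1))) (Fin (q + 1)) k[X] :=
    Matrix.of fun i j => PowerSeries.coeff (q + 1 + 1 + i - j) P with hM
  have hMv : ∀ τ (δ : k[X]), δ.natDegree ≤ q → ∀ i,
      (M.map (eval τ)).mulVec (fun j => δ.coeff j) i
        = PowerSeries.coeff (q + 1 + 1 + i) (PP τ * (δ : PowerSeries k)) := by
    intro τ δ hδ i
    rw [coeff_series_mul _ hδ (by omega)]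
    simp only [Matrix.mulVec, dotProduct, Matrix.map_apply, hM, Matrix.of_apply, hPP,
      PowerSeries.coeff_map, coe_evalRingHom]
  refine card_le_of_elimination M ?_ 1 ?_ J ?_
  · intro i j
    have := i.2
    exact (hP _).trans (by omega)
  · intro v hv
    by_contra hv0'
    set δ : k[X] := ∑ j : Fin (q + 1), C (v j) * X ^ (j : ℕ) with hδ
    have hδc : ∀ j : Fin (q + 1), δ.coeff j = v j := by
      intro j
      rw [hδ, finsetSum_coeff, Finset.sum_eq_single j]
      · rw [coeff_C_mul, coeff_X_pow_self, mul_one]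
      · intro i _ hij
        rw [coeff_C_mul, coeff_X_pow, if_neg (fun e => hij (Fin.ext e.symm)), mul_zero]
      · intro h
        exact absurd (Finset.mem_univ _) h
    have hδd : δ.natDegree ≤ q := by
      refine natDegree_sum_le_of_forall_le _ _ fun j _ => ?_
      exact (natDegree_C_mul_X_pow_le _ _).trans (by omega)
    have hδ0 : δ ≠ 0 := by
      intro h
      apply hv0'
      funext j
      rw [← hδc, h, coeff_zero, Pi.zero_apply]
    set n := PowerSeries.trunc (q + 1 + 1) (PP 1 * (δ : PowerSeries k)) with hn
    have hnd : n.natDegree ≤ q + 1 :=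
      Nat.lt_succ_iff.mp (PowerSeries.natDegree_trunc_lt _ _)
    have hdiv : PowerSeries.X ^ (S + 1) ∣ (n : PowerSeries k) - PP 1 * (δ : PowerSeries k) := by
      rw [PowerSeries.X_pow_dvd_iff]
      intro s hs
      rw [map_sub, coeff_coe, hn, PowerSeries.coeff_trunc]
      split_ifs with h
      · rw [sub_self]
      · have := hMv 1 δ hδd ⟨s - (q + 1 + 1), by omega⟩
        rw [show (fun j : Fin (q + 1) => δ.coeff j) = v from funext hδc, hv] at this
        rw [zero_sub, neg_eq_zero]
        simp only [Pi.zero_apply] at this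
        rw [show q + 1 + 1 + (s - (q + 1 + 1)) = s by omega] at this
        exact this.symm
    obtain ⟨g, hg⟩ := hdiv
    have hnP : (n : PowerSeries k) = PP 1 * (δ : PowerSeries k) + PowerSeries.X ^ (S + 1) * g := by
      rw [← hg]; ring
    have hZ : odeZ (-3 * 1) (2 * 1) c n δ = 0 := by
      refine coe_eq_zero_of_dvd (s := S + 1)
        (Nat.lt_succ_of_le (natDegree_odeZ_le _ _ _ hnd hδd)) ?_
      rw [coe_odeZ, hnP]
      have h1 := dvd_odeS_sub (-3 * 1) (2 * 1) c (PP 1 * (δ : PowerSeries k)) δ g S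
      have h2 : PowerSeries.X ^ (S + 1) ∣ odeS (-3 * 1) (2 * 1) c (PP 1 * (δ : PowerSeries k)) δ := by
        rw [odeS_mul]
        exact (hPPd 1).mul_left _
      have := dvd_add h1 h2
      rwa [sub_add_cancel] at this
    set N := reflect (q + 1) n with hN
    set D := reflect q δ with hD
    have hNd : N.natDegree ≤ q + 1 := natDegree_reflect_le.trans (by omega)
    have hDd : D.natDegree ≤ q := natDegree_reflect_le.trans (by omega)
    have hX : odeX (-3 * 1) (2 * 1) c N D = 0 := by
      rw [← odeZ_reflect_eq_zero hNd hDd, hN, hD, reflect_reflect, reflect_reflect]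
      exact hZ
    have hD0 : D ≠ 0 := fun h => hδ0 (reflect_eq_zero_iff.mp h)
    have hprop : ∀ e : k, N ≠ C e * D := by
      intro e he
      have h1 := reflect_mul D 1 hDd (natDegree_one.le.trans zero_le_one)
      rw [mul_one, reflect_one, pow_one, hD, reflect_reflect, ← hD] at h1
      have h2 : n = C e * (δ * X) := by
        rw [← h1, ← reflect_C_mul, ← he, hN, reflect_reflect]
      have h3 : (δ : PowerSeries k) * (PowerSeries.C e * PowerSeries.X - PP 1)
          = PowerSeries.X ^ (S + 1) * g := by
        rw [← hg, h2, coe_mul, coe_mul, coe_C, coe_X]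
        ring
      have h4 : IsUnit (PowerSeries.C e * PowerSeries.X - PP 1) := by
        rw [PowerSeries.isUnit_iff_constantCoeff, map_sub, hPP0, map_mul,
          PowerSeries.constantCoeff_X, mul_zero, zero_sub]
        exact (neg_ne_zero.mpr (inv_ne_zero hc)).isUnit
      refine hδ0 (coe_eq_zero_of_dvd (s := S + 1) (by omega) ?_)
      exact h4.dvd_mul_right.mp ⟨g, h3⟩
    obtain ⟨e, he, hce⟩ := exists_nat_sq_of_nodal h2 h3 hc hNd (hDd.trans (Nat.le_succ q)) hD0
      (fun h => hprop 1 (by rw [h, C_1, one_mul]))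
      (fun h => hprop (-2) (by
        rw [C_neg, show (C 2 : k[X]) = 2 from rfl]
        linear_combination h))
      (by
        rw [odeX, mul_one, mul_one, C_neg, show (C 2 : k[X]) = 2 from rfl,
          show (C 3 : k[X]) = 3 from rfl] at hX
        linear_combination hX)
    exact hsep e he hce
  · intro τ hτ
    obtain ⟨N, D, hN, hD, hD1, hN1, hode⟩ := hJ τ hτ
    set δ := reflect q D with hδ
    set n := reflect (q + 1) N with hn
    have hδd : δ.natDegree ≤ q := natDegree_reflect_le.trans (by omega)
    have hnd : n.natDegree ≤ q + 1 := natDegree_reflect_le.trans (by omega)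
    have hδ0 : δ.coeff 0 = 1 := by
      rw [hδ, coeff_reflect, revAt_le (Nat.zero_le _), Nat.sub_zero, hD1]
    have hn0 : n.coeff 0 = c⁻¹ := by
      rw [hn, coeff_reflect, revAt_le (Nat.zero_le _), Nat.sub_zero]
      exact eq_inv_of_mul_eq_one_right hN1
    have hZ : odeZ (-3 * τ) (2 * τ) c n δ = 0 := (odeZ_reflect_eq_zero hN hD).mpr hode
    have hδu : PowerSeries.constantCoeff (δ : PowerSeries k) = 1 := by
      rw [← PowerSeries.coeff_zero_eq_constantCoeff_apply, coeff_coe, hδ0]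
    set V : PowerSeries k := (n : PowerSeries k) * (δ : PowerSeries k)⁻¹ with hV
    have hVδ : V * (δ : PowerSeries k) = n := by
      rw [hV, mul_assoc, PowerSeries.inv_mul_cancel _ (by rw [hδu]; exact one_ne_zero), mul_one]
    have hV0 : PowerSeries.constantCoeff V = c⁻¹ := by
      have := congrArg PowerSeries.constantCoeff hVδ
      rwa [map_mul, hδu, mul_one, ← PowerSeries.coeff_zero_eq_constantCoeff_apply (n : PowerSeries k),
        coeff_coe, hn0] at this
    have hPhi : PhiS (-3 * τ) (2 * τ) c V = 0 := by
      have h1 := odeS_mul (-3 * τ) (2 * τ) c V δ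
      rw [hVδ, ← coe_odeZ, hZ, coe_zero] at h1
      refine (mul_eq_zero.mp h1.symm).resolve_left (pow_ne_zero _ ?_)
      intro h
      rw [h, map_zero] at hδu
      exact zero_ne_one hδu
    have hd := PhiS_unique hv0 hS (hPP0 τ) hV0 (hPPd τ) (by rw [hPhi]; exact dvd_zero _)
    refine ⟨fun j => δ.coeff j, fun h => ?_, ?_⟩
    · have := congrFun h 0
      rw [Fin.val_zero, hδ0] at this
      exact one_ne_zero this
    · funext i
      rw [hMv τ δ hδd i]
      have h1 := PowerSeries.X_pow_dvd_iff.mp (hd.mul_right (δ : PowerSeries k)) (q + 1 + 1 + i)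
        (by have := i.2; omega)
      rw [sub_mul, hVδ, map_sub, coeff_coe, coeff_eq_zero_of_natDegree_lt (by omega),
        sub_zero] at h1
      exact h1

end SeriesCount

section BaseBound
variable {k : Type} [Field k] [IsAlgClosed k] {W : ShortCurve k}

theorem IsAlg.exists_odeX {α : W.P k →+ W.P k} (hα : IsAlg α) {d : ℤ} (hd : (d : k) ≠ 0)
    (h : ∀ P, α (α P) = d • P) {q : ℕ} (hq : d.natAbs = q + 1) :
    ∃ N D : k[X], N.natDegree ≤ q + 1 ∧ D.natDegree ≤ q ∧ D.coeff q = 1 ∧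
      (d : k) * N.coeff (q + 1) = 1 ∧ odeX W.A W.B d N D = 0 := by
  obtain ⟨φ, hφ⟩ := hα
  have hcomp : α.comp α = d • AddMonoidHom.id (W.P k) := by
    ext P
    rw [AddMonoidHom.comp_apply, h]
    rfl
  have hα0 : α ≠ 0 := by
    rintro rfl
    refine zsmul_id_ne_zero (W := W) d hd ?_
    rw [← hcomp]
    rfl
  obtain ⟨g, hg, -⟩ := hφ.exists_hom hα0
  obtain ⟨u, hu⟩ := hφ.px_eq
  obtain ⟨c, hc⟩ := hφ.exists_cF
  have hgφ := hφ.comp hφ hg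
  rw [hcomp] at hgφ
  have hdg := (Rep.id (W := W)).zsmul d
  have hc2 : c ^ 2 = d := by
    have e := hgφ.cF_eq hdg
    rw [cF_pm, hg, hc, g.commutes, cF_zsmul_gen, ← map_mul, ← map_intCast (algebraMap k W.FF)] at e
    rw [sq]
    exact (algebraMap k W.FF).injective e
  have hhp : hp φ = q + 1 := by
    have e := hgφ.hp_unique hdg
    rw [hp_pm hg hu hφ.1, hp_zsmul pm_conj_gen, hp_gen, mul_one, hq, sq] at e
    exact Nat.mul_self_inj.mp e
  have hc0 : c ≠ 0 := by
    rintro rfl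
    apply hd
    rw [← hc2]
    ring
  obtain ⟨φ', hφ', hhp', hc', u', hu', hdeg, hlc⟩ := hφ.normalize hα0 hc hc0
  have hode := hφ'.ode hα0 hu' hc'
  rw [hp_of hu', hhp, ht, hdeg, max_eq_left (Nat.le_succ _)] at hhp'
  have hdd : u'.denom.natDegree = q := by omega
  refine ⟨u'.num, u'.denom, by omega, by omega, ?_, ?_, ?_⟩
  · rw [← hdd]
    exact u'.monic_denom
  · rw [← hdd, ← hdeg, ← hc2]
    exact hlc
  · rw [odeX, ← hc2, ← hode, fP]
    ring

theorem card_cmSet_one_le (h3 : (3 : k) ≠ 0) {d : ℤ} (hd0 : d < 0) {q : ℕ}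
    (hq : d.natAbs = q + 1)
    (hchar : ∀ n : ℕ, 0 < n → n ≤ 4 * (q + 1) ^ 2 + 8 * (q + 1) + 3 → (n : k) ≠ 0)
    (J : Finset k) (hJ : ∀ j ∈ J, j ∈ cmSet k d 1) :
    J.card ≤ (q + 1) * (4 * q + 5) + 2 := by
  classical
  have h2 : (2 : k) ≠ 0 := by exact_mod_cast hchar 2 (by omega) (by nlinarith)
  have hdq : (d : k) = -((q + 1 : ℕ) : k) := by
    have : d = -((q + 1 : ℕ) : ℤ) := by omega
    rw [this]
    push_cast
    ring
  have hdk : (d : k) ≠ 0 := by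
    rw [hdq]
    exact neg_ne_zero.mpr (hchar _ (by omega) (by nlinarith))
  set good : k → Prop := fun τ => ∃ N D : k[X], N.natDegree ≤ q + 1 ∧ D.natDegree ≤ q ∧
    D.coeff q = 1 ∧ (d : k) * N.coeff (q + 1) = 1 ∧ odeX (-3 * τ) (2 * τ) d N D = 0 with hgood
  have key : ∀ j ∈ J, j = 0 ∨ j = 1 / 4 ∨
      ∃ τ, good τ ∧ (-3 * τ) ^ 3 / (4 * (-3 * τ) ^ 3 + 27 * (2 * τ) ^ 2) = j := by
    intro j hj
    obtain ⟨W, α, hα, hsq, hjW⟩ := hJ j hj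
    rw [jinv] at hjW
    by_cases hA : W.A = 0
    · left
      rw [← hjW, hA]
      simp
    by_cases hB : W.B = 0
    · right; left
      rw [← hjW, hB, div_eq_div_iff _ (by
        have : (4 : k) = 2 ^ 2 := by norm_num
        rw [this]; exact pow_ne_zero _ h2)]
      · ring
      · have := W.disc
        rwa [hB] at this
    right; right
    obtain ⟨s, hs⟩ := IsAlgClosed.exists_pow_nat_eq (-2 * W.A / (3 * W.B)) (n := 2) (by norm_num)
    have hs0 : s ≠ 0 := by
      rintro rfl
      rw [eq_comm, zero_pow two_ne_zero, div_eq_zero_iff] at hs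
      rcases hs with e | e
      · exact mul_ne_zero (neg_ne_zero.mpr h2) hA e
      · exact mul_ne_zero h3 hB e
    rw [eq_div_iff (mul_ne_zero h3 hB)] at hs
    set τ := -(s ^ 4 * W.A) / 3 with hτ
    have hτ3 : τ * 3 = -(s ^ 4 * W.A) := div_mul_cancel₀ _ h3
    have hA' : -3 * τ = s ^ 4 * W.A := by linear_combination -hτ3
    have hB' : 2 * τ = s ^ 6 * W.B := by
      apply mul_left_cancel₀ h3
      linear_combination 2 * hτ3 - s ^ 4 * hs
    have hdisc : 4 * (-3 * τ) ^ 3 + 27 * (2 * τ) ^ 2 = s ^ 12 * (4 * W.A ^ 3 + 27 * W.B ^ 2) := by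
      rw [hA', hB']
      ring
    set W' : ShortCurve k := ⟨-3 * τ, 2 * τ, by
      rw [hdisc]; exact mul_ne_zero (pow_ne_zero _ hs0) W.disc, h2⟩ with hW'
    obtain ⟨β, γ, hβ, hγ, h1, h1'⟩ := exists_iso_of_scale (W := W) (W' := W') hs0 hA' hB'
    refine ⟨τ, ?_, ?_⟩
    · refine ((hβ.comp hα).comp hγ).exists_odeX hdk ?_ hq
      intro P
      have e1 : ∀ Q, γ (β Q) = Q := fun Q => DFunLike.congr_fun h1 Q
      have e2 : ∀ Q, β (γ Q) = Q := fun Q => DFunLike.congr_fun h1' Q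
      simp only [AddMonoidHom.comp_apply, e1]
      rw [hsq, map_zsmul, e2]
      simp
    · rw [hdisc, hA', ← hjW, mul_pow, ← pow_mul]
      exact mul_div_mul_left _ _ (pow_ne_zero _ hs0)
  have hsub : J ⊆ insert 0 (insert (1 / 4) ((J.filter fun j => ∃ τ, good τ ∧
      (-3 * τ) ^ 3 / (4 * (-3 * τ) ^ 3 + 27 * (2 * τ) ^ 2) = j))) := by
    intro j hj
    rw [Finset.mem_insert, Finset.mem_insert, Finset.mem_filter]
    rcases key j hj with h | h | h
    · exact Or.inl h
    · exact Or.inr (Or.inl h)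
    · exact Or.inr (Or.inr ⟨hj, h⟩)
  set J' := J.filter fun j => ∃ τ, good τ ∧
      (-3 * τ) ^ 3 / (4 * (-3 * τ) ^ 3 + 27 * (2 * τ) ^ 2) = j with hJ'
  have hex : ∀ j : k, ∃ τ, j ∈ J' → good τ ∧
      (-3 * τ) ^ 3 / (4 * (-3 * τ) ^ 3 + 27 * (2 * τ) ^ 2) = j := by
    intro j
    by_cases hj : j ∈ J'
    · obtain ⟨τ, hτ⟩ := (Finset.mem_filter.mp hj).2
      exact ⟨τ, fun _ => hτ⟩
    · exact ⟨0, fun h => absurd h hj⟩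
  choose T hT using hex
  have hcard : J'.card = (J'.image T).card := by
    refine (Finset.card_image_of_injOn fun i hi j hj hij => ?_).symm
    rw [← (hT i hi).2, ← (hT j hj).2, hij]
  have hb : (J'.image T).card ≤ (q + 1) * (4 * q + 5) := by
    refine card_ode_le h2 h3 hdk ?_ ?_ _ ?_
    · intro e he heq
      refine hchar (e ^ 2 + (q + 1)) (by omega) ?_ ?_
      · have : e ^ 2 ≤ (2 * (q + 1)) ^ 2 := Nat.pow_le_pow_left he 2
        nlinarith
      · push_cast
        rw [← heq, hdq]
        push_cast
        ring
    · intro s hs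
      exact hchar _ (by omega) (by nlinarith)
    · intro τ hτ
      obtain ⟨j, hj, rfl⟩ := Finset.mem_image.mp hτ
      exact (hT j hj).1
  calc J.card ≤ _ := Finset.card_le_card hsub
    _ ≤ J'.card + 1 + 1 := (Finset.card_insert_le _ _).trans
        (Nat.add_le_add_right (Finset.card_insert_le _ _) 1)
    _ ≤ _ := by omega

end BaseBound

section Reduction
variable {p : ℕ} [Fact p.Prime]

theorem ratRed_eq_cast (q : ℚ) : ratRed p q = (q : ZMod p) := by
  rw [ratRed, Rat.cast_def, div_eq_mul_inv]

theorem cast_den_add {q r : ℚ} (hq : (q.den : ZMod p) ≠ 0) (hr : (r.den : ZMod p) ≠ 0) :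
    ((q + r).den : ZMod p) ≠ 0 := by
  intro h
  rw [ZMod.natCast_eq_zero_iff] at h
  have := h.trans (Rat.add_den_dvd q r)
  rw [← ZMod.natCast_eq_zero_iff, Nat.cast_mul] at this
  exact mul_ne_zero hq hr this

theorem cast_den_mul {q r : ℚ} (hq : (q.den : ZMod p) ≠ 0) (hr : (r.den : ZMod p) ≠ 0) :
    ((q * r).den : ZMod p) ≠ 0 := by
  intro h
  rw [ZMod.natCast_eq_zero_iff] at h
  have := h.trans (Rat.mul_den_dvd q r)
  rw [← ZMod.natCast_eq_zero_iff, Nat.cast_mul] at this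
  exact mul_ne_zero hq hr this

theorem cast_den_pow {q : ℚ} (hq : (q.den : ZMod p) ≠ 0) (n : ℕ) :
    ((q ^ n).den : ZMod p) ≠ 0 := by
  rw [Rat.den_pow, Nat.cast_pow]
  exact pow_ne_zero _ hq

theorem cast_pow_of_den {q : ℚ} (hq : (q.den : ZMod p) ≠ 0) (n : ℕ) :
    ((q ^ n : ℚ) : ZMod p) = (q : ZMod p) ^ n := by
  induction n with
  | zero => simp
  | succ n ih => rw [pow_succ, Rat.cast_mul_of_ne_zero (cast_den_pow hq n) hq, ih, pow_succ]

theorem cast_evalQ {τ : ℚ} (hτ : (τ.den : ZMod p) ≠ 0) (A : ℤ[X]) :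
    ((evalQ A τ).den : ZMod p) ≠ 0 ∧
      ((evalQ A τ : ℚ) : ZMod p) = eval₂ (Int.castRingHom (ZMod p)) (τ : ZMod p) A := by
  have hisInt : ∀ a : ℤ, (((a : ℚ)).den : ZMod p) ≠ 0 := fun a => by simp
  induction A using Polynomial.induction_on' with
  | add f g hf hg =>
    rw [evalQ, eval₂_add, ← evalQ, ← evalQ, eval₂_add, ← hf.2, ← hg.2]
    exact ⟨cast_den_add hf.1 hg.1, Rat.cast_add_of_ne_zero hf.1 hg.1⟩
  | monomial n a =>
    rw [evalQ, eval₂_monomial, eval₂_monomial, eq_intCast, eq_intCast]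
    refine ⟨cast_den_mul (hisInt a) (cast_den_pow hτ n), ?_⟩
    rw [Rat.cast_mul_of_ne_zero (hisInt a) (cast_den_pow hτ n), cast_pow_of_den hτ, Rat.cast_intCast]

theorem cast_den_of_evalQ {A : ℤ[X]} (hA : 0 < A.natDegree) (hlc : (A.leadingCoeff : ZMod p) ≠ 0)
    {τ : ℚ} (h : ((evalQ A τ).den : ZMod p) ≠ 0) : (τ.den : ZMod p) ≠ 0 := by
  intro h0
  have hnum : (τ.num : ZMod p) ≠ 0 := by
    intro h1
    rw [ZMod.intCast_zmod_eq_zero_iff_dvd] at h1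
    rw [ZMod.natCast_eq_zero_iff] at h0
    have h2 := Int.natAbs_dvd_natAbs.mpr h1
    rw [Int.natAbs_natCast] at h2
    exact (Fact.out : p.Prime).one_lt.ne' (Nat.eq_one_of_dvd_coprimes τ.reduced h2 h0)
  have hτ0 : τ ≠ 0 := by
    rintro rfl
    exact hnum (by simp)
  have hinvden : ((τ⁻¹).den : ZMod p) ≠ 0 := by
    rw [Rat.den_inv_of_ne_zero hτ0]
    intro h1
    apply hnum
    rw [ZMod.natCast_eq_zero_iff] at h1
    rw [ZMod.intCast_zmod_eq_zero_iff_dvd]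
    exact Int.natCast_dvd.mpr h1
  have hinv0 : ((τ⁻¹ : ℚ) : ZMod p) = 0 := by
    have h2 : (1 : ZMod p) = ((τ⁻¹ : ℚ) : ZMod p) * 0 → False := by simp
    by_contra h3
    have h4 : ((τ⁻¹).num : ZMod p) = 0 := by
      rw [Rat.num_inv, Int.cast_mul, Int.cast_natCast, h0, mul_zero]
    apply h3
    rw [Rat.cast_def, h4, zero_div]
  have hr := cast_evalQ hinvden (reflect A.natDegree A)
  let _ : Invertible τ := invertibleOfNonzero hτ0
  have he := eval₂_reflect_mul_pow (Int.castRingHom ℚ) τ A.natDegree A le_rfl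
  rw [invOf_eq_inv] at he
  have he' : evalQ (reflect A.natDegree A) τ⁻¹ = evalQ A τ * (τ⁻¹) ^ A.natDegree := by
    rw [evalQ, evalQ, ← he, mul_assoc, ← mul_pow, mul_inv_cancel₀ hτ0, one_pow, mul_one]
  rw [he', Rat.cast_mul_of_ne_zero h (cast_den_pow hinvden _), cast_pow_of_den hinvden, hinv0,
    zero_pow hA.ne', mul_zero] at hr
  have hz := hr.2
  rw [eval₂_at_zero, coeff_reflect, revAt_le (Nat.zero_le _), Nat.sub_zero] at hz
  exact hlc hz.symm

theorem affinePoints_eq (a b : ZMod p) : affinePoints p a b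
    = (Finset.univ.filter fun z : ZMod p × ZMod p => z.2 ^ 2 = z.1 ^ 3 + a * z.1 + b).card := by
  rw [affinePoints]
  refine Finset.card_nbij' (fun xy => ((xy.1 : ZMod p), (xy.2 : ZMod p)))
    (fun z => (z.1.val, z.2.val)) ?_ ?_ ?_ ?_
  · intro xy h
    simp only [Finset.coe_filter, Set.mem_ofPred_eq] at h ⊢
    exact ⟨Finset.mem_univ _, h.2⟩
  · intro z h
    simp only [Finset.coe_filter, Set.mem_ofPred_eq, Finset.mem_product, Finset.mem_range,
      ZMod.natCast_val, ZMod.cast_id', id] at h ⊢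
    exact ⟨⟨ZMod.val_lt _, ZMod.val_lt _⟩, h.2⟩
  · intro xy h
    simp only [Finset.coe_filter, Set.mem_ofPred_eq, Finset.mem_product, Finset.mem_range] at h
    exact Prod.ext (ZMod.val_cast_of_lt h.1.1) (ZMod.val_cast_of_lt h.1.2)
  · intro z _
    simp

theorem goodRed_reduction {A B : ℤ[X]} {τ : ℚ}
    (hAB : (0 < A.natDegree ∧ (A.leadingCoeff : ZMod p) ≠ 0) ∨
      (0 < B.natDegree ∧ (B.leadingCoeff : ZMod p) ≠ 0)) (hg : goodRed A B τ p) :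
    (τ.den : ZMod p) ≠ 0 ∧
      4 * eval₂ (Int.castRingHom (ZMod p)) (τ : ZMod p) A ^ 3
        + 27 * eval₂ (Int.castRingHom (ZMod p)) (τ : ZMod p) B ^ 2 ≠ 0 ∧
      apFrob A B τ p = p - (Finset.univ.filter fun z : ZMod p × ZMod p =>
        z.2 ^ 2 = z.1 ^ 3 + eval₂ (Int.castRingHom (ZMod p)) (τ : ZMod p) A * z.1
          + eval₂ (Int.castRingHom (ZMod p)) (τ : ZMod p) B).card := by
  obtain ⟨h1, h2, h3⟩ := hg
  have hden : (τ.den : ZMod p) ≠ 0 := by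
    rcases hAB with h | h
    · refine cast_den_of_evalQ h.1 h.2 fun e => h1 ?_
      rw [ZMod.natCast_eq_zero_iff] at e
      exact_mod_cast e
    · refine cast_den_of_evalQ h.1 h.2 fun e => h2 ?_
      rw [ZMod.natCast_eq_zero_iff] at e
      exact_mod_cast e
  obtain ⟨hA1, hA2⟩ := cast_evalQ hden A
  obtain ⟨hB1, hB2⟩ := cast_evalQ hden B
  refine ⟨hden, ?_, ?_⟩
  · intro h0
    apply h3
    rw [ratRed_eq_cast, discQ]
    have h4 := cast_evalQ (p := p) hden (-16 * (4 * A ^ 3 + 27 * B ^ 2))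
    have e1 : evalQ (-16 * (4 * A ^ 3 + 27 * B ^ 2)) τ
        = -16 * (4 * evalQ A τ ^ 3 + 27 * evalQ B τ ^ 2) := by
      simp [evalQ, eval₂_mul, eval₂_add, eval₂_pow]
    rw [← e1, h4.2, eval₂_mul, eval₂_add, eval₂_mul, eval₂_mul, eval₂_pow, eval₂_pow]
    have e4 : eval₂ (Int.castRingHom (ZMod p)) (τ : ZMod p) (4 : ℤ[X]) = 4 := by simp
    have e27 : eval₂ (Int.castRingHom (ZMod p)) (τ : ZMod p) (27 : ℤ[X]) = 27 := by simp
    rw [e4, e27, h0, mul_zero]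
  · rw [apFrob, ratRed_eq_cast, ratRed_eq_cast, hA2, hB2, affinePoints_eq]

end Reduction

section Fibres
variable {A B : ℤ[X]}

theorem exists_minor_ne_zero (hΔ : 4 * A ^ 3 + 27 * B ^ 2 ≠ 0) (hj : jNonconstant A B) :
    ∃ i l : ℕ, (A ^ 3).coeff i * (4 * A ^ 3 + 27 * B ^ 2).coeff l
      - (A ^ 3).coeff l * (4 * A ^ 3 + 27 * B ^ 2).coeff i ≠ 0 := by
  by_contra! hcon
  set G := 4 * A ^ 3 + 27 * B ^ 2 with hG
  set l := G.natDegree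
  have hl : (G.coeff l : ℚ) ≠ 0 := by
    have : G.coeff l ≠ 0 := by simpa [l] using hΔ
    exact_mod_cast this
  refine hj (-6912 * ((A ^ 3).coeff l / G.coeff l : ℚ)) ?_
  have e1 : (A.map (Int.castRingHom ℚ)) ^ 3 = (A ^ 3).map (Int.castRingHom ℚ) := by simp
  have e2 : (4 * (A.map (Int.castRingHom ℚ)) ^ 3 + 27 * (B.map (Int.castRingHom ℚ)) ^ 2)
      = G.map (Int.castRingHom ℚ) := by simp [hG]
  rw [e2, e1, C_mul, mul_assoc]
  have e3 : (C (-6912 : ℚ) : ℚ[X]) = -6912 := by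
    rw [map_neg]; exact congrArg Neg.neg (map_ofNat C 6912)
  rw [e3]
  congr 1
  ext i
  rw [coeff_C_mul, coeff_map, coeff_map, eq_intCast, eq_intCast]
  have h := hcon i l
  have h' : ((A ^ 3).coeff i : ℚ) * G.coeff l - (A ^ 3).coeff l * G.coeff i = 0 := by exact_mod_cast h
  field_simp
  linarith

theorem natDegree_pos_of_jNonconstant (hΔ : 4 * A ^ 3 + 27 * B ^ 2 ≠ 0) (hj : jNonconstant A B) :
    0 < A.natDegree ∨ 0 < B.natDegree := by
  by_contra! hcon
  obtain ⟨hA, hB⟩ := hcon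
  obtain ⟨a, rfl⟩ := natDegree_eq_zero.mp (Nat.le_zero.mp hA)
  obtain ⟨b, rfl⟩ := natDegree_eq_zero.mp (Nat.le_zero.mp hB)
  obtain ⟨i, l, h⟩ := exists_minor_ne_zero hΔ hj
  have e1 : (C a : ℤ[X]) ^ 3 = C (a ^ 3) := by simp
  have e2 : 4 * (C a : ℤ[X]) ^ 3 + 27 * (C b) ^ 2 = C (4 * a ^ 3 + 27 * b ^ 2) := by simp
  rw [e2, e1, coeff_C, coeff_C, coeff_C, coeff_C] at h
  apply h
  split_ifs <;> ring

theorem exists_good_bound (hΔ : 4 * A ^ 3 + 27 * B ^ 2 ≠ 0) (hj : jNonconstant A B) :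
    ∃ M : ℕ, ∀ p : ℕ, p.Prime → M < p →
      ((0 < A.natDegree ∧ (A.leadingCoeff : ZMod p) ≠ 0) ∨
        (0 < B.natDegree ∧ (B.leadingCoeff : ZMod p) ≠ 0)) ∧
      ∀ c : ZMod p, (A ^ 3).map (Int.castRingHom (ZMod p))
        - C c * (4 * A ^ 3 + 27 * B ^ 2).map (Int.castRingHom (ZMod p)) ≠ 0 := by
  obtain ⟨i, l, h⟩ := exists_minor_ne_zero hΔ hj
  have hcast : ∀ (m : ℤ) (p : ℕ), m ≠ 0 → m.natAbs < p → (m : ZMod p) ≠ 0 := by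
    intro m p hm hlt h0
    rw [ZMod.intCast_zmod_eq_zero_iff_dvd] at h0
    have := Nat.le_of_dvd (Int.natAbs_pos.mpr hm) (Int.natCast_dvd.mp h0)
    omega
  set m := (A ^ 3).coeff i * (4 * A ^ 3 + 27 * B ^ 2).coeff l
      - (A ^ 3).coeff l * (4 * A ^ 3 + 27 * B ^ 2).coeff i with hm
  refine ⟨m.natAbs + A.leadingCoeff.natAbs + B.leadingCoeff.natAbs, fun p _ hMp => ⟨?_, fun c h0 => ?_⟩⟩
  · rcases natDegree_pos_of_jNonconstant hΔ hj with h1 | h1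
    · left
      refine ⟨h1, hcast _ _ (fun e => ?_) (by omega)⟩
      rw [leadingCoeff_eq_zero] at e
      simp [e] at h1
    · right
      refine ⟨h1, hcast _ _ (fun e => ?_) (by omega)⟩
      rw [leadingCoeff_eq_zero] at e
      simp [e] at h1
  · refine hcast m p h (by omega) ?_
    rw [sub_eq_zero] at h0
    have hc : ∀ n, ((A ^ 3).coeff n : ZMod p) = c * ((4 * A ^ 3 + 27 * B ^ 2).coeff n : ZMod p) := by
      intro n
      have := congrArg (fun f => f.coeff n) h0
      simpa only [coeff_map, coeff_C_mul, eq_intCast] using this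
    rw [hm, Int.cast_sub, Int.cast_mul, Int.cast_mul, hc, hc]
    ring

variable {p : ℕ} [Fact p.Prime]

/-- The residues at which the reduction of the family has a prescribed trace. -/
def traceFibre (A B : ℤ[X]) (p : ℕ) [Fact p.Prime] (a : ℤ) : Finset (ZMod p) :=
  Finset.univ.filter fun s => 4 * eval₂ (Int.castRingHom (ZMod p)) s A ^ 3
        + 27 * eval₂ (Int.castRingHom (ZMod p)) s B ^ 2 ≠ 0 ∧
      a = p - ((Finset.univ.filter fun z : ZMod p × ZMod p =>
        z.2 ^ 2 = z.1 ^ 3 + eval₂ (Int.castRingHom (ZMod p)) s A * z.1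
          + eval₂ (Int.castRingHom (ZMod p)) s B).card : ℤ)

theorem card_traceFibre_le (hp200 : 200 < p) {d : ℤ} (hd0 : d < 0) {q : ℕ} (hq : d.natAbs = q + 1)
    (hpq : 4 * (q + 1) ^ 2 + 8 * (q + 1) + 3 < p)
    (hAB : ∀ c : ZMod p, (A ^ 3).map (Int.castRingHom (ZMod p))
        - C c * (4 * A ^ 3 + 27 * B ^ 2).map (Int.castRingHom (ZMod p)) ≠ 0)
    {a : ℤ} {r : ℕ} (hr : r ≠ 0) (har : a ^ 2 - 4 * p = d * r ^ 2) :
    (traceFibre A B p a).card ≤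
      ((A ^ 3).natDegree + (4 * A ^ 3 + 27 * B ^ 2).natDegree) *
        (growth r * ((q + 1) * (4 * q + 5) + 2)) := by
  classical
  let k := AlgebraicClosure (ZMod p)
  have : CharP k p := charP_of_injective_algebraMap (algebraMap (ZMod p) k).injective p
  have hr0 : (0 : ℤ) < r ^ 2 := by positivity
  have hlt : a ^ 2 < 4 * p := by nlinarith
  have hrp : r < p := by
    have h1 : (r : ℤ) ^ 2 ≤ 4 * p := by nlinarith [sq_nonneg a]
    have h2 : (200 : ℤ) < p := by exact_mod_cast hp200
    have h3 : (r : ℤ) < p := by nlinarith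
    exact_mod_cast h3
  have hchar : ∀ n : ℕ, 0 < n → n < p → (n : k) ≠ 0 := by
    intro n hn hnp h0
    rw [CharP.cast_eq_zero_iff k p] at h0
    exact absurd (Nat.le_of_dvd hn h0) (by omega)
  have h3 : (3 : k) ≠ 0 := by exact_mod_cast hchar 3 (by norm_num) (by omega)
  have h2 : (2 : ZMod p) ≠ 0 := by
    intro h0
    apply hchar 2 (by norm_num) (by omega)
    have := congrArg (algebraMap (ZMod p) k) h0
    rw [map_ofNat, map_zero] at this
    exact_mod_cast this
  set F := (A ^ 3).map (Int.castRingHom (ZMod p)) with hF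
  set G := (4 * A ^ 3 + 27 * B ^ 2).map (Int.castRingHom (ZMod p)) with hG
  have evF : ∀ s, F.eval s = eval₂ (Int.castRingHom (ZMod p)) s A ^ 3 := fun s => by
    rw [hF, eval_map, eval₂_pow]
  have evG : ∀ s, G.eval s = 4 * eval₂ (Int.castRingHom (ZMod p)) s A ^ 3
        + 27 * eval₂ (Int.castRingHom (ZMod p)) s B ^ 2 := fun s => by
    rw [hG, eval_map, eval₂_add, eval₂_mul, eval₂_mul, eval₂_pow, eval₂_pow]
    simp
  let J : ZMod p → k := fun s => algebraMap (ZMod p) k (F.eval s / G.eval s)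
  have hJmem : ∀ j ∈ (traceFibre A B p a).image J, j ∈ cmSet k d r := by
    intro j hj
    obtain ⟨s, hs, rfl⟩ := Finset.mem_image.mp hj
    obtain ⟨hs1, hs2⟩ := (Finset.mem_filter.mp hs).2
    let W : ShortCurve (ZMod p) := ⟨_, _, hs1, h2⟩
    obtain ⟨α, hα, hαα⟩ := exists_endo (k := k) W hp200 a hs2 hlt
    refine ⟨W.bc k, α, hα, fun P => ?_, ?_⟩
    · rw [hαα, har]
    · simp only [jinv, bc, J, evF, evG, W]
      simp [map_ofNat]
  have hcm := card_cmSet_le h3 (N := (q + 1) * (4 * q + 5) + 2)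
    (card_cmSet_one_le h3 hd0 hq fun n h0 hn => hchar n h0 (by omega)) r hr
    (fun m h0 hm => hchar m h0 (by omega)) _ hJmem
  refine (Finset.card_le_mul_card_image (f := J) (traceFibre A B p a)
    ((A ^ 3).natDegree + (4 * A ^ 3 + 27 * B ^ 2).natDegree) fun j hj => ?_).trans
      (Nat.mul_le_mul_left _ hcm)
  obtain ⟨s0, -, rfl⟩ := Finset.mem_image.mp hj
  set c := F.eval s0 / G.eval s0 with hc
  have hdeg : (F - C c * G).natDegree ≤ (A ^ 3).natDegree + (4 * A ^ 3 + 27 * B ^ 2).natDegree := by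
    refine (natDegree_sub_le _ _).trans (max_le ?_ ?_)
    · exact natDegree_map_le.trans (by omega)
    · exact (natDegree_C_mul_le _ _).trans (natDegree_map_le.trans (by omega))
  refine le_trans (Finset.card_le_card (t := (F - C c * G).roots.toFinset) ?_)
    ((Multiset.toFinset_card_le _).trans ((card_roots' _).trans hdeg))
  intro s hs
  obtain ⟨hs, hsj⟩ := Finset.mem_filter.mp hs
  have hs1 := (Finset.mem_filter.mp hs).2.1
  rw [← evG] at hs1
  have hsc : F.eval s / G.eval s = c := (algebraMap (ZMod p) k).injective hsj
  rw [Multiset.mem_toFinset, mem_roots (hAB c), IsRoot, eval_sub, eval_mul, eval_C, ← hsc,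
    div_mul_cancel₀ _ hs1, sub_self]

end Fibres

section FareyCount

theorem card_le_of_det_dvd_of_le {p N : ℕ} (hp : 0 < p) (S : Finset (ℕ × ℕ))
    (hS : ∀ v ∈ S, 0 < v.1 ∧ v.1 ≤ v.2 ∧ v.2 ≤ N ∧ Nat.Coprime v.1 v.2)
    (hdet : ∀ v ∈ S, ∀ w ∈ S, (p : ℤ) ∣ (v.1 : ℤ) * w.2 - w.1 * v.2) :
    S.card ≤ N ^ 2 / p + 1 := by
  have key : ∀ v ∈ S, ∀ w ∈ S, v.1 * N ^ 2 / (v.2 * p) = w.1 * N ^ 2 / (w.2 * p) →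
      (v.1 : ℤ) * w.2 - w.1 * v.2 < p := by
    intro v hv w hw h
    obtain ⟨v1, v2, v3, -⟩ := hS v hv
    obtain ⟨w1, w2, w3, -⟩ := hS w hw
    have hvp : 0 < v.2 * p := Nat.mul_pos (by omega) hp
    have hwp : 0 < w.2 * p := Nat.mul_pos (by omega) hp
    set m := v.1 * N ^ 2 / (v.2 * p) with hm
    have e1 : v.1 * N ^ 2 < (m + 1) * (v.2 * p) := by
      rw [hm, mul_comm _ (v.2 * p)]; exact Nat.lt_mul_div_succ _ hvp
    have e2 : m * (w.2 * p) ≤ w.1 * N ^ 2 := by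
      rw [h]; exact Nat.div_mul_le_self _ _
    have e3 : v.2 * w.2 ≤ N ^ 2 := by rw [sq]; exact Nat.mul_le_mul v3 w3
    zify at *
    have e4 : (v.1 : ℤ) * N ^ 2 * (w.2 * p) < (m + 1) * (v.2 * p) * (w.2 * p) :=
      mul_lt_mul_of_pos_right e1 hwp
    have e5 : m * (w.2 * p) * ((v.2 : ℤ) * p) ≤ w.1 * N ^ 2 * (v.2 * p) :=
      mul_le_mul_of_nonneg_right e2 hvp.le
    have e6 : ((v.1 : ℤ) * w.2 - w.1 * v.2) * (N ^ 2 * p) < p * (N ^ 2 * p) := by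
      have : (v.2 : ℤ) * w.2 * (p * p) ≤ N ^ 2 * (p * p) :=
        mul_le_mul_of_nonneg_right e3 (by positivity)
      linarith
    exact lt_of_mul_lt_mul_right e6 (by positivity)
  rw [← Finset.card_range (N ^ 2 / p + 1)]
  refine Finset.card_le_card_of_injOn (fun v => v.1 * N ^ 2 / (v.2 * p)) (fun v hv => ?_) ?_
  · obtain ⟨v1, v2, v3, -⟩ := hS v hv
    have hv2 : 0 < v.2 := by omega
    have : v.1 * N ^ 2 / (v.2 * p) ≤ N ^ 2 / p := by
      refine (Nat.div_le_div_right (Nat.mul_le_mul_right _ v2)).trans_eq ?_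
      exact Nat.mul_div_mul_left _ _ hv2
    simpa using Nat.lt_succ_of_le this
  · intro v hv w hw h
    have h1 := key v hv w hw h
    have h2 := key w hw v hv h.symm
    have h3 : (v.1 : ℤ) * w.2 - w.1 * v.2 = 0 :=
      Int.eq_zero_of_abs_lt_dvd (hdet v hv w hw) (abs_lt.mpr ⟨by linarith, h1⟩)
    have h4 : v.1 * w.2 = w.1 * v.2 := by
      have : (v.1 : ℤ) * w.2 = w.1 * v.2 := by linarith
      exact_mod_cast this
    obtain ⟨v1, v2, -, v4⟩ := hS v hv
    obtain ⟨w1, w2, -, w4⟩ := hS w hw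
    have d1 : v.1 ∣ w.1 := v4.dvd_of_dvd_mul_right (h4 ▸ Dvd.intro _ rfl)
    have d2 : w.1 ∣ v.1 := w4.dvd_of_dvd_mul_right (h4 ▸ Dvd.intro _ rfl)
    have e1 := Nat.dvd_antisymm d1 d2
    rw [e1] at h4
    exact Prod.ext e1 (Nat.eq_of_mul_eq_mul_left w1 h4).symm

theorem card_le_of_det_dvd {p N : ℕ} (hp : 0 < p) (S : Finset (ℕ × ℕ))
    (hS : ∀ v ∈ S, 0 < v.1 ∧ 0 < v.2 ∧ v.1 ≤ N ∧ v.2 ≤ N ∧ Nat.Coprime v.1 v.2)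
    (hdet : ∀ v ∈ S, ∀ w ∈ S, (p : ℤ) ∣ (v.1 : ℤ) * w.2 - w.1 * v.2) :
    S.card ≤ 2 * (N ^ 2 / p + 1) := by
  have h1 : (S.filter fun v => v.1 ≤ v.2).card ≤ N ^ 2 / p + 1 := by
    refine card_le_of_det_dvd_of_le hp _ (fun v hv => ?_) fun v hv w hw =>
      hdet v (Finset.mem_filter.mp hv).1 w (Finset.mem_filter.mp hw).1
    obtain ⟨hv, hle⟩ := Finset.mem_filter.mp hv
    obtain ⟨a, b, c, d, e⟩ := hS v hv
    exact ⟨a, hle, d, e⟩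
  have h2 : ((S.filter fun v => ¬ v.1 ≤ v.2).image Prod.swap).card ≤ N ^ 2 / p + 1 := by
    refine card_le_of_det_dvd_of_le hp _ (fun v hv => ?_) fun v hv w hw => ?_
    · obtain ⟨u, hu, rfl⟩ := Finset.mem_image.mp hv
      obtain ⟨hu, hle⟩ := Finset.mem_filter.mp hu
      obtain ⟨a, b, c, d, e⟩ := hS u hu
      exact ⟨b, by simp; omega, c, e.symm⟩
    · obtain ⟨u, hu, rfl⟩ := Finset.mem_image.mp hv
      obtain ⟨t, ht, rfl⟩ := Finset.mem_image.mp hw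
      have := hdet t (Finset.mem_filter.mp ht).1 u (Finset.mem_filter.mp hu).1
      convert this using 1
      simp only [Prod.fst_swap, Prod.snd_swap]
      ring
  rw [Finset.card_image_of_injective _ Prod.swap_injective] at h2
  rw [← Finset.card_filter_add_card_filter_not (s := S) (fun v : ℕ × ℕ => v.1 ≤ v.2)]
  omega

theorem sum_inv_sq_le (N : ℕ) (hN : 2 ≤ N) :
    ∑ e ∈ Finset.Icc 2 N, (1 : ℝ) / e ^ 2 ≤ 3 / 4 - 1 / N := by
  induction N, hN using Nat.le_induction with
  | base => norm_num
  | succ n hn ih =>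
    rw [Finset.sum_Icc_succ_top (by omega)]
    have hn0 : (0 : ℝ) < n := by positivity
    have : (1 : ℝ) / ((n + 1 : ℕ) : ℝ) ^ 2 ≤ 1 / n - 1 / ((n + 1 : ℕ) : ℝ) := by
      push_cast
      rw [div_sub_div _ _ hn0.ne' (by positivity), div_le_div_iff₀ (by positivity) (by positivity)]
      nlinarith
    linarith

theorem card_fareyPairs_ge (T : ℝ) (hT : 1 ≤ T) : T ^ 2 / 16 ≤ ((fareyPairs T).card : ℝ) := by
  classical
  set N := ⌊T⌋₊ with hN
  have hN1 : 1 ≤ N := Nat.le_floor (by simpa using hT)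
  have hNT : T < N + 1 := Nat.lt_floor_add_one T
  have hN1' : (1 : ℝ) ≤ N := by exact_mod_cast hN1
  set X := Finset.Icc 1 N ×ˢ Finset.Icc 1 N with hX
  have hXc : X.card = N ^ 2 := by rw [hX, Finset.card_product, Nat.card_Icc]; simp [sq]
  have hsub : (X.filter fun v => ¬ Nat.Coprime v.1 v.2) ⊆ (Finset.Icc 2 N).biUnion fun e =>
      (((Finset.Icc 1 (N / e)) ×ˢ (Finset.Icc 1 (N / e))).image fun u => (e * u.1, e * u.2)) := by
    intro v hv
    obtain ⟨hv, hc⟩ := Finset.mem_filter.mp hv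
    obtain ⟨h1, h2⟩ := Finset.mem_product.mp hv
    rw [Finset.mem_Icc] at h1 h2
    have g1 : Nat.gcd v.1 v.2 ∣ v.1 := Nat.gcd_dvd_left _ _
    have g2 : Nat.gcd v.1 v.2 ∣ v.2 := Nat.gcd_dvd_right _ _
    have g0 : 0 < Nat.gcd v.1 v.2 := Nat.gcd_pos_of_pos_left _ (by omega)
    rw [Nat.Coprime] at hc
    have gle := Nat.le_of_dvd (by omega) g1
    rw [Finset.mem_biUnion]
    refine ⟨Nat.gcd v.1 v.2, Finset.mem_Icc.mpr ⟨by omega, by omega⟩, ?_⟩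
    rw [Finset.mem_image]
    refine ⟨(v.1 / Nat.gcd v.1 v.2, v.2 / Nat.gcd v.1 v.2), ?_,
      Prod.ext (Nat.mul_div_cancel' g1) (Nat.mul_div_cancel' g2)⟩
    rw [Finset.mem_product, Finset.mem_Icc, Finset.mem_Icc]
    exact ⟨⟨Nat.div_pos gle g0, Nat.div_le_div_right h1.2⟩,
      ⟨Nat.div_pos (Nat.le_of_dvd (by omega) g2) g0, Nat.div_le_div_right h2.2⟩⟩
  have hcard : ((X.filter fun v => ¬ Nat.Coprime v.1 v.2).card : ℝ) ≤ 3 / 4 * N ^ 2 := by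
    have h1 := (Finset.card_le_card hsub).trans Finset.card_biUnion_le
    have h2 : ((X.filter fun v => ¬ Nat.Coprime v.1 v.2).card : ℝ) ≤
        ∑ e ∈ Finset.Icc 2 N, (N : ℝ) ^ 2 * (1 / e ^ 2) := by
      refine (Nat.cast_le.mpr h1).trans ?_
      rw [Nat.cast_sum]
      refine Finset.sum_le_sum fun e he => ?_
      refine (Nat.cast_le.mpr Finset.card_image_le).trans ?_
      rw [Finset.card_product, Nat.card_Icc, Nat.add_sub_cancel, Nat.cast_mul, ← sq, mul_one_div,
        ← div_pow]
      exact pow_le_pow_left₀ (by positivity) Nat.cast_div_le 2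
    rw [← Finset.mul_sum] at h2
    have h3 : ∑ e ∈ Finset.Icc 2 N, (1 : ℝ) / e ^ 2 ≤ 3 / 4 := by
      rcases Nat.lt_or_ge N 2 with h | h
      · rw [Finset.Icc_eq_empty (by omega)]; norm_num
      · have := sum_inv_sq_le N h
        have : (0 : ℝ) ≤ 1 / N := by positivity
        linarith
    nlinarith [mul_le_mul_of_nonneg_left h3 (by positivity : (0 : ℝ) ≤ (N : ℝ) ^ 2)]
  have hsum := Finset.card_filter_add_card_filter_not (s := X) (fun v : ℕ × ℕ => Nat.Coprime v.1 v.2)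
  have hF : (X.filter fun v => Nat.Coprime v.1 v.2) = fareyPairs T := rfl
  rw [hF, hXc] at hsum
  have hsum' : ((fareyPairs T).card : ℝ) + ((X.filter fun v => ¬ Nat.Coprime v.1 v.2).card : ℝ) = (N : ℝ) ^ 2 := by
    exact_mod_cast hsum
  nlinarith

end FareyCount

section GrowthSum

theorem sum_le_of_recursion {w : ℕ → ℝ} {ℓ : ℕ} (hℓ : 2 ≤ ℓ) {b K c u : ℝ} (hb : 0 ≤ b) (hc : 0 ≤ c)
    (hw : ∀ r, 0 < r → w (ℓ * r) = b * w r) (hu : 0 < u) (hℓu : u ≤ (ℓ : ℝ) ^ ((4 : ℝ) / 3))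
    (hK : ∀ R : ℕ, ∑ r ∈ (Finset.Icc 1 R).filter (fun r => ¬ ℓ ∣ r), w r ≤ K * (R : ℝ) ^ ((4 : ℝ) / 3))
    (hbc : K + b * c / u ≤ c) (R : ℕ) :
    ∑ r ∈ Finset.Icc 1 R, w r ≤ c * (R : ℝ) ^ ((4 : ℝ) / 3) := by
  induction R using Nat.strong_induction_on with
  | _ R ih =>
    rcases Nat.eq_zero_or_pos R with rfl | hR
    · simp
    rw [← Finset.sum_filter_add_sum_filter_not (Finset.Icc 1 R) (fun r => ℓ ∣ r)]
    have h1 : ∑ r ∈ (Finset.Icc 1 R).filter (fun r => ℓ ∣ r), w r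
        = b * ∑ r ∈ Finset.Icc 1 (R / ℓ), w r := by
      rw [Finset.mul_sum]
      symm
      refine Finset.sum_nbij (fun r => ℓ * r) ?_ ?_ ?_ ?_
      · intro r hr
        rw [Finset.mem_Icc] at hr
        rw [Finset.mem_filter, Finset.mem_Icc]
        refine ⟨⟨Nat.mul_pos (by omega) (by omega), ?_⟩, dvd_mul_right _ _⟩
        exact (Nat.mul_le_mul_left ℓ hr.2).trans (Nat.mul_div_le R ℓ)
      · intro r _ r' _ h
        exact Nat.eq_of_mul_eq_mul_left (by omega) h
      · intro r hr
        simp only [Finset.coe_filter, Finset.mem_Icc, Set.mem_ofPred_eq] at hr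
        obtain ⟨⟨ha, hb⟩, m, rfl⟩ := hr
        refine ⟨m, ?_, rfl⟩
        rw [Finset.mem_coe, Finset.mem_Icc]
        refine ⟨Nat.pos_of_mul_pos_left (by omega : 0 < ℓ * m), ?_⟩
        rw [Nat.le_div_iff_mul_le (by omega), mul_comm]
        exact hb
      · intro r hr
        rw [Finset.mem_Icc] at hr
        exact (hw r (by omega)).symm
    have h2 := ih (R / ℓ) (Nat.div_lt_self hR (by omega))
    have h3 : ((R / ℓ : ℕ) : ℝ) ^ ((4 : ℝ) / 3) ≤ (R : ℝ) ^ ((4 : ℝ) / 3) / u := by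
      refine (Real.rpow_le_rpow (by positivity) Nat.cast_div_le (by norm_num)).trans ?_
      rw [Real.div_rpow (by positivity) (by positivity)]
      exact div_le_div_of_nonneg_left (by positivity) hu hℓu
    have h4 := hK R
    rw [h1]
    have h5 : (0 : ℝ) ≤ (R : ℝ) ^ ((4 : ℝ) / 3) := by positivity
    calc _ ≤ b * (c * ((R : ℝ) ^ ((4 : ℝ) / 3) / u)) + K * (R : ℝ) ^ ((4 : ℝ) / 3) := by
          gcongr
          exact h2.trans (mul_le_mul_of_nonneg_left h3 hc)
      _ = (K + b * c / u) * (R : ℝ) ^ ((4 : ℝ) / 3) := by ring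
      _ ≤ _ := mul_le_mul_of_nonneg_right hbc h5

theorem growth_pow_three_le (r : ℕ) (h2 : ¬ 2 ∣ r) (h3 : ¬ 3 ∣ r) : growth r ^ 3 ≤ r ^ 4 := by
  induction r using induction_on_primes with
  | zero => simp at h2
  | one => simp [growth_one]
  | prime_mul ℓ n hℓ ih =>
    have hn : n ≠ 0 := by rintro rfl; simp at h2
    rw [growth_mul hℓ.ne_zero hn, growth_prime hℓ, mul_pow, mul_pow]
    refine Nat.mul_le_mul ?_ (ih (fun h => h2 (h.mul_left _)) (fun h => h3 (h.mul_left _)))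
    have h5 : 5 ≤ ℓ := by
      have h22 : ℓ ≠ 2 := by rintro rfl; exact h2 (dvd_mul_right _ _)
      have h33 : ℓ ≠ 3 := by rintro rfl; exact h3 (dvd_mul_right _ _)
      have h44 : ℓ ≠ 4 := by rintro rfl; exact absurd hℓ (by norm_num)
      have := hℓ.two_le
      omega
    obtain ⟨m, rfl⟩ := Nat.exists_eq_add_of_le h5
    nlinarith [sq_nonneg m, Nat.zero_le m, Nat.zero_le (m ^ 3)]

theorem growth_div_mul {ℓ r : ℕ} (hℓ : ℓ.Prime) (hr : 0 < r) :
    ((growth (ℓ * r) : ℕ) : ℝ) / ((ℓ * r : ℕ) : ℝ) = ((ℓ + 3 : ℝ) / ℓ) * (growth r / r) := by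
  rw [growth_mul hℓ.ne_zero hr.ne', growth_prime hℓ]
  push_cast
  rw [div_mul_div_comm]

theorem sum_growth_le (R : ℕ) :
    ∑ r ∈ Finset.Icc 1 R, (growth r : ℝ) / r ≤ 350 * (R : ℝ) ^ ((4 : ℝ) / 3) := by
  have cube : ∀ (y z : ℝ), 0 ≤ y → 0 ≤ z → z ^ 3 ≤ y ^ 4 → z ≤ y ^ ((4 : ℝ) / 3) := by
    intro y z hy hz h
    have : (y ^ ((4 : ℝ) / 3)) ^ 3 = y ^ 4 := by
      rw [← Real.rpow_natCast, ← Real.rpow_mul hy, ← Real.rpow_natCast y 4]; norm_num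
    rw [← this] at h
    exact le_of_pow_le_pow_left₀ (by norm_num) (by positivity) h
  have step3 : ∀ R : ℕ, ∑ r ∈ Finset.Icc 1 R, (if 2 ∣ r then 0 else (growth r : ℝ) / r)
      ≤ 2 * (R : ℝ) ^ ((4 : ℝ) / 3) := by
    refine sum_le_of_recursion (ℓ := 3) (b := 2) (K := 1) (u := 4) (by norm_num) (by norm_num)
      (by norm_num) (fun r hr => ?_) (by norm_num) (cube _ _ (by norm_num) (by norm_num) (by norm_num))
      (fun R => ?_) (by norm_num)
    · have e : 2 ∣ 3 * r ↔ 2 ∣ r := by omega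
      by_cases h : 2 ∣ r
      · rw [if_pos h, if_pos (e.mpr h), mul_zero]
      · rw [if_neg h, if_neg (fun h' => h (e.mp h')), growth_div_mul Nat.prime_three hr]
        norm_num
    · have hterm : ∀ r ∈ (Finset.Icc 1 R).filter (fun r => ¬ 3 ∣ r),
          (if 2 ∣ r then 0 else (growth r : ℝ) / r) ≤ (R : ℝ) ^ ((1 : ℝ) / 3) := by
        intro r hr
        obtain ⟨hr, h3⟩ := Finset.mem_filter.mp hr
        rw [Finset.mem_Icc] at hr
        split_ifs with h2
        · positivity
        have hr0 : (0 : ℝ) < r := by exact_mod_cast hr.1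
        have h1 : (growth r : ℝ) ≤ (r : ℝ) ^ ((4 : ℝ) / 3) :=
          cube _ _ (by positivity) (by positivity) (by exact_mod_cast growth_pow_three_le r h2 h3)
        have h4 : (r : ℝ) ^ ((4 : ℝ) / 3) = r ^ ((1 : ℝ) / 3) * r := by
          rw [← Real.rpow_add_one hr0.ne']; norm_num
        rw [div_le_iff₀ hr0]
        refine h1.trans (h4.le.trans (mul_le_mul_of_nonneg_right ?_ hr0.le))
        exact Real.rpow_le_rpow hr0.le (by exact_mod_cast hr.2) (by norm_num)
      refine (Finset.sum_le_card_nsmul _ _ _ hterm).trans ?_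
      have hc : ((Finset.Icc 1 R).filter (fun r => ¬ 3 ∣ r)).card ≤ R := by
        refine (Finset.card_filter_le _ _).trans ?_
        simp
      rcases Nat.eq_zero_or_pos R with rfl | hR
      · simp
      have hR0 : (0 : ℝ) < R := by exact_mod_cast hR
      have h4 : (R : ℝ) ^ ((4 : ℝ) / 3) = R ^ ((1 : ℝ) / 3) * R := by
        rw [← Real.rpow_add_one hR0.ne']; norm_num
      rw [nsmul_eq_mul, one_mul, h4, mul_comm]
      exact mul_le_mul_of_nonneg_left (by exact_mod_cast hc) (by positivity)
  refine sum_le_of_recursion (w := fun r => (growth r : ℝ) / r) (ℓ := 2) (b := 5 / 2) (K := 2)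
    (u := 2.519) (by norm_num) (by norm_num)
    (by norm_num) (fun r hr => ?_) (by norm_num) (cube _ _ (by norm_num) (by norm_num) (by norm_num))
    (fun R => ?_) (by norm_num) R
  · have := growth_div_mul Nat.prime_two hr
    rw [this]
    norm_num
  · refine le_trans (le_of_eq ?_) (step3 R)
    rw [Finset.sum_filter]
    exact Finset.sum_congr rfl fun r _ => by by_cases h : 2 ∣ r <;> simp [h]

theorem sum_inv_sq_add_sq_le {r : ℕ} (hr : 0 < r) (R : ℕ) :
    ∑ n ∈ Finset.range R, (1 : ℝ) / (n ^ 2 + r ^ 2) ≤ 4 / r := by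
  have hr0 : (1 : ℝ) ≤ r := by exact_mod_cast hr
  have key : ∀ R : ℕ, ∑ n ∈ Finset.range (R + 1), (1 : ℝ) / (n ^ 2 + r ^ 2) ≤ 4 / r - 2 / (R + r) := by
    intro R
    induction R with
    | zero =>
      simp only [zero_add, Finset.sum_range_one, Nat.cast_zero]
      rw [div_sub_div_same, div_le_div_iff₀ (by positivity) (by positivity)]
      nlinarith
    | succ n ih =>
      rw [Finset.sum_range_succ]
      have hn : (0 : ℝ) ≤ n := by positivity
      have : (1 : ℝ) / (((n + 1 : ℕ) : ℝ) ^ 2 + r ^ 2) ≤ 2 / (n + r) - 2 / (((n + 1 : ℕ) : ℝ) + r) := by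
        push_cast
        rw [div_sub_div _ _ (by positivity) (by positivity), div_le_div_iff₀ (by positivity) (by positivity)]
        nlinarith [sq_nonneg ((n : ℝ) + 1 - r)]
      linarith
  refine (Finset.sum_le_sum_of_subset_of_nonneg
    (Finset.range_mono (Nat.le_succ R)) fun _ _ _ => by positivity).trans ((key R).trans ?_)
  have : (0 : ℝ) ≤ 2 / (R + r) := by positivity
  linarith

end GrowthSum

section Average

theorem exists_nat_of_rat {d : ℤ} (hd : Squarefree d) {z : ℤ} {r : ℚ}
    (h : (z : ℚ) = d * r ^ 2) : ∃ m : ℕ, z = d * m ^ 2 := by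
  have hd0 : d ≠ 0 := hd.ne_zero
  have hdq : (d : ℚ) ≠ 0 := by exact_mod_cast hd0
  have h1 : (d * r) ^ 2 = ((d * z : ℤ) : ℚ) := by push_cast; rw [h]; ring
  have hisInt : IsIntegral ℤ (d * r : ℚ) := by
    refine IsIntegral.of_pow (n := 2) (by norm_num) ?_
    rw [h1]
    exact isIntegral_algebraMap (R := ℤ) (A := ℚ) (x := d * z)
  obtain ⟨n, hn⟩ := IsIntegrallyClosed.isIntegral_iff.mp hisInt
  rw [eq_intCast] at hn
  rw [← hn] at h1
  have h2 : n ^ 2 = d * z := by exact_mod_cast h1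
  have h3 : d ∣ n := (hd.dvd_pow_iff_dvd (by norm_num : (2 : ℕ) ≠ 0)).mp (h2 ▸ dvd_mul_right _ _)
  obtain ⟨m, rfl⟩ := h3
  refine ⟨m.natAbs, ?_⟩
  rw [Int.natCast_natAbs, sq_abs]
  apply mul_left_cancel₀ hd0
  rw [← h2]; ring

/-- The condition on the prime `p` in `PiField` at the Farey fraction of a pair. -/
def FieldCond (A B : ℤ[X]) (d : ℤ) (p : ℕ) (ab : ℕ × ℕ) : Prop :=
  p.Prime ∧ goodRed A B (fareyFrac ab) p ∧ apFrob A B (fareyFrac ab) p ≠ 0 ∧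
    ∃ r : ℚ, ((apFrob A B (fareyFrac ab) p : ℚ) ^ 2 - 4 * p) = d * r ^ 2

open Classical in
theorem card_fieldCond_le {A B : ℤ[X]} {p : ℕ} (hp : p.Prime) (hp200 : 200 < p) {d : ℤ}
    (hd : Squarefree d) (hd0 : d < 0) {q : ℕ} (hq : d.natAbs = q + 1)
    (hpq : 4 * (q + 1) ^ 2 + 8 * (q + 1) + 3 < p)
    (hlc : (0 < A.natDegree ∧ (A.leadingCoeff : ZMod p) ≠ 0) ∨
      (0 < B.natDegree ∧ (B.leadingCoeff : ZMod p) ≠ 0))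
    (hAB : ∀ c : ZMod p, (A ^ 3).map (Int.castRingHom (ZMod p))
        - C c * (4 * A ^ 3 + 27 * B ^ 2).map (Int.castRingHom (ZMod p)) ≠ 0)
    (T : ℝ) {R : ℕ} (hR : ∀ n : ℕ, n ^ 2 ≤ 4 * p → n ≤ R) :
    ((fareyPairs T).filter (FieldCond A B d p)).card ≤
      ∑ nr ∈ (Finset.range (R + 1) ×ˢ Finset.Icc 1 R).filter
          (fun nr : ℕ × ℕ => nr.1 ^ 2 + (q + 1) * nr.2 ^ 2 = 4 * p),
        2 * (((A ^ 3).natDegree + (4 * A ^ 3 + 27 * B ^ 2).natDegree) *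
          (growth nr.2 * ((q + 1) * (4 * q + 5) + 2))) * (2 * (⌊T⌋₊ ^ 2 / p + 1)) := by
  have : Fact p.Prime := ⟨hp⟩
  have hdq : d = -((q : ℤ) + 1) := by omega
  set V : ZMod p → Finset (ℕ × ℕ) := fun s => (fareyPairs T).filter fun ab => (ab.1 : ZMod p) = s * ab.2
    with hV
  have hVc : ∀ s, (V s).card ≤ 2 * (⌊T⌋₊ ^ 2 / p + 1) := by
    intro s
    refine card_le_of_det_dvd hp.pos _ (fun v hv => ?_) fun v hv w hw => ?_
    · have h := (Finset.mem_filter.mp hv).1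
      rw [fareyPairs, Finset.mem_filter, Finset.mem_product, Finset.mem_Icc, Finset.mem_Icc] at h
      exact ⟨h.1.1.1, h.1.2.1, h.1.1.2, h.1.2.2, h.2⟩
    · have h1 := (Finset.mem_filter.mp hv).2
      have h2 := (Finset.mem_filter.mp hw).2
      rw [← ZMod.intCast_zmod_eq_zero_iff_dvd]
      push_cast
      rw [h1, h2]; ring
  have hsub : (fareyPairs T).filter (FieldCond A B d p) ⊆
      ((Finset.range (R + 1) ×ˢ Finset.Icc 1 R).filter
          (fun nr : ℕ × ℕ => nr.1 ^ 2 + (q + 1) * nr.2 ^ 2 = 4 * p)).biUnion fun nr =>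
        (traceFibre A B p nr.1 ∪ traceFibre A B p (-nr.1)).biUnion V := by
    intro ab hab
    obtain ⟨hab, -, hg, -, r, hr⟩ := Finset.mem_filter.mp hab
    obtain ⟨g1, g2, g3⟩ := goodRed_reduction hlc hg
    set a := apFrob A B (fareyFrac ab) p with ha
    obtain ⟨m, hm⟩ := exists_nat_of_rat hd (z := a ^ 2 - 4 * p) (r := r) (by push_cast; exact hr)
    have hm0 : m ≠ 0 := by
      rintro rfl
      have h1 : a ^ 2 = 4 * p := by rw [Nat.cast_zero] at hm; linarith
      have h2 : (p : ℤ) ∣ a := (Nat.prime_iff_prime_int.mp hp).dvd_of_dvd_pow (h1 ▸ dvd_mul_left _ _)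
      obtain ⟨b, hb⟩ := h2
      have hp0 : (200 : ℤ) < p := by exact_mod_cast hp200
      have h3 : p * b ^ 2 = 4 := by
        apply mul_left_cancel₀ (show (p : ℤ) ≠ 0 by omega)
        rw [hb] at h1; linarith
      rcases eq_or_ne b 0 with rfl | hb0
      · simp at h3
      · have : 0 < b ^ 2 := by positivity
        nlinarith
    have hsum : a.natAbs ^ 2 + (q + 1) * m ^ 2 = 4 * p := by
      zify
      rw [sq_abs]
      rw [hdq] at hm
      linarith
    rw [Finset.mem_biUnion]
    refine ⟨(a.natAbs, m), ?_, ?_⟩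
    · rw [Finset.mem_filter, Finset.mem_product, Finset.mem_range, Finset.mem_Icc]
      refine ⟨⟨Nat.lt_succ_of_le (hR _ (by rw [← hsum]; exact Nat.le_add_right _ _)), by change 1 ≤ m; omega, hR _ ?_⟩, hsum⟩
      change m ^ 2 ≤ 4 * p
      nlinarith [Nat.zero_le (a.natAbs ^ 2), Nat.zero_le (q * m ^ 2)]
    · rw [Finset.mem_biUnion]
      have hmem : (fareyFrac ab : ZMod p) ∈ traceFibre A B p a := by
        rw [traceFibre, Finset.mem_filter]
        exact ⟨Finset.mem_univ _, g2, g3⟩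
      refine ⟨(fareyFrac ab : ZMod p), ?_, ?_⟩
      · rw [Finset.mem_union]
        change _ ∈ traceFibre A B p (a.natAbs : ℤ) ∨ _ ∈ traceFibre A B p (-(a.natAbs : ℤ))
        rcases Int.natAbs_eq a with h | h
        · left; rw [← h]; exact hmem
        · right; rw [← h]; exact hmem
      · rw [hV, Finset.mem_filter]
        refine ⟨hab, ?_⟩
        rw [fareyPairs, Finset.mem_filter, Finset.mem_product, Finset.mem_Icc, Finset.mem_Icc] at hab
        have e1 : fareyFrac ab = ((ab.1 : ℤ) : ℚ) / ((ab.2 : ℤ) : ℚ) := by simp [fareyFrac]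
        have hb0 : (0 : ℤ) < (ab.2 : ℤ) := by exact_mod_cast hab.1.2.1
        have hnum : (fareyFrac ab).num = ab.1 := by
          rw [e1]; exact Rat.num_div_eq_of_coprime hb0 (by simpa using hab.2)
        have hden : (((fareyFrac ab).den : ℕ) : ℤ) = ab.2 := by
          rw [e1]; exact Rat.den_div_eq_of_coprime hb0 (by simpa using hab.2)
        have hden' : (fareyFrac ab).den = ab.2 := by exact_mod_cast hden
        rw [Rat.cast_def, hnum, hden']
        rw [hden'] at g1
        rw [div_mul_cancel₀ _ g1]
        simp
  refine (Finset.card_le_card hsub).trans (Finset.card_biUnion_le.trans (Finset.sum_le_sum fun nr hnr => ?_))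
  obtain ⟨hnr, heq⟩ := Finset.mem_filter.mp hnr
  rw [Finset.mem_product, Finset.mem_Icc] at hnr
  have hr0 : nr.2 ≠ 0 := by omega
  have hz : (nr.1 : ℤ) ^ 2 - 4 * p = d * nr.2 ^ 2 := by
    rw [hdq]
    zify at heq
    linarith
  have hf : ∀ a : ℤ, a ^ 2 = (nr.1 : ℤ) ^ 2 → (traceFibre A B p a).card ≤ _ := fun a ha =>
    card_traceFibre_le hp200 hd0 hq hpq hAB hr0 (a := a) (by rw [ha, hz])
  refine (Finset.card_biUnion_le_card_mul _ _ _ fun s _ => hVc s).trans (Nat.mul_le_mul_right _ ?_)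
  refine (Finset.card_union_le _ _).trans ?_
  rw [two_mul]
  exact Nat.add_le_add (hf _ rfl) (hf _ (by ring))

theorem sum_box_le (T : ℝ) (R : ℕ) :
    ∑ nr ∈ Finset.range (R + 1) ×ˢ Finset.Icc 1 R,
      (growth nr.2 : ℝ) * (4 * T ^ 2 * (1 / (nr.1 ^ 2 + nr.2 ^ 2)) + 1) ≤
      (16 * T ^ 2 + 2 * R ^ 2) * (350 * (R : ℝ) ^ ((4 : ℝ) / 3)) := by
  rw [Finset.sum_product_right]
  refine le_trans (Finset.sum_le_sum (g := fun r => (16 * T ^ 2 + 2 * R ^ 2) * ((growth r : ℝ) / r))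
    fun r hr => ?_) ?_
  · rw [Finset.mem_Icc] at hr
    have hr0 : (0 : ℝ) < r := by exact_mod_cast hr.1
    have hrR : (r : ℝ) ≤ R := by exact_mod_cast hr.2
    have hR1 : (1 : ℝ) ≤ R := by exact_mod_cast hr.1.trans hr.2
    dsimp only
    rw [← Finset.mul_sum, Finset.sum_add_distrib, ← Finset.mul_sum]
    have h1 := sum_inv_sq_add_sq_le (r := r) (by omega) (R + 1)
    have h2 : (16 * T ^ 2 + 2 * R ^ 2) * ((growth r : ℝ) / r)
        = growth r * (4 * T ^ 2 * (4 / r) + 2 * R ^ 2 / r) := by ring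
    rw [h2]
    refine mul_le_mul_of_nonneg_left (add_le_add (mul_le_mul_of_nonneg_left h1 (by positivity)) ?_)
      (by positivity)
    rw [Finset.sum_const, Finset.card_range, nsmul_eq_mul, mul_one, le_div_iff₀ hr0]
    push_cast
    nlinarith
  · rw [← Finset.mul_sum]
    exact mul_le_mul_of_nonneg_left (sum_growth_le R) (by positivity)

open Classical in
theorem sum_piField_le {A B : ℤ[X]} (hΔ : 4 * A ^ 3 + 27 * B ^ 2 ≠ 0) (hj : jNonconstant A B)
    {d : ℤ} (hd : Squarefree d) (hdneg : d < 0) :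
    ∃ K P : ℕ, ∀ (x T : ℝ) (R : ℕ), 0 ≤ T → R = Nat.sqrt (4 * ⌊x⌋₊) →
      ∑ ab ∈ fareyPairs T, (PiField A B (fareyFrac ab) d x : ℝ) ≤
        (P + 1) * (fareyPairs T).card +
          ∑ nr ∈ Finset.range (R + 1) ×ˢ Finset.Icc 1 R,
            K * ((growth nr.2 : ℝ) * (4 * T ^ 2 * (1 / (nr.1 ^ 2 + nr.2 ^ 2)) + 1)) := by
  obtain ⟨M, hM⟩ := exists_good_bound hΔ hj
  obtain ⟨q, hq⟩ : ∃ q, d.natAbs = q + 1 := ⟨d.natAbs - 1, by omega⟩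
  set D := (A ^ 3).natDegree + (4 * A ^ 3 + 27 * B ^ 2).natDegree with hD
  set E := (q + 1) * (4 * q + 5) + 2 with hE
  set P := M + 200 + (4 * (q + 1) ^ 2 + 8 * (q + 1) + 3) with hP
  refine ⟨4 * D * E, P, fun x T R hT hR => ?_⟩
  set w : ℕ × ℕ → ℝ := fun nr =>
    ((4 * D * E : ℕ) : ℝ) * ((growth nr.2 : ℝ) * (4 * T ^ 2 * (1 / (nr.1 ^ 2 + nr.2 ^ 2)) + 1)) with hw
  have hw0 : ∀ nr, 0 ≤ w nr := fun nr => by positivity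
  have e1 : ∑ ab ∈ fareyPairs T, (PiField A B (fareyFrac ab) d x : ℝ)
      = ∑ p ∈ Finset.range (⌊x⌋₊ + 1), (((fareyPairs T).filter (FieldCond A B d p)).card : ℝ) := by
    simp only [PiField, Finset.card_filter, Nat.cast_sum]
    rw [Finset.sum_comm]
    refine Finset.sum_congr rfl fun p _ => Finset.sum_congr rfl fun ab _ => ?_
    congr 2
  set Q := fun (p : ℕ) (nr : ℕ × ℕ) => nr.1 ^ 2 + (q + 1) * nr.2 ^ 2 = 4 * p with hQ
  set box := Finset.range (R + 1) ×ˢ Finset.Icc 1 R with hbox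
  have e2 : ∀ p ∈ Finset.range (⌊x⌋₊ + 1), (((fareyPairs T).filter (FieldCond A B d p)).card : ℝ) ≤
      (if p < P + 1 then ((fareyPairs T).card : ℝ) else 0)
        + ∑ nr ∈ box, (if Q p nr then w nr else 0) := by
    intro p hpx
    rw [Finset.mem_range] at hpx
    have hnn : 0 ≤ ∑ nr ∈ box, (if Q p nr then w nr else 0) :=
      Finset.sum_nonneg fun nr _ => by split_ifs; exacts [hw0 nr, le_rfl]
    by_cases hpP : p < P + 1
    · rw [if_pos hpP]
      have : (((fareyPairs T).filter (FieldCond A B d p)).card : ℝ) ≤ (fareyPairs T).card :=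
        Nat.cast_le.mpr (Finset.card_filter_le _ _)
      linarith
    rw [if_neg hpP, zero_add]
    by_cases hp : p.Prime
    · obtain ⟨h1, h2⟩ := hM p hp (by omega)
      have h3 := card_fieldCond_le hp (by omega) hd hdneg hq (by omega) h1 h2 T (R := R) (fun n hn => by
        rw [hR, Nat.le_sqrt']; omega)
      refine (Nat.cast_le.mpr h3).trans ?_
      rw [Nat.cast_sum, ← Finset.sum_filter]
      refine Finset.sum_le_sum fun nr hnr => ?_
      obtain ⟨hnr, heq⟩ := Finset.mem_filter.mp hnr
      rw [Finset.mem_product, Finset.mem_Icc] at hnr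
      have hr0 : (1 : ℝ) ≤ nr.2 := by exact_mod_cast hnr.2.1
      have hp0 : (0 : ℝ) < p := by exact_mod_cast hp.pos
      have h4 : ((⌊T⌋₊ ^ 2 / p : ℕ) : ℝ) ≤ 4 * T ^ 2 * (1 / (nr.1 ^ 2 + nr.2 ^ 2)) := by
        refine Nat.cast_div_le.trans ?_
        have h5 : ((nr.1 : ℝ) ^ 2 + nr.2 ^ 2) ≤ 4 * p := by
          have : (nr.1 : ℝ) ^ 2 + (q + 1) * nr.2 ^ 2 = 4 * p := by exact_mod_cast heq
          have : (0 : ℝ) ≤ q * (nr.2 : ℝ) ^ 2 := by positivity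
          linarith
        have h6 : (⌊T⌋₊ : ℝ) ^ 2 ≤ T ^ 2 := pow_le_pow_left₀ (by positivity) (Nat.floor_le hT) 2
        rw [Nat.cast_pow, mul_one_div, div_le_div_iff₀ hp0 (by positivity)]
        calc (⌊T⌋₊ : ℝ) ^ 2 * (nr.1 ^ 2 + nr.2 ^ 2) ≤ T ^ 2 * (4 * p) := by gcongr
          _ = _ := by ring
      rw [hw, Nat.cast_mul, Nat.cast_mul 2 (_ + 1), Nat.cast_add]
      push_cast at h4 ⊢
      calc _ = ((4 * D * E : ℝ) * growth nr.2) * (((⌊T⌋₊ ^ 2 / p : ℕ) : ℝ) + 1) := by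
            rw [hE, hD]; push_cast; ring
        _ ≤ ((4 * D * E : ℝ) * growth nr.2) * (4 * T ^ 2 * (1 / (nr.1 ^ 2 + nr.2 ^ 2)) + 1) := by
            refine mul_le_mul_of_nonneg_left ?_ (by positivity)
            linarith
        _ = _ := by ring
    · rw [Finset.filter_false_of_mem fun ab _ h => hp h.1]
      simpa using hnn
  rw [e1]
  refine (Finset.sum_le_sum e2).trans ?_
  rw [Finset.sum_add_distrib]
  refine add_le_add ?_ ?_
  · rw [← Finset.sum_filter, Finset.sum_const, nsmul_eq_mul]
    refine mul_le_mul_of_nonneg_right ?_ (by positivity)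
    have : ((Finset.range (⌊x⌋₊ + 1)).filter fun p => p < P + 1).card ≤ P + 1 := by
      refine (Finset.card_le_card (t := Finset.range (P + 1)) fun p hp => ?_).trans_eq
        (Finset.card_range _)
      exact Finset.mem_range.mpr (Finset.mem_filter.mp hp).2
    exact_mod_cast this
  · rw [Finset.sum_comm]
    refine Finset.sum_le_sum fun nr _ => ?_
    rw [← Finset.sum_filter, Finset.sum_const, nsmul_eq_mul]
    have : ((Finset.range (⌊x⌋₊ + 1)).filter fun p => Q p nr).card ≤ 1 := by
      rw [Finset.card_le_one]
      intro p hp p' hp'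
      have h1 : Q p nr := (Finset.mem_filter.mp hp).2
      have h2 : Q p' nr := (Finset.mem_filter.mp hp').2
      simp only [hQ] at h1 h2
      omega
    have h1 : (((Finset.range (⌊x⌋₊ + 1)).filter fun p => Q p nr).card : ℝ) ≤ 1 := by
      exact_mod_cast this
    exact mul_le_of_le_one_left (hw0 nr) h1

end Average
end ShortCurve

/-- Averaged Lang–Trotter bound for Frobenius fields: for `x ≥ 2` and
`T ≥ x^{5/6+ε}`, `(1/#F(T))·Σ_{τ ∈ F(T), Δ(τ) ≠ 0} Π_{E(τ)}(𝕂, x) ≤ C·x^{2/3}`,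
where `𝕂 = ℚ(√d)`. -/
theorem avg_lang_trotter_field_normalized (A B : Polynomial ℤ)
    (hΔ : 4 * A ^ 3 + 27 * B ^ 2 ≠ 0) (hj : jNonconstant A B)
    (d : ℤ) (hd : Squarefree d) (hdneg : d < 0)
    (ε : ℝ) (hε : 0 < ε) :
    ∃ C : ℝ, 0 < C ∧ ∀ x T : ℝ, 2 ≤ x → x ^ ((5 : ℝ) / 6 + ε) ≤ T →
      (1 / ((fareyPairs T).card : ℝ)) *
          ∑ ab ∈ fareyPairs T,
            (if discQ A B (fareyFrac ab) ≠ 0 then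
              ((PiField A B (fareyFrac ab) d x : ℝ)) else 0) ≤
        C * x ^ ((2 : ℝ) / 3) := by
  obtain ⟨K, P, h⟩ := ShortCurve.sum_piField_le hΔ hj hd hdneg
  refine ⟨P + 1 + 537600 * K, by positivity, fun x T hx hT => ?_⟩
  have hx1 : 1 ≤ x := by linarith
  have hT1 : 1 ≤ T := (Real.one_le_rpow hx1 (by linarith)).trans hT
  have hxT : x ≤ T ^ 2 := by
    have h1 : x ^ ((1 : ℝ) / 2) ≤ T :=
      (Real.rpow_le_rpow_of_exponent_le hx1 (by linarith)).trans hT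
    have h2 : (x ^ ((1 : ℝ) / 2)) ^ 2 = x := by
      rw [← Real.rpow_natCast, ← Real.rpow_mul (by linarith)]; norm_num
    rw [← h2]
    exact pow_le_pow_left₀ (by positivity) h1 2
  obtain ⟨R, hR⟩ : ∃ R, R = Nat.sqrt (4 * ⌊x⌋₊) := ⟨_, rfl⟩
  have hRx : (R : ℝ) ^ 2 ≤ 4 * x := by
    have h1 : R ^ 2 ≤ 4 * ⌊x⌋₊ := by rw [hR]; exact Nat.sqrt_le' _
    have h2 : (R : ℝ) ^ 2 ≤ 4 * ⌊x⌋₊ := by exact_mod_cast h1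
    have := Nat.floor_le (show 0 ≤ x by linarith)
    linarith
  have hR43 : (R : ℝ) ^ ((4 : ℝ) / 3) ≤ 4 * x ^ ((2 : ℝ) / 3) := by
    have h1 : (R : ℝ) ^ ((4 : ℝ) / 3) = ((R : ℝ) ^ 2) ^ ((2 : ℝ) / 3) := by
      rw [← Real.rpow_natCast, ← Real.rpow_mul (by positivity)]; norm_num
    rw [h1]
    refine (Real.rpow_le_rpow (by positivity) hRx (by norm_num)).trans ?_
    rw [Real.mul_rpow (by norm_num) (by linarith)]
    refine mul_le_mul_of_nonneg_right ?_ (by positivity)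
    calc (4 : ℝ) ^ ((2 : ℝ) / 3) ≤ 4 ^ (1 : ℝ) :=
          Real.rpow_le_rpow_of_exponent_le (by norm_num) (by norm_num)
      _ = 4 := Real.rpow_one _
  have hF := ShortCurve.card_fareyPairs_ge T hT1
  have hT2 : (0 : ℝ) < T ^ 2 := by positivity
  have hF0 : (0 : ℝ) < (fareyPairs T).card := by linarith [div_pos hT2 (by norm_num : (0 : ℝ) < 16)]
  have hX1 : 1 ≤ x ^ ((2 : ℝ) / 3) := Real.one_le_rpow hx1 (by norm_num)
  rw [one_div, inv_mul_le_iff₀ hF0]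
  calc _ ≤ ∑ ab ∈ fareyPairs T, (PiField A B (fareyFrac ab) d x : ℝ) :=
        Finset.sum_le_sum fun ab _ => by split_ifs <;> simp
    _ ≤ _ := h x T R (by linarith) hR
    _ ≤ (P + 1) * (fareyPairs T).card
          + K * ((16 * T ^ 2 + 2 * R ^ 2) * (350 * (R : ℝ) ^ ((4 : ℝ) / 3))) := by
        rw [← Finset.mul_sum]
        have := ShortCurve.sum_box_le T R
        gcongr
    _ ≤ (P + 1) * (fareyPairs T).card
          + K * ((24 * T ^ 2) * (350 * (4 * x ^ ((2 : ℝ) / 3)))) := by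
        have : 16 * T ^ 2 + 2 * (R : ℝ) ^ 2 ≤ 24 * T ^ 2 := by linarith
        gcongr
    _ ≤ (P + 1) * (fareyPairs T).card * x ^ ((2 : ℝ) / 3)
          + K * (537600 * (T ^ 2 / 16) * x ^ ((2 : ℝ) / 3)) := by
        refine add_le_add (le_mul_of_one_le_right (by positivity) hX1) (le_of_eq (by ring))
    _ ≤ (P + 1) * (fareyPairs T).card * x ^ ((2 : ℝ) / 3)
          + K * (537600 * (fareyPairs T).card * x ^ ((2 : ℝ) / 3)) := by gcongr
    _ = _ := by ring
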